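/- Let a and m be positive integers. There exist real constants α > 0 and C > 0 such that for all real X ≥ 2: #{n ≤ X : M(a;n) ≢ 0 (mod m)} ≤ C·X/(log X)^α and #{n ≤ X : MO(a;n) ≢ 0 (mod m)} ≤ C·X/(log X)^α. In other words, M(a;n) and MO(a;n) are divisible by m for almost all n. -/

import Mathlib

open Finset

/-- `MO a n` is MacMahon's coefficient: the sum of the products `s_1 ⋯ s_a` over all
strictly increasing tuples `0 < k_1 < ⋯ < k_a` of positive integers and positive
integers `s_1, …, s_a` with `s_1*k_1 + ⋯ + s_a*k_a = n` (all such data satisfy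
`k_i, s_i ≤ n`, so we may sum over a finite set); in particular `MO a 0 = 0` for `a ≥ 1`. -/
def MO (a n : ℕ) : ℕ :=
  ∑ f ∈ Finset.univ.filter (fun f : Fin a → Fin (n + 1) × Fin (n + 1) =>
      (∀ i, 0 < ((f i).1 : ℕ) ∧ 0 < ((f i).2 : ℕ)) ∧
      (∀ i j : Fin a, i < j → (f i).1 < (f j).1) ∧
      (∑ i, ((f i).2 : ℕ) * ((f i).1 : ℕ)) = n),
    ∏ i, ((f i).2 : ℕ)

/-- `M a n` is the coefficient of Amdeberhan-Andrews-Tauraso: the sum of the products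
`s_1 ⋯ s_a` over all weakly increasing tuples `1 ≤ k_1 ≤ ⋯ ≤ k_a` of positive integers
and positive integers `s_1, …, s_a` with `s_1*k_1 + ⋯ + s_a*k_a = n`;
in particular `M a 0 = 0` for `a ≥ 1`. -/
def M (a n : ℕ) : ℕ :=
  ∑ f ∈ Finset.univ.filter (fun f : Fin a → Fin (n + 1) × Fin (n + 1) =>
      (∀ i, 0 < ((f i).1 : ℕ) ∧ 0 < ((f i).2 : ℕ)) ∧
      (∀ i j : Fin a, i ≤ j → (f i).1 ≤ (f j).1) ∧
      (∑ i, ((f i).2 : ℕ) * ((f i).1 : ℕ)) = n),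
    ∏ i, ((f i).2 : ℕ)

namespace MacMahon
open scoped MatrixGroups Manifold UpperHalfPlane
/-- The weight `y + 1/y` controlling moderate growth on the upper half plane. -/
noncomputable def height (z : ℍ) : ℝ := z.im + 1 / z.im

lemma height_pos (z : ℍ) : 0 < height z := by
  have := z.im_pos
  unfold height; positivity

/-- Holomorphic functions on `ℍ` all of whose `SL(2, ℤ)`-translates have moderate growth. -/
noncomputable def modGrowth : Subalgebra ℂ (ℍ → ℂ) where
  carrier := {u | MDiff u ∧ ∃ A C : ℝ, 0 ≤ A ∧ 0 ≤ C ∧ ∀ (δ : SL(2, ℤ)) (z : ℍ),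
    ‖u (δ • z)‖ ≤ A * Real.exp (C * height z)}
  mul_mem' := by
    rintro u v ⟨hu, A, C, hA, hC, h⟩ ⟨hv, A', C', hA', hC', h'⟩
    refine ⟨hu.mul hv, A * A', C + C', by positivity, by positivity, fun δ z => ?_⟩
    calc ‖(u * v) (δ • z)‖ = ‖u (δ • z)‖ * ‖v (δ • z)‖ := by simp
      _ ≤ (A * Real.exp (C * height z)) * (A' * Real.exp (C' * height z)) := by
        gcongr <;> [exact h δ z; exact h' δ z]
      _ = _ := by rw [add_mul, Real.exp_add]; ring
  add_mem' := by
    rintro u v ⟨hu, A, C, hA, hC, h⟩ ⟨hv, A', C', hA', hC', h'⟩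
    refine ⟨hu.add hv, A + A', C + C', by positivity, by positivity, fun δ z => ?_⟩
    have hz := (height_pos z).le
    calc ‖(u + v) (δ • z)‖ ≤ ‖u (δ • z)‖ + ‖v (δ • z)‖ := norm_add_le _ _
      _ ≤ A * Real.exp (C * height z) + A' * Real.exp (C' * height z) := add_le_add (h δ z) (h' δ z)
      _ ≤ A * Real.exp ((C + C') * height z) + A' * Real.exp ((C + C') * height z) := by
        gcongr <;> linarith
      _ = _ := by ring
  algebraMap_mem' c := by
    refine ⟨mdifferentiable_const, ‖c‖, 0, norm_nonneg _, le_rfl, fun δ z => ?_⟩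
    simp

lemma sl_smul_mdifferentiable {u : ℍ → ℂ} (hu : MDiff u) (δ : SL(2, ℤ)) :
    MDiff (fun z => u (δ • z)) := by
  refine hu.comp (UpperHalfPlane.mdifferentiable_smul
    (g := Matrix.SpecialLinearGroup.toGL (Matrix.SpecialLinearGroup.map (Int.castRingHom ℝ) δ)) ?_)
  simp

lemma modGrowth_smul {u : ℍ → ℂ} (hu : u ∈ modGrowth) (δ : SL(2, ℤ)) :
    (fun z => u (δ • z)) ∈ modGrowth := by
  obtain ⟨hu, A, C, hA, hC, h⟩ := hu
  refine ⟨sl_smul_mdifferentiable hu δ, A, C, hA, hC, fun δ' z => ?_⟩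
  simpa [mul_smul] using h (δ * δ') z

lemma im_smul_le_height (δ : SL(2, ℤ)) (z : ℍ) : (δ • z).im ≤ height z := by
  have hz := z.im_pos
  rw [ModularGroup.im_smul_eq_div_normSq, ModularGroup.denom_apply]
  have key : Complex.normSq (((δ 1 0 : ℤ) : ℂ) * z + ((δ 1 1 : ℤ) : ℂ)) =
      ((δ 1 0 : ℤ) * z.re + (δ 1 1 : ℤ)) ^ 2 + ((δ 1 0 : ℤ) * z.im : ℝ) ^ 2 := by
    simp [Complex.normSq_apply]; ring
  rw [key, height]
  by_cases h : δ 1 0 = 0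
  · have hdet := δ.det_coe
    rw [Matrix.det_fin_two, h] at hdet
    have : (δ 1 1 : ℤ) ≠ 0 := by rintro h1; simp [h1] at hdet
    have h1 : (1 : ℝ) ≤ ((δ 1 1 : ℤ) : ℝ) ^ 2 := by
      have : (1 : ℤ) ≤ (δ 1 1) ^ 2 := by
        have := pow_pos (abs_pos.mpr this) 2
        rw [sq_abs] at this; linarith
      exact_mod_cast this
    rw [h]; simp only [Int.cast_zero, zero_mul, zero_add]
    have : z.im / (((δ 1 1 : ℤ) : ℝ) ^ 2 + 0 ^ 2) ≤ z.im := by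
      apply div_le_self hz.le; nlinarith
    have : 0 < 1 / z.im := by positivity
    linarith
  · have h1 : (1 : ℝ) ≤ ((δ 1 0 : ℤ) : ℝ) ^ 2 := by
      have : (1 : ℤ) ≤ (δ 1 0) ^ 2 := by
        have := pow_pos (abs_pos.mpr h) 2
        rw [sq_abs] at this; linarith
      exact_mod_cast this
    have h2 : z.im ^ 2 ≤ ((δ 1 0 : ℤ) * z.re + (δ 1 1 : ℤ)) ^ 2 + ((δ 1 0 : ℤ) * z.im : ℝ) ^ 2 := by
      rw [mul_pow]; nlinarith [sq_nonneg ((δ 1 0 : ℤ) * z.re + (δ 1 1 : ℤ) : ℝ), sq_nonneg z.im]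
    have : z.im / (((δ 1 0 : ℤ) * z.re + (δ 1 1 : ℤ)) ^ 2 + ((δ 1 0 : ℤ) * z.im : ℝ) ^ 2)
        ≤ z.im / z.im ^ 2 := by
      apply div_le_div_of_nonneg_left hz.le (by positivity) h2
    have e : z.im / z.im ^ 2 = 1 / z.im := by field_simp
    linarith

open scoped Modular in
lemma mem_modGrowth_of_fd {u : ℍ → ℂ} (hu : MDiff u) {A C : ℝ} (hA : 0 ≤ A) (hC : 0 ≤ C)
    (h : ∀ (δ : SL(2, ℤ)) (z : ℍ), z ∈ 𝒟 → ‖u (δ • z)‖ ≤ A * Real.exp (C * z.im)) :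
    u ∈ modGrowth := by
  refine ⟨hu, A, C, hA, hC, fun δ z => ?_⟩
  obtain ⟨g, hg⟩ := ModularGroup.exists_smul_mem_fd z
  have := h (δ * g⁻¹) _ hg
  rw [mul_smul, inv_smul_smul] at this
  refine this.trans ?_
  gcongr
  exact im_smul_le_height g z

open scoped Modular in
open UpperHalfPlane in
/-- A continuous function with exponential growth at `i∞` has exponential growth on the
fundamental domain. -/
lemma exists_bound_on_fd {u : ℍ → ℂ} (hu : Continuous u) {C : ℝ}
    (h : u =O[atImInfty] fun z => Real.exp (C * z.im)) :
    ∃ A, 0 ≤ A ∧ ∀ z ∈ 𝒟, ‖u z‖ ≤ A * Real.exp (C * z.im) := by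
  obtain ⟨A, hA⟩ := h.bound
  rw [atImInfty, Filter.eventually_comap, Filter.eventually_atTop] at hA
  obtain ⟨y, hy⟩ := hA
  have hc : ContinuousOn (fun z : ℍ => ‖u z‖ / Real.exp (C * z.im))
      (ModularGroup.truncatedFundamentalDomain y) := by
    refine Continuous.continuousOn ?_
    have := UpperHalfPlane.continuous_im
    refine hu.norm.div (by fun_prop) fun z => (Real.exp_pos _).ne'
  obtain ⟨E, hE⟩ := (ModularGroup.isCompact_truncatedFundamentalDomain y).exists_bound_of_continuousOn hc
  refine ⟨max (max A E) 0, le_max_right _ _, fun z hz => ?_⟩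
  rcases le_total z.im y with h1 | h1
  · have := hE z ⟨hz, h1⟩
    rw [Real.norm_of_nonneg (by positivity), div_le_iff₀ (Real.exp_pos _)] at this
    refine this.trans ?_
    gcongr
    exact (le_max_right _ _).trans (le_max_left _ _)
  · have := hy _ h1 z rfl
    rw [Real.norm_of_nonneg (Real.exp_pos _).le] at this
    refine this.trans ?_
    gcongr
    exact (le_max_left _ _).trans (le_max_left _ _)

end MacMahon

namespace MacMahon
open scoped MatrixGroups Manifold UpperHalfPlane
open CongruenceSubgroup UpperHalfPlane

/-- The seed of the weight 12 Poincaré series, slashed by `γ`. -/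
noncomputable def seed (ν : ℝ) (γ : SL(2, ℤ)) (z : ℍ) : ℂ :=
  Complex.exp (2 * Real.pi * Complex.I * ν * ((γ • z : ℍ) : ℂ)) * (denom γ z) ^ (-12 : ℤ)

lemma denom_ne_zero' (γ : SL(2, ℤ)) (z : ℍ) : denom γ z ≠ 0 := denom_ne_zero _ _

lemma denom_mul' (γ δ : SL(2, ℤ)) (z : ℍ) :
    denom ((γ * δ : SL(2, ℤ)) : GL (Fin 2) ℝ) z = denom γ (δ • z : ℍ) * denom δ z := by
  have := denom_cocycle_σ (γ : GL (Fin 2) ℝ) (δ : GL (Fin 2) ℝ) z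
  simp only [ModularGroup.sl_moeb, map_mul] at *
  rw [this]
  simp [σ]

lemma seed_smul (ν : ℝ) (γ δ : SL(2, ℤ)) (z : ℍ) :
    seed ν γ (δ • z) * (denom δ z) ^ (-12 : ℤ) = seed ν (γ * δ) z := by
  unfold seed
  rw [denom_mul', mul_zpow, mul_smul, mul_assoc]

lemma norm_seed (ν : ℝ) (γ : SL(2, ℤ)) (z : ℍ) :
    ‖seed ν γ z‖ = Real.exp (-2 * Real.pi * ν * (γ • z).im) * ‖denom γ z‖ ^ (-12 : ℤ) := by
  rw [seed, norm_mul, Complex.norm_exp, norm_zpow]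
  congr 2
  simp

lemma seed_mdifferentiable (ν : ℝ) (γ : SL(2, ℤ)) : MDiff (seed ν γ) := by
  have h1 : MDiff (fun z : ℍ => Complex.exp (2 * Real.pi * Complex.I * ν * (z : ℂ))) := by
    rw [UpperHalfPlane.mdifferentiable_iff]
    refine DifferentiableOn.congr (f := fun z : ℂ =>
      Complex.exp (2 * Real.pi * Complex.I * ν * z)) (by fun_prop) fun z hz => ?_
    simp [ofComplex_apply_of_im_pos hz]
  have h2 := sl_smul_mdifferentiable h1 γ
  exact h2.mul (mdifferentiable_denom_zpow (γ : GL (Fin 2) ℝ) (-12))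

/-- Bottom rows of elements of `Γ(m)`. -/
def bottomRows (m : ℕ) : Set (Fin 2 → ℤ) := Set.range fun γ : Gamma m => (γ : SL(2, ℤ)).1 1

/-- A chosen element of `Γ(m)` with given bottom row. -/
noncomputable def rowLift {m : ℕ} (v : bottomRows m) : Gamma m := v.2.choose

lemma rowLift_row {m : ℕ} (v : bottomRows m) : (rowLift v : SL(2, ℤ)).1 1 = v.1 := v.2.choose_spec

lemma mul_row (γ δ : SL(2, ℤ)) : (γ * δ).1 1 = Matrix.vecMul (γ.1 1) δ.1 := by
  ext i
  simp [Matrix.SpecialLinearGroup.coe_mul, Matrix.mul_apply, Matrix.vecMul, dotProduct]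

lemma vecMul_injective' (δ : SL(2, ℤ)) : Function.Injective fun v => Matrix.vecMul v δ.1 := by
  intro v w h
  have := congrArg (fun u => Matrix.vecMul u (δ⁻¹).1) h
  simpa only [Matrix.vecMul_vecMul, ← Matrix.SpecialLinearGroup.coe_mul, mul_inv_cancel,
    Matrix.SpecialLinearGroup.coe_one, Matrix.vecMul_one] using this

/-- The Poincaré series of weight 12 on `Γ(m)` with character `χ`. -/
noncomputable def poincare {m : ℕ} (χ : Gamma m →* ℂ) (ν : ℝ) (z : ℍ) : ℂ :=
  ∑' v : bottomRows m, (χ (rowLift v))⁻¹ * seed ν (rowLift v) z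

lemma poincare_slash {m : ℕ} (χ : Gamma m →* ℂ) (ν : ℝ) (δ : SL(2, ℤ)) (z : ℍ) :
    poincare χ ν (δ • z) * (denom δ z) ^ (-12 : ℤ) =
      ∑' v : bottomRows m, (χ (rowLift v))⁻¹ * seed ν (rowLift v * δ) z := by
  rw [poincare, ← tsum_mul_right]
  exact tsum_congr fun v => by rw [mul_assoc, seed_smul]

lemma norm_char {m : ℕ} (hm : m ≠ 0) {χ : Gamma m →* ℂ} (hχ : ∀ γ, χ γ ^ m = 1) (γ : Gamma m) :
    ‖χ γ‖ = 1 := Complex.norm_eq_one_of_pow_eq_one (hχ γ) hm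

lemma char_ne_zero {m : ℕ} (hm : m ≠ 0) {χ : Gamma m →* ℂ} (hχ : ∀ γ, χ γ ^ m = 1) (γ : Gamma m) :
    χ γ ≠ 0 := by
  have := norm_char hm hχ γ
  intro h; simp [h] at this

/-- Domination of the general term on a vertical strip. -/
lemma norm_seed_le (ν : ℝ) (γ : SL(2, ℤ)) {A B : ℝ} (hB : 0 < B) {z : ℍ}
    (hz : z ∈ verticalStrip A B) :
    ‖seed ν γ z‖ ≤ Real.exp (-2 * Real.pi * ν * (γ • z).im) *
      (EisensteinSeries.r ⟨⟨A, B⟩, hB⟩ ^ (-12 : ℝ) * ‖γ.1 1‖ ^ (-12 : ℝ)) := by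
  rw [norm_seed]
  gcongr
  have h1 := EisensteinSeries.summand_bound_of_mem_verticalStrip (k := 12) (by norm_num) (γ.1 1) hB hz
  refine le_trans (le_of_eq ?_) h1
  rw [ModularGroup.denom_apply, ← Real.rpow_intCast]
  norm_cast

lemma summable_row_norm {m : ℕ} (δ : SL(2, ℤ)) :
    Summable fun v : bottomRows m => ‖((rowLift v : SL(2, ℤ)) * δ).1 1‖ ^ (-12 : ℝ) := by
  have h := EisensteinSeries.summable_one_div_norm_rpow (k := 12) (by norm_num)
  refine (h.comp_injective (i := fun v : bottomRows m => Matrix.vecMul v.1 δ.1)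
    ((vecMul_injective' δ).comp Subtype.val_injective)).congr fun v => ?_
  simp only [Function.comp]
  rw [mul_row, rowLift_row]

lemma tsum_row_norm_le {m : ℕ} (δ : SL(2, ℤ)) :
    ∑' v : bottomRows m, ‖((rowLift v : SL(2, ℤ)) * δ).1 1‖ ^ (-12 : ℝ) ≤
      ∑' v : Fin 2 → ℤ, ‖v‖ ^ (-12 : ℝ) := by
  have h := EisensteinSeries.summable_one_div_norm_rpow (k := 12) (by norm_num)
  refine (summable_row_norm δ).tsum_le_tsum_of_inj (fun v : bottomRows m => Matrix.vecMul v.1 δ.1)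
    ((vecMul_injective' δ).comp Subtype.val_injective) (fun _ _ => by positivity) (fun v => ?_) h
  rw [mul_row, rowLift_row]

lemma poincare_mdifferentiable {m : ℕ} (hm : m ≠ 0) {χ : Gamma m →* ℂ} (hχ : ∀ γ, χ γ ^ m = 1)
    {ν : ℝ} (hν : ν ≤ 0) : MDiff (poincare χ ν) := by
  rw [UpperHalfPlane.mdifferentiable_iff]
  intro z0 hz0
  have hz0 : 0 < z0.im := hz0
  refine DifferentiableAt.differentiableWithinAt ?_
  set A := |z0.re| + 1
  set B := z0.im / 2
  set B' := z0.im + 1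
  have hB : 0 < B := by positivity
  set U : Set ℂ := {z | |z.re| < A ∧ B < z.im ∧ z.im < B'}
  have hU : IsOpen U := by
    have h1 : IsOpen {z : ℂ | |z.re| < A} := isOpen_lt (by fun_prop) continuous_const
    have h2 : IsOpen {z : ℂ | B < z.im} := isOpen_lt continuous_const Complex.continuous_im
    have h3 : IsOpen {z : ℂ | z.im < B'} := isOpen_lt Complex.continuous_im continuous_const
    exact h1.inter (h2.inter h3)
  have hzU : z0 ∈ U := ⟨by simp [A], by simp [B, hz0], by simp [B']⟩
  have hpos : ∀ z ∈ U, 0 < z.im := fun z hz => hB.trans hz.2.1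
  refine DifferentiableOn.differentiableAt (s := U) ?_ (hU.mem_nhds hzU)
  have hs := (summable_row_norm (m := m) 1).mul_left
    (Real.exp (-2 * Real.pi * ν * (B' + 1 / B)) * EisensteinSeries.r ⟨⟨A, B⟩, hB⟩ ^ (-12 : ℝ))
  refine Complex.differentiableOn_tsum_of_summable_norm hs (fun v => ?_) hU fun v z hz => ?_
  · intro z hz
    have := (UpperHalfPlane.mdifferentiable_iff.mp (seed_mdifferentiable ν (rowLift v))) z (hpos z hz)
    exact ((this.differentiableAt ((isOpen_lt continuous_const Complex.continuous_im).mem_nhds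
      (hpos z hz))).const_mul _).differentiableWithinAt
  · rw [norm_mul, norm_inv, norm_char hm hχ, inv_one, one_mul, ofComplex_apply_of_im_pos (hpos z hz)]
    refine (norm_seed_le ν _ hB (A := A) (z := ⟨z, hpos z hz⟩) ⟨hz.1.le, hz.2.1.le⟩).trans ?_
    have hr := (EisensteinSeries.r_pos ⟨⟨A, B⟩, hB⟩).le
    rw [← mul_assoc, mul_one]
    gcongr ?_ * _ * _
    apply Real.exp_le_exp.mpr
    have h1 : ((rowLift v : SL(2, ℤ)) • (⟨z, hpos z hz⟩ : ℍ)).im ≤ B' + 1 / B := by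
      refine (im_smul_le_height _ _).trans ?_
      show z.im + 1 / z.im ≤ _
      have := one_div_le_one_div_of_le hB hz.2.1.le
      have := hz.2.2
      linarith
    have : 0 ≤ -2 * Real.pi * ν := by nlinarith [Real.pi_pos]
    exact mul_le_mul_of_nonneg_left h1 this

lemma T_zpow_mem_iff {m : ℕ} (k : ℤ) : ModularGroup.T ^ k ∈ Gamma m ↔ (m : ℤ) ∣ k := by
  rw [Gamma_mem]
  simp [ModularGroup.coe_T_zpow, ZMod.intCast_zmod_eq_zero_iff_dvd, ZMod.intCast_zmod_eq_zero_iff_dvd]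

lemma T_pow_mem (m : ℕ) : ModularGroup.T ^ m ∈ Gamma m := by
  rw [← zpow_natCast, T_zpow_mem_iff]

/-- Translation by `m`, as an element of `Γ(m)`. -/
def Tm (m : ℕ) : Gamma m := ⟨ModularGroup.T ^ m, T_pow_mem m⟩

lemma eq_T_zpow_mul_of_row_eq {γ γ' : SL(2, ℤ)} (h : γ.1 1 = γ'.1 1) :
    γ = ModularGroup.T ^ ((γ * γ'⁻¹) 0 1) * γ' := by
  have h1 : (γ * γ'⁻¹).1 1 = ![0, 1] := by
    rw [mul_row, h, ← mul_row, mul_inv_cancel]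
    ext i; fin_cases i <;> simp
  set g := γ * γ'⁻¹ with hg
  have h10 : g 1 0 = 0 := congrFun h1 0
  have h11 : g 1 1 = 1 := congrFun h1 1
  have h00 : g 0 0 = 1 := by
    have := g.det_coe
    rw [Matrix.det_fin_two, h10, h11] at this
    linarith
  have : g = ModularGroup.T ^ (g 0 1) := by
    ext i j
    rw [ModularGroup.coe_T_zpow]
    fin_cases i <;> fin_cases j <;> simp [h10, h11, h00]
  rw [← this, hg]; simp

lemma seed_T_zpow_mul (ν : ℝ) (k : ℤ) (γ : SL(2, ℤ)) (z : ℍ) :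
    seed ν (ModularGroup.T ^ k * γ) z =
      Complex.exp (2 * Real.pi * Complex.I * ν * k) * seed ν γ z := by
  unfold seed
  rw [denom_mul', mul_smul, UpperHalfPlane.modular_T_zpow_smul, coe_vadd, ← mul_assoc,
    ← Complex.exp_add]
  have : denom (ModularGroup.T ^ k : SL(2, ℤ)) (γ • z : ℍ) = 1 := by
    rw [ModularGroup.denom_apply, ModularGroup.coe_T_zpow]; simp
  rw [this, one_mul]
  congr 2
  push_cast; ring

lemma seed_term_eq {m : ℕ} {χ : Gamma m →* ℂ} {ν : ℝ} (hT : χ (Tm m) ≠ 0)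
    (hν : Complex.exp (2 * Real.pi * Complex.I * ν * m) = χ (Tm m)) {γ γ' : Gamma m}
    (h : (γ : SL(2, ℤ)).1 1 = (γ' : SL(2, ℤ)).1 1) (δ : SL(2, ℤ)) (z : ℍ) :
    (χ γ)⁻¹ * seed ν (γ * δ) z = (χ γ')⁻¹ * seed ν (γ' * δ) z := by
  have h1 := eq_T_zpow_mul_of_row_eq h
  set k := ((γ : SL(2, ℤ)) * (γ' : SL(2, ℤ))⁻¹) 0 1
  have h2 : ModularGroup.T ^ k ∈ Gamma m := by
    rw [eq_mul_inv_of_mul_eq h1.symm]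
    exact mul_mem γ.2 (inv_mem γ'.2)
  obtain ⟨j, hj⟩ := (T_zpow_mem_iff k).mp h2
  have h3 : γ = Tm m ^ j * γ' := by
    apply Subtype.ext
    rw [Subgroup.coe_mul, Subgroup.coe_zpow]
    show _ = (ModularGroup.T ^ m) ^ j * _
    rw [← zpow_natCast, ← zpow_mul, ← hj]
    exact h1
  have hu : χ (Tm m ^ j) = χ (Tm m) ^ j := by
    rcases j with n | n
    · simp
    · rw [zpow_negSucc, zpow_negSucc, ← map_pow]
      exact eq_inv_of_mul_eq_one_left (by rw [← map_mul, inv_mul_cancel, map_one])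
  have h4 : χ γ = χ (Tm m) ^ j * χ γ' := by
    conv_lhs => rw [h3]
    rw [map_mul, hu]
  conv_lhs => rw [h1, mul_assoc, seed_T_zpow_mul, h4, mul_inv]
  have h5 : Complex.exp (2 * Real.pi * Complex.I * ν * k) = χ (Tm m) ^ j := by
    rw [← hν, ← Complex.exp_int_mul, hj]
    congr 1; push_cast; ring
  rw [h5]
  have := zpow_ne_zero j hT
  field_simp

lemma poincare_smul {m : ℕ} {χ : Gamma m →* ℂ} (h0 : ∀ γ, χ γ ≠ 0) {ν : ℝ}
    (hν : Complex.exp (2 * Real.pi * Complex.I * ν * m) = χ (Tm m)) (γ : Gamma m) (z : ℍ) :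
    poincare χ ν ((γ : SL(2, ℤ)) • z) * (denom (γ : SL(2, ℤ)) z) ^ (-12 : ℤ) =
      χ γ * poincare χ ν z := by
  let e : bottomRows m ≃ bottomRows m :=
    { toFun := fun v => ⟨Matrix.vecMul v.1 (γ : SL(2, ℤ)).1, rowLift v * γ, by
        show ((rowLift v : SL(2, ℤ)) * γ).1 1 = _
        rw [mul_row, rowLift_row]⟩
      invFun := fun v => ⟨Matrix.vecMul v.1 (γ⁻¹ : SL(2, ℤ)).1, rowLift v * γ⁻¹, by
        show ((rowLift v : SL(2, ℤ)) * (γ : SL(2, ℤ))⁻¹).1 1 = _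
        rw [mul_row, rowLift_row]⟩
      left_inv := fun v => Subtype.ext (by
        simp only [Matrix.vecMul_vecMul, ← Matrix.SpecialLinearGroup.coe_mul, mul_inv_cancel,
          Matrix.SpecialLinearGroup.coe_one, Matrix.vecMul_one])
      right_inv := fun v => Subtype.ext (by
        simp only [Matrix.vecMul_vecMul, ← Matrix.SpecialLinearGroup.coe_mul, inv_mul_cancel,
          Matrix.SpecialLinearGroup.coe_one, Matrix.vecMul_one]) }
  rw [poincare_slash, poincare, ← tsum_mul_left,
    ← e.tsum_eq (fun v => χ γ * ((χ (rowLift v))⁻¹ * seed ν (rowLift v) z))]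
  refine tsum_congr fun v => ?_
  have h1 : ((rowLift v * γ : Gamma m) : SL(2, ℤ)).1 1 = (rowLift (e v) : SL(2, ℤ)).1 1 := by
    rw [rowLift_row, Subgroup.coe_mul, mul_row, rowLift_row]; rfl
  have := seed_term_eq (h0 _) hν h1 1 z
  rw [mul_one, mul_one, map_mul] at this
  rw [← this, Subgroup.coe_mul]
  have := h0 γ
  have := h0 (rowLift v)
  field_simp

end MacMahon

namespace MacMahon
open scoped MatrixGroups Manifold UpperHalfPlane
open CongruenceSubgroup UpperHalfPlane

lemma discriminant_smul (δ : SL(2, ℤ)) (z : ℍ) :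
    ModularForm.discriminant (δ • z) * (denom δ z) ^ (-12 : ℤ) = ModularForm.discriminant z := by
  have := congrFun (SlashInvariantForm.slash_action_generators_SL2Z ModularForm.discriminant_S_invariant
    ModularForm.discriminant_T_invariant δ) z
  rwa [ModularForm.SL_slash_apply] at this

/-- The Poincaré series divided by the discriminant. -/
noncomputable def poincareFun {m : ℕ} (χ : Gamma m →* ℂ) (ν : ℝ) (z : ℍ) : ℂ :=
  poincare χ ν z / ModularForm.discriminant z

lemma poincareFun_smul {m : ℕ} (χ : Gamma m →* ℂ) (ν : ℝ) (δ : SL(2, ℤ)) (z : ℍ) :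
    poincareFun χ ν (δ • z) = poincare χ ν (δ • z) * (denom δ z) ^ (-12 : ℤ) /
      ModularForm.discriminant z := by
  have h := denom_ne_zero' δ z
  have h1 : (denom δ z) ^ (-12 : ℤ) ≠ 0 := zpow_ne_zero _ h
  rw [← discriminant_smul δ z, poincareFun, mul_div_mul_right _ _ h1]

lemma poincareFun_char {m : ℕ} {χ : Gamma m →* ℂ} (h0 : ∀ γ, χ γ ≠ 0) {ν : ℝ}
    (hν : Complex.exp (2 * Real.pi * Complex.I * ν * m) = χ (Tm m)) (γ : Gamma m) (z : ℍ) :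
    poincareFun χ ν ((γ : SL(2, ℤ)) • z) = χ γ * poincareFun χ ν z := by
  rw [poincareFun_smul, poincare_smul h0 hν, poincareFun, mul_div_assoc]

lemma discriminant_mdifferentiable : MDiff ModularForm.discriminant :=
  CuspForm.discriminant.holo'

lemma inv_discriminant_mdifferentiable : MDiff fun z => (ModularForm.discriminant z)⁻¹ := by
  have := discriminant_mdifferentiable
  rw [UpperHalfPlane.mdifferentiable_iff] at this ⊢
  exact this.inv fun z _ => ModularForm.discriminant_ne_zero _

lemma poincareFun_mdifferentiable {m : ℕ} (hm : m ≠ 0) {χ : Gamma m →* ℂ}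
    (hχ : ∀ γ, χ γ ^ m = 1) {ν : ℝ} (hν : ν ≤ 0) : MDiff (poincareFun χ ν) := by
  have : poincareFun χ ν = poincare χ ν * fun z => (ModularForm.discriminant z)⁻¹ := by
    ext z; exact div_eq_mul_inv _ _
  rw [this]
  exact (poincare_mdifferentiable hm hχ hν).mul inv_discriminant_mdifferentiable

open scoped Modular in
lemma exists_inv_discriminant_bound : ∃ A, 0 ≤ A ∧ ∀ z ∈ 𝒟,
    ‖(ModularForm.discriminant z)⁻¹‖ ≤ A * Real.exp (2 * Real.pi * z.im) := by
  refine exists_bound_on_fd inv_discriminant_mdifferentiable.continuous ?_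
  have := ModularForm.exp_isBigO_discriminant.inv_rev
    (Filter.Eventually.of_forall fun z h => absurd h (Real.exp_pos _).ne')
  refine this.congr_right fun z => ?_
  rw [← Real.exp_neg]; ring_nf

lemma norm_poincare_slash_le {m : ℕ} (hm : m ≠ 0) {χ : Gamma m →* ℂ}
    (hχ : ∀ γ, χ γ ^ m = 1) {ν : ℝ} (hν : ν ≤ 0) {A B : ℝ} (hB : 0 < B) {z : ℍ}
    (hz : z ∈ verticalStrip A B) (δ : SL(2, ℤ)) {Y : ℝ}
    (hY : ∀ γ : SL(2, ℤ), (γ • z).im ≤ Y) :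
    ‖poincare χ ν (δ • z) * (denom δ z) ^ (-12 : ℤ)‖ ≤
      Real.exp (-2 * Real.pi * ν * Y) * (EisensteinSeries.r ⟨⟨A, B⟩, hB⟩ ^ (-12 : ℝ) *
        ∑' v : Fin 2 → ℤ, ‖v‖ ^ (-12 : ℝ)) := by
  have hr := (EisensteinSeries.r_pos ⟨⟨A, B⟩, hB⟩).le
  have hterm (v : bottomRows m) : ‖(χ (rowLift v))⁻¹ * seed ν (rowLift v * δ) z‖ ≤
      (Real.exp (-2 * Real.pi * ν * Y) * EisensteinSeries.r ⟨⟨A, B⟩, hB⟩ ^ (-12 : ℝ)) *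
        ‖((rowLift v : SL(2, ℤ)) * δ).1 1‖ ^ (-12 : ℝ) := by
    rw [norm_mul, norm_inv, norm_char hm hχ, inv_one, one_mul]
    refine (norm_seed_le ν _ hB hz).trans ?_
    rw [mul_assoc (Real.exp (-2 * Real.pi * ν * Y))]
    refine mul_le_mul_of_nonneg_right (Real.exp_le_exp.mpr ?_) (by positivity)
    have := hY ((rowLift v : SL(2, ℤ)) * δ)
    have : 0 ≤ (-2 * Real.pi * ν) * (Y - (((rowLift v : SL(2, ℤ)) * δ) • z).im) :=
      mul_nonneg (by nlinarith [Real.pi_pos]) (by linarith)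
    linarith
  have hs := (summable_row_norm (m := m) δ).mul_left
    (Real.exp (-2 * Real.pi * ν * Y) * EisensteinSeries.r ⟨⟨A, B⟩, hB⟩ ^ (-12 : ℝ))
  rw [poincare_slash]
  refine (tsum_of_norm_bounded hs.hasSum hterm).trans ?_
  rw [tsum_mul_left, ← mul_assoc]
  gcongr
  exact tsum_row_norm_le δ

open scoped Modular in
lemma poincareFun_mem {m : ℕ} (hm : m ≠ 0) {χ : Gamma m →* ℂ}
    (hχ : ∀ γ, χ γ ^ m = 1) {ν : ℝ} (hν : ν ≤ 0) : poincareFun χ ν ∈ modGrowth := by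
  obtain ⟨A, hA, hA'⟩ := exists_inv_discriminant_bound
  have hB : (0 : ℝ) < 1 / 2 := by norm_num
  set K := EisensteinSeries.r ⟨⟨1, 1/2⟩, hB⟩ ^ (-12 : ℝ) * ∑' v : Fin 2 → ℤ, ‖v‖ ^ (-12 : ℝ)
  have hr := (EisensteinSeries.r_pos ⟨⟨1, 1/2⟩, hB⟩).le
  have hK : 0 ≤ K := mul_nonneg (by positivity) (tsum_nonneg fun _ => by positivity)
  have hpi := Real.pi_pos
  refine mem_modGrowth_of_fd (poincareFun_mdifferentiable hm hχ hν) (A := K * A)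
    (C := -2 * Real.pi * ν * 5 + 2 * Real.pi) (by positivity) (by nlinarith) fun δ z hz => ?_
  have hz2 : (1 / 2 : ℝ) ≤ z.im := by
    have := ModularGroup.three_le_four_mul_im_sq_of_mem_fd hz
    have := z.im_pos
    nlinarith
  have hstrip : z ∈ verticalStrip 1 (1 / 2) := ⟨hz.2.trans (by norm_num), hz2⟩
  have h1 := norm_poincare_slash_le hm hχ hν hB hstrip δ (Y := height z)
    fun γ => im_smul_le_height γ z
  rw [poincareFun_smul, norm_div, div_eq_mul_inv, ← norm_inv]
  calc _ ≤ (Real.exp (-2 * Real.pi * ν * height z) * K) * (A * Real.exp (2 * Real.pi * z.im)) :=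
        mul_le_mul h1 (hA' z hz) (norm_nonneg _) (by positivity)
    _ = K * A * Real.exp (-2 * Real.pi * ν * height z + 2 * Real.pi * z.im) := by
        rw [Real.exp_add]; ring
    _ ≤ _ := by
        gcongr
        have h2 : height z ≤ 5 * z.im := by
          have h3 : 1 / z.im ≤ 2 := by
            rw [div_le_iff₀ z.im_pos]; linarith
          unfold height; linarith
        have := mul_le_mul_of_nonneg_left h2 (show 0 ≤ -2 * Real.pi * ν by nlinarith)
        linarith

/-- The point `iy` of the upper half plane, for `y ≥ 1`. -/
noncomputable def ipt (y : ℝ) : ℍ := ⟨⟨0, max y 1⟩, lt_max_of_lt_right one_pos⟩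

lemma ipt_im (y : ℝ) : (ipt y).im = max y 1 := rfl

lemma ipt_re (y : ℝ) : (ipt y).re = 0 := rfl

lemma im_smul_ipt (γ : SL(2, ℤ)) (y : ℝ) : (γ • ipt y).im =
    max y 1 / (((γ 1 0 : ℤ) : ℝ) ^ 2 * max y 1 ^ 2 + ((γ 1 1 : ℤ) : ℝ) ^ 2) := by
  rw [ModularGroup.im_smul_eq_div_normSq, ModularGroup.denom_apply, ipt_im]
  congr 1
  simp [Complex.normSq_apply, ipt]
  ring

lemma row_sq_pos (γ : SL(2, ℤ)) (h : γ 1 0 = 0) : ((γ 1 1 : ℤ) : ℝ) ^ 2 = 1 ∧ γ 0 0 * γ 1 1 = 1 := by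
  have := γ.det_coe
  rw [Matrix.det_fin_two, h, mul_zero, sub_zero] at this
  refine ⟨?_, this⟩
  rcases Int.eq_one_or_neg_one_of_mul_eq_one' this with h | h <;> simp [h.2]

lemma im_smul_ipt_le (γ : SL(2, ℤ)) (y : ℝ) : (γ • ipt y).im ≤ max y 1 := by
  rw [im_smul_ipt]
  have h1 : 1 ≤ max y 1 := le_max_right _ _
  by_cases h : γ 1 0 = 0
  · rw [(row_sq_pos γ h).1, h]; simp
  · have h2 : (1 : ℝ) ≤ ((γ 1 0 : ℤ) : ℝ) ^ 2 := by
      rw [← sq_abs]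
      have : (1 : ℤ) ≤ |γ 1 0| := Int.one_le_abs h
      have : (1 : ℝ) ≤ |((γ 1 0 : ℤ) : ℝ)| := by exact_mod_cast this
      nlinarith
    refine div_le_self (by positivity) ?_
    nlinarith [sq_nonneg ((γ 1 1 : ℤ) : ℝ)]

lemma im_smul_ipt_le_one (γ : SL(2, ℤ)) (h : γ 1 0 ≠ 0) (y : ℝ) : (γ • ipt y).im ≤ 1 := by
  rw [im_smul_ipt]
  have h1 : 1 ≤ max y 1 := le_max_right _ _
  have h2 : (1 : ℝ) ≤ ((γ 1 0 : ℤ) : ℝ) ^ 2 := by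
    rw [← sq_abs]
    have : (1 : ℤ) ≤ |γ 1 0| := Int.one_le_abs h
    have : (1 : ℝ) ≤ |((γ 1 0 : ℤ) : ℝ)| := by exact_mod_cast this
    nlinarith
  rw [div_le_one (by positivity)]
  nlinarith [sq_nonneg ((γ 1 1 : ℤ) : ℝ)]

lemma ipt_mem_strip (y : ℝ) : ipt y ∈ verticalStrip 1 1 := by
  constructor
  · rw [ipt_re]; simp
  · rw [ipt_im]; exact le_max_right _ _

lemma norm_exp_mul_seed_le (ν : ℝ) (γ : SL(2, ℤ)) (y : ℝ) {c : ℝ}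
    (hc : Real.exp (2 * Real.pi * ν * max y 1) * Real.exp (-2 * Real.pi * ν * (γ • ipt y).im) ≤ c) :
    ‖(Real.exp (2 * Real.pi * ν * max y 1) : ℂ) * seed ν γ (ipt y)‖ ≤
      c * (EisensteinSeries.r ⟨⟨1, 1⟩, one_pos⟩ ^ (-12 : ℝ) * ‖γ.1 1‖ ^ (-12 : ℝ)) := by
  have hr := (EisensteinSeries.r_pos ⟨⟨1, 1⟩, one_pos⟩).le
  rw [norm_mul, Complex.norm_real, Real.norm_of_nonneg (Real.exp_pos _).le]
  refine (mul_le_mul_of_nonneg_left (norm_seed_le ν γ one_pos (ipt_mem_strip y))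
    (Real.exp_pos _).le).trans ?_
  rw [← mul_assoc]
  exact mul_le_mul_of_nonneg_right hc (by positivity)

open Classical in
/-- The limit of a term of the Poincaré series at `i∞`, after normalisation. -/
noncomputable def seedLimit (ν : ℝ) (γ : SL(2, ℤ)) : ℂ :=
  if γ 1 0 = 0 then Complex.exp (2 * Real.pi * Complex.I * ν * (γ 0 1 * γ 1 1 : ℤ)) else 0

lemma tendsto_seed {ν : ℝ} (hν : ν < 0) (γ : SL(2, ℤ)) :
    Filter.Tendsto (fun y : ℝ => (Real.exp (2 * Real.pi * ν * max y 1) : ℂ) * seed ν γ (ipt y))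
      Filter.atTop (nhds (seedLimit ν γ)) := by
  unfold seedLimit
  split_ifs with h
  · obtain ⟨h1, h2⟩ := row_sq_pos γ h
    refine tendsto_const_nhds.congr fun y => ?_
    have hd : ((γ 1 1 : ℤ) : ℂ) ^ 2 = 1 := by exact_mod_cast h1
    have hd0 : ((γ 1 1 : ℤ) : ℂ) ≠ 0 := by intro h; simp [h] at hd
    have ha : ((γ 0 0 : ℤ) : ℂ) * ((γ 1 1 : ℤ) : ℂ) = 1 := by exact_mod_cast h2
    have hz : ((γ • ipt y : ℍ) : ℂ) = (ipt y : ℂ) + (γ 0 1 * γ 1 1 : ℤ) := by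
      rw [UpperHalfPlane.coe_specialLinearGroup_apply]
      simp only [algebraMap_int_eq, eq_intCast, h, Int.cast_zero, Complex.ofReal_zero, zero_mul, zero_add, Complex.ofReal_intCast]
      rw [div_eq_iff hd0]
      push_cast
      linear_combination (ipt y : ℂ) * (((γ 1 1 : ℤ) : ℂ) * ha - ((γ 0 0 : ℤ) : ℂ) * hd)
        - ((γ 0 1 : ℤ) : ℂ) * hd
    rw [seed, hz, ModularGroup.denom_apply, h]
    simp only [Int.cast_zero, zero_mul, zero_add]
    have e1 : ((γ 1 1 : ℤ) : ℂ) ^ (-12 : ℤ) = 1 := by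
      rw [show (-12 : ℤ) = 2 * (-6) by norm_num, zpow_mul]
      norm_cast at hd ⊢
      simp [hd]
    rw [e1, mul_one, Complex.ofReal_exp, ← Complex.exp_add]
    congr 1
    have : (ipt y : ℂ) = Complex.I * (max y 1 : ℝ) := by
      apply Complex.ext <;> simp [ipt]
    rw [this]; push_cast
    linear_combination (-2 * Real.pi * ν * ((max y 1 : ℝ) : ℂ)) * Complex.I_sq
  · rw [tendsto_zero_iff_norm_tendsto_zero]
    refine squeeze_zero (fun _ => norm_nonneg _) (fun y => norm_exp_mul_seed_le ν γ y
      (c := Real.exp (2 * Real.pi * ν * max y 1) * Real.exp (-2 * Real.pi * ν * 1)) ?_) ?_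
    · gcongr _ * Real.exp ?_
      exact mul_le_mul_of_nonneg_left (im_smul_ipt_le_one γ h y) (by nlinarith [Real.pi_pos])
    · have h1 : Filter.Tendsto (fun y : ℝ => Real.exp (2 * Real.pi * ν * max y 1)) Filter.atTop
          (nhds 0) := by
        refine Real.tendsto_exp_atBot.comp ?_
        refine Filter.Tendsto.const_mul_atTop_of_neg (by nlinarith [Real.pi_pos]) ?_
        exact Filter.tendsto_atTop_mono (fun y => le_max_left y 1) Filter.tendsto_id
      have := (h1.mul_const (Real.exp (-2 * Real.pi * ν * 1))).mul_const
        (EisensteinSeries.r ⟨⟨1, 1⟩, one_pos⟩ ^ (-12 : ℝ) * ‖γ.1 1‖ ^ (-12 : ℝ))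
      simpa using this

lemma tendsto_poincare {m : ℕ} (hm : m ≠ 0) {χ : Gamma m →* ℂ} (hχ : ∀ γ, χ γ ^ m = 1) {ν : ℝ}
    (hν : ν < 0) (δ : SL(2, ℤ)) :
    Filter.Tendsto (fun y : ℝ => (Real.exp (2 * Real.pi * ν * max y 1) : ℂ) *
      (poincareFun χ ν (δ • ipt y) * ModularForm.discriminant (ipt y))) Filter.atTop
      (nhds (∑' v : bottomRows m, (χ (rowLift v))⁻¹ * seedLimit ν (rowLift v * δ))) := by
  have h1 (y : ℝ) : (Real.exp (2 * Real.pi * ν * max y 1) : ℂ) *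
      (poincareFun χ ν (δ • ipt y) * ModularForm.discriminant (ipt y)) =
      ∑' v : bottomRows m, (χ (rowLift v))⁻¹ * ((Real.exp (2 * Real.pi * ν * max y 1) : ℂ) *
        seed ν (rowLift v * δ) (ipt y)) := by
    rw [poincareFun_smul, div_mul_cancel₀ _ (ModularForm.discriminant_ne_zero _), poincare_slash,
      ← tsum_mul_left]
    exact tsum_congr fun v => by ring
  simp only [h1]
  refine tendsto_tsum_of_dominated_convergence
    ((summable_row_norm (m := m) δ).mul_left (EisensteinSeries.r ⟨⟨1, 1⟩, one_pos⟩ ^ (-12 : ℝ)))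
    (fun v => (tendsto_seed hν _).const_mul _) (Filter.Eventually.of_forall fun y v => ?_)
  rw [norm_mul, norm_inv, norm_char hm hχ, inv_one, one_mul]
  refine (norm_exp_mul_seed_le ν _ y (c := 1) ?_).trans (one_mul _).le
  rw [← Real.exp_add, Real.exp_le_one_iff]
  have := mul_le_mul_of_nonneg_left (im_smul_ipt_le ((rowLift v : SL(2, ℤ)) * δ) y)
    (show 0 ≤ -2 * Real.pi * ν by nlinarith [Real.pi_pos])
  linarith

lemma Gamma_diag {m : ℕ} (hm : 3 ≤ m) {γ : SL(2, ℤ)} (hγ : γ ∈ Gamma m) (h : γ 1 0 = 0) :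
    γ 1 1 = 1 := by
  rw [Gamma_mem] at hγ
  have h1 := hγ.2.2.2
  rcases Int.eq_one_or_neg_one_of_mul_eq_one' (row_sq_pos γ h).2 with h2 | h2
  · exact h2.2
  · exfalso
    rw [h2.2] at h1
    have h3 : ((2 : ℕ) : ZMod m) = 0 := by push_cast at h1 ⊢; linear_combination -h1
    rw [ZMod.natCast_eq_zero_iff] at h3
    have := Nat.le_of_dvd two_pos h3
    omega

/-- The bottom row `(0, 1)`. -/
def oneRow (m : ℕ) : bottomRows m := ⟨![0, 1], 1, by ext i; fin_cases i <;> simp⟩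

lemma tsum_seedLimit_T {m : ℕ} (hm : 3 ≤ m) {χ : Gamma m →* ℂ} (h0 : ∀ γ, χ γ ≠ 0) {ν : ℝ}
    (hν : Complex.exp (2 * Real.pi * Complex.I * ν * m) = χ (Tm m)) (i : ℤ) :
    ∑' v : bottomRows m, (χ (rowLift v))⁻¹ * seedLimit ν (rowLift v * ModularGroup.T ^ i) =
      Complex.exp (2 * Real.pi * Complex.I * ν * i) := by
  have hT10 (γ : SL(2, ℤ)) : (γ * ModularGroup.T ^ i) 1 0 = γ 1 0 := by
    simp [Matrix.SpecialLinearGroup.coe_mul, ModularGroup.coe_T_zpow, Matrix.mul_apply]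
  rw [tsum_eq_single (oneRow m)]
  · have h1 : ((rowLift (oneRow m) : Gamma m) : SL(2, ℤ)).1 1 = ((1 : Gamma m) : SL(2, ℤ)).1 1 := by
      rw [rowLift_row]; ext i; fin_cases i <;> simp [oneRow]
    have h2 := seed_term_eq (h0 _) hν h1 (ModularGroup.T ^ i) (ipt 0)
    have h3 (γ : SL(2, ℤ)) (h : γ.1 1 = ![0, 1]) : seed ν (γ * ModularGroup.T ^ i) (ipt 0) =
        seedLimit ν (γ * ModularGroup.T ^ i) * seed ν 1 (ipt 0) := by
      have := eq_T_zpow_mul_of_row_eq (γ := γ) (γ' := 1) (by rw [h]; ext i; fin_cases i <;> simp)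
      rw [mul_one] at this
      set k := (γ * 1⁻¹) 0 1
      have e : γ * ModularGroup.T ^ i = ModularGroup.T ^ (k + i) * 1 := by
        rw [zpow_add, ← this, mul_one]
      rw [e, seed_T_zpow_mul, seedLimit, if_pos]
      · simp [ModularGroup.coe_T_zpow]
      · simp [ModularGroup.coe_T_zpow]
    have hne : seed ν 1 (ipt 0) ≠ 0 :=
      mul_ne_zero (Complex.exp_ne_zero _) (zpow_ne_zero _ (denom_ne_zero' _ _))
    rw [h3 _ (rowLift_row _), map_one, inv_one, one_mul, Subgroup.coe_one, one_mul, ← mul_assoc,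
      ← mul_one (ModularGroup.T ^ i), seed_T_zpow_mul] at h2
    rw [← mul_right_cancel₀ hne h2, mul_one]
  · intro v hv
    have : (rowLift v : SL(2, ℤ)) 1 0 ≠ 0 := by
      intro h
      refine hv (Subtype.ext ?_)
      rw [← rowLift_row v]
      ext j; fin_cases j
      · simpa [oneRow] using h
      · simpa [oneRow] using Gamma_diag hm (rowLift v).2 h
    rw [seedLimit, if_neg (by rwa [hT10]), mul_zero]

lemma tendsto_poincareFun_T {m : ℕ} (hm : 3 ≤ m) {χ : Gamma m →* ℂ} (hχ : ∀ γ, χ γ ^ m = 1) {ν : ℝ}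
    (hν0 : ν < 0) (hν : Complex.exp (2 * Real.pi * Complex.I * ν * m) = χ (Tm m)) (i : ℤ) :
    Filter.Tendsto (fun y : ℝ => (Real.exp (2 * Real.pi * ν * max y 1) : ℂ) *
      (poincareFun χ ν (ModularGroup.T ^ i • ipt y) * ModularForm.discriminant (ipt y))) Filter.atTop
      (nhds (Complex.exp (2 * Real.pi * Complex.I * ν * i))) := by
  have hm0 : m ≠ 0 := by omega
  rw [← tsum_seedLimit_T hm (char_ne_zero hm0 hχ) hν i]
  exact tendsto_poincare hm0 hχ hν0 _

lemma poincareFun_ne_zero {m : ℕ} (hm : 3 ≤ m) {χ : Gamma m →* ℂ} (hχ : ∀ γ, χ γ ^ m = 1) {ν : ℝ}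
    (hν0 : ν < 0) (hν : Complex.exp (2 * Real.pi * Complex.I * ν * m) = χ (Tm m)) :
    poincareFun χ ν ≠ 0 := by
  intro h
  have := tendsto_poincareFun_T hm hχ hν0 hν 0
  simp only [h, Pi.zero_apply, zero_mul, mul_zero, Int.cast_zero, Complex.exp_zero] at this
  exact zero_ne_one (tendsto_nhds_unique tendsto_const_nhds this)

/-- The exponent `-(m+1)/m`. -/
noncomputable def baseExp (m : ℕ) : ℝ := -((m : ℝ) + 1) / m

/-- The base function on `Γ(m)`, generating the function field. -/
noncomputable def baseFun (m : ℕ) : ℍ → ℂ := poincareFun (1 : Gamma m →* ℂ) (baseExp m)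

lemma baseExp_lt {m : ℕ} (hm : m ≠ 0) : baseExp m < -1 := by
  have : (0 : ℝ) < m := by positivity
  rw [baseExp, div_lt_iff₀ this]; linarith

lemma exp_baseExp {m : ℕ} (hm : m ≠ 0) (i : ℤ) :
    Complex.exp (2 * Real.pi * Complex.I * baseExp m * i) = 1 ↔ (m : ℤ) ∣ i := by
  have hm' : (m : ℂ) ≠ 0 := by exact_mod_cast hm
  have hpi := Complex.two_pi_I_ne_zero
  rw [Complex.exp_eq_one_iff]
  have e : 2 * Real.pi * Complex.I * baseExp m * i = (-(m + 1) * i / m) * (2 * Real.pi * Complex.I) := by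
    rw [baseExp]; push_cast; ring
  rw [e]
  constructor
  · rintro ⟨n, h⟩
    have := mul_right_cancel₀ hpi h
    rw [div_eq_iff hm'] at this
    have : -((m : ℤ) + 1) * i = n * m := by exact_mod_cast this
    exact ⟨-n - i, by linarith⟩
  · rintro ⟨k, rfl⟩
    refine ⟨-(m + 1) * k, ?_⟩
    push_cast
    field_simp

lemma baseFun_smul {m : ℕ} (hm : m ≠ 0) (γ : Gamma m) (z : ℍ) :
    baseFun m ((γ : SL(2, ℤ)) • z) = baseFun m z := by
  have := poincareFun_char (χ := (1 : Gamma m →* ℂ)) (by simp) (ν := baseExp m)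
    (by simpa using (exp_baseExp hm m).2 dvd_rfl) γ z
  simpa [baseFun] using this

lemma baseFun_mem {m : ℕ} (hm : m ≠ 0) : baseFun m ∈ modGrowth :=
  poincareFun_mem hm (by simp) (by linarith [baseExp_lt hm])

/-- Functions that are small compared with the base function at every cusp. -/
def SmallAtCusps (m : ℕ) (B : ℍ → ℂ) : Prop := ∀ δ : SL(2, ℤ),
  Filter.Tendsto (fun y : ℝ => (Real.exp (2 * Real.pi * baseExp m * max y 1) : ℂ) *
    (B (δ • ipt y) * ModularForm.discriminant (ipt y))) Filter.atTop (nhds 0)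

lemma smallAtCusps_poincareFun {m : ℕ} (hm : m ≠ 0) {χ : Gamma m →* ℂ} (hχ : ∀ γ, χ γ ^ m = 1)
    {ν : ℝ} (hν0 : ν < 0) (hν1 : -1 ≤ ν) : SmallAtCusps m (poincareFun χ ν) := by
  intro δ
  have h := tendsto_poincare hm hχ hν0 δ
  have h1 : Filter.Tendsto (fun y : ℝ => (Real.exp (2 * Real.pi * (baseExp m - ν) * max y 1) : ℂ))
      Filter.atTop (nhds 0) := by
    have : Filter.Tendsto (fun y : ℝ => Real.exp (2 * Real.pi * (baseExp m - ν) * max y 1))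
        Filter.atTop (nhds 0) := by
      refine Real.tendsto_exp_atBot.comp ?_
      refine Filter.Tendsto.const_mul_atTop_of_neg
        (mul_neg_of_pos_of_neg (by positivity) (by linarith [baseExp_lt hm])) ?_
      exact Filter.tendsto_atTop_mono (fun y => le_max_left y 1) Filter.tendsto_id
    exact_mod_cast (Complex.continuous_ofReal.tendsto 0).comp this
  have := h1.mul h
  rw [zero_mul] at this
  refine this.congr fun y => ?_
  rw [← mul_assoc, ← Complex.ofReal_mul, ← Real.exp_add]
  congr 3; ring_nf

/-- The stabilizer of the base function plus a small function lies in `±Γ(m)`. -/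
lemma stab_baseFun_add {m : ℕ} (hm : 3 ≤ m) {B : ℍ → ℂ} (hB : SmallAtCusps m B) {δ : SL(2, ℤ)}
    (h : ∀ z, (baseFun m + B) (δ • z) = (baseFun m + B) z) : δ ∈ Gamma m ∨ -δ ∈ Gamma m := by
  have hm0 : m ≠ 0 := by omega
  have hν := baseExp_lt hm0
  have hTm := (exp_baseExp hm0 m).2 dvd_rfl
  have hone := tendsto_poincareFun_T hm (χ := (1 : Gamma m →* ℂ)) (by simp) (ν := baseExp m)
    (by linarith) (by simpa using hTm)
  have hlim : Filter.Tendsto (fun y : ℝ => (Real.exp (2 * Real.pi * baseExp m * max y 1) : ℂ) *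
      (baseFun m (δ • ipt y) * ModularForm.discriminant (ipt y))) Filter.atTop (nhds 1) := by
    have h1 := hone 0
    have h2 := (h1.add (hB 1)).sub (hB δ)
    simp only [Int.cast_zero, mul_zero, Complex.exp_zero, add_zero, sub_zero] at h2
    refine h2.congr fun y => ?_
    have := h (ipt y)
    simp only [Pi.add_apply] at this
    rw [zpow_zero, one_smul, eq_sub_of_add_eq this, baseFun]
    ring
  have hex : ∃ v : bottomRows m, ((rowLift v : SL(2, ℤ)) * δ) 1 0 = 0 := by
    by_contra! hne
    have h1 := tendsto_poincare hm0 (χ := (1 : Gamma m →* ℂ)) (by simp) (ν := baseExp m)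
      (by linarith) δ
    have h2 : ∑' v : bottomRows m, ((1 : Gamma m →* ℂ) (rowLift v))⁻¹ *
        seedLimit (baseExp m) (rowLift v * δ) = 0 := by
      refine (tsum_congr fun v => ?_).trans tsum_zero
      rw [seedLimit, if_neg (hne v), mul_zero]
    rw [h2] at h1
    exact zero_ne_one (tendsto_nhds_unique h1 hlim)
  obtain ⟨v, hv⟩ := hex
  set γ := rowLift v
  obtain ⟨i, hi⟩ : ∃ i : ℤ, (γ : SL(2, ℤ)) * δ = ModularGroup.T ^ i ∨
      (γ : SL(2, ℤ)) * δ = -ModularGroup.T ^ i := by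
    have key (g : SL(2, ℤ)) (h0 : g 1 0 = 0) (h1 : g 1 1 = 1) : ∃ i : ℤ, g = ModularGroup.T ^ i := by
      have := eq_T_zpow_mul_of_row_eq (γ := g) (γ' := 1)
        (by ext j; fin_cases j <;> simp [h0, h1])
      exact ⟨_, by simpa using this⟩
    rcases Int.eq_one_or_neg_one_of_mul_eq_one' (row_sq_pos _ hv).2 with h2 | h2
    · obtain ⟨i, hi⟩ := key _ hv h2.2
      exact ⟨i, Or.inl hi⟩
    · obtain ⟨i, hi⟩ := key (-((γ : SL(2, ℤ)) * δ)) (by simpa using hv) (by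
        rw [Matrix.SpecialLinearGroup.coe_neg, Matrix.neg_apply, h2.2, neg_neg])
      exact ⟨i, Or.inr (by rw [← hi, neg_neg])⟩
  have hT (z : ℍ) : baseFun m (δ • z) = baseFun m (ModularGroup.T ^ i • z) := by
    rw [← baseFun_smul hm0 γ, ← mul_smul]
    rcases hi with hi | hi <;> rw [hi]
    rw [ModularGroup.SL_neg_smul]
  have h2 := hone i
  have h3 : Complex.exp (2 * Real.pi * Complex.I * baseExp m * i) = 1 := by
    refine tendsto_nhds_unique h2 (hlim.congr fun y => ?_)
    rw [hT, baseFun]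
  have h4 := (T_zpow_mem_iff (m := m) i).2 ((exp_baseExp hm0 i).1 h3)
  have h5 : (γ : SL(2, ℤ))⁻¹ ∈ Gamma m := inv_mem γ.2
  rcases hi with hi | hi
  · left
    rw [← inv_mul_cancel_left (γ : SL(2, ℤ)) δ, hi]
    exact mul_mem h5 h4
  · right
    rw [← inv_mul_cancel_left (γ : SL(2, ℤ)) δ, hi, mul_neg, neg_neg]
    exact mul_mem h5 h4

lemma exists_exponent {m : ℕ} (hm : m ≠ 0) {χ : Gamma m →* ℂ} (hχ : ∀ γ, χ γ ^ m = 1) :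
    ∃ ν : ℝ, ν < 0 ∧ -1 ≤ ν ∧ Complex.exp (2 * Real.pi * Complex.I * ν * m) = χ (Tm m) := by
  have hm' : (m : ℂ) ≠ 0 := by exact_mod_cast hm
  have hm0 : (0 : ℝ) < m := by positivity
  have := NeZero.mk hm
  obtain ⟨k, hk, h⟩ := (Complex.isPrimitiveRoot_exp m hm).eq_pow_of_pow_eq_one (hχ (Tm m))
  have hk' : (k : ℝ) ≤ m - 1 := by
    have : (k : ℝ) + 1 ≤ m := by exact_mod_cast hk
    linarith
  have hk2 : (k : ℝ) / (m : ℝ) ^ 2 < 1 := by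
    have : (1 : ℝ) ≤ m := by exact_mod_cast Nat.one_le_iff_ne_zero.mpr hm
    rw [div_lt_one (by positivity)]; nlinarith
  refine ⟨k / (m : ℝ) ^ 2 - 1, by linarith, ?_, ?_⟩
  · have : (0 : ℝ) ≤ k / (m : ℝ) ^ 2 := by positivity
    linarith
  · rw [← h, ← Complex.exp_nat_mul]
    have : 2 * (Real.pi : ℂ) * Complex.I * ((k / (m : ℝ) ^ 2 - 1 : ℝ) : ℂ) * m =
        k * (2 * Real.pi * Complex.I / m) - (m : ℕ) * (2 * Real.pi * Complex.I) := by
      push_cast; field_simp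
    rw [this, Complex.exp_sub, Complex.exp_nat_mul_two_pi_mul_I, div_one]

end MacMahon

namespace MacMahon
open scoped MatrixGroups Manifold UpperHalfPlane
open UpperHalfPlane PowerSeries

/-- The function `q_N(z) = exp(2πiz/N)` on the upper half plane. -/
noncomputable def qpar (N : ℕ) (z : ℍ) : ℂ := Function.Periodic.qParam (N : ℝ) z

/-- `u` is the sum of the power series `p` in `q_N`. -/
def HasExp (N : ℕ) (p : ℂ⟦X⟧) (u : ℍ → ℂ) : Prop :=
  ∀ z, HasSum (fun n => coeff n p * qpar N z ^ n) (u z)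

variable {N : ℕ}

lemma HasExp.add {p p' : ℂ⟦X⟧} {u u' : ℍ → ℂ} (h : HasExp N p u) (h' : HasExp N p' u') :
    HasExp N (p + p') (u + u') := fun z => by
  simpa [add_mul] using (h z).add (h' z)

lemma HasExp.mul {p p' : ℂ⟦X⟧} {u u' : ℍ → ℂ} (h : HasExp N p u) (h' : HasExp N p' u') :
    HasExp N (p * p') (u * u') := fun z => by
  have h1 := (h z).summable.norm
  have h2 := (h' z).summable.norm
  have h3 := tsum_mul_tsum_eq_tsum_sum_antidiagonal_of_summable_norm h1 h2
  rw [(h z).tsum_eq, (h' z).tsum_eq] at h3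
  have h4 := (summable_norm_sum_mul_antidiagonal_of_summable_norm h1 h2).of_norm
  have h5 := h4.hasSum
  rw [← h3] at h5
  refine h5.congr_fun fun n => ?_
  rw [coeff_mul, sum_mul]
  refine sum_congr rfl fun x hx => ?_
  rw [← mem_antidiagonal.mp hx, pow_add]; ring

lemma hasExp_C (c : ℂ) : HasExp N (PowerSeries.C c) fun _ => c := fun z => by
  convert hasSum_single (f := fun n => coeff n (PowerSeries.C c) * qpar N z ^ n) 0 fun n hn => ?_
  · simp
  · simp [coeff_C, hn]

lemma hasExp_X_pow (k : ℕ) : HasExp N (X ^ k) (qpar N ^ k) := fun z => by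
  convert hasSum_single (f := fun n => coeff n (X ^ k : ℂ⟦X⟧) * qpar N z ^ n) k fun n hn => ?_
  · simp
  · simp [coeff_X_pow, hn]

lemma HasExp.unique (hN : 0 < N) {p p' : ℂ⟦X⟧} {u : ℍ → ℂ} (h : HasExp N p u)
    (h' : HasExp N p' u) : p = p' := by
  have h0 : HasExp N (p + PowerSeries.C (-1) * p') 0 := by
    have := h.add ((hasExp_C (-1)).mul h')
    convert this using 1
    ext z; simp
  have hc : cuspFunction (N : ℝ) ((0 : C(ℍ, ℂ)) : ℍ → ℂ) = 0 := by
    ext q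
    by_cases hq : q = 0
    · subst hq
      simp only [cuspFunction, Function.Periodic.cuspFunction, Function.update_self]
      refine Filter.Tendsto.limUnder_eq ?_
      refine tendsto_const_nhds.congr fun q => ?_
      simp
    · simp [cuspFunction, Function.Periodic.cuspFunction, hq]
  ext n
  have := qExpansion_coeff_unique (0 : C(ℍ, ℂ)) (h := N) (by exact_mod_cast hN)
    (c := fun n => coeff n (p + PowerSeries.C (-1) * p'))
    (by rw [hc]; exact analyticAt_const) (fun τ => by simpa [qpar] using h0 τ) n
  rw [qExpansion_coeff, hc] at this
  have h3 : iteratedDeriv n (0 : ℂ → ℂ) 0 = 0 := by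
    simp [iteratedDeriv_eq_iteratedFDeriv]
  rw [h3, mul_zero] at this
  simp only [map_add, coeff_C_mul] at this
  linear_combination this

lemma qpar_ne_zero (z : ℍ) : qpar N z ≠ 0 := Complex.exp_ne_zero _

lemma norm_qpar (z : ℍ) : ‖qpar N z‖ = Real.exp (-2 * Real.pi * z.im / N) :=
  Function.Periodic.norm_qParam _ _

lemma qpar_mdifferentiable : MDiff (qpar N) := by
  rw [UpperHalfPlane.mdifferentiable_iff]
  refine DifferentiableOn.congr (f := Function.Periodic.qParam (N : ℝ)) ?_ fun z hz => ?_
  · exact Function.Periodic.differentiable_qParam.differentiableOn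
  · simp [qpar, ofComplex_apply_of_im_pos hz]

lemma T_pow_smul (z : ℍ) : ModularGroup.T ^ N • z = (N : ℝ) +ᵥ z := by
  have := modular_T_zpow_smul z N
  simpa using this

lemma qpar_T_pow (hN : 0 < N) (z : ℍ) : qpar N (ModularGroup.T ^ N • z) = qpar N z := by
  rw [T_pow_smul, qpar, coe_vadd, qpar]
  have hN' : (N : ℂ) ≠ 0 := by exact_mod_cast hN.ne'
  simp only [Function.Periodic.qParam, Complex.ofReal_natCast]
  rw [mul_add, add_div, mul_div_cancel_right₀ _ hN', Complex.exp_add, Complex.exp_two_pi_mul_I,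
    one_mul]

lemma exists_hasExp (hN : 0 < N) {u : ℍ → ℂ} (hu : u ∈ modGrowth)
    (hT : ∀ z, u (ModularGroup.T ^ N • z) = u z) :
    ∃ k p, HasExp N p (u * qpar N ^ k) := by
  obtain ⟨hd, A, C, hA, hC, h⟩ := hu
  have hN' : (0 : ℝ) < N := by exact_mod_cast hN
  obtain ⟨k, hk⟩ := exists_nat_ge (C * N / (2 * Real.pi))
  refine ⟨k, qExpansion N (u * qpar N ^ k), fun z => ?_⟩
  have := hasSum_qExpansion (h := N) (f := u * qpar N ^ k) hN' ?_ ?_ ?_ z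
  · simpa [qpar] using this
  · intro z
    by_cases hz : 0 < z.im
    · have hz' : 0 < (z + (N : ℝ)).im := by simpa using hz
      have e : ofComplex (z + (N : ℝ)) = ModularGroup.T ^ N • ofComplex z := by
        rw [T_pow_smul]
        ext
        rw [coe_vadd, ofComplex_apply_of_im_pos hz, ofComplex_apply_of_im_pos hz']
        simp [add_comm]
      simp only [Function.comp, Pi.mul_apply, Pi.pow_apply, e, hT, qpar_T_pow hN]
    · have hz' : ¬ 0 < (z + (N : ℝ)).im := by simpa using hz
      simp only [Function.comp]
      rw [ofComplex_apply_of_im_nonpos (not_lt.mp hz), ofComplex_apply_of_im_nonpos (not_lt.mp hz')]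
  · have hq : MDiff (qpar N ^ k) := by
      clear hk
      induction k with
      | zero => exact mdifferentiable_const (c := (1 : ℂ))
      | succ n ih =>
        rw [pow_succ]
        exact MDifferentiable.mul ih qpar_mdifferentiable
    exact hd.mul hq
  · rw [isBoundedAtImInfty_iff]
    refine ⟨A * Real.exp C, 1, fun z hz => ?_⟩
    have h1 := h 1 z
    rw [one_smul] at h1
    rw [Pi.mul_apply, Pi.pow_apply, norm_mul, norm_pow, norm_qpar, ← Real.exp_nat_mul]
    refine (mul_le_mul_of_nonneg_right h1 (Real.exp_pos _).le).trans ?_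
    rw [mul_assoc, ← Real.exp_add]
    gcongr
    rw [div_le_iff₀ (by positivity)] at hk
    have h2 : height z ≤ z.im + 1 := by
      unfold height
      have : 1 / z.im ≤ 1 := by rw [div_le_one z.im_pos]; exact hz
      linarith
    have h3 : C * z.im ≤ k * (2 * Real.pi * z.im / N) := by
      rw [← mul_div_assoc, le_div_iff₀ hN']
      have := mul_le_mul_of_nonneg_right hk z.im_pos.le
      linarith
    have h4 := mul_le_mul_of_nonneg_left h2 hC
    have h5 : (k : ℝ) * (-2 * Real.pi * z.im / N) = - (k * (2 * Real.pi * z.im / N)) := by ring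
    rw [h5]; linarith

open LaurentSeries in
/-- Pairs of a function having a Laurent expansion in `q_N` with coefficients in `A`, and the
Laurent series obtained by applying `r` to the coefficients. -/
noncomputable def relRing {A κ : Type*} [CommRing A] [Field κ] (ι : A →+* ℂ) (r : A →+* κ) (N : ℕ) :
    Subring ((ℍ → ℂ) × κ⸨X⸩) where
  carrier := {w | ∃ (k : ℕ) (p : A⟦X⟧), HasExp N (p.map ι) (w.1 * qpar N ^ k) ∧
    w.2 * algebraMap κ⟦X⟧ κ⸨X⸩ (X ^ k) = algebraMap κ⟦X⟧ κ⸨X⸩ (p.map r)}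
  mul_mem' := by
    rintro ⟨u, x⟩ ⟨u', x'⟩ ⟨k, p, h1, h2⟩ ⟨k', p', h1', h2'⟩
    refine ⟨k + k', p * p', ?_, ?_⟩
    · rw [map_mul]
      convert h1.mul h1' using 1
      simp only [Prod.fst_mul]; ring
    · simp only [map_mul, ← h2, ← h2', pow_add, Prod.snd_mul]; ring
  one_mem' := ⟨0, 1, by
    rw [map_one, pow_zero, mul_one]; exact hasExp_C (N := N) 1, by simp⟩
  zero_mem' := ⟨0, 0, by simpa [Pi.zero_def] using hasExp_C (N := N) 0, by simp⟩
  add_mem' := by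
    rintro ⟨u, x⟩ ⟨u', x'⟩ ⟨k, p, h1, h2⟩ ⟨k', p', h1', h2'⟩
    refine ⟨k + k', p * X ^ k' + p' * X ^ k, ?_, ?_⟩
    · simp only [map_add, map_mul, map_pow, map_X]
      convert (h1.mul (hasExp_X_pow k')).add (h1'.mul (hasExp_X_pow k)) using 1
      simp only [Prod.fst_add]; ring
    · simp only [map_add, map_mul, map_pow, map_X, ← h2, ← h2', pow_add, Prod.snd_add]; ring
  neg_mem' := by
    rintro ⟨u, x⟩ ⟨k, p, h1, h2⟩
    refine ⟨k, PowerSeries.C (-1) * p, ?_, ?_⟩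
    · simp only [map_mul, map_neg, map_one]
      convert (hasExp_C (-1)).mul h1 using 1
      · simp
      · ext z; simp
    · simp only [map_mul, ← h2, Prod.snd_neg, map_neg, map_one]; ring

section relRing
open LaurentSeries
variable {A κ : Type*} [CommRing A] [Field κ] {ι : A →+* ℂ} {r : A →+* κ}

lemma relRing_const (a : A) :
    ((fun _ => ι a, algebraMap κ⟦X⟧ κ⸨X⸩ (PowerSeries.C (r a))) : (ℍ → ℂ) × κ⸨X⸩) ∈
      relRing ι r N :=
  ⟨0, PowerSeries.C a, by
    rw [PowerSeries.map_C]
    convert hasExp_C (N := N) (ι a) using 1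
    ext z; simp, by simp⟩

lemma algebraMap_X_pow_ne_zero (k : ℕ) : algebraMap κ⟦X⟧ κ⸨X⸩ (X ^ k) ≠ 0 := by
  rw [Ne, FaithfulSMul.algebraMap_eq_zero_iff]
  exact pow_ne_zero _ X_ne_zero

lemma relRing_zero (hN : 0 < N) (hι : Function.Injective ι) {x : κ⸨X⸩}
    (h : ((0, x) : (ℍ → ℂ) × κ⸨X⸩) ∈ relRing ι r N) : x = 0 := by
  obtain ⟨k, p, h1, h2⟩ := h
  have h0 : HasExp N 0 (0 : ℍ → ℂ) := by simpa [Pi.zero_def] using hasExp_C (N := N) 0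
  simp only [zero_mul] at h1
  have h3 : p.map ι = 0 := h1.unique hN h0
  have h4 : p = 0 := PowerSeries.map_injective ι hι (by rw [h3, map_zero])
  rw [h4, map_zero, map_zero] at h2
  exact (mul_eq_zero.mp h2).resolve_right (algebraMap_X_pow_ne_zero k)

lemma relRing_unique (hN : 0 < N) (hι : Function.Injective ι) {u : ℍ → ℂ} {x y : κ⸨X⸩}
    (h : ((u, x) : (ℍ → ℂ) × κ⸨X⸩) ∈ relRing ι r N)
    (h' : ((u, y) : (ℍ → ℂ) × κ⸨X⸩) ∈ relRing ι r N) : x = y := by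
  have := sub_mem h h'
  rw [Prod.mk_sub_mk, sub_self] at this
  exact sub_eq_zero.mp (relRing_zero hN hι this)

lemma expand_injective' (e : ℕ) (he : e ≠ 0) :
    Function.Injective (PowerSeries.expand (R := κ) e he : κ⟦X⟧ →+* κ⟦X⟧) := fun p p' h => by
  ext n
  have := congrArg (coeff (e * n)) h
  simpa [PowerSeries.coeff_expand_mul] using this

variable (κ) in
/-- The substitution `t ↦ t ^ e` on Laurent series. -/
noncomputable def subst (e : ℕ) (he : e ≠ 0) : κ⸨X⸩ →+* κ⸨X⸩ :=
  IsFractionRing.lift (A := κ⟦X⟧) (K := κ⸨X⸩) (L := κ⸨X⸩) (g := (algebraMap κ⟦X⟧ κ⸨X⸩).comp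
    (PowerSeries.expand (R := κ) e he : κ⟦X⟧ →+* κ⟦X⟧))
    ((FaithfulSMul.algebraMap_injective κ⟦X⟧ κ⸨X⸩).comp (expand_injective' e he))

lemma subst_algebraMap (e : ℕ) (he : e ≠ 0) (p : κ⟦X⟧) :
    subst κ e he (algebraMap κ⟦X⟧ κ⸨X⸩ p) = algebraMap κ⟦X⟧ κ⸨X⸩ (PowerSeries.expand e he p) :=
  IsFractionRing.lift_algebraMap _ p

lemma relRing_subst {M e : ℕ} (he : e ≠ 0) {α : ℍ → ℍ} {ζ ζ' : A} (hζ : ζ * ζ' = 1)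
    (hr : r ζ = 1) (hα : ∀ z, qpar N (α z) = ι ζ * qpar M z ^ e) {u : ℍ → ℂ} {x : κ⸨X⸩}
    (h : ((u, x) : (ℍ → ℂ) × κ⸨X⸩) ∈ relRing ι r N) :
    ((fun z => u (α z), subst κ e he x) : (ℍ → ℂ) × κ⸨X⸩) ∈ relRing ι r M := by
  obtain ⟨k, p, h1, h2⟩ := h
  have hr' : r ζ' = 1 := by simpa [hr] using congrArg r hζ
  have hι' : ι ζ' * ι ζ = 1 := by rw [← map_mul, mul_comm, hζ, map_one]
  refine ⟨e * k, PowerSeries.C (ζ' ^ k) * PowerSeries.expand e he (PowerSeries.rescale ζ p), ?_, ?_⟩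
  · intro z
    have h3 := (h1 (α z)).mul_left (ι ζ' ^ k)
    have h4 : ι ζ' ^ k * ((u, x).1 * qpar N ^ k) (α z) = u (α z) * qpar M z ^ (e * k) := by
      simp only [Pi.mul_apply, Pi.pow_apply, hα, mul_pow, ← pow_mul]
      have : ι ζ' ^ k * ι ζ ^ k = 1 := by rw [← mul_pow, hι', one_pow]
      linear_combination u (α z) * qpar M z ^ (e * k) * this
    rw [h4] at h3
    simp only [Pi.mul_apply, Pi.pow_apply]
    have hinj : Function.Injective (fun n : ℕ => e * n) := fun a b h =>
      Nat.eq_of_mul_eq_mul_left (Nat.pos_of_ne_zero he) h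
    rw [← hinj.hasSum_iff]
    · refine h3.congr_fun fun n => ?_
      simp only [Function.comp]
      rw [coeff_map, coeff_C_mul, PowerSeries.coeff_expand_mul, coeff_rescale, coeff_map, hα]
      simp only [map_mul, map_pow]
      ring
    · intro n hn
      rw [coeff_map, coeff_C_mul, PowerSeries.coeff_expand_of_not_dvd]
      · simp
      · rintro ⟨c, rfl⟩; exact hn ⟨c, rfl⟩
  · have h3 := congrArg (subst κ e he) h2
    rw [map_mul, subst_algebraMap, subst_algebraMap, map_pow, PowerSeries.expand_X, ← pow_mul] at h3
    rw [h3]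
    congr 1
    rw [map_mul, PowerSeries.map_C, map_pow, hr', one_pow, map_one, one_mul, PowerSeries.map_expand]
    congr 1
    ext n
    simp [coeff_rescale, hr]

end relRing

end MacMahon

namespace MacMahon
open scoped MatrixGroups Manifold UpperHalfPlane
open UpperHalfPlane PowerSeries ModularForm EisensteinSeries

/-- The `j`-invariant. -/
noncomputable def jFun (z : ℍ) : ℂ := E₄ z ^ 3 / discriminant z

lemma modularForm_hasExp {k : ℤ} (f : ModularForm 𝒮ℒ k) : HasExp 1 (qExpansion 1 f) f := fun z => by
  simpa [qpar] using ModularForm.hasSum_qExpansion (h := 1) (Γ := 𝒮ℒ) (f := f) one_pos (by simp) z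

lemma modularForm_smul {k : ℤ} (f : ModularForm 𝒮ℒ k) (δ : SL(2, ℤ)) (z : ℍ) :
    f (δ • z) = denom δ z ^ k * f z :=
  SlashInvariantForm.slash_action_eqn' f (by simp) z

lemma jFun_smul (δ : SL(2, ℤ)) (z : ℍ) : jFun (δ • z) = jFun z := by
  have hd := denom_ne_zero δ z
  have := discriminant_smul δ z
  rw [zpow_neg, ← div_eq_mul_inv, div_eq_iff (zpow_ne_zero _ hd)] at this
  rw [jFun, jFun, modularForm_smul, this, mul_pow, ← zpow_natCast, ← zpow_mul, mul_comm _ (_ ^ (12 : ℤ))]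
  exact mul_div_mul_left _ _ (zpow_ne_zero _ hd)

lemma jFun_mdifferentiable : MDiff jFun := by
  have h : jFun = (E₄ : ℍ → ℂ) * (E₄ : ℍ → ℂ) * (E₄ : ℍ → ℂ) * fun z => (discriminant z)⁻¹ := by
    ext z; simp only [jFun, Pi.mul_apply, div_eq_mul_inv]; ring
  rw [h]
  have h4 := ModularFormClass.holo E₄
  exact ((h4.mul h4).mul h4).mul inv_discriminant_mdifferentiable

lemma jFun_mem : jFun ∈ modGrowth := by
  obtain ⟨A, hA, hA'⟩ := exists_inv_discriminant_bound
  have h1 : (fun z => E₄ z) =O[atImInfty] fun z => Real.exp (0 * z.im) := by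
    have := ModularFormClass.bdd_at_infty E₄
    simp only [zero_mul, Real.exp_zero]
    exact this
  obtain ⟨B, hB, hB'⟩ := exists_bound_on_fd (ModularFormClass.holo E₄).continuous h1
  refine mem_modGrowth_of_fd jFun_mdifferentiable (A := B ^ 3 * A) (C := 2 * Real.pi) (by positivity)
    (by positivity) fun δ z hz => ?_
  rw [jFun_smul, jFun, div_eq_mul_inv, norm_mul, norm_pow, mul_assoc]
  have := hB' z hz
  simp only [zero_mul, Real.exp_zero, mul_one] at this
  gcongr
  exact hA' z hz

lemma HasExp.of_X_mul {N : ℕ} {p : ℂ⟦X⟧} {u : ℍ → ℂ} (h : HasExp N (X * p) (u * qpar N)) :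
    HasExp N p u := fun z => by
  have := h z
  rw [← hasSum_nat_add_iff' 1] at this
  have h2 := this.mul_right (qpar N z)⁻¹
  have hq := qpar_ne_zero (N := N) z
  simp only [range_one, sum_singleton, coeff_zero_X_mul, zero_mul, sub_zero, Pi.mul_apply] at h2
  rw [mul_assoc, mul_inv_cancel₀ hq, mul_one] at h2
  refine h2.congr_fun fun n => ?_
  rw [coeff_succ_X_mul, pow_succ]
  field_simp

lemma HasExp.of_X_pow_mul {N k : ℕ} {p : ℂ⟦X⟧} {u : ℍ → ℂ}
    (h : HasExp N (X ^ k * p) (u * qpar N ^ k)) : HasExp N p u := by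
  induction k with
  | zero => simpa using h
  | succ k ih =>
    refine ih (HasExp.of_X_mul ?_)
    convert h using 1 <;> ring

lemma exists_jFun_hasExp : ∃ p : ℂ⟦X⟧, HasExp 1 p (jFun * qpar 1) ∧ coeff 0 p = 1 ∧
    ∀ A : Subring ℂ, (1728 : ℂ)⁻¹ ∈ A → ∀ n, coeff n p ∈ A := by
  set e4 := qExpansion 1 E₄
  set e6 := qExpansion 1 E₆
  have he4 := modularForm_hasExp E₄
  have he6 := modularForm_hasExp E₆
  have c4 : ∀ n, ∃ a : ℤ, coeff n e4 = a := fun n => by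
    rw [E_qExpansion_coeff _ ⟨2, rfl⟩, show bernoulli 4 = -1 / 30 by decide +kernel]
    split_ifs
    · exact ⟨1, by simp⟩
    · exact ⟨240 * (ArithmeticFunction.sigma 3 n : ℕ), by push_cast; norm_num⟩
  have c6 : ∀ n, ∃ a : ℤ, coeff n e6 = a := fun n => by
    rw [E_qExpansion_coeff _ ⟨3, rfl⟩, show bernoulli 6 = 1 / 42 by decide +kernel]
    split_ifs
    · exact ⟨1, by simp⟩
    · exact ⟨-504 * (ArithmeticFunction.sigma 5 n : ℕ), by push_cast; norm_num⟩
  choose a4 ha4 using c4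
  choose a6 ha6 using c6
  have h40 : coeff 0 e4 = 1 := E_qExpansion_coeff_zero _ ⟨2, rfl⟩
  have h60 : coeff 0 e6 = 1 := E_qExpansion_coeff_zero _ ⟨3, rfl⟩
  have h41 : coeff 1 e4 = 240 := E₄_qExpansion_coeff_one
  have h61 : coeff 1 e6 = -504 := E₆_qExpansion_coeff_one
  set d := PowerSeries.C ((1728 : ℂ)⁻¹) * (e4 ^ 3 + PowerSeries.C (-1) * e6 ^ 2)
  have hd : HasExp 1 d discriminant := by
    have e4' : HasExp 1 (e4 ^ 3) ((E₄ : ℍ → ℂ) ^ 3) := by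
      simpa only [pow_succ, pow_zero, one_mul] using (he4.mul he4).mul he4
    have e6' : HasExp 1 (e6 ^ 2) ((E₆ : ℍ → ℂ) ^ 2) := by
      simpa only [pow_succ, pow_zero, one_mul] using he6.mul he6
    convert (hasExp_C (1728 : ℂ)⁻¹).mul (e4'.add ((hasExp_C (-1)).mul e6')) using 1
    ext z
    rw [discriminant_eq_E₄_cube_sub_E₆_sq]
    simp only [Pi.mul_apply, Pi.add_apply, Pi.pow_apply]; ring
  have key : ∀ {A : Type} [CommRing A] (f g : A⟦X⟧) (a : A), coeff 0 f = 1 → coeff 0 g = 1 →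
      coeff 1 f = 240 → coeff 1 g = -504 → 1728 * a = 1 → ∃ d' : A⟦X⟧, 
      PowerSeries.C a * (f ^ 3 + PowerSeries.C (-1) * g ^ 2) = X * d' ∧ constantCoeff d' = 1 := by
    intro A _ f g a hf hg hf1 hg1 ha
    rw [coeff_zero_eq_constantCoeff] at hf hg
    have : X ∣ PowerSeries.C a * (f ^ 3 + PowerSeries.C (-1) * g ^ 2) := by
      rw [X_dvd_iff]; simp [hf, hg]
    obtain ⟨d', h⟩ := this
    refine ⟨d', h, ?_⟩
    have h1 := congrArg (coeff 1) h
    rw [coeff_C_mul, map_add, coeff_C_mul, show (1 : ℕ) = 0 + 1 from rfl, coeff_succ_X_mul] at h1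
    rw [← coeff_zero_eq_constantCoeff_apply, ← h1]
    simp only [zero_add, PowerSeries.coeff_one_pow, hf, hg, hf1, hg1]
    simp only [one_pow]
    linear_combination ha
  obtain ⟨d', hd', hd'1⟩ := key e4 e6 (1728 : ℂ)⁻¹ h40 h60 h41 h61 (by norm_num)
  obtain ⟨g, hg⟩ : ∃ g, d' * g = 1 :=
    ⟨invOfUnit d' 1, mul_invOfUnit _ _ (by rw [hd'1, Units.val_one])⟩
  have hp : HasExp 1 (e4 ^ 3 * g) (jFun * qpar 1) := by
    obtain ⟨k, p, hp⟩ := exists_hasExp one_pos jFun_mem fun z => jFun_smul _ z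
    have h1 : HasExp 1 (e4 * e4 * e4 * X ^ k) ((E₄ : ℍ → ℂ) * (E₄ : ℍ → ℂ) * (E₄ : ℍ → ℂ) * qpar 1 ^ k) :=
      ((he4.mul he4).mul he4).mul (hasExp_X_pow k)
    have h2 := hp.mul hd
    have h3 : jFun * qpar 1 ^ k * discriminant =
        (E₄ : ℍ → ℂ) * (E₄ : ℍ → ℂ) * (E₄ : ℍ → ℂ) * qpar 1 ^ k := by
      ext z
      have := discriminant_ne_zero z
      simp only [Pi.mul_apply, Pi.pow_apply, jFun]
      field_simp
    rw [h3] at h2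
    have h4 := h2.unique one_pos h1
    refine HasExp.of_X_pow_mul (k := k) ?_
    have h5 := hp.mul (hasExp_X_pow 1)
    convert h5 using 1
    · have h6 : d = X * d' := hd'
      rw [h6] at h4
      linear_combination (-g) * h4 + p * X * hg
    · ring
  refine ⟨_, hp, ?_, fun A hA n => ?_⟩
  · have := congrArg (coeff 0) hg
    simp only [coeff_zero_eq_constantCoeff, map_mul, map_pow, hd'1, map_one, one_mul] at this h40 ⊢
    rw [this, h40]; norm_num
  · let fA : A⟦X⟧ := PowerSeries.mk fun n => (a4 n : A)
    let gA : A⟦X⟧ := PowerSeries.mk fun n => (a6 n : A)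
    have hfA : fA.map A.subtype = e4 := by ext n; simp [fA, ha4]
    have hgA : gA.map A.subtype = e6 := by ext n; simp [gA, ha6]
    have inj : Function.Injective A.subtype := Subtype.val_injective
    have e1 : ∀ n, A.subtype (coeff n fA) = coeff n e4 := fun n => by rw [← hfA, coeff_map]
    have e2 : ∀ n, A.subtype (coeff n gA) = coeff n e6 := fun n => by rw [← hgA, coeff_map]
    obtain ⟨dA, h1, h2⟩ := key fA gA ⟨_, hA⟩ (inj (by rw [e1, h40, map_one]))
      (inj (by rw [e2, h60, map_one])) (inj (by rw [e1, h41, map_ofNat]))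
      (inj (by rw [e2, h61, map_neg, map_ofNat]))
      (inj (by rw [map_mul, map_ofNat, map_one]; exact mul_inv_cancel₀ (by norm_num)))
    have h3 : dA.map A.subtype = d' := by
      have := congrArg (PowerSeries.map A.subtype) h1
      simp only [map_mul, map_add, map_pow, PowerSeries.map_C, map_X, hfA, hgA, map_neg, map_one] at this
      have h4 : X * dA.map A.subtype = X * d' := by
        rw [← this, ← hd']; simp
      exact mul_left_cancel₀ X_ne_zero h4
    have h4 : dA * invOfUnit dA 1 = 1 := mul_invOfUnit _ _ (by rw [h2, Units.val_one])
    have h5 : g = (invOfUnit dA 1).map A.subtype := by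
      have := congrArg (PowerSeries.map A.subtype) h4
      rw [map_mul, h3, map_one] at this
      linear_combination (invOfUnit dA 1).map A.subtype * hg - g * this
    rw [h5, ← hfA, ← map_pow, ← map_mul, coeff_map]
    exact Subtype.property _

end MacMahon

namespace MacMahon
open scoped MatrixGroups Manifold UpperHalfPlane
open UpperHalfPlane ModularForm EisensteinSeries

/-- Translation of functions of moderate growth by elements of `SL(2, ℤ)`. -/
noncomputable def transl (δ : SL(2, ℤ)) : modGrowth →+* modGrowth where
  toFun u := ⟨fun z => u.1 (δ • z), modGrowth_smul u.2 δ⟩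
  map_one' := rfl
  map_mul' _ _ := rfl
  map_zero' := rfl
  map_add' _ _ := rfl

/-- Evaluation of functions of moderate growth. -/
noncomputable def evalAt (z : ℍ) : modGrowth →+* ℂ := (Pi.evalRingHom (fun _ : ℍ => ℂ) z).comp modGrowth.subtype

lemma const_of_bounded {u : ℍ → ℂ} (hu : MDiff u) (hinv : ∀ (δ : SL(2, ℤ)) z, u (δ • z) = u z)
    (hb : IsBoundedAtImInfty u) : ∃ c, ∀ z, u z = c := by
  have hs : ∀ γ : SL(2, ℤ), u ∣[(0 : ℤ)] γ = u := fun γ => by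
    ext z; rw [SL_slash_apply, hinv]; simp
  let f : ModularForm 𝒮ℒ 0 :=
    { toFun := u
      slash_action_eq' := fun _ ⟨γ, hγ⟩ => hγ ▸ hs γ
      holo' := hu
      bdd_at_cusps' := fun {c} hc => by
        rw [Subgroup.IsArithmetic.isCusp_iff_isCusp_SL2Z] at hc
        rw [OnePoint.isBoundedAt_iff_forall_SL2Z hc]
        intro γ _
        rw [hs]; exact hb }
  obtain ⟨c, hc⟩ := ModularFormClass.levelOne_weight_zero_const f
  exact ⟨c, fun z => congrFun hc z⟩

lemma exists_poly_jFun {u : ℍ → ℂ} (hu : u ∈ modGrowth)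
    (hinv : ∀ (δ : SL(2, ℤ)) z, u (δ • z) = u z) :
    ∃ P : Polynomial ℂ, ∀ z, u z = P.eval (jFun z) := by
  obtain ⟨k, p, h⟩ := exists_hasExp one_pos hu fun z => hinv _ z
  obtain ⟨pj, hj, hj0, -⟩ := exists_jFun_hasExp
  induction k generalizing u p with
  | zero =>
    obtain ⟨c, hc⟩ := const_of_bounded hu.1 hinv
      (isBoundedAtImInfty_of_hasSum_qExpansion one_pos (c := fun n => PowerSeries.coeff n p) fun τ => by
        simpa [qpar] using h τ)
    exact ⟨.C c, fun z => by rw [hc, Polynomial.eval_C]⟩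
  | succ k ih =>
    set c := PowerSeries.coeff 0 p
    have hjp : ∀ n : ℕ, HasExp 1 (pj ^ n) ((jFun * qpar 1) ^ n) := fun n => by
      induction n with
      | zero => simpa [Pi.one_def] using hasExp_C (N := 1) 1
      | succ n ih => rw [pow_succ, pow_succ]; exact ih.mul hj
    have h1 := h.add ((hasExp_C (-c)).mul (hjp (k + 1)))
    obtain ⟨p', hp'⟩ : PowerSeries.X ∣ p + PowerSeries.C (-c) * pj ^ (k + 1) := by
      rw [PowerSeries.X_dvd_iff]
      rw [PowerSeries.coeff_zero_eq_constantCoeff_apply] at hj0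
      simp [hj0, c]
    let u' : ℍ → ℂ := u - (algebraMap ℂ (ℍ → ℂ) c) * jFun ^ (k + 1)
    obtain ⟨P, hP⟩ := ih (u := u') (p := p')
      (sub_mem hu (mul_mem (algebraMap_mem _ c) (pow_mem jFun_mem _)))
      (fun δ z => by
        simp only [u', Pi.sub_apply, Pi.mul_apply, Pi.pow_apply, Pi.algebraMap_apply, hinv, jFun_smul]) (by
        refine HasExp.of_X_mul ?_
        rw [← hp']
        convert h1 using 1
        ext z
        simp only [u', Pi.mul_apply, Pi.sub_apply, Pi.pow_apply, Pi.add_apply, Pi.algebraMap_apply,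
          Algebra.algebraMap_self, RingHom.id_apply]
        ring)
    refine ⟨P + .C c * .X ^ (k + 1), fun z => ?_⟩
    have := hP z
    simp only [u', Pi.mul_apply, Pi.sub_apply, Pi.pow_apply, Pi.algebraMap_apply,
          Algebra.algebraMap_self, RingHom.id_apply] at this
    simp only [Polynomial.eval_add, Polynomial.eval_mul, Polynomial.eval_C, Polynomial.eval_pow,
      Polynomial.eval_X, ← this]
    ring

open Polynomial in
lemma exists_norm_poly (H : Subgroup SL(2, ℤ)) [Fintype (SL(2, ℤ) ⧸ H)] (a w : modGrowth)
    (ha : ∀ δ ∈ H, transl δ a = a) (hw : ∀ δ ∈ H, transl δ w = w) :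
    ∃ Q : ℂ[X][X], Q.natDegree ≤ H.index ∧
      (∀ z, (Q.coeff H.index).eval (jFun z) = ∏ q : SL(2, ℤ) ⧸ H, a.1 (q.out⁻¹ • z)) ∧
      ∀ z, ∑ i ∈ range (H.index + 1), (Q.coeff i).eval (jFun z) * w.1 z ^ i * a.1 z ^ (H.index - i) = 0 := by
  have tt : ∀ (δ δ' : SL(2, ℤ)) (b : modGrowth), transl δ (transl δ' b) = transl (δ' * δ) b := fun δ δ' b =>
    Subtype.ext <| funext fun z => by
      change b.1 (δ' • δ • z) = b.1 ((δ' * δ) • z)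
      rw [mul_smul]
  have tq : ∀ (δ : SL(2, ℤ)) (b : modGrowth), (∀ δ ∈ H, transl δ b = b) → ∀ q : SL(2, ℤ) ⧸ H,
      transl δ (transl q.out⁻¹ b) = transl (δ⁻¹ • q).out⁻¹ b := fun δ b hb q => by
    obtain ⟨h, hh⟩ := QuotientGroup.mk_out_eq_mul H (δ⁻¹ * q.out)
    have e : ((δ⁻¹ * q.out : SL(2, ℤ)) : SL(2, ℤ) ⧸ H) = δ⁻¹ • q := by
      conv_rhs => rw [← q.out_eq']
      rfl
    rw [← e, hh, mul_inv_rev, ← tt, hb _ (inv_mem h.2), tt]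
    group
  set D := H.index
  have hD : Fintype.card (SL(2, ℤ) ⧸ H) = D := by rw [← Nat.card_eq_fintype_card]; rfl
  let F : modGrowth[X] := ∏ q : SL(2, ℤ) ⧸ H, (C (transl q.out⁻¹ a) * X - C (transl q.out⁻¹ w))
  have hF1 : F.natDegree ≤ D := by
    refine (natDegree_prod_le _ _).trans ?_
    rw [← hD, Fintype.card, card_eq_sum_ones]
    refine sum_le_sum fun q _ => ?_
    compute_degree
  have hF2 : ∀ δ, F.map (transl δ) = F := fun δ => by
    simp only [F, Polynomial.map_prod, Polynomial.map_sub, Polynomial.map_mul, map_C, map_X, tq δ a ha, tq δ w hw]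
    exact Equiv.prod_comp (MulAction.toPerm δ⁻¹)
      (fun q : SL(2, ℤ) ⧸ H => (C (transl q.out⁻¹ a) * X - C (transl q.out⁻¹ w)))
  have hF3 : ∀ i, ∃ P : ℂ[X], ∀ z, (F.coeff i).1 z = P.eval (jFun z) := fun i =>
    exists_poly_jFun (F.coeff i).2 fun δ z => by
      have := congrArg (fun G => (coeff G i).1 z) (hF2 δ)
      simp only [coeff_map] at this
      exact this
  choose P hP using hF3
  have hPc : ∀ i ∈ range (D + 1), (∑ i ∈ range (D + 1), monomial i (P i)).coeff i = P i := fun i hi => by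
    rw [finsetSum_coeff, sum_eq_single_of_mem i hi]
    · simp
    · intro j _ hj; rw [coeff_monomial, if_neg hj]
  refine ⟨∑ i ∈ range (D + 1), monomial i (P i), ?_, fun z => ?_, fun z => ?_⟩
  · exact natDegree_sum_le_of_forall_le _ _ fun i hi =>
      (natDegree_monomial_le _).trans (by rw [mem_range] at hi; omega)
  · rw [hPc _ (self_mem_range_succ D), ← hP]
    have : F.coeff D = ∏ q : SL(2, ℤ) ⧸ H, transl q.out⁻¹ a := by
      have := coeff_prod_of_natDegree_le univ (fun q : SL(2, ℤ) ⧸ H =>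
        (C (transl q.out⁻¹ a) * X - C (transl q.out⁻¹ w))) 1 (fun q _ => by compute_degree)
      rw [mul_one, ← Fintype.card, hD] at this
      rw [this]
      simp [coeff_C]
    rw [this]
    exact (map_prod (evalAt z) _ _)
  · rw [sum_congr rfl fun i hi => by rw [hPc i hi, ← hP]]
    have hG : ∀ i, (F.map (evalAt z)).coeff i = (F.coeff i).1 z := fun i => coeff_map _ _
    have hG2 : F.map (evalAt z) = ∏ q : SL(2, ℤ) ⧸ H, (C (a.1 (q.out⁻¹ • z)) * X - C (w.1 (q.out⁻¹ • z))) := by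
      simp only [F, Polynomial.map_prod, Polynomial.map_sub, Polynomial.map_mul, map_C, map_X]
      rfl
    have h1 : (((1 : SL(2, ℤ)) : SL(2, ℤ) ⧸ H)).out⁻¹ ∈ H := by
      obtain ⟨h, hh⟩ := QuotientGroup.mk_out_eq_mul H 1
      rw [hh]; simp
    have ha1 : a.1 ((((1 : SL(2, ℤ)) : SL(2, ℤ) ⧸ H)).out⁻¹ • z) = a.1 z :=
      congrArg (fun b : modGrowth => b.1 z) (ha _ h1)
    have hw1 : w.1 ((((1 : SL(2, ℤ)) : SL(2, ℤ) ⧸ H)).out⁻¹ • z) = w.1 z :=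
      congrArg (fun b : modGrowth => b.1 z) (hw _ h1)
    simp only [← hG]
    by_cases h0 : a.1 z = 0
    · have hlead : (F.map (evalAt z)).coeff D = 0 := by
        have := coeff_prod_of_natDegree_le univ (fun q : SL(2, ℤ) ⧸ H =>
          (C (a.1 (q.out⁻¹ • z)) * X - C (w.1 (q.out⁻¹ • z)))) 1 (fun q _ => by compute_degree)
        rw [mul_one, ← Fintype.card, hD, ← hG2] at this
        rw [this]
        exact prod_eq_zero (mem_univ ((1 : SL(2, ℤ)) : SL(2, ℤ) ⧸ H)) (by rw [ha1, h0]; simp)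
      refine sum_eq_zero fun i hi => ?_
      rcases (Nat.lt_succ_iff.mp (mem_range.mp hi)).eq_or_lt with rfl | hi
      · rw [hlead]; ring
      · rw [h0, zero_pow (by omega), mul_zero]
    · have he : (F.map (evalAt z)).eval (w.1 z / a.1 z) = 0 := by
        rw [hG2, eval_prod]
        refine prod_eq_zero (mem_univ ((1 : SL(2, ℤ)) : SL(2, ℤ) ⧸ H)) ?_
        rw [ha1, hw1]
        simp only [eval_sub, eval_mul, eval_C, eval_X]
        field_simp; ring
      rw [eval_eq_sum_range' (n := D + 1) (Nat.lt_succ_of_le (natDegree_map_le.trans hF1))] at he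
      rw [← mul_zero (a.1 z ^ D), ← he, mul_sum]
      refine sum_congr rfl fun i hi => ?_
      have : a.1 z ^ D = a.1 z ^ (D - i) * a.1 z ^ i := by
        rw [← pow_add, Nat.sub_add_cancel (Nat.lt_succ_iff.mp (mem_range.mp hi))]
      rw [this, div_pow]
      field_simp

end MacMahon

namespace MacMahon
open scoped MatrixGroups Manifold UpperHalfPlane
open PowerSeries

/-- Power series with coefficients in a subring of `ℂ`. -/
noncomputable def psRing (A : Subring ℂ) : Subring ℂ⟦X⟧ := (PowerSeries.map A.subtype).range

lemma mem_psRing {A : Subring ℂ} {p : ℂ⟦X⟧} : p ∈ psRing A ↔ ∀ n, coeff n p ∈ A := by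
  constructor
  · rintro ⟨p, rfl⟩ n
    rw [coeff_map]; exact Subtype.property _
  · intro h
    exact ⟨PowerSeries.mk fun n => ⟨coeff n p, h n⟩, by ext n; simp⟩

lemma psRing_mono {A B : Subring ℂ} (h : A ≤ B) : psRing A ≤ psRing B := fun p hp => by
  rw [mem_psRing] at hp ⊢
  exact fun n => h (hp n)

lemma psRing_of_X_pow_mul {A : Subring ℂ} {k : ℕ} {p : ℂ⟦X⟧} (h : X ^ k * p ∈ psRing A) :
    p ∈ psRing A := by
  rw [mem_psRing] at h ⊢
  exact fun n => by simpa [coeff_X_pow_mul] using h (n + k)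

lemma X_mem_psRing {A : Subring ℂ} : X ∈ psRing A := ⟨X, map_X _⟩

lemma C_mem_psRing {A : Subring ℂ} {c : ℂ} (hc : c ∈ A) : PowerSeries.C c ∈ psRing A :=
  ⟨PowerSeries.C ⟨c, hc⟩, by simp⟩

lemma exists_inv_mem_psRing {A : Subring ℂ} {p : ℂ⟦X⟧} (hp : p ∈ psRing A) (h0 : constantCoeff p ≠ 0)
    (h1 : (constantCoeff p)⁻¹ ∈ A) : ∃ g ∈ psRing A, p * g = 1 := by
  obtain ⟨p, rfl⟩ := hp
  have e : constantCoeff (PowerSeries.map A.subtype p) = A.subtype (constantCoeff p) := by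
    rw [← coeff_zero_eq_constantCoeff_apply, coeff_map, coeff_zero_eq_constantCoeff_apply]
  rw [e] at h0 h1
  let w : Aˣ := ⟨constantCoeff p, ⟨_, h1⟩, Subtype.ext (mul_inv_cancel₀ h0), Subtype.ext (inv_mul_cancel₀ h0)⟩
  exact ⟨_, ⟨invOfUnit p w, rfl⟩, by rw [← map_mul, mul_invOfUnit _ _ rfl, map_one]⟩

lemma eval_mem_psRing {R : Type*} [CommRing R] {A : Subring R} {F : Polynomial R} {p : R}
    (hF : ∀ i, F.coeff i ∈ A) (hp : p ∈ A) : F.eval p ∈ A := by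
  rw [Polynomial.eval_eq_sum]
  exact sum_mem fun i _ => mul_mem (hF i) (pow_mem hp i)

lemma mem_psRing_of_fixedPoint {A : Subring ℂ} {R : Polynomial ℂ⟦X⟧} (hR : ∀ i, R.coeff i ∈ psRing A)
    {a w : ℂ⟦X⟧} (ha : a ∈ psRing A) (h : w = a + X * R.eval w) : w ∈ psRing A := by
  have key : ∀ n : ℕ, ∃ p ∈ psRing A, X ^ n ∣ w - p := fun n => by
    induction n with
    | zero => exact ⟨0, zero_mem _, by simp⟩
    | succ n ih =>
      obtain ⟨p, hp, hd⟩ := ih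
      refine ⟨a + X * R.eval p, add_mem ha (mul_mem X_mem_psRing (eval_mem_psRing hR hp)), ?_⟩
      have : w - (a + X * R.eval p) = X * (R.eval w - R.eval p) := by
        nth_rewrite 1 [h]; ring
      rw [this, pow_succ']
      exact mul_dvd_mul_left _ (hd.trans (Polynomial.sub_dvd_eval_sub _ _ _))
  rw [mem_psRing]
  intro n
  obtain ⟨p, hp, hd⟩ := key (n + 1)
  have := X_pow_dvd_iff.mp hd n (Nat.lt_succ_self n)
  rw [map_sub, sub_eq_zero] at this
  rw [this]
  exact mem_psRing.mp hp n

lemma exists_finset_of_simple_root {A : Subring ℂ} {s : ℂ⟦X⟧} {F : Polynomial ℂ⟦X⟧}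
    (hF : ∀ i, F.coeff i ∈ psRing A) (h0 : F.eval s = 0) (h1 : F.derivative.eval s ≠ 0) :
    ∃ S : Finset ℂ, s ∈ psRing (Subring.closure (A ∪ S)) := by
  obtain ⟨e, u, hu, hue⟩ : ∃ e u, F.derivative.eval s = X ^ e * u ∧ constantCoeff u ≠ 0 := by
    refine ⟨_, _, X_pow_order_mul_divXPowOrder.symm, ?_⟩
    exact (constantCoeff_divXPowOrder_eq_zero_iff.not).mpr h1
  obtain ⟨w, s0, hs⟩ : ∃ (w : ℂ⟦X⟧) (s0 : Polynomial ℂ), s = (s0 : ℂ⟦X⟧) + X ^ (e + 1) * w :=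
    ⟨_, trunc (e + 1) s, (eq_X_pow_mul_shift_add_trunc (e + 1) s).trans (add_comm _ _)⟩
  set A1 := Subring.closure (A ∪ (s0.coeffs : Set ℂ))
  have hA1 : A ≤ A1 := fun x hx => Subring.subset_closure (Or.inl hx)
  have hF1 : ∀ i, F.coeff i ∈ psRing A1 := fun i => psRing_mono hA1 (hF i)
  have hs0A : (s0 : ℂ⟦X⟧) ∈ psRing A1 := by
    rw [mem_psRing]
    intro n
    rw [Polynomial.coeff_coe]
    by_cases h : s0.coeff n = 0
    · rw [h]; exact zero_mem _
    · exact Subring.subset_closure (Or.inr (Polynomial.coeff_mem_coeffs h))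
  set G := Polynomial.taylor (s0 : ℂ⟦X⟧) F
  have hG : ∀ i, G.coeff i ∈ psRing A1 := fun i => by
    rw [Polynomial.taylor_coeff]
    refine eval_mem_psRing (fun j => ?_) hs0A
    rw [Polynomial.hasseDeriv_coeff]
    exact mul_mem (natCast_mem _ _) (hF1 _)
  set K := G.divX.divX
  have hK : ∀ i, K.coeff i ∈ psRing A1 := fun i => by
    rw [Polynomial.coeff_divX, Polynomial.coeff_divX]; exact hG _
  have hexp : ∀ y, F.eval ((s0 : ℂ⟦X⟧) + y) = F.eval (s0 : ℂ⟦X⟧) + F.derivative.eval (s0 : ℂ⟦X⟧) * y + y ^ 2 * K.eval y := fun y => by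
    have : F.eval ((s0 : ℂ⟦X⟧) + y) = G.eval y := by rw [Polynomial.taylor_eval, add_comm]
    rw [this, ← Polynomial.divX_mul_X_add G, ← Polynomial.divX_mul_X_add G.divX,
      Polynomial.coeff_divX, Polynomial.taylor_coeff_zero, Polynomial.taylor_coeff_one]
    simp only [Polynomial.eval_add, Polynomial.eval_mul, Polynomial.eval_C, Polynomial.eval_X]
    ring
  obtain ⟨v, hv⟩ : (s - (s0 : ℂ⟦X⟧)) ∣ F.derivative.eval s - F.derivative.eval (s0 : ℂ⟦X⟧) := Polynomial.sub_dvd_eval_sub _ _ _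
  set u1 := u - X * (w * v)
  have hu1 : F.derivative.eval (s0 : ℂ⟦X⟧) = X ^ e * u1 := by
    have h2 : s - (s0 : ℂ⟦X⟧) = X ^ (e + 1) * w := by rw [hs]; ring
    rw [h2, hu] at hv
    linear_combination -hv
  have hu10 : constantCoeff u1 = constantCoeff u := by simp [u1]
  have hu1A : u1 ∈ psRing A1 := by
    refine psRing_of_X_pow_mul (k := e) ?_
    rw [← hu1]
    refine eval_mem_psRing (fun j => ?_) hs0A
    rw [Polynomial.coeff_derivative]
    exact mul_mem (hF1 _) (add_mem (natCast_mem _ _) (one_mem _))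
  have heq := hexp (X ^ (e + 1) * w)
  rw [← hs, h0, hu1] at heq
  set c := -(u1 * w + X * (w ^ 2 * K.eval (X ^ (e + 1) * w)))
  have hc : F.eval (s0 : ℂ⟦X⟧) = X ^ (2 * e + 1) * c := by
    linear_combination -heq
  have hcA : c ∈ psRing A1 := by
    refine psRing_of_X_pow_mul (k := 2 * e + 1) ?_
    rw [← hc]
    exact eval_mem_psRing hF1 hs0A
  set A2 := Subring.closure (A ∪ ((s0.coeffs ∪ {(constantCoeff u1)⁻¹} : Finset ℂ) : Set ℂ))
  have hA2 : A1 ≤ A2 := Subring.closure_mono (Set.union_subset_union_right _ (by simp))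
  obtain ⟨g, hg, hg1⟩ := exists_inv_mem_psRing (psRing_mono hA2 hu1A) (by rwa [hu10])
    (Subring.subset_closure (Or.inr (by simp)))
  refine ⟨s0.coeffs ∪ {(constantCoeff u1)⁻¹}, ?_⟩
  rw [hs]
  refine add_mem (psRing_mono hA2 hs0A) (mul_mem (pow_mem X_mem_psRing _) ?_)
  refine mem_psRing_of_fixedPoint (a := -(g * c))
    (R := Polynomial.C (-g) * (Polynomial.X ^ 2 * K.comp (Polynomial.C (X ^ (e + 1)) * Polynomial.X)))
    (fun i => ?_) (neg_mem (mul_mem hg (psRing_mono hA2 hcA))) ?_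
  · rw [Polynomial.coeff_C_mul]
    refine mul_mem (neg_mem hg) ?_
    rw [Polynomial.coeff_X_pow_mul']
    split_ifs
    · rw [Polynomial.comp_C_mul_X_coeff]
      exact mul_mem (psRing_mono hA2 (hK _)) (pow_mem (pow_mem X_mem_psRing _) _)
    · exact zero_mem _
  · simp only [Polynomial.eval_mul, Polynomial.eval_C, Polynomial.eval_pow, Polynomial.eval_X,
      Polynomial.eval_comp]
    linear_combination (norm := skip) (-w) * hg1
    simp only [c]; ring

lemma exists_finset_of_root {A : Subring ℂ} {s : ℂ⟦X⟧} {F : Polynomial ℂ⟦X⟧}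
    (hF : ∀ i, F.coeff i ∈ psRing A) (hF0 : F ≠ 0) (h0 : F.eval s = 0) :
    ∃ S : Finset ℂ, s ∈ psRing (Subring.closure (A ∪ S)) := by
  induction hn : F.natDegree using Nat.strong_induction_on generalizing F with
  | _ n ih =>
    by_cases h1 : F.derivative.eval s = 0
    · by_cases hd : F.natDegree = 0
      · rw [Polynomial.eq_C_of_natDegree_eq_zero hd] at h0 hF0
        rw [Polynomial.eval_C] at h0
        rw [h0] at hF0
        simp at hF0
      · refine ih _ ?_ (F := F.derivative) (fun j => ?_) ?_ h1 rfl
        · rw [← hn]; exact Polynomial.natDegree_derivative_lt hd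
        · rw [Polynomial.coeff_derivative]
          exact mul_mem (hF _) (add_mem (natCast_mem _ _) (one_mem _))
        · intro h
          have : IsAddTorsionFree ℂ⟦X⟧ := ⟨fun n hn a b h => by
            ext i
            have := congrArg (coeff i) h
            simp only [map_nsmul] at this
            exact nsmul_right_injective hn this⟩
          exact hd (Polynomial.derivative_eq_zero.mp h)
    · exact exists_finset_of_simple_root hF h0 h1

end MacMahon

namespace MacMahon
open scoped MatrixGroups Manifold UpperHalfPlane
open UpperHalfPlane PowerSeries LaurentSeries

variable {N : ℕ}

/-- Pairs consisting of a function and its expansion. -/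
noncomputable def expRing (N : ℕ) : Subring ((ℍ → ℂ) × ℂ⟦X⟧) where
  carrier := {w | HasExp N w.2 w.1}
  mul_mem' h h' := HasExp.mul h h'
  one_mem' := by simpa [Pi.one_def] using hasExp_C (N := N) 1
  add_mem' h h' := HasExp.add h h'
  zero_mem' := by simpa [Pi.zero_def] using hasExp_C (N := N) 0
  neg_mem' {w} h := by
    have := (hasExp_C (N := N) (-1)).mul h
    simpa [Pi.mul_def, Pi.neg_def] using this

/-- Functions with a Laurent expansion in `q_N` with coefficients in `A`. -/
noncomputable def defRing (N : ℕ) (A : Subring ℂ) : Subring (ℍ → ℂ) :=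
  (relRing A.subtype A.subtype N).map (RingHom.fst _ _)

lemma mem_defRing {A : Subring ℂ} {u : ℍ → ℂ} :
    u ∈ defRing N A ↔ ∃ k, ∃ p ∈ psRing A, HasExp N p (u * qpar N ^ k) := by
  constructor
  · rintro ⟨⟨u, x⟩, ⟨k, p, h, -⟩, rfl⟩
    exact ⟨k, _, ⟨p, rfl⟩, h⟩
  · rintro ⟨k, _, ⟨p, rfl⟩, h⟩
    refine ⟨⟨u, algebraMap ℂ⟦X⟧ ℂ⸨X⸩ (p.map A.subtype) / algebraMap ℂ⟦X⟧ ℂ⸨X⸩ (X ^ k)⟩,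
      ⟨k, p, h, ?_⟩, rfl⟩
    exact div_mul_cancel₀ _ (algebraMap_X_pow_ne_zero k)

lemma exists_relRing {κ : Type*} [Field κ] {A V : Subring ℂ} (hAV : A ≤ V) (r : V →+* κ)
    {u : ℍ → ℂ} (hu : u ∈ defRing N A) : ∃ x, (u, x) ∈ relRing V.subtype r N := by
  obtain ⟨k, p, hp, h⟩ := mem_defRing.mp hu
  obtain ⟨p, rfl⟩ := psRing_mono hAV hp
  exact ⟨algebraMap κ⟦X⟧ κ⸨X⸩ (p.map r) / algebraMap κ⟦X⟧ κ⸨X⸩ (X ^ k),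
    k, p, h, div_mul_cancel₀ _ (algebraMap_X_pow_ne_zero k)⟩

lemma defRing_mono {A B : Subring ℂ} (h : A ≤ B) : defRing N A ≤ defRing N B := fun u hu => by
  rw [mem_defRing] at hu ⊢
  obtain ⟨k, p, hp, h'⟩ := hu
  exact ⟨k, p, psRing_mono h hp, h'⟩

lemma const_mem_defRing {A : Subring ℂ} {c : ℂ} (hc : c ∈ A) : (fun _ => c) ∈ defRing N A :=
  mem_defRing.mpr ⟨0, _, C_mem_psRing hc, by
    simpa using hasExp_C c⟩

lemma qpar_pow (hN : 0 < N) (z : ℍ) : qpar N z ^ N = qpar 1 z := by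
  have hN' : (N : ℂ) ≠ 0 := by exact_mod_cast hN.ne'
  simp only [qpar, Function.Periodic.qParam, ← Complex.exp_nat_mul]
  congr 1
  push_cast
  field_simp

lemma defRing_level (hN : 0 < N) {A : Subring ℂ} {u : ℍ → ℂ} (hu : u ∈ defRing 1 A) :
    u ∈ defRing N A := by
  obtain ⟨⟨u, x⟩, h, rfl⟩ := hu
  exact ⟨_, relRing_subst (α := id) (ζ := 1) (ζ' := 1) hN.ne' (by simp) (by simp)
    (fun z => by simp [qpar_pow hN]) h, rfl⟩

lemma jFun_mem_defRing (hN : 0 < N) {A : Subring ℂ} (hA : (1728 : ℂ)⁻¹ ∈ A) : jFun ∈ defRing N A := by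
  obtain ⟨p, h, -, h'⟩ := exists_jFun_hasExp
  exact defRing_level hN (mem_defRing.mpr ⟨1, p, mem_psRing.mpr (h' A hA), by simpa using h⟩)

lemma eval_mem_defRing {A : Subring ℂ} {P : Polynomial ℂ} (hP : ∀ i, P.coeff i ∈ A) {u : ℍ → ℂ}
    (hu : u ∈ defRing N A) : (fun z => P.eval (u z)) ∈ defRing N A := by
  have : (fun z => P.eval (u z)) = ∑ i ∈ range (P.natDegree + 1), (fun _ => P.coeff i) * u ^ i := by
    ext z; simp [Polynomial.eval_eq_sum_range]
  rw [this]
  exact sum_mem fun i _ => mul_mem (const_mem_defRing (hP i)) (pow_mem hu i)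

lemma HasExp.mul_qpar {p : ℂ⟦X⟧} {u : ℍ → ℂ} (h : HasExp N p u) (k : ℕ) :
    HasExp N (p * X ^ k) (u * qpar N ^ k) := h.mul (hasExp_X_pow k)

/-- The subring generated by finitely many complex numbers. -/
noncomputable def finRing (S : Finset ℂ) : Subring ℂ := Subring.closure S

lemma finRing_mono {S T : Finset ℂ} (h : S ⊆ T) : finRing S ≤ finRing T :=
  Subring.closure_mono (by exact_mod_cast h)

lemma mem_finRing {S : Finset ℂ} {c : ℂ} (h : c ∈ S) : c ∈ finRing S := Subring.subset_closure h

lemma exists_finset_defRing (hN : 0 < N) (H : Subgroup SL(2, ℤ)) [H.FiniteIndex] (u : modGrowth)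
    (hu : ∀ δ ∈ H, transl δ u = u) (hT : ∀ z, u.1 (ModularGroup.T ^ N • z) = u.1 z) :
    ∃ S : Finset ℂ, u.1 ∈ defRing N (finRing S) := by
  classical
  have := Fintype.ofFinite (SL(2, ℤ) ⧸ H)
  obtain ⟨Q, -, h1, h2⟩ := exists_norm_poly H 1 u (fun δ _ => map_one _) hu
  obtain ⟨k, p, hp⟩ := exists_hasExp hN u.2 hT
  set D := H.index
  set S0 : Finset ℂ := insert (1728 : ℂ)⁻¹ ((range (D + 1)).biUnion fun i => (Q.coeff i).coeffs)
  have hc : ∀ i ∈ range (D + 1), (fun z => (Q.coeff i).eval (jFun z)) ∈ defRing N (finRing S0) :=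
    fun i hi => eval_mem_defRing (fun n => by
      by_cases h : (Q.coeff i).coeff n = 0
      · rw [h]; exact zero_mem _
      · exact mem_finRing (mem_insert_of_mem (mem_biUnion.mpr ⟨i, hi, Polynomial.coeff_mem_coeffs h⟩)))
      (jFun_mem_defRing hN (mem_finRing (mem_insert_self _ _)))
  simp only [mem_defRing] at hc
  choose! e c hcA hcE using hc
  set K := ∑ i ∈ range (D + 1), e i
  have hK : ∀ i ∈ range (D + 1), HasExp N (c i * X ^ (K - e i))
      ((fun z => (Q.coeff i).eval (jFun z)) * qpar N ^ K) := fun i hi => by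
    have := (hcE i hi).mul_qpar (K - e i)
    rwa [mul_assoc, ← pow_add, Nat.add_sub_cancel' (single_le_sum (fun _ _ => Nat.zero_le _) hi)] at this
  set F : Polynomial ℂ⟦X⟧ := ∑ i ∈ range (D + 1), Polynomial.monomial i (c i * X ^ (K - e i) * X ^ (k * (D - i)))
  have hFc : ∀ i, F.coeff i = if i ∈ range (D + 1) then c i * X ^ (K - e i) * X ^ (k * (D - i)) else 0 := fun i => by
    simp only [F, Polynomial.finsetSum_coeff, Polynomial.coeff_monomial]
    rw [Finset.sum_ite_eq']
  suffices h : ∃ S : Finset ℂ, p ∈ psRing (Subring.closure (finRing S0 ∪ S)) by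
    obtain ⟨S, hS⟩ := h
    refine ⟨S0 ∪ S, mem_defRing.mpr ⟨k, p, psRing_mono ?_ hS, hp⟩⟩
    rw [Subring.closure_le]
    rintro x (hx | hx)
    · exact finRing_mono subset_union_left hx
    · exact mem_finRing (mem_union_right _ hx)
  refine exists_finset_of_root (F := F) (fun i => ?_) ?_ ?_
  · rw [hFc]
    split_ifs with hi
    · exact mul_mem (mul_mem (hcA i hi) (pow_mem X_mem_psRing _)) (pow_mem X_mem_psRing _)
    · exact zero_mem _
  · intro h
    have h3 := congrArg (fun P => P.coeff D) h
    simp only [hFc, self_mem_range_succ, if_true, Nat.sub_self, mul_zero, pow_zero, mul_one,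
      Polynomial.coeff_zero] at h3
    have h4 := hK D (self_mem_range_succ D)
    rw [h3] at h4
    have h5 : ((fun z => (Q.coeff D).eval (jFun z)) * qpar N ^ K) = qpar N ^ K := by
      ext z; simp [h1]
    rw [h5] at h4
    exact pow_ne_zero K X_ne_zero (((hasExp_X_pow K).unique hN h4))
  · have h3 : ((∑ i ∈ range (D + 1), ((fun z => (Q.coeff i).eval (jFun z)) * qpar N ^ K) * (qpar N ^ (k * (D - i)))
        * (u.1 * qpar N ^ k) ^ i, F.eval p) : (ℍ → ℂ) × ℂ⟦X⟧) ∈ expRing N := by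
      have : F.eval p = ∑ i ∈ range (D + 1), c i * X ^ (K - e i) * X ^ (k * (D - i)) * p ^ i := by
        simp [F, Polynomial.eval_finsetSum]
      rw [this]
      have := sum_mem (S := expRing N) (t := range (D + 1)) (f := fun i =>
        ((((fun z => (Q.coeff i).eval (jFun z)) * qpar N ^ K), c i * X ^ (K - e i)) : (ℍ → ℂ) × ℂ⟦X⟧) *
        (qpar N ^ (k * (D - i)), X ^ (k * (D - i))) * (u.1 * qpar N ^ k, p) ^ i) fun i hi =>
          mul_mem (mul_mem (hK i hi) (hasExp_X_pow _)) (pow_mem (show (u.1 * qpar N ^ k, p) ∈ expRing N from hp) i)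
      convert this using 1
      ext <;> simp [Prod.fst_sum, Prod.snd_sum]
    have h4 : ∑ i ∈ range (D + 1), ((fun z => (Q.coeff i).eval (jFun z)) * qpar N ^ K) * (qpar N ^ (k * (D - i)))
        * (u.1 * qpar N ^ k) ^ i = 0 := by
      ext z
      have : ∀ i ∈ range (D + 1), (((fun z => (Q.coeff i).eval (jFun z)) * qpar N ^ K) * (qpar N ^ (k * (D - i)))
        * (u.1 * qpar N ^ k) ^ i) z = ((Q.coeff i).eval (jFun z) * u.1 z ^ i) * qpar N z ^ (K + k * D) := fun i hi => by
        have hi' : i ≤ D := Nat.lt_succ_iff.mp (mem_range.mp hi)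
        have h6 : K + k * D = K + k * (D - i) + k * i := by
          rw [add_assoc, ← mul_add, Nat.sub_add_cancel hi']
        simp only [Pi.mul_apply, Pi.pow_apply, h6, pow_add, mul_pow, ← pow_mul]
        ring
      rw [Finset.sum_apply, sum_congr rfl this, ← sum_mul]
      have h5 := h2 z
      simp only [OneMemClass.coe_one, Pi.one_apply, one_pow, mul_one] at h5
      rw [h5]; simp
    rw [h4] at h3
    have h0 : HasExp N 0 (0 : ℍ → ℂ) := (expRing N).zero_mem
    exact HasExp.unique hN h3 h0

end MacMahon

namespace MacMahon
open scoped MatrixGroups Manifold UpperHalfPlane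
open UpperHalfPlane PowerSeries LaurentSeries

/-- Evaluation of a bivariate polynomial. -/
noncomputable def ev2 {R L : Type*} [CommRing R] [CommRing L] (i : R →+* L) (x y : L) :
    Polynomial (Polynomial R) →+* L :=
  Polynomial.eval₂RingHom (Polynomial.eval₂RingHom i x) y

lemma map_ev2 {R L L' : Type*} [CommRing R] [CommRing L] [CommRing L'] (i : R →+* L) (f : L →+* L')
    (x y : L) (P : Polynomial (Polynomial R)) :
    f (ev2 i x y P) = ev2 (f.comp i) (f x) (f y) P := by
  have : f.comp (ev2 i x y) = ev2 (f.comp i) (f x) (f y) := by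
    ext <;> simp [ev2]
  exact RingHom.congr_fun this P

lemma ev2_map {R R' L : Type*} [CommRing R] [CommRing R'] [CommRing L] (i : R' →+* L) (f : R →+* R')
    (x y : L) (P : Polynomial (Polynomial R)) :
    ev2 i x y (P.map (Polynomial.mapRingHom f)) = ev2 (i.comp f) x y P := by
  have : (ev2 i x y).comp (Polynomial.mapRingHom (Polynomial.mapRingHom f)) = ev2 (i.comp f) x y := by
    ext <;> simp [ev2]
  exact RingHom.congr_fun this P

lemma ev2_mem {R L : Type*} [CommRing R] [CommRing L] {i : R →+* L} {x y : L} {S : Subring L}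
    (hi : ∀ a, i a ∈ S) (hx : x ∈ S) (hy : y ∈ S) (P : Polynomial (Polynomial R)) :
    ev2 i x y P ∈ S := by
  simp only [ev2, Polynomial.coe_eval₂RingHom, Polynomial.eval₂_eq_sum_range]
  exact sum_mem fun k _ => mul_mem (sum_mem fun l _ => mul_mem (hi _) (pow_mem hx _)) (pow_mem hy _)

lemma ev2_eq_sum {R L : Type*} [CommRing R] [CommRing L] (i : R →+* L) (x y : L) {D : ℕ}
    {P : Polynomial (Polynomial R)} (hP : P.natDegree ≤ D) :
    ev2 i x y P = ∑ k ∈ range (D + 1), (P.coeff k).eval₂ i x * y ^ k := by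
  simp only [ev2, Polynomial.coe_eval₂RingHom]
  exact Polynomial.eval₂_eq_sum_range' _ (Nat.lt_succ_of_le hP) _

lemma coeff_coeff_swap {R : Type*} [CommRing R] (P : Polynomial (Polynomial R)) (k l : ℕ) :
    ((Polynomial.Bivariate.swap P).coeff k).coeff l = (P.coeff l).coeff k := by
  induction P using Polynomial.induction_on' with
  | add p q hp hq => simp [hp, hq]
  | monomial n p =>
    induction p using Polynomial.induction_on' with
    | add p q hp hq => simp_all
    | monomial m a =>
      rw [Polynomial.Bivariate.swap_monomial_monomial]
      simp only [Polynomial.coeff_monomial]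
      split_ifs <;> simp_all [Polynomial.coeff_monomial]

lemma natDegree_swap_le {R : Type*} [CommRing R] {P : Polynomial (Polynomial R)} {K : ℕ} :
    (Polynomial.Bivariate.swap P).natDegree ≤ K ↔ ∀ i, (P.coeff i).natDegree ≤ K := by
  simp only [Polynomial.natDegree_le_iff_coeff_eq_zero, Polynomial.ext_iff, Polynomial.coeff_zero,
    coeff_coeff_swap]
  exact ⟨fun h i k hk => h k hk i, fun h k hk i => h i k hk⟩

lemma exists_small_relation {κ L : Type*} [Field κ] [Field L] {i : κ →+* L} {x y : L}
    (hx : ∀ P : Polynomial κ, P.eval₂ i x = 0 → P = 0) {Φ Q : Polynomial (Polynomial κ)} {D K : ℕ}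
    (hΦ : Φ.Monic) (hΦK : ∀ k, (Φ.coeff k).natDegree ≤ K) (hΦ0 : ev2 i x y Φ = 0)
    (hQ : Q ≠ 0) (hQD : Q.natDegree ≤ D) (hQ0 : ev2 i x y Q = 0) :
    ∃ P : Polynomial (Polynomial κ), P ≠ 0 ∧ P.natDegree ≤ D ∧ (∀ k, (P.coeff k).natDegree ≤ K) ∧
      ev2 i x y P = 0 := by
  let _ : Algebra (Polynomial κ) L := (Polynomial.eval₂RingHom i x).toAlgebra
  have hinj : Function.Injective (algebraMap (Polynomial κ) L) :=
    (injective_iff_map_eq_zero _).mpr hx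
  have : FaithfulSMul (Polynomial κ) L := (faithfulSMul_iff_algebraMap_injective _ _).mpr hinj
  have hev : ∀ P : Polynomial (Polynomial κ), Polynomial.aeval y P = ev2 i x y P := fun P => rfl
  have h_int : IsIntegral (Polynomial κ) y := ⟨Φ, hΦ, hΦ0⟩
  refine ⟨minpoly (Polynomial κ) y, minpoly.ne_zero h_int, ?_, ?_, ?_⟩
  · exact (Polynomial.natDegree_le_of_dvd (minpoly.isIntegrallyClosed_dvd h_int (by rw [hev, hQ0])) hQ).trans hQD
  · rw [← natDegree_swap_le] at hΦK ⊢
    refine (Polynomial.natDegree_le_of_dvd (map_dvd _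
      (minpoly.isIntegrallyClosed_dvd h_int (by rw [hev, hΦ0]))) ?_).trans hΦK
    rw [Ne, EmbeddingLike.map_eq_zero_iff]
    exact hΦ.ne_zero
  · rw [← hev, minpoly.aeval]

/-- The embedding of constants in Laurent series. -/
noncomputable def laurentC (κ : Type*) [Field κ] : κ →+* κ⸨X⸩ :=
  (algebraMap κ⟦X⟧ κ⸨X⸩).comp PowerSeries.C

lemma transcendental_laurent {κ : Type*} [Field κ] {x : κ⸨X⸩} {N : ℕ} (hN : 0 < N) {p : κ⟦X⟧}
    (hp : coeff 0 p = 1) (h : x * algebraMap κ⟦X⟧ κ⸨X⸩ (X ^ N) = algebraMap κ⟦X⟧ κ⸨X⸩ p)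
    (P : Polynomial κ) (hP : P.eval₂ (laurentC κ) x = 0) : P = 0 := by
  by_contra hP0
  set d := P.natDegree
  have h1 : ∑ k ∈ range (d + 1), PowerSeries.C (P.coeff k) * p ^ k * X ^ (N * (d - k)) = 0 := by
    apply FaithfulSMul.algebraMap_injective κ⟦X⟧ κ⸨X⸩
    rw [Polynomial.eval₂_eq_sum_range] at hP
    have h2 := congrArg (· * algebraMap κ⟦X⟧ κ⸨X⸩ (X ^ N) ^ d) hP
    simp only [zero_mul, sum_mul] at h2
    rw [map_zero, ← h2, map_sum]
    refine sum_congr rfl fun k hk => ?_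
    have hk' : k ≤ d := Nat.lt_succ_iff.mp (mem_range.mp hk)
    obtain ⟨e, he⟩ := Nat.exists_eq_add_of_le hk'
    rw [he, Nat.add_sub_cancel_left, map_mul, map_mul, map_pow, ← h, pow_mul, map_pow _ _ e, laurentC,
      RingHom.comp_apply]
    ring
  have h2 := congrArg constantCoeff h1
  rw [map_sum, sum_range_succ, sum_eq_zero] at h2
  · simp only [Nat.sub_self, map_mul, constantCoeff_C, map_pow, map_zero,
      mul_zero, pow_zero, mul_one, zero_add, ← coeff_zero_eq_constantCoeff_apply, hp, one_pow] at h2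
    simp only [coeff_zero_eq_constantCoeff_apply, map_one, mul_one] at h2
    exact hP0 (Polynomial.leadingCoeff_eq_zero.mp h2)
  · intro k hk
    have : N * (d - k) ≠ 0 := (Nat.mul_pos hN (Nat.sub_pos_of_lt (mem_range.mp hk))).ne'
    simp [this]

instance : NoZeroDivisors modGrowth where
  eq_zero_or_eq_zero_of_mul_eq_zero {u v} h := by
    have han : ∀ w : modGrowth, AnalyticOnNhd ℂ (w.1 ∘ ofComplex) {z | 0 < z.im} := fun w =>
      ((UpperHalfPlane.mdifferentiable_iff).mp w.2.1).analyticOnNhd isOpen_upperHalfPlaneSet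
    have hpre : IsPreconnected {z : ℂ | 0 < z.im} := (convex_halfSpace_im_gt 0).isPreconnected
    have key : ∀ w : modGrowth, (∀ z ∈ {z : ℂ | 0 < z.im}, (w.1 ∘ ofComplex) z = 0) → w = 0 := fun w hw => by
      ext z
      simpa using hw z z.im_pos
    refine (AnalyticOnNhd.eq_zero_or_eq_zero_of_mul_eq_zero (han u) (han v) (fun z hz => ?_) hpre).imp
      (key u) (key v)
    exact congrFun (congrArg Subtype.val h) (ofComplex z)

instance : Nontrivial modGrowth := ⟨0, 1, fun h => zero_ne_one (congrFun (congrArg Subtype.val h) UpperHalfPlane.I)⟩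

instance : IsDomain modGrowth := NoZeroDivisors.to_isDomain _

end MacMahon

namespace MacMahon
open scoped MatrixGroups Manifold UpperHalfPlane
open UpperHalfPlane PowerSeries LaurentSeries

variable {N : ℕ}

lemma exists_dual_functionals {ι : Type*} [Fintype ι] [DecidableEq ι] (p : ι → ℂ⟦X⟧)
    (h : ∀ c : ι → ℂ, (∀ n, ∑ a, c a * coeff n (p a) = 0) → c = 0) :
    ∃ B : ι → ℕ →₀ ℂ, ∀ a b, (B a).sum (fun n t => t * coeff n (p b)) = if a = b then 1 else 0 := by
  let φ : ℕ → Module.Dual ℂ (ι → ℂ) := fun n => ∑ a, (coeff n (p a)) • LinearMap.proj a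
  have hφ : ∀ n c, φ n c = ∑ a, c a * coeff n (p a) := fun n c => by
    simp [φ, LinearMap.sum_apply, mul_comm]
  have hbot : (Submodule.span ℂ (Set.range φ)).dualCoannihilator = ⊥ := by
    rw [eq_bot_iff]
    intro c hc
    rw [Submodule.mem_dualCoannihilator] at hc
    exact h c fun n => by rw [← hφ]; exact hc _ (Submodule.subset_span ⟨n, rfl⟩)
  have htop : Submodule.span ℂ (Set.range φ) = ⊤ := by
    rw [← Subspace.dualCoannihilator_dualAnnihilator_eq (W := Submodule.span ℂ (Set.range φ)), hbot,
      Submodule.dualAnnihilator_bot]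
  have : ∀ a : ι, ∃ B : ℕ →₀ ℂ, (B.sum fun n t => t • φ n) = LinearMap.proj a := fun a =>
    Finsupp.mem_span_range_iff_exists_finsupp.mp (htop ▸ Submodule.mem_top)
  choose B hB using this
  refine ⟨B, fun a b => ?_⟩
  have := LinearMap.congr_fun (hB a) (Pi.single b 1)
  rw [Finsupp.sum, LinearMap.sum_apply, LinearMap.proj_apply, Pi.single_apply] at this
  rw [← this]
  refine sum_congr rfl fun n _ => ?_
  rw [LinearMap.smul_apply, hφ]
  simp [Pi.single_apply]

lemma relRing_mul_X_pow {A κ : Type*} [CommRing A] [Field κ] {ι : A →+* ℂ} {r : A →+* κ} (hN : 0 < N)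
    (hι : Function.Injective ι) {u : ℍ → ℂ} {x : κ⸨X⸩}
    (h : (u, x) ∈ relRing ι r N) {k : ℕ} {p : A⟦X⟧} (hp : HasExp N (p.map ι) (u * qpar N ^ k)) :
    x * algebraMap κ⟦X⟧ κ⸨X⸩ (X ^ k) = algebraMap κ⟦X⟧ κ⸨X⸩ (p.map r) := by
  have h2 := div_mul_cancel₀ (algebraMap κ⟦X⟧ κ⸨X⸩ (p.map r)) (algebraMap_X_pow_ne_zero (κ := κ) k)
  rw [relRing_unique hN hι h ⟨k, p, hp, h2⟩, h2]

lemma exists_finset_independent (hN : 0 < N) {ι : Type*} [Fintype ι] (f : ι → ℍ → ℂ) (S₀ : Finset ℂ)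
    (hf : ∀ a, f a ∈ defRing N (finRing S₀))
    (hind : ∀ c : ι → ℂ, (∀ z, ∑ a, c a * f a z = 0) → c = 0) :
    ∃ S : Finset ℂ, S₀ ⊆ S ∧ ∀ (κ : Type) [Field κ] (V : Subring ℂ) (r : V →+* κ) (x : ι → κ⸨X⸩),
      finRing S ≤ V → (∀ a, (f a, x a) ∈ relRing V.subtype r N) →
      ∀ c : ι → κ, ∑ a, laurentC κ (c a) * x a = 0 → c = 0 := by
  classical
  simp only [mem_defRing] at hf
  choose e p hp hE using hf
  set K := ∑ a, e a
  set P : ι → ℂ⟦X⟧ := fun a => p a * X ^ (K - e a)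
  have hPE : ∀ a, HasExp N (P a) (f a * qpar N ^ K) := fun a => by
    have := (hE a).mul_qpar (K - e a)
    rwa [mul_assoc, ← pow_add, Nat.add_sub_cancel' (single_le_sum (fun _ _ => Nat.zero_le _) (mem_univ a))] at this
  obtain ⟨B, hB⟩ := exists_dual_functionals P fun c hc => by
    refine hind c fun z => ?_
    have h1 : HasExp N (∑ a, PowerSeries.C (c a) * P a) (∑ a, (fun _ => c a) * (f a * qpar N ^ K)) := by
      have := sum_mem (S := expRing N) (t := univ) (f := fun a =>
        (((fun _ => c a) * (f a * qpar N ^ K), PowerSeries.C (c a) * P a) : (ℍ → ℂ) × ℂ⟦X⟧)) fun a _ =>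
          (hasExp_C (c a)).mul (hPE a)
      have h2 : HasExp N _ _ := this
      simpa only [Prod.fst_sum, Prod.snd_sum] using h2
    have h2 : (∑ a, PowerSeries.C (c a) * P a) = 0 := by
      ext n; simpa using hc n
    have h3 := (h1 z).unique (a₂ := 0) (by simp [h2, hasSum_zero])
    have h4 : (∑ a, c a * f a z) * qpar N z ^ K = 0 := by
      rw [sum_mul, ← h3, Finset.sum_apply]
      exact sum_congr rfl fun a _ => by simp [mul_assoc]
    exact (mul_eq_zero.mp h4).resolve_right (pow_ne_zero _ (qpar_ne_zero z))
  refine ⟨S₀ ∪ univ.biUnion fun a => (B a).support.image (B a), subset_union_left,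
    fun κ _ V r x hV hx c hc => ?_⟩
  have hPV : ∀ a, ∃ P' : V⟦X⟧, P'.map V.subtype = P a := fun a =>
    psRing_mono ((finRing_mono subset_union_left).trans hV) (mul_mem (hp a) (pow_mem X_mem_psRing _))
  choose P' hP' using hPV
  have hBV : ∀ a n, B a n ∈ V := fun a n => by
    by_cases h : B a n = 0
    · rw [h]; exact zero_mem _
    · exact hV (mem_finRing (mem_union_right _ (mem_biUnion.mpr
        ⟨a, mem_univ _, mem_image_of_mem _ (Finsupp.mem_support_iff.mpr h)⟩)))
  have h1 : ∀ n, ∑ a, c a * r (coeff n (P' a)) = 0 := fun n => by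
    have h2 : ∑ a, PowerSeries.C (c a) * (P' a).map r = 0 := by
      apply FaithfulSMul.algebraMap_injective κ⟦X⟧ κ⸨X⸩
      have h3 := congrArg (· * algebraMap κ⟦X⟧ κ⸨X⸩ (X ^ K)) hc
      simp only [zero_mul, sum_mul, mul_assoc] at h3
      rw [map_zero, ← h3, map_sum]
      refine sum_congr rfl fun a _ => ?_
      rw [relRing_mul_X_pow hN Subtype.coe_injective (hx a) (p := P' a) (by rw [hP']; exact hPE a), map_mul]
      rfl
    simpa using congrArg (coeff n) h2
  ext b
  have h2 : ∀ a, ∑ n ∈ (B b).support, r ⟨B b n, hBV b n⟩ * r (coeff n (P' a)) = if b = a then 1 else 0 := fun a => by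
    have h3 : ∑ n ∈ (B b).support, (⟨B b n, hBV b n⟩ : V) * coeff n (P' a) = if b = a then 1 else 0 := by
      refine Subtype.ext ?_
      have := hB b a
      rw [Finsupp.sum] at this
      have h4 : ((if b = a then 1 else 0 : V) : ℂ) = if b = a then 1 else 0 := by split_ifs <;> rfl
      rw [h4, ← this, AddSubmonoidClass.coe_finsetSum]
      refine sum_congr rfl fun n _ => ?_
      rw [← hP', coeff_map]; rfl
    have := congrArg r h3
    rw [map_sum] at this
    simp only [map_mul] at this
    rw [this]; split_ifs <;> simp
  calc c b = ∑ a, c a * ∑ n ∈ (B b).support, r ⟨B b n, hBV b n⟩ * r (coeff n (P' a)) := by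
        simp [h2]
    _ = ∑ n ∈ (B b).support, r ⟨B b n, hBV b n⟩ * ∑ a, c a * r (coeff n (P' a)) := by
        simp only [mul_sum]
        rw [sum_comm]
        exact sum_congr rfl fun n _ => sum_congr rfl fun a _ => by ring
    _ = 0 := by simp [h1]

lemma exists_finset_no_relation (hN : 0 < N) (u : modGrowth) (S₀ : Finset ℂ)
    (h0 : (1728 : ℂ)⁻¹ ∈ S₀) (hu : u.1 ∈ defRing N (finRing S₀)) (D K : ℕ)
    (hind : ∀ P : Polynomial (Polynomial ℂ), P.natDegree ≤ D →
      (∀ z, ev2 (RingHom.id ℂ) (jFun z) (u.1 z) P = 0) → P = 0) :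
    ∃ S : Finset ℂ, S₀ ⊆ S ∧ ∀ (κ : Type) [Field κ] (V : Subring ℂ) (r : V →+* κ) (x y : κ⸨X⸩),
      finRing S ≤ V → (jFun, x) ∈ relRing V.subtype r N → (u.1, y) ∈ relRing V.subtype r N →
      ∀ P : Polynomial (Polynomial κ), P.natDegree ≤ D → (∀ k, (P.coeff k).natDegree ≤ K) →
        ev2 (laurentC κ) x y P = 0 → P = 0 := by
  obtain ⟨S, hS, h⟩ := exists_finset_independent hN (ι := Fin (D + 1) × Fin (K + 1))
    (fun a => jFun ^ (a.2 : ℕ) * u.1 ^ (a.1 : ℕ)) S₀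
    (fun a => mul_mem (pow_mem (jFun_mem_defRing hN (mem_finRing h0)) _) (pow_mem hu _))
    (fun c hc => by
      set P : Polynomial (Polynomial ℂ) := ∑ a : Fin (D + 1) × Fin (K + 1),
        Polynomial.monomial a.1 (Polynomial.monomial a.2 (c a))
      have hP : P = 0 := by
        refine hind P (Polynomial.natDegree_sum_le_of_forall_le _ _ fun a _ =>
          (Polynomial.natDegree_monomial_le _).trans (by omega)) fun z => ?_
        rw [← hc z, map_sum]
        refine sum_congr rfl fun a _ => ?_
        simp [ev2, mul_assoc]
      ext ⟨i, k⟩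
      have := congrArg (fun P => (P.coeff i).coeff k) hP
      simp only [P, Polynomial.finsetSum_coeff, Polynomial.coeff_zero, Polynomial.coeff_monomial] at this
      rw [Finset.sum_eq_single (i, k)] at this
      · simpa using this
      · rintro ⟨i', k'⟩ - hne
        split_ifs with h1
        · rw [Polynomial.coeff_monomial, if_neg]
          intro h2
          exact hne (Prod.ext (Fin.ext h1) (Fin.ext h2))
        · simp
      · simp)
  refine ⟨S, hS, fun κ _ V r x y hV hx hy P hPD hPK hP => ?_⟩
  have := h κ V r (fun a => x ^ (a.2 : ℕ) * y ^ (a.1 : ℕ)) hV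
    (fun a => mul_mem (pow_mem hx _) (pow_mem hy _)) (fun a => (P.coeff a.1).coeff a.2) ?_
  · ext i k
    by_cases hi : i ≤ D
    · by_cases hk : k ≤ K
      · exact congrFun this (⟨i, Nat.lt_succ_of_le hi⟩, ⟨k, Nat.lt_succ_of_le hk⟩)
      · rw [Polynomial.coeff_eq_zero_of_natDegree_lt ((hPK i).trans_lt (not_le.mp hk))]; simp
    · rw [Polynomial.coeff_eq_zero_of_natDegree_lt (hPD.trans_lt (not_le.mp hi))]; simp
  · rw [← hP, ev2_eq_sum _ _ _ hPD, Fintype.sum_prod_type, Finset.sum_range]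
    refine sum_congr rfl fun i _ => ?_
    rw [Polynomial.eval₂_eq_sum_range' _ (Nat.lt_succ_of_le (hPK i)), Finset.sum_range, sum_mul]
    exact sum_congr rfl fun k _ => by rw [mul_assoc]

lemma jFun_transcendental (P : Polynomial ℂ) (h : ∀ z, P.eval (jFun z) = 0) : P = 0 := by
  obtain ⟨p, hp, hp0, -⟩ := exists_jFun_hasExp
  set x : ℂ⸨X⸩ := algebraMap ℂ⟦X⟧ ℂ⸨X⸩ p / algebraMap ℂ⟦X⟧ ℂ⸨X⸩ (X ^ 1)
  have hx : x * algebraMap ℂ⟦X⟧ ℂ⸨X⸩ (X ^ 1) = algebraMap ℂ⟦X⟧ ℂ⸨X⸩ p :=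
    div_mul_cancel₀ _ (algebraMap_X_pow_ne_zero 1)
  have hj : (jFun, x) ∈ relRing (RingHom.id ℂ) (RingHom.id ℂ) 1 := by
    refine ⟨1, p, by simpa using hp, ?_⟩
    rw [PowerSeries.map_id]; exact hx
  refine transcendental_laurent one_pos hp0 hx P (relRing_zero (ι := RingHom.id ℂ) (r := RingHom.id ℂ)
    one_pos Function.injective_id ?_)
  have : (0, P.eval₂ (laurentC ℂ) x) =
      ∑ i ∈ range (P.natDegree + 1), ((fun _ => P.coeff i, laurentC ℂ (P.coeff i)) : (ℍ → ℂ) × ℂ⸨X⸩) *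
        (jFun, x) ^ i := by
    ext z
    · simp [Prod.fst_sum, ← h z, Polynomial.eval_eq_sum_range]
    · simp [Prod.snd_sum, Polynomial.eval₂_eq_sum_range]
  rw [this]
  exact sum_mem fun i _ => mul_mem (relRing_const _) (pow_mem hj _)

lemma no_relation_of_translates (u : modGrowth) {D : ℕ} (T : Finset SL(2, ℤ)) (hT : D < T.card)
    (hinj : Set.InjOn (fun δ => transl δ u) T) (P : Polynomial (Polynomial ℂ)) (hP : P.natDegree ≤ D)
    (h : ∀ z, ev2 (RingHom.id ℂ) (jFun z) (u.1 z) P = 0) : P = 0 := by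
  classical
  let J : Polynomial ℂ →+* modGrowth :=
    Polynomial.eval₂RingHom (algebraMap ℂ modGrowth) ⟨jFun, jFun_mem⟩
  have hJ : ∀ p z, (J p).1 z = p.eval (jFun z) := fun p z => by
    have : (evalAt z).comp J = Polynomial.evalRingHom (jFun z) := by
      ext
      · simp only [J, evalAt, RingHom.comp_apply, Polynomial.coe_eval₂RingHom, Polynomial.eval₂_C]
        simp only [Polynomial.coe_evalRingHom, Polynomial.eval_C]; rfl
      · simp [J, evalAt]
    exact RingHom.congr_fun this p
  have hJinj : Function.Injective J := (injective_iff_map_eq_zero _).mpr fun p hp =>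
    jFun_transcendental p fun z => by rw [← hJ, hp]; rfl
  have hroot : ∀ δ, (P.map J).eval (transl δ u) = 0 := fun δ => by
    ext z
    have h1 : ((P.map J).eval (transl δ u)).1 z = ev2 (RingHom.id ℂ) (jFun (δ • z)) (u.1 (δ • z)) P := by
      rw [Polynomial.eval_map]
      have : (evalAt z).comp (Polynomial.eval₂RingHom J (transl δ u)) =
          ev2 (RingHom.id ℂ) (jFun (δ • z)) (u.1 (δ • z)) := by
        ext
        · simp [ev2, evalAt, J]
        · simpa [ev2, evalAt, J] using (jFun_smul δ z).symm
        · simp [ev2, evalAt, transl]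
      exact RingHom.congr_fun this P
    rw [h1, h]; rfl
  rw [← Polynomial.map_eq_zero_iff hJinj]
  by_contra h0
  have h1 : T.image (fun δ => transl δ u) ⊆ (P.map J).roots.toFinset := fun w hw => by
    obtain ⟨δ, -, rfl⟩ := mem_image.mp hw
    rw [Multiset.mem_toFinset, Polynomial.mem_roots h0]
    exact hroot δ
  have h2 := (card_le_card h1).trans (Multiset.toFinset_card_le _)
  rw [card_image_of_injOn hinj] at h2
  have := (Polynomial.card_roots' (P.map J)).trans (Polynomial.natDegree_map_le.trans hP)
  omega

end MacMahon

namespace MacMahon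
open scoped MatrixGroups Manifold UpperHalfPlane
open UpperHalfPlane PowerSeries LaurentSeries CongruenceSubgroup

lemma transl_mul (a b : SL(2, ℤ)) (u : modGrowth) : transl (a * b) u = transl b (transl a u) := by
  ext z; simp [transl, mul_smul]

lemma transl_one (u : modGrowth) : transl 1 u = u := by
  ext z; simp [transl]

/-- The stabilizer of a function. -/
noncomputable def stab (u : modGrowth) : Subgroup SL(2, ℤ) where
  carrier := {δ | transl δ u = u}
  mul_mem' {a b} ha hb := by
    rw [Set.mem_ofPred_eq] at *
    rw [transl_mul, ha, hb]
  one_mem' := transl_one u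
  inv_mem' {a} ha := by
    rw [Set.mem_ofPred_eq] at *
    nth_rewrite 1 [← ha]
    rw [← transl_mul, mul_inv_cancel, transl_one]

lemma mem_stab {u : modGrowth} {δ : SL(2, ℤ)} : δ ∈ stab u ↔ transl δ u = u := Iff.rfl

lemma mem_stab' {u : modGrowth} {δ : SL(2, ℤ)} : δ ∈ stab u ↔ ∀ z, u.1 (δ • z) = u.1 z :=
  ⟨fun h z => congrFun (congrArg Subtype.val h) z, fun h => Subtype.ext (funext h)⟩

lemma exists_translates (u : modGrowth) [(stab u).FiniteIndex] :
    ∃ T : Finset SL(2, ℤ), T.card = (stab u).index ∧ Set.InjOn (fun δ => transl δ u) T := by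
  classical
  have := Fintype.ofFinite (SL(2, ℤ) ⧸ stab u)
  have key : ∀ p q : SL(2, ℤ) ⧸ stab u, transl p.out⁻¹ u = transl q.out⁻¹ u → p = q := fun p q h => by
    rw [← QuotientGroup.out_eq' p, ← QuotientGroup.out_eq' q, QuotientGroup.eq, mem_stab, transl_mul, h,
      ← transl_mul, inv_mul_cancel, transl_one]
  refine ⟨univ.image fun q : SL(2, ℤ) ⧸ stab u => q.out⁻¹, ?_, ?_⟩
  · rw [card_image_of_injective, card_univ, ← Nat.card_eq_fintype_card]; rfl
    intro p q h
    exact key p q (congrArg (fun δ => transl δ u) h)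
  · rintro a ha b hb h
    obtain ⟨p, -, rfl⟩ := mem_image.mp ha
    obtain ⟨q, -, rfl⟩ := mem_image.mp hb
    exact congrArg (fun q : SL(2, ℤ) ⧸ stab u => q.out⁻¹) (key p q h)

variable {m : ℕ}

/-- The base function as an element of the ring. -/
noncomputable def yb (hm : 3 ≤ m) : modGrowth := ⟨baseFun m, baseFun_mem (by omega)⟩

lemma Gamma_le_stab (hm : 3 ≤ m) : Gamma m ≤ stab (yb hm) := fun γ hγ =>
  mem_stab'.mpr fun z => baseFun_smul (by omega) ⟨γ, hγ⟩ z

instance (hm : 3 ≤ m) : (stab (yb hm)).FiniteIndex :=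
  have : NeZero m := ⟨by omega⟩
  Subgroup.finiteIndex_of_le (Gamma_le_stab hm)

lemma transl_neg (δ : SL(2, ℤ)) (u : modGrowth) : transl (-δ) u = transl δ u := by
  ext z
  exact congrArg u.1 (ModularGroup.SL_neg_smul δ z)

/-- Invariance under the principal congruence subgroup. -/
lemma invariant_of_Gamma (hm : 3 ≤ m) {u : modGrowth}
    (hu : ∀ (γ : Gamma m) z, u.1 ((γ : SL(2, ℤ)) • z) = u.1 z) (δ : SL(2, ℤ)) (hδ : δ ∈ stab (yb hm)) :
    transl δ u = u := by
  have h0 : SmallAtCusps m 0 := fun δ => by simp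
  have h1 : ∀ γ ∈ Gamma m, transl γ u = u := fun γ hγ => mem_stab'.mpr (hu ⟨γ, hγ⟩)
  rcases stab_baseFun_add hm h0 (δ := δ) (by simpa [yb] using mem_stab'.mp hδ) with h | h
  · exact h1 _ h
  · rw [← transl_neg]; exact h1 _ h

/-- A small function transforming by a character. -/
structure IsCharFun (hm : 3 ≤ m) (χ : Gamma m →* ℂ) (b : modGrowth) : Prop where
  ne_zero : b ≠ 0
  smul : ∀ (γ : Gamma m) z, b.1 ((γ : SL(2, ℤ)) • z) = χ γ * b.1 z
  small : SmallAtCusps m b.1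

lemma exists_isCharFun (hm : 3 ≤ m) (χ : Gamma m →* ℂ) (hχ : ∀ γ, χ γ ^ m = 1) :
    ∃ b, IsCharFun hm χ b := by
  have hm0 : m ≠ 0 := by omega
  obtain ⟨ν, h0, h1, h2⟩ := exists_exponent hm0 hχ
  refine ⟨⟨poincareFun χ ν, poincareFun_mem hm0 hχ h0.le⟩, fun h => ?_, fun γ z => ?_, ?_⟩
  · exact poincareFun_ne_zero hm hχ h0 h2 (congrArg Subtype.val h)
  · exact poincareFun_char (char_ne_zero hm0 hχ) h2 γ z
  · exact smallAtCusps_poincareFun hm0 hχ h0 h1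

lemma T_sq_periodic {χ : Gamma m →* ℂ} (hχ : ∀ γ, χ γ ^ m = 1) {u : ℍ → ℂ}
    (hu : ∀ (γ : Gamma m) z, u ((γ : SL(2, ℤ)) • z) = χ γ * u z) (z : ℍ) :
    u (ModularGroup.T ^ (m ^ 2) • z) = u z := by
  have := hu (Tm m ^ m) z
  rw [map_pow, hχ, one_mul] at this
  rwa [sq, pow_mul]

lemma finiteIndex_ker (hm : 3 ≤ m) (χ : Gamma m →* ℂ) (hχ : ∀ γ, χ γ ^ m = 1) :
    (χ.ker.map (Gamma m).subtype).FiniteIndex := by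
  have : NeZero m := ⟨by omega⟩
  have h1 : χ.ker.FiniteIndex := by
    have hle : χ.toHomUnits.range ≤ rootsOfUnity m ℂ := by
      rintro _ ⟨γ, rfl⟩
      exact (mem_rootsOfUnity _ _).mpr (Units.ext (by simpa using hχ γ))
    have : Finite χ.toHomUnits.range := Finite.of_injective _ (Subgroup.inclusion_injective hle)
    have h2 : χ.toHomUnits.ker = χ.ker := by
      ext γ
      rw [MonoidHom.mem_ker, MonoidHom.mem_ker, Units.ext_iff]; simp
    rw [← h2]
    infer_instance
  refine ⟨?_⟩
  rw [Subgroup.index_map_subtype]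
  exact mul_ne_zero h1.index_ne_zero (inferInstance : (Gamma m).FiniteIndex).index_ne_zero

lemma ker_le_stab (hm : 3 ≤ m) {χ : Gamma m →* ℂ} {b : modGrowth} (hb : IsCharFun hm χ b) :
    χ.ker.map (Gamma m).subtype ≤ stab (yb hm + b) := by
  rintro _ ⟨γ, hγ, rfl⟩
  refine mem_stab'.mpr fun z => ?_
  have h1 : (yb hm).1 ((γ : SL(2, ℤ)) • z) = (yb hm).1 z := baseFun_smul (by omega) γ z
  have h2 := hb.smul γ z
  rw [MonoidHom.mem_ker.mp hγ, one_mul] at h2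
  exact congrArg₂ (· + ·) h1 h2

lemma stab_lt (hm : 3 ≤ m) {χ : Gamma m →* ℂ} (h1 : χ ≠ 1) {b : modGrowth} (hb : IsCharFun hm χ b) :
    stab (yb hm + b) < stab (yb hm) := by
  refine lt_of_le_of_ne (fun δ hδ => ?_) fun h => h1 ?_
  · rcases stab_baseFun_add hm hb.small (δ := δ) (mem_stab'.mp hδ) with h | h
    · exact Gamma_le_stab hm h
    · rw [mem_stab, ← transl_neg]
      exact mem_stab.mp (Gamma_le_stab hm h)
  · ext γ
    obtain ⟨z, hz⟩ : ∃ z, b.1 z ≠ 0 := by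
      by_contra! hz
      exact hb.ne_zero (Subtype.ext (funext hz))
    have h2 : (γ : SL(2, ℤ)) ∈ stab (yb hm + b) := h ▸ Gamma_le_stab hm γ.2
    have h3 : (yb hm).1 ((γ : SL(2, ℤ)) • z) + b.1 ((γ : SL(2, ℤ)) • z) = (yb hm).1 z + b.1 z :=
      mem_stab'.mp h2 z
    rw [mem_stab'.mp (Gamma_le_stab hm γ.2) z, hb.smul, add_right_inj] at h3
    exact (mul_eq_right₀ hz).mp h3

lemma jFun_reduction_transcendental {N : ℕ} (hN : 0 < N) {κ : Type*} [Field κ] {V : Subring ℂ} {r : V →+* κ}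
    (hV : (1728 : ℂ)⁻¹ ∈ V) {x : κ⸨X⸩} (hx : (jFun, x) ∈ relRing V.subtype r N)
    (P : Polynomial κ) (hP : P.eval₂ (laurentC κ) x = 0) : P = 0 := by
  obtain ⟨p, hp, hp0, hpV⟩ := exists_jFun_hasExp
  obtain ⟨p, rfl⟩ := mem_psRing.mpr (hpV V hV)
  have h1 : HasExp N ((PowerSeries.expand N hN.ne' p).map V.subtype) (jFun * qpar N ^ N) := fun z => by
    have hinj : Function.Injective (fun n : ℕ => N * n) := fun a b h => Nat.eq_of_mul_eq_mul_left hN h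
    have h3 : (jFun * qpar N ^ N) z = (jFun * qpar 1) z := by simp [qpar_pow hN]
    rw [h3, ← hinj.hasSum_iff]
    · refine (hp z).congr_fun fun n => ?_
      simp only [Function.comp, coeff_map]
      rw [PowerSeries.coeff_expand_mul, pow_mul, qpar_pow hN]
    · intro n hn
      rw [coeff_map, PowerSeries.coeff_expand_of_not_dvd]
      · simp
      · rintro ⟨c, rfl⟩; exact hn ⟨c, rfl⟩
  have h2 := PowerSeries.coeff_expand_mul N hN.ne' p 0
  rw [mul_zero, show coeff 0 p = 1 from Subtype.ext (by simpa using hp0)] at h2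
  refine transcendental_laurent hN ?_ (relRing_mul_X_pow hN Subtype.coe_injective hx h1) P hP
  rw [coeff_map, h2, map_one]

lemma exists_lift {V : Subring ℂ} {Φ : Polynomial (Polynomial ℂ)} (h : ∀ i k, (Φ.coeff i).coeff k ∈ V) :
    ∃ Ψ : Polynomial (Polynomial V), Ψ.map (Polynomial.mapRingHom V.subtype) = Φ := by
  have h1 : Φ ∈ Polynomial.lifts (Polynomial.mapRingHom V.subtype) := by
    refine (Polynomial.lifts_iff_coeff_lifts _).mpr fun i => ?_
    have h2 : Φ.coeff i ∈ Polynomial.lifts V.subtype :=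
      (Polynomial.lifts_iff_coeff_lifts _).mpr fun k => ⟨⟨_, h i k⟩, rfl⟩
    exact (Polynomial.mem_lifts _).mp h2
  exact (Polynomial.mem_lifts _).mp h1

lemma relRing_ev2 {A κ : Type*} [CommRing A] [Field κ] {ι : A →+* ℂ} {r : A →+* κ} {N : ℕ}
    {u w : ℍ → ℂ} {x y : κ⸨X⸩} (h : (u, x) ∈ relRing ι r N) (h' : (w, y) ∈ relRing ι r N)
    (P : Polynomial (Polynomial A)) :
    ((fun z => ev2 ι (u z) (w z) P), ev2 ((laurentC κ).comp r) x y P) ∈ relRing ι r N := by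
  have := ev2_mem (i := RingHom.prod ((Pi.constRingHom ℍ ℂ).comp ι) ((laurentC κ).comp r)) (x := (u, x))
    (y := (w, y)) (fun a => relRing_const a) h h' P
  convert this using 1
  ext1
  · ext z
    exact (map_ev2
      (RingHom.prod ((Pi.constRingHom ℍ ℂ).comp ι) ((laurentC κ).comp r))
      ((Pi.evalRingHom (fun _ : ℍ => ℂ) z).comp (RingHom.fst _ (κ⸨X⸩))) (u, x) (w, y) P).symm
  · exact (map_ev2
      (RingHom.prod ((Pi.constRingHom ℍ ℂ).comp ι) ((laurentC κ).comp r))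
      (RingHom.snd (ℍ → ℂ) (κ⸨X⸩)) (u, x) (w, y) P).symm

lemma exists_finset_char (hm : 3 ≤ m) {χ : Gamma m →* ℂ} (hχ : ∀ γ, χ γ ^ m = 1) (h1 : χ ≠ 1)
    {b : modGrowth} (hb : IsCharFun hm χ b) :
    ∃ S : Finset ℂ, (1728 : ℂ)⁻¹ ∈ S ∧ (yb hm).1 ∈ defRing (m ^ 2) (finRing S) ∧
      b.1 ∈ defRing (m ^ 2) (finRing S) ∧
      ∀ (κ : Type) [Field κ] (V : Subring ℂ) (r : V →+* κ) (x y : κ⸨X⸩), finRing S ≤ V →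
        (jFun, x) ∈ relRing V.subtype r (m ^ 2) → ((yb hm + b).1, y) ∈ relRing V.subtype r (m ^ 2) →
        ∀ Q : Polynomial (Polynomial κ), Q.natDegree ≤ (stab (yb hm)).index →
          ev2 (laurentC κ) x y Q = 0 → Q = 0 := by
  classical
  have hN : 0 < m ^ 2 := by positivity
  have := finiteIndex_ker hm χ hχ
  have hfi : (stab (yb hm + b)).FiniteIndex := Subgroup.finiteIndex_of_le (ker_le_stab hm hb)
  have := Fintype.ofFinite (SL(2, ℤ) ⧸ stab (yb hm + b))
  obtain ⟨Φ, hΦd, hΦ1, hΦ⟩ := exists_norm_poly (stab (yb hm + b)) 1 (yb hm + b)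
    (fun δ _ => map_one _) (fun δ hδ => hδ)
  obtain ⟨T, hTc, hT⟩ := exists_translates (yb hm + b)
  have hlt := Subgroup.index_strictAnti (stab_lt hm h1 hb)
  have hper : ∀ u : modGrowth, u = yb hm ∨ u = b → ∀ z, u.1 (ModularGroup.T ^ (m ^ 2) • z) = u.1 z := by
    rintro u (rfl | rfl)
    · exact T_sq_periodic (χ := (1 : Gamma m →* ℂ)) (by simp) fun γ z => by
        rw [MonoidHom.one_apply, one_mul]; exact baseFun_smul (by omega) γ z
    · exact T_sq_periodic hχ hb.smul
  obtain ⟨S1, hS1⟩ := exists_finset_defRing hN (stab (yb hm)) (yb hm) (fun _ h => h) (hper _ (Or.inl rfl))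
  have : (stab b).FiniteIndex := Subgroup.finiteIndex_of_le (H := χ.ker.map (Gamma m).subtype) (by
    rintro _ ⟨γ, hγ, rfl⟩
    refine mem_stab'.mpr fun z => ?_
    have h2 := hb.smul γ z
    rwa [MonoidHom.mem_ker.mp hγ, one_mul] at h2)
  obtain ⟨S2, hS2⟩ := exists_finset_defRing hN (stab b) b (fun _ h => h) (hper _ (Or.inr rfl))
  set S3 : Finset ℂ := insert (1728 : ℂ)⁻¹ (S1 ∪ S2)
  have hy3 : (yb hm).1 ∈ defRing (m ^ 2) (finRing S3) :=
    defRing_mono (finRing_mono (subset_union_left.trans (subset_insert _ _))) hS1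
  have hb3 : b.1 ∈ defRing (m ^ 2) (finRing S3) :=
    defRing_mono (finRing_mono (subset_union_right.trans (subset_insert _ _))) hS2
  set K := (range (Φ.natDegree + 1)).sup fun i => (Φ.coeff i).natDegree
  obtain ⟨S4, hS4, hrel⟩ := exists_finset_no_relation hN (yb hm + b) S3 (mem_insert_self _ _)
    (add_mem hy3 hb3) (stab (yb hm)).index K
    (no_relation_of_translates (yb hm + b) T (by rwa [hTc]) hT)
  set S5 := S4 ∪ (range (Φ.natDegree + 1)).biUnion fun i => (Φ.coeff i).coeffs
  have h45 : S3 ⊆ S5 := hS4.trans subset_union_left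
  refine ⟨S5, h45 (mem_insert_self _ _), defRing_mono (finRing_mono h45) hy3,
    defRing_mono (finRing_mono h45) hb3, fun κ _ V r x y hV hx hy Q hQd hQ => ?_⟩
  by_contra hQ0
  have h1728 : (1728 : ℂ)⁻¹ ∈ V := hV (mem_finRing (h45 (mem_insert_self _ _)))
  have hΦV : ∀ i k, (Φ.coeff i).coeff k ∈ V := fun i k => by
    by_cases hi : i ∈ range (Φ.natDegree + 1)
    · by_cases h : (Φ.coeff i).coeff k = 0
      · rw [h]; exact zero_mem _
      · exact hV (mem_finRing (mem_union_right _ (mem_biUnion.mpr ⟨i, hi, Polynomial.coeff_mem_coeffs h⟩)))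
    · rw [Polynomial.coeff_eq_zero_of_natDegree_lt (n := i) (by simpa [Nat.lt_succ_iff] using hi)]
      exact zero_mem _
  have hΦm : Φ.Monic := by
    have h2 : Φ.coeff (stab (yb hm + b)).index = 1 := by
      rw [← sub_eq_zero]
      refine jFun_transcendental _ fun z => ?_
      rw [Polynomial.eval_sub, hΦ1]; simp
    exact Polynomial.monic_of_natDegree_le_of_coeff_eq_one _ hΦd h2
  obtain ⟨Ψ, hΨ⟩ := exists_lift hΦV
  have hinj : Function.Injective (Polynomial.mapRingHom V.subtype) :=
    Polynomial.map_injective _ Subtype.coe_injective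
  have hΨm : Ψ.Monic := Polynomial.monic_of_injective hinj (hΨ ▸ hΦm)
  have hΨ0 : ev2 ((laurentC κ).comp r) x y Ψ = 0 := by
    refine relRing_zero (ι := V.subtype) (r := r) hN Subtype.coe_injective ?_
    convert relRing_ev2 hx hy Ψ using 2
    ext z
    rw [← RingHom.id_comp V.subtype, ← ev2_map, hΨ, ev2_eq_sum _ _ _ hΦd, Pi.zero_apply, ← hΦ z]
    refine sum_congr rfl fun i _ => ?_
    simp [Polynomial.eval₂_id]
  have hK : ∀ k, ((Ψ.map (Polynomial.mapRingHom r)).coeff k).natDegree ≤ K := fun k => by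
    rw [Polynomial.coeff_map]
    refine Polynomial.natDegree_map_le.trans ?_
    rw [← Polynomial.natDegree_map_eq_of_injective (f := V.subtype) Subtype.coe_injective (Ψ.coeff k),
      ← Polynomial.coe_mapRingHom, ← Polynomial.coeff_map, hΨ]
    by_cases hi : k ∈ range (Φ.natDegree + 1)
    · exact le_sup (f := fun i => (Φ.coeff i).natDegree) hi
    · rw [Polynomial.coeff_eq_zero_of_natDegree_lt (n := k) (by simpa [Nat.lt_succ_iff] using hi)]; simp
  obtain ⟨P, hP0, hPD, hPK, hP⟩ := exists_small_relation (jFun_reduction_transcendental hN h1728 hx)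
    (hΨm.map (Polynomial.mapRingHom r)) hK (by rw [ev2_map, hΨ0]) hQ0 hQd hQ
  exact hP0 (hrel κ V r x y ((finRing_mono subset_union_left).trans hV) hx hy P hPD hPK hP)

end MacMahon

namespace MacMahon
open scoped MatrixGroups Manifold UpperHalfPlane
open UpperHalfPlane PowerSeries LaurentSeries CongruenceSubgroup

variable {m ℓ : ℕ} [Fact ℓ.Prime]

/-- Representatives of the integer matrices of determinant `ℓ`, all congruent to `diag(1, -1)`
modulo `m` when `ℓ ≡ -1`. -/
def hecMat (m ℓ : ℕ) : Option (ZMod ℓ) → Matrix (Fin 2) (Fin 2) ℤ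
  | none => !![-ℓ, 0; 0, -1]
  | some j => !![1, m ^ 2 * j.val; 0, ℓ]

omit [Fact ℓ.Prime] in
lemma det_hecMat (i : Option (ZMod ℓ)) : (hecMat m ℓ i).det = ℓ := by
  cases i <;> simp [hecMat, Matrix.det_fin_two_of]

lemma exists_hecMat (hm : (m : ZMod ℓ) ≠ 0) (B : Matrix (Fin 2) (Fin 2) ℤ) (hB : B.det = ℓ) :
    ∃ (i : Option (ZMod ℓ)) (δ : SL(2, ℤ)), B = δ * hecMat m ℓ i := by
  have hℓ : (ℓ : ℤ) ≠ 0 := by exact_mod_cast (Fact.out : ℓ.Prime).ne_zero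
  suffices h : ∃ i, ∀ r : Fin 2, (ℓ : ℤ) ∣ (B * (hecMat m ℓ i).adjugate) r 0 ∧
      (ℓ : ℤ) ∣ (B * (hecMat m ℓ i).adjugate) r 1 by
    obtain ⟨i, h⟩ := h
    choose u v using h
    choose u hu using u
    choose v hv using v
    set D : Matrix (Fin 2) (Fin 2) ℤ := !![u 0, v 0; u 1, v 1]
    have hD : B * (hecMat m ℓ i).adjugate = (ℓ : ℤ) • D := by
      ext r c
      fin_cases r <;> fin_cases c <;> simp [D, hu, hv]
    have h2 : B = D * hecMat m ℓ i := by
      have := congrArg (· * hecMat m ℓ i) hD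
      simp only [Matrix.mul_assoc, Matrix.adjugate_mul, det_hecMat, Matrix.smul_mul, Matrix.mul_smul,
        Matrix.mul_one] at this
      exact smul_right_injective _ hℓ this
    have h3 : D.det = 1 := by
      have := congrArg Matrix.det h2
      rw [Matrix.det_mul, hB, det_hecMat] at this
      exact mul_right_cancel₀ hℓ (by rw [← this, one_mul])
    exact ⟨i, ⟨D, h3⟩, h2⟩
  have hB' : (B 0 0 : ZMod ℓ) * B 1 1 = B 0 1 * B 1 0 := by
    have := congrArg (Int.cast : ℤ → ZMod ℓ) hB
    rw [Matrix.det_fin_two] at this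
    push_cast at this
    rw [← sub_eq_zero, this, ZMod.natCast_self]
  simp only [← ZMod.intCast_zmod_eq_zero_iff_dvd]
  by_cases h0 : (B 0 0 : ZMod ℓ) = 0
  · by_cases h1 : (B 1 0 : ZMod ℓ) = 0
    · refine ⟨none, fun r => ?_⟩
      fin_cases r <;> simp [hecMat, Matrix.mul_apply, Matrix.adjugate_fin_two_of, h0, h1]
    · refine ⟨some (B 1 1 / (m ^ 2 * B 1 0)), fun r => ?_⟩
      have : (B 0 1 : ZMod ℓ) = 0 := by
        rw [h0, zero_mul, eq_comm] at hB'
        exact (mul_eq_zero.mp hB').resolve_right h1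
      fin_cases r <;> simp [hecMat, Matrix.mul_apply, Matrix.adjugate_fin_two_of, h0, this]
      field_simp
      ring
  · refine ⟨some (B 0 1 / (m ^ 2 * B 0 0)), fun r => ?_⟩
    fin_cases r <;> simp [hecMat, Matrix.mul_apply, Matrix.adjugate_fin_two_of] <;> field_simp
    · ring
    · linear_combination hB'

lemma hecMat_unique (hm : (m : ZMod ℓ) ≠ 0) {i k : Option (ZMod ℓ)} {δ : SL(2, ℤ)}
    (h : hecMat m ℓ i = δ * hecMat m ℓ k) : i = k := by
  have h00 := congrFun (congrFun h 0) 0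
  have h01 := congrFun (congrFun h 0) 1
  have h10 := congrFun (congrFun h 1) 0
  have h11 := congrFun (congrFun h 1) 1
  rcases i with _ | i <;> rcases k with _ | k
  · rfl
  all_goals
    simp only [hecMat, Matrix.mul_apply, Fin.sum_univ_two] at h00 h01 h10 h11
    replace h00 := congrArg (Int.cast : ℤ → ZMod ℓ) h00
    replace h01 := congrArg (Int.cast : ℤ → ZMod ℓ) h01
    replace h10 := congrArg (Int.cast : ℤ → ZMod ℓ) h10
    replace h11 := congrArg (Int.cast : ℤ → ZMod ℓ) h11
  · simp at h10 h11
    simp [← h10] at h11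
  · simp at h00
  · simp at h00 h01
    rw [← h00, one_mul] at h01
    rw [mul_left_cancel₀ (pow_ne_zero 2 hm) h01]

lemma exists_hecRep (hm : (m : ZMod ℓ) ≠ 0) (γ : SL(2, ℤ)) (i : Option (ZMod ℓ)) :
    ∃ p : Option (ZMod ℓ) × SL(2, ℤ), hecMat m ℓ i * γ = p.2 * hecMat m ℓ p.1 := by
  obtain ⟨k, δ, h⟩ := exists_hecMat hm (hecMat m ℓ i * γ) (by rw [Matrix.det_mul, det_hecMat, γ.2, mul_one])
  exact ⟨(k, δ), h⟩

/-- The permutation of the representatives induced by right multiplication. -/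
noncomputable def hecIdx (hm : (m : ZMod ℓ) ≠ 0) (γ : SL(2, ℤ)) (i : Option (ZMod ℓ)) : Option (ZMod ℓ) :=
  (exists_hecRep hm γ i).choose.1

/-- The cocycle of right multiplication on the representatives. -/
noncomputable def hecRep (hm : (m : ZMod ℓ) ≠ 0) (γ : SL(2, ℤ)) (i : Option (ZMod ℓ)) : SL(2, ℤ) :=
  (exists_hecRep hm γ i).choose.2

lemma hecRep_spec (hm : (m : ZMod ℓ) ≠ 0) (γ : SL(2, ℤ)) (i : Option (ZMod ℓ)) :
    hecMat m ℓ i * γ = hecRep hm γ i * hecMat m ℓ (hecIdx hm γ i) :=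
  (exists_hecRep hm γ i).choose_spec

lemma hecMat_cancel {A B : Matrix (Fin 2) (Fin 2) ℤ} {k : Option (ZMod ℓ)}
    (h : A * hecMat m ℓ k = B * hecMat m ℓ k) : A = B := by
  have hℓ : (ℓ : ℤ) ≠ 0 := by exact_mod_cast (Fact.out : ℓ.Prime).ne_zero
  have := congrArg (· * (hecMat m ℓ k).adjugate) h
  simp only [Matrix.mul_assoc, Matrix.mul_adjugate, det_hecMat, Matrix.mul_smul, Matrix.mul_one] at this
  exact smul_right_injective _ hℓ this

lemma hecIdx_bijective (hm : (m : ZMod ℓ) ≠ 0) (γ : SL(2, ℤ)) : Function.Bijective (hecIdx hm γ) := by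
  refine (Finite.injective_iff_bijective).mp fun i k h => ?_
  refine hecMat_unique hm (δ := (hecRep hm γ i * (hecRep hm γ k)⁻¹ : SL(2, ℤ))) ?_
  have h1 := hecRep_spec hm γ i
  have h2 := hecRep_spec hm γ k
  rw [← h] at h2
  have h3 : hecMat m ℓ i * γ = ((hecRep hm γ i * (hecRep hm γ k)⁻¹ : SL(2, ℤ)) : Matrix (Fin 2) (Fin 2) ℤ) * hecMat m ℓ k * γ := by
    rw [Matrix.mul_assoc, h2, h1, ← Matrix.mul_assoc, ← Matrix.SpecialLinearGroup.coe_mul,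
      inv_mul_cancel_right]
  have := congrArg (· * ((γ⁻¹ : SL(2, ℤ)) : Matrix (Fin 2) (Fin 2) ℤ)) h3
  rwa [Matrix.mul_assoc, Matrix.mul_assoc, ← Matrix.SpecialLinearGroup.coe_mul, mul_inv_cancel,
    Matrix.SpecialLinearGroup.coe_one, Matrix.mul_one, Matrix.mul_one] at this

lemma hecRep_unique (hm : (m : ZMod ℓ) ≠ 0) {γ δ : SL(2, ℤ)} {i k : Option (ZMod ℓ)}
    (h : hecMat m ℓ i * γ = δ * hecMat m ℓ k) : hecIdx hm γ i = k ∧ hecRep hm γ i = δ := by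
  have h1 := hecRep_spec hm γ i
  rw [h] at h1
  have h2 : k = hecIdx hm γ i := hecMat_unique hm (δ := δ⁻¹ * hecRep hm γ i) (by
    rw [Matrix.SpecialLinearGroup.coe_mul, Matrix.mul_assoc, ← h1, ← Matrix.mul_assoc,
      ← Matrix.SpecialLinearGroup.coe_mul, inv_mul_cancel, Matrix.SpecialLinearGroup.coe_one, Matrix.one_mul])
  refine ⟨h2.symm, ?_⟩
  rw [← h2] at h1
  exact (Subtype.ext (hecMat_cancel h1)).symm

lemma hecRep_mul (hm : (m : ZMod ℓ) ≠ 0) (γ δ : SL(2, ℤ)) (i : Option (ZMod ℓ)) :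
    hecIdx hm (γ * δ) i = hecIdx hm δ (hecIdx hm γ i) ∧
      hecRep hm (γ * δ) i = hecRep hm γ i * hecRep hm δ (hecIdx hm γ i) := by
  refine hecRep_unique hm ?_
  rw [Matrix.SpecialLinearGroup.coe_mul, ← Matrix.mul_assoc, hecRep_spec, Matrix.mul_assoc, hecRep_spec,
    ← Matrix.mul_assoc, ← Matrix.SpecialLinearGroup.coe_mul]

omit [Fact ℓ.Prime] in
lemma hecMat_mod (hℓ : (ℓ : ZMod m) = -1) (i : Option (ZMod ℓ)) :
    (hecMat m ℓ i).map (Int.cast : ℤ → ZMod m) = !![1, 0; 0, -1] := by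
  ext r c
  cases i <;> fin_cases r <;> fin_cases c <;> simp [hecMat, hℓ]

lemma hecRep_mod (hm : (m : ZMod ℓ) ≠ 0) (hℓ : (ℓ : ZMod m) = -1) (γ : SL(2, ℤ)) (i : Option (ZMod ℓ)) :
    (hecRep hm γ i : Matrix _ _ ℤ).map (Int.cast : ℤ → ZMod m) =
      !![1, 0; 0, -1] * (γ : Matrix _ _ ℤ).map (Int.cast : ℤ → ZMod m) * !![1, 0; 0, -1] := by
  have h := congrArg (Int.castRingHom (ZMod m)).mapMatrix (hecRep_spec hm γ i)
  rw [map_mul, map_mul] at h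
  simp only [RingHom.mapMatrix_apply, Int.coe_castRingHom, hecMat_mod hℓ] at h
  rw [h, Matrix.mul_assoc, Matrix.mul_fin_two]
  simp [← Matrix.one_fin_two]

lemma hecRep_mem_Gamma (hm : (m : ZMod ℓ) ≠ 0) (hℓ : (ℓ : ZMod m) = -1) {γ : SL(2, ℤ)} (hγ : γ ∈ Gamma m)
    (i : Option (ZMod ℓ)) : hecRep hm γ i ∈ Gamma m := by
  have h := hecRep_mod hm hℓ γ i
  rw [Gamma_mem] at hγ ⊢
  obtain ⟨h1, h2, h3, h4⟩ := hγ
  have e := fun r c => congrFun (congrFun h r) c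
  simp only [Matrix.mul_apply, Fin.sum_univ_two, Matrix.map_apply] at e
  refine ⟨(e 0 0).trans ?_, (e 0 1).trans ?_, (e 1 0).trans ?_, (e 1 1).trans ?_⟩ <;>
    simp [h1, h2, h3, h4]

/-- The representatives as real matrices. -/
noncomputable def hecGL (m : ℕ) (i : Option (ZMod ℓ)) : GL (Fin 2) ℝ :=
  Matrix.GeneralLinearGroup.mkOfDetNeZero ((Int.castRingHom ℝ).mapMatrix (hecMat m ℓ i)) (by
    rw [← RingHom.map_det, det_hecMat]
    simp [(Fact.out : ℓ.Prime).ne_zero])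

/-- The action of the representatives on the upper half plane. -/
noncomputable def hecAct (m : ℕ) (i : Option (ZMod ℓ)) (z : ℍ) : ℍ := hecGL m i • z

lemma det_hecGL_pos (i : Option (ZMod ℓ)) : 0 < (hecGL m i).det.val := by
  change 0 < ((Int.castRingHom ℝ).mapMatrix (hecMat m ℓ i)).det
  rw [← RingHom.map_det, det_hecMat]
  simp [(Fact.out : ℓ.Prime).pos]

lemma hecAct_smul (hm : (m : ZMod ℓ) ≠ 0) (γ : SL(2, ℤ)) (i : Option (ZMod ℓ)) (z : ℍ) :
    hecAct m i (γ • z) = hecRep hm γ i • hecAct m (hecIdx hm γ i) z := by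
  have h : hecGL m i * Matrix.SpecialLinearGroup.mapGL ℝ γ =
      Matrix.SpecialLinearGroup.mapGL ℝ (hecRep hm γ i) * hecGL m (hecIdx hm γ i) := by
    refine Units.ext ?_
    have h := congrArg (Int.castRingHom ℝ).mapMatrix (hecRep_spec hm γ i)
    rw [map_mul, map_mul] at h
    exact h
  change hecGL m i • Matrix.SpecialLinearGroup.mapGL ℝ γ • z =
    Matrix.SpecialLinearGroup.mapGL ℝ (hecRep hm γ i) • hecGL m (hecIdx hm γ i) • z
  rw [← mul_smul, h, mul_smul]

lemma coe_hecAct_some (j : ZMod ℓ) (z : ℍ) :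
    (hecAct m (some j) z : ℂ) = (z + m ^ 2 * j.val) / ℓ := by
  rw [hecAct, coe_smul_of_det_pos (det_hecGL_pos _), num, denom]
  simp [hecGL, hecMat, Matrix.GeneralLinearGroup.mkOfDetNeZero, -ZMod.natCast_val]

lemma coe_hecAct_none (z : ℍ) : (hecAct m (none : Option (ZMod ℓ)) z : ℂ) = ℓ * z := by
  rw [hecAct, coe_smul_of_det_pos (det_hecGL_pos _), num, denom]
  simp [hecGL, hecMat, Matrix.GeneralLinearGroup.mkOfDetNeZero]

lemma height_hecAct (i : Option (ZMod ℓ)) (z : ℍ) : height (hecAct m i z) ≤ ℓ * height z := by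
  have hℓ : (1 : ℝ) ≤ ℓ := by exact_mod_cast (Fact.out : ℓ.Prime).one_le
  have hz := z.im_pos
  unfold height
  rcases i with _ | j
  · have h : (hecAct m (none : Option (ZMod ℓ)) z).im = ℓ * z.im := by
      rw [← coe_im, coe_hecAct_none]; simp
    rw [h, mul_add]
    gcongr
    calc 1 / (ℓ * z.im) ≤ 1 / (1 * z.im) := by gcongr
      _ ≤ ℓ * (1 / z.im) := by rw [one_mul]; exact le_mul_of_one_le_left (by positivity) hℓ
  · have h : (hecAct m (some j) z).im = z.im / ℓ := by
      have h1 : (m : ℂ) ^ 2 * j.val = ((m ^ 2 * j.val : ℕ) : ℂ) := by push_cast; rfl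
      rw [← coe_im, coe_hecAct_some, h1, Complex.div_natCast_im, Complex.add_im, Complex.natCast_im, add_zero,
        coe_im]
    rw [h, mul_add, one_div_div]
    gcongr ?_ + ?_
    · exact (div_le_self hz.le hℓ).trans (le_mul_of_one_le_left hz.le hℓ)
    · rw [div_eq_mul_one_div]

lemma mdifferentiable_hecAct (i : Option (ZMod ℓ)) : MDiff (hecAct m i) :=
  mdifferentiable_smul (det_hecGL_pos i)

lemma hecAct_mem (hm : (m : ZMod ℓ) ≠ 0) {u : ℍ → ℂ} (hu : u ∈ modGrowth) (i : Option (ZMod ℓ)) :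
    (fun z => u (hecAct m i z)) ∈ modGrowth := by
  obtain ⟨hu, A, C, hA, hC, h⟩ := hu
  refine ⟨hu.comp (mdifferentiable_hecAct i), A, C * ℓ, hA, by positivity, fun δ z => ?_⟩
  beta_reduce
  rw [hecAct_smul hm]
  refine (h _ _).trans ?_
  rw [mul_assoc C]
  gcongr
  exact height_hecAct _ z

lemma qpar_hecAct_some {N : ℕ} (hN : N = m ^ 2) (hm : m ≠ 0) (j : ZMod ℓ) (z : ℍ) :
    qpar N (hecAct m (some j) z) = Complex.exp (2 * Real.pi * Complex.I / ℓ) ^ j.val * qpar (N * ℓ) z ^ 1 := by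
  have hℓ : (ℓ : ℂ) ≠ 0 := by exact_mod_cast (Fact.out : ℓ.Prime).ne_zero
  have hm' : (m : ℂ) ≠ 0 := by exact_mod_cast hm
  subst hN
  rw [pow_one, qpar, qpar, Function.Periodic.qParam, Function.Periodic.qParam, ← Complex.exp_nat_mul,
    ← Complex.exp_add, coe_hecAct_some]
  congr 1
  push_cast
  field_simp
  ring

lemma qpar_hecAct_none {N : ℕ} (z : ℍ) :
    qpar N (hecAct m (none : Option (ZMod ℓ)) z) = qpar (N * ℓ) z ^ (ℓ ^ 2) := by
  have hℓ : (ℓ : ℂ) ≠ 0 := by exact_mod_cast (Fact.out : ℓ.Prime).ne_zero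
  rw [qpar, qpar, Function.Periodic.qParam, Function.Periodic.qParam, ← Complex.exp_nat_mul, coe_hecAct_none]
  congr 1
  push_cast
  field_simp

omit [Fact ℓ.Prime] in
lemma qpar_mul_pow (hℓ : ℓ ≠ 0) {N : ℕ} (z : ℍ) : qpar (N * ℓ) z ^ ℓ = qpar N z := by
  have hℓ : (ℓ : ℂ) ≠ 0 := by exact_mod_cast hℓ
  rw [qpar, qpar, Function.Periodic.qParam, Function.Periodic.qParam, ← Complex.exp_nat_mul]
  congr 1
  push_cast
  field_simp

/-- The action of the representatives on functions of moderate growth. -/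
noncomputable def hecTransl (hm : (m : ZMod ℓ) ≠ 0) (i : Option (ZMod ℓ)) : modGrowth →+* modGrowth where
  toFun u := ⟨fun z => u.1 (hecAct m i z), hecAct_mem hm u.2 i⟩
  map_one' := rfl
  map_mul' _ _ := rfl
  map_zero' := rfl
  map_add' _ _ := rfl

/-- The transfer of a character along the representatives. -/
noncomputable def hecChar (hm : (m : ZMod ℓ) ≠ 0) (hℓ : (ℓ : ZMod m) = -1) {R : Type*} [CommMonoid R]
    (χ : Gamma m →* R) : Gamma m →* R where
  toFun γ := ∏ i, χ ⟨hecRep hm γ i, hecRep_mem_Gamma hm hℓ γ.2 i⟩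
  map_one' := by
    refine prod_eq_one fun i _ => ?_
    have : hecRep hm (1 : SL(2, ℤ)) i = 1 := (hecRep_unique hm (k := i) (by simp)).2
    rw [← map_one χ]
    exact congrArg χ (Subtype.ext this)
  map_mul' γ δ := by
    rw [← (Equiv.ofBijective _ (hecIdx_bijective hm γ.1)).prod_comp
      (fun i => χ ⟨hecRep hm δ i, hecRep_mem_Gamma hm hℓ δ.2 i⟩), ← prod_mul_distrib]
    refine prod_congr rfl fun i _ => ?_
    rw [← map_mul]
    exact congrArg χ (Subtype.ext (hecRep_mul hm γ.1 δ.1 i).2)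

end MacMahon

namespace MacMahon
open scoped MatrixGroups Manifold UpperHalfPlane
open UpperHalfPlane PowerSeries LaurentSeries CongruenceSubgroup

variable {m ℓ : ℕ} [Fact ℓ.Prime]

lemma exists_valuation {A : Subring ℂ} {F : Type*} [Field F] [Finite F] {n : ℕ} (hF : Nat.card F = ℓ ^ n)
    (φ : A →+* F) : ∃ V : ValuationSubring ℂ, ∃ h : A ≤ V.toSubring,
      CharP (IsLocalRing.ResidueField V) ℓ ∧
      ∀ a (ha : a ∈ A), IsLocalRing.residue V ⟨a, h ha⟩ ^ ℓ ^ n = IsLocalRing.residue V ⟨a, h ha⟩ := by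
  have := Fintype.ofFinite F
  obtain ⟨V, hV, h⟩ := (RingHom.ker φ).image_subset_nonunits_valuationSubring (RingHom.ker_ne_top φ)
  have key : ∀ a : A, φ a = 0 → IsLocalRing.residue V ⟨a, hV a.2⟩ = 0 := fun a ha => by
    rw [IsLocalRing.residue_eq_zero_iff]
    have h1 : (a : ℂ) ∈ V.nonunits := h ⟨a, ha, rfl⟩
    exact (V.mem_nonunits_iff_exists_mem_maximalIdeal.mp h1).2
  have hq : ∀ x : F, x ^ ℓ ^ n = x := fun x => by
    rw [← hF, Nat.card_eq_fintype_card]; exact FiniteField.pow_card x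
  have hn : n ≠ 0 := by
    rintro rfl
    have := Finite.one_lt_card (α := F)
    rw [hF, pow_zero] at this
    exact lt_irrefl _ this
  have hℓ : (ℓ : F) = 0 := by
    have := Nat.cast_card_eq_zero F
    rw [← Nat.card_eq_fintype_card, hF, Nat.cast_pow] at this
    exact eq_zero_of_pow_eq_zero this
  refine ⟨V, hV, (CharP.charP_iff_prime_eq_zero Fact.out).mpr ?_, fun a ha => ?_⟩
  · have := key ℓ (by rw [map_natCast, hℓ])
    rw [← this, ← map_natCast (IsLocalRing.residue V)]
    rfl
  · rw [← sub_eq_zero]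
    have := key (⟨a, ha⟩ ^ ℓ ^ n - ⟨a, ha⟩) (by rw [map_sub, map_pow, hq, sub_self])
    rw [← this, ← map_pow, ← map_sub]
    rfl

lemma subst_eq_pow {N : ℕ} (hN : 0 < N) {κ : Type*} [Field κ] [CharP κ ℓ] {A V : Subring ℂ} (hAV : A ≤ V)
    {r : V →+* κ} {n : ℕ} (hr : ∀ a (ha : a ∈ A), r ⟨a, hAV ha⟩ ^ ℓ ^ n = r ⟨a, hAV ha⟩) {u : ℍ → ℂ}
    (hu : u ∈ defRing N A) {x : κ⸨X⸩} (hx : (u, x) ∈ relRing V.subtype r N) :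
    subst κ (ℓ ^ n) (pow_ne_zero n (Fact.out : ℓ.Prime).ne_zero) x = x ^ ℓ ^ n := by
  have hℓ := (Fact.out : ℓ.Prime).ne_zero
  have : ExpChar κ ℓ := ExpChar.prime Fact.out
  obtain ⟨k, p, hp, h⟩ := mem_defRing.mp hu
  obtain ⟨p', hp'⟩ := psRing_mono hAV hp
  rw [← hp'] at h
  have h1 := relRing_mul_X_pow hN Subtype.coe_injective hx h
  have h2 : (p'.map r) ^ ℓ ^ n = PowerSeries.expand (ℓ ^ n) (pow_ne_zero n hℓ) (p'.map r) := by
    have h3 : (PowerSeries.expand (ℓ ^ n) (pow_ne_zero n hℓ) (p'.map r)).map (iterateFrobenius κ ℓ n) =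
      (p'.map r) ^ ℓ ^ n := MvPowerSeries.map_iterateFrobenius_expand ℓ hℓ (p'.map r) n
    rw [← h3, PowerSeries.map_expand]
    congr 1
    ext i
    have h4 : ((coeff i p' : V) : ℂ) ∈ A := by
      have h5 := mem_psRing.mp hp i
      rwa [← hp', coeff_map] at h5
    rw [coeff_map, coeff_map, iterateFrobenius_def]
    exact hr _ h4
  have h3 := congrArg (subst κ (ℓ ^ n) (pow_ne_zero n hℓ)) h1
  have h4 := congrArg (· ^ ℓ ^ n) h1
  simp only [mul_pow, ← map_pow, h2] at h4
  rw [map_mul, subst_algebraMap, subst_algebraMap, map_pow, PowerSeries.expand_X, ← h4, ← pow_mul, ← pow_mul,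
    mul_comm k] at h3
  exact mul_right_cancel₀ (algebraMap_X_pow_ne_zero _) h3

lemma zeta_mem (V : ValuationSubring ℂ) {z : ℂ} {n : ℕ} (hn : n ≠ 0) (hz : z ^ n = 1) : z ∈ V := by
  rcases V.mem_or_inv_mem z with h | h
  · exact h
  · have h1 : z = z⁻¹ ^ (n - 1) := by
      have hz0 : z ≠ 0 := by rintro rfl; simp [hn] at hz
      rw [inv_pow, ← mul_eq_one_iff_eq_inv₀ (pow_ne_zero _ hz0), ← pow_succ', Nat.sub_add_cancel (by omega), hz]
    rw [h1]
    exact pow_mem h _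

lemma exists_scale (V : ValuationSubring ℂ) {Q : Polynomial (Polynomial ℂ)} (hQ : Q ≠ 0) :
    ∃ (c : ℂ) (Ψ : Polynomial (Polynomial V)), c ≠ 0 ∧
      Ψ.map (Polynomial.mapRingHom V.subtype) = Polynomial.C (Polynomial.C c) * Q ∧
      Ψ.map (Polynomial.mapRingHom (IsLocalRing.residue V)) ≠ 0 := by
  classical
  set s := Q.support.sigma fun i => (Q.coeff i).support
  have hs : s.Nonempty := by
    obtain ⟨i, hi⟩ := Polynomial.support_nonempty.mpr hQ
    obtain ⟨k, hk⟩ := Polynomial.support_nonempty.mpr (Polynomial.mem_support_iff.mp hi)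
    exact ⟨⟨i, k⟩, mem_sigma.mpr ⟨hi, hk⟩⟩
  obtain ⟨⟨i, k⟩, hik, hmax⟩ := s.exists_max_image (fun p => V.valuation ((Q.coeff p.1).coeff p.2)) hs
  set c := (Q.coeff i).coeff k with hc
  have hc0 : c ≠ 0 := Polynomial.mem_support_iff.mp (mem_sigma.mp hik).2
  have hco : ∀ a b, ((Polynomial.C (Polynomial.C c⁻¹) * Q).coeff a).coeff b = c⁻¹ * (Q.coeff a).coeff b := by
    simp
  have hV : ∀ a b, ((Polynomial.C (Polynomial.C c⁻¹) * Q).coeff a).coeff b ∈ V.toSubring := fun a b => by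
    rw [hco]
    by_cases h0 : (Q.coeff a).coeff b = 0
    · rw [h0, mul_zero]; exact zero_mem _
    · have h1 := hmax ⟨a, b⟩ (mem_sigma.mpr ⟨Polynomial.mem_support_iff.mpr fun h => h0 (by simp [h]),
        Polynomial.mem_support_iff.mpr h0⟩)
      refine (V.valuation_le_one_iff _).mp ?_
      rw [map_mul, map_inv₀]
      calc _ ≤ (V.valuation c)⁻¹ * V.valuation c := by gcongr
        _ = 1 := inv_mul_cancel₀ ((Valuation.ne_zero_iff _).mpr hc0)
  obtain ⟨Ψ, hΨ⟩ := exists_lift hV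
  refine ⟨c⁻¹, Ψ, inv_ne_zero hc0, hΨ, fun h => ?_⟩
  have h1 : (((Ψ.coeff i).coeff k : V) : ℂ) = 1 := by
    have := hco i k
    rw [← hΨ, ← hc, inv_mul_cancel₀ hc0] at this
    simpa using this
  have h2 := congrArg (fun P => (P.coeff i).coeff k) h
  simp only [Polynomial.coeff_map, Polynomial.coe_mapRingHom, Polynomial.coeff_zero] at h2
  rw [show (Ψ.coeff i).coeff k = 1 from Subtype.ext h1, map_one] at h2
  exact one_ne_zero h2


lemma subst_one {κ : Type*} [Field κ] (x : κ⸨X⸩) : subst κ 1 one_ne_zero x = x := by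
  have : subst κ 1 one_ne_zero = RingHom.id _ := IsFractionRing.ringHom_ext (A := κ⟦X⟧) fun p => by
    rw [subst_algebraMap, PowerSeries.expand_one_apply, RingHom.id_apply]
  rw [this, RingHom.id_apply]

lemma subst_comp_laurentC {κ : Type*} [Field κ] (e : ℕ) (he : e ≠ 0) :
    (subst κ e he).comp (laurentC κ) = laurentC κ := by
  ext1 c
  exact (subst_algebraMap e he _).trans (by rw [PowerSeries.expand_C]; rfl)

lemma hecTransl_relRing (hm : m ≠ 0) {A κ : Type*} [CommRing A] [Field κ] {ι : A →+* ℂ} {r : A →+* κ} {ζ : A}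
    (hζ : ι ζ = Complex.exp (2 * Real.pi * Complex.I / ℓ)) (hζ1 : ζ ^ ℓ = 1) (hr : r ζ = 1) {u : ℍ → ℂ} {x : κ⸨X⸩}
    (h : (u, x) ∈ relRing ι r (m ^ 2)) :
    (∀ j : ZMod ℓ, (fun z => u (hecAct m (some j) z), x) ∈ relRing ι r (m ^ 2 * ℓ)) ∧
    (fun z => u (hecAct m (none : Option (ZMod ℓ)) z),
      subst κ (ℓ ^ 2) (pow_ne_zero 2 (Fact.out : ℓ.Prime).ne_zero) x) ∈ relRing ι r (m ^ 2 * ℓ) ∧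
    (u, subst κ ℓ (Fact.out : ℓ.Prime).ne_zero x) ∈ relRing ι r (m ^ 2 * ℓ) := by
  have hℓ := (Fact.out : ℓ.Prime).pos
  refine ⟨fun j => ?_, ?_, ?_⟩
  · have := relRing_subst (M := m ^ 2 * ℓ) (e := 1) one_ne_zero (α := hecAct m (some j)) (ζ := ζ ^ j.val)
      (ζ' := (ζ ^ (ℓ - 1)) ^ j.val) ?_ (by rw [map_pow, hr, one_pow])
      (fun z => by rw [qpar_hecAct_some rfl hm, map_pow, hζ]) h
    · rwa [subst_one] at this
    · rw [← mul_pow, ← pow_succ', Nat.sub_add_cancel hℓ, hζ1, one_pow]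
  · exact relRing_subst (ζ := 1) (ζ' := 1) _ (by simp) (by simp)
      (fun z => by rw [qpar_hecAct_none, map_one, one_mul]) h
  · exact relRing_subst (α := id) (ζ := 1) (ζ' := 1) _ (by simp) (by simp)
      (fun z => by rw [qpar_mul_pow hℓ.ne', map_one, one_mul]; rfl) h

lemma exists_reduced_relation (hm : 3 ≤ m) (hm0 : (m : ZMod ℓ) ≠ 0) (hℓ : (ℓ : ZMod m) = -1) {χ : Gamma m →* ℂ}
    (hχ : ∀ γ, χ γ ^ m = 1) {G b : modGrowth} (hG : IsCharFun hm χ G) (hb : IsCharFun hm (hecChar hm0 hℓ χ) b)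
    {A : Subring ℂ} (hGA : G.1 ∈ defRing (m ^ 2) A) (hbA : b.1 ∈ defRing (m ^ 2) A)
    (hyA : (yb hm).1 ∈ defRing (m ^ 2) A) (h1728 : (1728 : ℂ)⁻¹ ∈ A)
    {κ : Type*} [Field κ] [CharP κ ℓ] {V : Subring ℂ} {r : V →+* κ} (hAV : A ≤ V)
    (hr : ∀ a (ha : a ∈ A), r ⟨a, hAV ha⟩ ^ ℓ ^ 2 = r ⟨a, hAV ha⟩)
    (hV : ∀ z : ℂ, z ^ ℓ = 1 → z ∈ V)
    (hsc : ∀ Q : Polynomial (Polynomial ℂ), Q ≠ 0 → ∃ (c : ℂ) (Ψ : Polynomial (Polynomial V)), c ≠ 0 ∧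
      Ψ.map (Polynomial.mapRingHom V.subtype) = Polynomial.C (Polynomial.C c) * Q ∧
      Ψ.map (Polynomial.mapRingHom r) ≠ 0)
    (hG0 : (G.1, 0) ∉ relRing V.subtype r (m ^ 2)) :
    ∃ x y : κ⸨X⸩, (jFun, x) ∈ relRing V.subtype r (m ^ 2) ∧
      ((yb hm + b).1, y) ∈ relRing V.subtype r (m ^ 2) ∧
      ∃ Q : Polynomial (Polynomial κ), Q.natDegree ≤ (stab (yb hm)).index ∧
        ev2 (laurentC _) x y Q = 0 ∧ Q ≠ 0 := by
  classical
  have hm' : m ≠ 0 := by omega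
  have hN : 0 < m ^ 2 := by positivity
  have hp : ℓ ≠ 0 := (Fact.out : ℓ.Prime).ne_zero
  have hNℓ : 0 < m ^ 2 * ℓ := Nat.mul_pos hN (Nat.pos_of_ne_zero hp)
  have hℓκ : ((ℓ : ℕ) : κ⸨X⸩) = 0 := by
    rw [← map_natCast (laurentC κ), CharP.cast_eq_zero, map_zero]
  have hζ0 : Complex.exp (2 * Real.pi * Complex.I / ℓ) ^ ℓ = 1 := by
    rw [← Complex.exp_nat_mul, mul_div_cancel₀ _ (Nat.cast_ne_zero.mpr hp), Complex.exp_two_pi_mul_I]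
  set ζ : V := ⟨_, hV _ hζ0⟩ with hζ
  have hζ1 : ζ ^ ℓ = 1 := Subtype.ext hζ0
  have hrζ : r ζ = 1 := by
    have : ExpChar κ ℓ := ExpChar.prime Fact.out
    refine frobenius_inj κ ℓ ?_
    rw [frobenius_def, frobenius_def, one_pow, ← map_pow, hζ1, map_one]
  obtain ⟨xG, hxG⟩ := exists_relRing hAV r hGA
  obtain ⟨xb, hxb⟩ := exists_relRing hAV r hbA
  obtain ⟨xy, hxy⟩ := exists_relRing hAV r hyA
  obtain ⟨xj, hxj⟩ := exists_relRing hAV r (jFun_mem_defRing hN h1728)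
  have hxG0 : xG ≠ 0 := by rintro rfl; exact hG0 hxG
  obtain ⟨hGs, hGn, -⟩ := hecTransl_relRing hm' (ι := V.subtype) (r := r) (ζ := ζ) rfl hζ1 hrζ hxG
  rw [subst_eq_pow hN hAV hr hGA hxG] at hGn
  obtain ⟨-, -, hb'⟩ := hecTransl_relRing hm' (ι := V.subtype) (r := r) (ζ := ζ) rfl hζ1 hrζ hxb
  obtain ⟨-, -, hy'⟩ := hecTransl_relRing hm' (ι := V.subtype) (r := r) (ζ := ζ) rfl hζ1 hrζ hxy
  obtain ⟨-, -, hj'⟩ := hecTransl_relRing hm' (ι := V.subtype) (r := r) (ζ := ζ) rfl hζ1 hrζ hxj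
  set R : Subring (modGrowth × κ⸨X⸩) := (relRing V.subtype r (m ^ 2 * ℓ)).comap
    (RingHom.prodMap (modGrowth.val : modGrowth →+* (ℍ → ℂ)) (RingHom.id _)) with hR
  set xi : Option (ZMod ℓ) → κ⸨X⸩ := fun i => i.elim (xG ^ ℓ ^ 2) fun _ => xG
  have hi : ∀ i, (hecTransl hm0 i G, xi i) ∈ R := fun i => by
    cases i
    · exact hGn
    · exact hGs _
  obtain ⟨e, he⟩ : m ∣ ℓ + 1 := by
    rw [← ZMod.natCast_eq_zero_iff, Nat.cast_add, hℓ]; simp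
  set TG : modGrowth := ∏ i, hecTransl hm0 i G
  set v : modGrowth := ∑ i, hecTransl hm0 i G ^ m
  set a := v ^ e
  set w := a * yb hm + TG ^ ℓ * b
  set xa := xG ^ (ℓ ^ 2 * (ℓ + 1))
  have hxa : xa ≠ 0 := pow_ne_zero _ hxG0
  have hTGR : (TG, xG ^ (ℓ ^ 2 + ℓ)) ∈ R := by
    have := prod_mem fun i (_ : i ∈ univ) => hi i
    convert this using 1
    refine Prod.ext (by rw [Prod.fst_prod]) ?_
    rw [Prod.snd_prod, Fintype.prod_option]
    simp [xi, pow_add, ZMod.card]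
  have haR : (a, xa) ∈ R := by
    have := pow_mem (sum_mem fun i (_ : i ∈ univ) => pow_mem (hi i) m) e
    convert this using 1
    refine Prod.ext ?_ ?_
    · rw [Prod.pow_fst, Prod.fst_sum]; rfl
    · rw [Prod.pow_snd, Prod.snd_sum, Fintype.sum_option]
      simp only [xi, Prod.pow_snd, Option.elim, sum_const, card_univ, ZMod.card, nsmul_eq_mul, hℓκ, zero_mul,
        add_zero, ← pow_mul, xa, he, mul_assoc]
  have hwR : (w, xa * subst κ ℓ hp (xy + xb)) ∈ R := by
    have := add_mem (mul_mem haR (show (yb hm, _) ∈ R from hy')) (mul_mem (pow_mem hTGR ℓ) (show (b, _) ∈ R from hb'))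
    convert this using 1
    refine Prod.ext rfl ?_
    simp only [Prod.snd_add, Prod.snd_mul, Prod.pow_snd, map_add, mul_add, ← pow_mul, xa]
    congr 3
    ring
  have hψ : ∀ γ, hecChar hm0 hℓ χ γ ^ m = 1 := fun γ => by
    rw [hecChar, MonoidHom.coe_mk, OneHom.coe_mk, ← prod_pow]
    exact prod_eq_one fun i _ => hχ _
  have hGi : ∀ (γ : Gamma m) z i, (hecTransl hm0 i G).1 ((γ : SL(2, ℤ)) • z) =
      χ ⟨hecRep hm0 γ i, hecRep_mem_Gamma hm0 hℓ γ.2 i⟩ * (hecTransl hm0 (hecIdx hm0 γ i) G).1 z := fun γ z i => by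
    refine Eq.trans ?_ (hG.smul ⟨hecRep hm0 γ i, hecRep_mem_Gamma hm0 hℓ γ.2 i⟩ (hecAct m (hecIdx hm0 γ i) z))
    exact congrArg G.1 (hecAct_smul hm0 _ _ _)
  have hTGi : ∀ (γ : Gamma m) z, TG.1 ((γ : SL(2, ℤ)) • z) = hecChar hm0 hℓ χ γ * TG.1 z := fun γ z => by
    change evalAt _ TG = _ * evalAt z TG
    rw [map_prod, map_prod, ← (hecIdx_bijective hm0 γ).prod_comp fun i => evalAt z (hecTransl hm0 i G)]
    refine (prod_congr rfl fun i _ => hGi γ z i).trans prod_mul_distrib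
  have hvi : ∀ (γ : Gamma m) z, v.1 ((γ : SL(2, ℤ)) • z) = v.1 z := fun γ z => by
    change evalAt _ v = evalAt z v
    rw [map_sum, map_sum, ← (hecIdx_bijective hm0 γ).sum_comp fun i => evalAt z (hecTransl hm0 i G ^ m)]
    refine sum_congr rfl fun i _ => ?_
    rw [map_pow, map_pow]
    refine (congrArg (· ^ m) (hGi γ z i)).trans ?_
    simp only [mul_pow, hχ, one_mul]
    rfl
  have hTb : ∀ (γ : Gamma m) z, (TG ^ ℓ * b).1 ((γ : SL(2, ℤ)) • z) = (TG ^ ℓ * b).1 z := fun γ z => by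
    change TG.1 _ ^ ℓ * b.1 _ = TG.1 z ^ ℓ * b.1 z
    rw [hTGi, hb.smul]
    have : hecChar hm0 hℓ χ γ ^ (ℓ + 1) = 1 := by rw [he, pow_mul, hψ, one_pow]
    linear_combination TG.1 z ^ ℓ * b.1 z * this
  have ha1 : ∀ δ ∈ stab (yb hm), transl δ a = a := fun δ hδ => by
    rw [map_pow, invariant_of_Gamma hm hvi δ hδ]
  have hw1 : ∀ δ ∈ stab (yb hm), transl δ w = w := fun δ hδ => by
    rw [map_add, map_mul, ha1 δ hδ, invariant_of_Gamma hm hTb δ hδ, mem_stab.mp hδ]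
  have hfin : (stab (yb hm)).FiniteIndex :=
    have : NeZero m := ⟨hm'⟩
    Subgroup.finiteIndex_of_le (Gamma_le_stab hm)
  have : Fintype (SL(2, ℤ) ⧸ stab (yb hm)) := Fintype.ofFinite _
  obtain ⟨Q, hQD, hQ1, hQ2⟩ := exists_norm_poly (stab (yb hm)) a w ha1 hw1
  have hQ0 : Q ≠ 0 := by
    rintro rfl
    have h0 : ∏ q : SL(2, ℤ) ⧸ stab (yb hm), transl q.out⁻¹ a = 0 := by
      refine Subtype.ext (funext fun z => ?_)
      have := hQ1 z
      rw [Polynomial.coeff_zero, Polynomial.eval_zero] at this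
      refine Eq.trans ?_ this.symm
      change evalAt z _ = _
      rw [map_prod]
      rfl
    obtain ⟨q, -, hq⟩ := prod_eq_zero_iff.mp h0
    have ha0 : a = 0 := by
      have := congrArg (transl q.out) hq
      rwa [← transl_mul, inv_mul_cancel, transl_one, map_zero] at this
    rw [ha0] at haR
    exact hxa (relRing_zero hNℓ Subtype.val_injective haR)
  obtain ⟨c, Ψ, hc, hΨ, hΨ0⟩ := hsc Q hQ0
  set D := (stab (yb hm)).index
  have hΨD : Ψ.natDegree ≤ D := by
    have hinj : Function.Injective (Polynomial.mapRingHom V.subtype) := Polynomial.map_injective _ V.subtype_injective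
    rw [← Polynomial.natDegree_map_eq_of_injective hinj, hΨ]
    exact (Polynomial.natDegree_C_mul_le _ _).trans hQD
  have hΨc : ∀ i z, (Ψ.coeff i).eval₂ V.subtype (jFun z) = c * (Q.coeff i).eval (jFun z) := fun i z => by
    have := congrArg (fun p => (p.coeff i).eval (jFun z)) hΨ
    simpa [Polynomial.eval_map] using this
  set xw := subst κ ℓ hp (xy + xb)
  have hR1 : ∀ i, ((fun z => (Ψ.coeff i).eval₂ V.subtype (jFun z)),
      (Ψ.coeff i).eval₂ ((laurentC κ).comp r) (subst κ ℓ hp xj)) ∈ relRing V.subtype r (m ^ 2 * ℓ) := fun i => by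
    simpa [ev2] using relRing_ev2 hj' hj' (Polynomial.C (Ψ.coeff i))
  have hsum := sum_mem fun i (_ : i ∈ range (D + 1)) => mul_mem (mul_mem (hR1 i)
    (pow_mem (show (w.1, xa * xw) ∈ relRing V.subtype r (m ^ 2 * ℓ) from hwR) i))
    (pow_mem (show (a.1, xa) ∈ relRing V.subtype r (m ^ 2 * ℓ) from haR) (D - i))
  have hzero : ∑ i ∈ range (D + 1), (Ψ.coeff i).eval₂ ((laurentC κ).comp r) (subst κ ℓ hp xj) *
      (xa * xw) ^ i * xa ^ (D - i) = 0 := by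
    refine relRing_zero (r := r) hNℓ V.subtype_injective ?_
    convert hsum using 1
    refine Prod.ext ?_ ?_
    · rw [Prod.fst_sum]
      ext z
      rw [Finset.sum_apply]
      refine Eq.trans ?_ (sum_congr rfl fun i _ => congrArg (· * w.1 z ^ i * a.1 z ^ (D - i)) (hΨc i z).symm)
      simp only [mul_assoc, ← mul_sum]
      simp only [← mul_assoc]
      rw [hQ2, mul_zero]
      rfl
    · rw [Prod.snd_sum]
      rfl
  have hev : ev2 ((laurentC κ).comp r) (subst κ ℓ hp xj) xw Ψ = 0 := by
    rw [ev2_eq_sum _ _ _ hΨD]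
    refine (mul_eq_zero.mp (?_ : xa ^ D * _ = 0)).resolve_left (pow_ne_zero _ hxa)
    rw [← hzero, mul_sum]
    refine sum_congr rfl fun i hi => ?_
    rw [← Nat.sub_add_cancel (Nat.lt_succ_iff.mp (mem_range.mp hi)), Nat.add_sub_cancel, mul_pow, pow_add]
    ring
  refine ⟨xj, xy + xb, hxj, (relRing V.subtype r (m ^ 2)).add_mem hxy hxb, Ψ.map (Polynomial.mapRingHom r),
    Polynomial.natDegree_map_le.trans hΨD, ?_, hΨ0⟩
  rw [ev2_map]
  refine (subst κ ℓ hp).injective ?_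
  rw [map_ev2, map_zero, ← RingHom.comp_assoc, subst_comp_laurentC]
  exact hev

end MacMahon

namespace MacMahon
open scoped MatrixGroups Manifold UpperHalfPlane
open UpperHalfPlane PowerSeries LaurentSeries CongruenceSubgroup

variable {m : ℕ}

lemma finite_characters (hm : 3 ≤ m) : {χ : Gamma m →* ℂ | ∀ γ, χ γ ^ m = 1}.Finite := by
  have : NeZero m := ⟨by omega⟩
  have : Group.FG SL(2, ℤ) := Group.fg_iff.mpr
    ⟨_, SpecialLinearGroup.SL2Z_generators, Set.toFinite _⟩
  obtain ⟨S, hS, hSf⟩ := Group.fg_iff.mp (inferInstance : Group.FG (Gamma m))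
  have hfin : {z : ℂ | z ^ m = 1}.Finite := by
    refine (Polynomial.nthRootsFinset m (1 : ℂ)).finite_toSet.subset fun z hz => ?_
    exact (Polynomial.mem_nthRootsFinset (by omega) _).mpr hz
  have := hSf.to_subtype
  refine Set.Finite.of_injOn (f := fun (χ : Gamma m →* ℂ) (s : S) => χ s) (t := Set.pi Set.univ fun _ => {z : ℂ | z ^ m = 1})
    (fun χ hχ s _ => hχ s.1) (fun χ _ ψ _ h => ?_) (Set.Finite.pi fun _ => hfin)
  refine MonoidHom.eq_of_eqOn_dense hS fun s hs => congrFun h ⟨s, hs⟩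

lemma IsCharFun.exists_finset_defRing (hm : 3 ≤ m) {χ : Gamma m →* ℂ} (hχ : ∀ γ, χ γ ^ m = 1) {b : modGrowth}
    (hb : IsCharFun hm χ b) : ∃ S : Finset ℂ, b.1 ∈ defRing (m ^ 2) (finRing S) := by
  have := finiteIndex_ker hm χ hχ
  have : (stab b).FiniteIndex := Subgroup.finiteIndex_of_le (H := χ.ker.map (Gamma m).subtype) (by
    rintro _ ⟨γ, hγ, rfl⟩
    refine mem_stab'.mpr fun z => ?_
    have h2 := hb.smul γ z
    rwa [MonoidHom.mem_ker.mp hγ, one_mul] at h2)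
  exact MacMahon.exists_finset_defRing (by positivity) (stab b) b (fun _ h => h) (T_sq_periodic hχ hb.smul)

lemma IsCharFun.exists_finset_ne_zero (hm : 3 ≤ m) {χ : Gamma m →* ℂ} (hχ : ∀ γ, χ γ ^ m = 1) {b : modGrowth}
    (hb : IsCharFun hm χ b) : ∃ S : Finset ℂ, b.1 ∈ defRing (m ^ 2) (finRing S) ∧
      ∀ (κ : Type) [Field κ] (V : Subring ℂ) (r : V →+* κ), finRing S ≤ V →
        (b.1, 0) ∉ relRing V.subtype r (m ^ 2) := by
  obtain ⟨S₀, hS₀⟩ := hb.exists_finset_defRing hm hχ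
  obtain ⟨S, hS, h⟩ := exists_finset_independent (N := m ^ 2) (by positivity) (ι := Unit) (fun _ => b.1) S₀
    (fun _ => hS₀) fun c hc => by
      by_contra hne
      refine hb.ne_zero (Subtype.ext (funext fun z => ?_))
      have h1 : c () ≠ 0 := fun h => hne (funext fun _ => h)
      simpa [h1] using hc z
  refine ⟨S, defRing_mono (finRing_mono hS) hS₀, fun κ _ V r hV h0 => ?_⟩
  exact one_ne_zero (congrFun (h κ V r (fun _ => 0) hV (fun _ => h0) 1 (by simp)) ())

/-- For `m ≥ 3` there is a finitely generated ring such that, for every prime `ℓ ≡ -1 mod m`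
for which the ring has a homomorphism to the field with `ℓ²` elements, the Hecke operator at `ℓ`
annihilates the characters of `Γ(m)` of order dividing `m`. -/
theorem exists_finset_hecChar_eq_one (hm : 3 ≤ m) :
    ∃ S : Finset ℂ, ∀ (ℓ : ℕ) [Fact ℓ.Prime] (hm0 : (m : ZMod ℓ) ≠ 0) (hℓ : (ℓ : ZMod m) = -1)
      (F : Type) [Field F], Nat.card F = ℓ ^ 2 → ∀ _ : finRing S →+* F,
      ∀ χ : Gamma m →* ℂ, (∀ γ, χ γ ^ m = 1) → hecChar hm0 hℓ χ = 1 := by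
  classical
  have hfin := finite_characters hm
  have := hfin.to_subtype
  have := Fintype.ofFinite {χ : Gamma m →* ℂ | ∀ γ, χ γ ^ m = 1}
  choose b hb using fun χ : {χ : Gamma m →* ℂ | ∀ γ, χ γ ^ m = 1} => exists_isCharFun hm χ.1 χ.2
  choose S1 hS1 hS1' using fun χ => (hb χ).exists_finset_ne_zero hm χ.2
  choose S2 hS2 hS2y hS2b hS2' using fun χ : {χ : {χ : Gamma m →* ℂ | ∀ γ, χ γ ^ m = 1} // χ.1 ≠ 1} =>
    exists_finset_char hm χ.1.2 χ.2 (hb χ.1)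
  refine ⟨(univ.biUnion S1) ∪ univ.biUnion S2, fun ℓ _ hm0 hℓ F _ hF φ χ hχ => ?_⟩
  set S := (univ.biUnion S1) ∪ univ.biUnion S2
  have hs1 : ∀ χ, finRing (S1 χ) ≤ finRing S := fun χ =>
    finRing_mono ((subset_biUnion_of_mem S1 (mem_univ χ)).trans subset_union_left)
  have hs2 : ∀ χ, S2 χ ⊆ S := fun χ =>
    (subset_biUnion_of_mem S2 (mem_univ χ)).trans subset_union_right
  by_contra hne
  have hψ : ∀ γ, hecChar hm0 hℓ χ γ ^ m = 1 := fun γ => by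
    rw [hecChar, MonoidHom.coe_mk, OneHom.coe_mk, ← prod_pow]
    exact prod_eq_one fun i _ => hχ _
  set ψ : {χ : {χ : Gamma m →* ℂ | ∀ γ, χ γ ^ m = 1} // χ.1 ≠ 1} := ⟨⟨_, hψ⟩, hne⟩ with hψd
  have hF0 : Nat.card F ≠ 0 := by rw [hF]; exact pow_ne_zero _ (Fact.out : ℓ.Prime).ne_zero
  have := Nat.finite_of_card_ne_zero hF0
  obtain ⟨V, hAV, hκ, hr⟩ := exists_valuation hF φ
  obtain ⟨x, y, hx, hy, Q, hQ, hQ0, hne⟩ := exists_reduced_relation (r := IsLocalRing.residue V) (V := V.toSubring)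
    hm hm0 hℓ hχ (hb ⟨χ, hχ⟩) (hb ψ.1)
    (defRing_mono (hs1 _) (hS1 ⟨χ, hχ⟩)) (defRing_mono (finRing_mono (hs2 ψ)) (hS2b ψ))
    (defRing_mono (finRing_mono (hs2 ψ)) (hS2y ψ)) (mem_finRing (hs2 ψ (hS2 ψ))) hAV hr
    (fun z hz => zeta_mem V (Fact.out : ℓ.Prime).ne_zero hz) (fun Q hQ => exists_scale V hQ)
    (hS1' _ _ _ _ ((hs1 _).trans hAV))
  exact hne (hS2' ψ _ _ _ x y ((finRing_mono (hs2 ψ)).trans hAV) hx hy Q hQ hQ0)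

end MacMahon

namespace MacMahon
open scoped MatrixGroups Manifold UpperHalfPlane
/-- The action of an integral matrix on complex vectors. -/
def mv (A : Matrix (Fin 2) (Fin 2) ℤ) (v : Fin 2 → ℂ) : Fin 2 → ℂ :=
  ![A 0 0 * v 0 + A 0 1 * v 1, A 1 0 * v 0 + A 1 1 * v 1]

lemma mv_mul (A B : Matrix (Fin 2) (Fin 2) ℤ) (v : Fin 2 → ℂ) : mv (A * B) v = mv A (mv B v) := by
  ext i
  fin_cases i <;> simp [mv, Matrix.mul_apply, Fin.sum_univ_two] <;> ring

lemma mv_one (v : Fin 2 → ℂ) : mv 1 v = v := by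
  ext i
  fin_cases i <;> simp [mv]

lemma mv_int (A : Matrix (Fin 2) (Fin 2) ℤ) (a b : ℤ) :
    mv A ![(a : ℂ), (b : ℂ)] = ![((A 0 0 * a + A 0 1 * b : ℤ) : ℂ), ((A 1 0 * a + A 1 1 * b : ℤ) : ℂ)] := by
  simp [mv]

/-- Homogeneous polynomial functions of degree `n` in two variables. -/
def pol (n : ℕ) : Submodule ℂ ((Fin 2 → ℂ) → ℂ) :=
  Submodule.span ℂ {p | ∃ i j, i + j = n ∧ p = fun v => v 0 ^ i * v 1 ^ j}

lemma monomial_mem_pol (i j : ℕ) : (fun v : Fin 2 → ℂ => v 0 ^ i * v 1 ^ j) ∈ pol (i + j) :=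
  Submodule.subset_span ⟨i, j, rfl, rfl⟩

lemma linear_mul_mem_pol (a b : ℂ) {n : ℕ} {p : (Fin 2 → ℂ) → ℂ} (hp : p ∈ pol n) :
    (fun v => (a * v 0 + b * v 1) * p v) ∈ pol (n + 1) := by
  induction hp using Submodule.span_induction with
  | mem p h =>
    obtain ⟨i, j, rfl, rfl⟩ := h
    have h1 := (pol (i + j + 1)).smul_mem a (Submodule.subset_span ⟨i + 1, j, by omega, rfl⟩)
    have h2 := (pol (i + j + 1)).smul_mem b (Submodule.subset_span ⟨i, j + 1, by omega, rfl⟩)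
    convert add_mem h1 h2 using 1
    ext v
    simp only [Pi.add_apply, Pi.smul_apply, smul_eq_mul]
    ring
  | zero =>
    convert (pol (n + 1)).zero_mem using 1
    ext v
    simp
  | add p q _ _ hp hq =>
    convert add_mem hp hq using 1
    ext v
    simp only [Pi.add_apply]
    ring
  | smul c p _ hp =>
    convert (pol (n + 1)).smul_mem c hp using 1
    ext v
    simp only [Pi.smul_apply, smul_eq_mul]
    ring

lemma comp_mv_mem_pol {n : ℕ} {p : (Fin 2 → ℂ) → ℂ} (hp : p ∈ pol n) (A : Matrix (Fin 2) (Fin 2) ℤ) :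
    (fun v => p (mv A v)) ∈ pol n := by
  induction hp using Submodule.span_induction with
  | mem p h =>
    obtain ⟨i, j, rfl, rfl⟩ := h
    simp only [mv, Matrix.cons_val_zero, Matrix.cons_val_one]
    induction i with
    | zero =>
      induction j with
      | zero => simpa using monomial_mem_pol 0 0
      | succ j ih =>
        convert linear_mul_mem_pol (A 1 0) (A 1 1) ih using 1
        · rw [add_assoc]
        · funext v
          ring
    | succ i ih =>
      rw [Nat.add_right_comm]
      convert linear_mul_mem_pol (A 0 0) (A 0 1) ih using 1
      ext v; ring
  | zero => exact (pol n).zero_mem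
  | add p q _ _ hp hq => exact add_mem hp hq
  | smul c p _ hp => exact (pol n).smul_mem c hp

lemma pol_smul {n : ℕ} {p : (Fin 2 → ℂ) → ℂ} (hp : p ∈ pol n) (c : ℂ) (v : Fin 2 → ℂ) :
    p (c • v) = c ^ n * p v := by
  induction hp using Submodule.span_induction with
  | mem p h =>
    obtain ⟨i, j, rfl, rfl⟩ := h
    simp only [Pi.smul_apply, smul_eq_mul]
    ring
  | zero => simp
  | add p q _ _ hp hq => simp only [Pi.add_apply, hp, hq]; ring
  | smul c p _ hp => simp only [Pi.smul_apply, hp, smul_eq_mul]; ring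

lemma pol_eq_eval {n : ℕ} {p : (Fin 2 → ℂ) → ℂ} (hp : p ∈ pol n) :
    ∃ P : Polynomial ℂ, P.degree < (n + 1 : ℕ) ∧ ∀ x, p ![x, 1] = P.eval x := by
  induction hp using Submodule.span_induction with
  | mem p h =>
    obtain ⟨i, j, rfl, rfl⟩ := h
    refine ⟨Polynomial.X ^ i, ?_, fun x => by simp⟩
    rw [Polynomial.degree_X_pow]
    exact_mod_cast (by omega : i < i + j + 1)
  | zero => exact ⟨0, by simp, by simp⟩
  | add p q _ _ hp hq =>
    obtain ⟨P, hP, hP'⟩ := hp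
    obtain ⟨Q, hQ, hQ'⟩ := hq
    exact ⟨P + Q, (Polynomial.degree_add_le _ _).trans_lt (max_lt hP hQ), fun x => by simp [hP', hQ']⟩
  | smul c p _ hp =>
    obtain ⟨P, hP, hP'⟩ := hp
    exact ⟨Polynomial.C c * P, by
      rw [← Polynomial.smul_eq_C_mul]; exact (Polynomial.degree_smul_le _ _).trans_lt hP, fun x => by simp [hP']⟩

/-- Functions whose values on integral vectors lie in `W` and are compatible with congruences. -/
def congPol (W : AddSubgroup ℂ) : AddSubgroup ((Fin 2 → ℂ) → ℂ) where
  carrier := {p | (∀ a b : ℤ, p ![(a : ℂ), (b : ℂ)] ∈ W) ∧ ∀ (m : ℕ) (a b s t : ℤ), ∃ w ∈ W,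
    p ![((a + m * s : ℤ) : ℂ), ((b + m * t : ℤ) : ℂ)] = p ![(a : ℂ), (b : ℂ)] + m * w}
  add_mem' {p q} hp hq := by
    refine ⟨fun a b => add_mem (hp.1 a b) (hq.1 a b), fun m a b s t => ?_⟩
    obtain ⟨w, hw, h⟩ := hp.2 m a b s t
    obtain ⟨w', hw', h'⟩ := hq.2 m a b s t
    exact ⟨w + w', add_mem hw hw', by rw [Pi.add_apply, Pi.add_apply, h, h']; ring⟩
  zero_mem' := ⟨fun _ _ => W.zero_mem, fun _ _ _ _ _ => ⟨0, W.zero_mem, by simp⟩⟩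
  neg_mem' {p} hp := by
    refine ⟨fun a b => neg_mem (hp.1 a b), fun m a b s t => ?_⟩
    obtain ⟨w, hw, h⟩ := hp.2 m a b s t
    exact ⟨-w, neg_mem hw, by rw [Pi.neg_apply, Pi.neg_apply, h]; ring⟩

lemma congPol_mono {W W' : AddSubgroup ℂ} (h : W ≤ W') : congPol W ≤ congPol W' := fun p hp => by
  refine ⟨fun a b => h (hp.1 a b), fun m a b s t => ?_⟩
  obtain ⟨w, hw, h'⟩ := hp.2 m a b s t
  exact ⟨w, h hw, h'⟩

lemma comp_mv_mem_congPol {W : AddSubgroup ℂ} {p : (Fin 2 → ℂ) → ℂ} (hp : p ∈ congPol W)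
    (A : Matrix (Fin 2) (Fin 2) ℤ) : (fun v => p (mv A v)) ∈ congPol W := by
  refine ⟨fun a b => by beta_reduce; rw [mv_int]; exact hp.1 _ _, fun m a b s t => ?_⟩
  obtain ⟨w, hw, h⟩ := hp.2 m (A 0 0 * a + A 0 1 * b) (A 1 0 * a + A 1 1 * b) (A 0 0 * s + A 0 1 * t)
    (A 1 0 * s + A 1 1 * t)
  refine ⟨w, hw, ?_⟩
  beta_reduce
  rw [mv_int, mv_int, ← h]
  congr 3 <;> ring_nf

lemma congPol_congr {W : AddSubgroup ℂ} {p : (Fin 2 → ℂ) → ℂ} (hp : p ∈ congPol W) {m : ℕ}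
    {A B : Matrix (Fin 2) (Fin 2) ℤ} (h : ∀ i j, (A i j : ZMod m) = B i j) (a b : ℤ) :
    ∃ w ∈ W, p (mv A ![(a : ℂ), (b : ℂ)]) = p (mv B ![(a : ℂ), (b : ℂ)]) + m * w := by
  have h' : ∀ i j, ∃ k, A i j = B i j + m * k := fun i j => by
    obtain ⟨k, hk⟩ := (ZMod.intCast_eq_intCast_iff_dvd_sub _ _ _).mp (h i j).symm
    exact ⟨k, by linarith⟩
  choose k hk using h'
  obtain ⟨w, hw, h⟩ := hp.2 m (B 0 0 * a + B 0 1 * b) (B 1 0 * a + B 1 1 * b) (k 0 0 * a + k 0 1 * b)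
    (k 1 0 * a + k 1 1 * b)
  refine ⟨w, hw, ?_⟩
  rw [mv_int, mv_int, ← h, hk, hk, hk, hk]
  congr 3 <;> ring_nf

lemma exists_congPol {n : ℕ} {p : (Fin 2 → ℂ) → ℂ} (hp : p ∈ pol n) :
    ∃ W : AddSubgroup ℂ, W.FG ∧ p ∈ congPol W := by
  suffices h : ∀ c : ℂ, ∃ W : AddSubgroup ℂ, W.FG ∧ c • p ∈ congPol W by simpa using h 1
  induction hp using Submodule.span_induction with
  | mem p h =>
    obtain ⟨i, j, rfl, rfl⟩ := h
    refine fun c => ⟨AddSubgroup.closure {c}, ⟨{c}, by simp⟩, fun a b => ?_, fun m a b s t => ?_⟩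
    · refine AddSubgroup.mem_closure_singleton.mpr ⟨a ^ i * b ^ j, ?_⟩
      simp [mul_comm]
    · have h1 : (m : ℤ) ∣ (a + m * s) ^ i * (b + m * t) ^ j - a ^ i * b ^ j := by
        refine (Int.ModEq.mul (Int.ModEq.pow _ ?_) (Int.ModEq.pow _ ?_)).symm.dvd <;>
        · refine (Int.modEq_iff_dvd.mpr ?_).symm; simp
      obtain ⟨k, hk⟩ := h1
      refine ⟨k * c, AddSubgroup.mem_closure_singleton.mpr ⟨k, by simp⟩, ?_⟩
      have hk' : ((a + m * s : ℤ) : ℂ) ^ i * ((b + m * t : ℤ) : ℂ) ^ j - (a : ℂ) ^ i * (b : ℂ) ^ j = m * k := by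
        exact_mod_cast congrArg (Int.cast (R := ℂ)) hk
      simp only [Pi.smul_apply, smul_eq_mul, Matrix.cons_val_zero, Matrix.cons_val_one, Matrix.cons_val_fin_one]
      linear_combination c * hk'
  | zero => exact fun c => ⟨⊥, ⟨∅, by simp⟩, by rw [smul_zero]; exact zero_mem _⟩
  | add p q _ _ hp hq =>
    intro c
    obtain ⟨W, hW, h⟩ := hp c
    obtain ⟨W', hW', h'⟩ := hq c
    refine ⟨W ⊔ W', hW.sup hW', ?_⟩
    rw [smul_add]
    exact add_mem (congPol_mono le_sup_left h) (congPol_mono le_sup_right h')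
  | smul c p _ hp => exact fun c' => by rw [smul_smul]; exact hp _

end MacMahon

namespace MacMahon
open scoped MatrixGroups Manifold UpperHalfPlane
open UpperHalfPlane PowerSeries CongruenceSubgroup

section Series

variable {m ℓ : ℕ} [Fact ℓ.Prime]

lemma sum_root_pow (hm : (m : ZMod ℓ) ≠ 0) (k : ℕ) :
    ∑ j : ZMod ℓ, (Complex.exp (2 * Real.pi * Complex.I / ℓ) ^ m ^ 2) ^ (j.val * k) = if ℓ ∣ k then (ℓ : ℂ) else 0 := by
  have hℓ := (Fact.out : ℓ.Prime)
  have h1 : ∑ j : ZMod ℓ, (Complex.exp (2 * Real.pi * Complex.I / ℓ) ^ m ^ 2) ^ (j.val * k) =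
      ∑ i ∈ range ℓ, ((Complex.exp (2 * Real.pi * Complex.I / ℓ) ^ m ^ 2) ^ k) ^ i := by
    refine sum_nbij' ZMod.val (fun i => (i : ZMod ℓ)) (fun j _ => mem_range.mpr (ZMod.val_lt j)) (by simp) (by simp)
      (fun i hi => ZMod.val_cast_of_lt (mem_range.mp hi)) fun j _ => ?_
    rw [← pow_mul _ k, mul_comm k]
  have hp : IsPrimitiveRoot (Complex.exp (2 * Real.pi * Complex.I / ℓ) ^ m ^ 2) ℓ := by
    refine (Complex.isPrimitiveRoot_exp ℓ hℓ.ne_zero).pow_of_coprime _ (Nat.Coprime.pow_left 2 ?_)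
    exact ((Nat.Prime.coprime_iff_not_dvd hℓ).mpr fun h => hm ((ZMod.natCast_eq_zero_iff _ _).mpr h)).symm
  rw [h1]
  split_ifs with h
  · simp [(hp.pow_eq_one_iff_dvd k).mpr h]
  · refine (hp.pow_of_coprime k ((Nat.Prime.coprime_iff_not_dvd hℓ).mpr h).symm).geom_sum_eq_zero hℓ.one_lt

/-- The Hecke operator of weight `n + 2` on power series. -/
noncomputable def heckeSeries (ℓ n : ℕ) (p : ℂ⟦X⟧) : ℂ⟦X⟧ :=
  PowerSeries.mk fun j => coeff (ℓ * j) p + if ℓ ∣ j then (ℓ : ℂ) ^ (n + 1) * coeff (j / ℓ) p else 0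

/-- The Hecke operator of weight `n + 2` on functions. -/
noncomputable def heckeFun (m ℓ n : ℕ) [Fact ℓ.Prime] (g : ℍ → ℂ) (z : ℍ) : ℂ :=
  (∑ j : ZMod ℓ, g (hecAct m (some j) z) * (ℓ : ℂ)⁻¹) + g (hecAct m (none : Option (ZMod ℓ)) z) * (ℓ : ℂ) ^ (n + 1)

lemma qpar_one_hecAct_some (j : ZMod ℓ) (z : ℍ) :
    qpar 1 (hecAct m (some j) z) =
      (Complex.exp (2 * Real.pi * Complex.I / ℓ) ^ m ^ 2) ^ j.val * qpar ℓ z := by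
  have hℓ : (ℓ : ℂ) ≠ 0 := by exact_mod_cast (Fact.out : ℓ.Prime).ne_zero
  rw [qpar, qpar, Function.Periodic.qParam, Function.Periodic.qParam, ← pow_mul, ← Complex.exp_nat_mul,
    ← Complex.exp_add, coe_hecAct_some]
  congr 1
  push_cast
  field_simp
  ring

lemma qpar_one_hecAct_none (z : ℍ) :
    qpar 1 (hecAct m (none : Option (ZMod ℓ)) z) = qpar 1 z ^ ℓ := by
  rw [qpar, qpar, Function.Periodic.qParam, Function.Periodic.qParam, ← Complex.exp_nat_mul, coe_hecAct_none]
  congr 1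
  push_cast
  ring

lemma hasExp_heckeFun (hm : (m : ZMod ℓ) ≠ 0) (n : ℕ) {p : ℂ⟦X⟧} {g : ℍ → ℂ} (h : HasExp 1 p g) :
    HasExp 1 (heckeSeries ℓ n p) (heckeFun m ℓ n g) := fun z => by
  have hℓ0 := (Fact.out : ℓ.Prime).ne_zero
  have hℓ : (ℓ : ℂ) ≠ 0 := by exact_mod_cast hℓ0
  have hq : qpar ℓ z ^ ℓ = qpar 1 z := by simpa using qpar_mul_pow hℓ0 (N := 1) z
  have hinj : Function.Injective fun k : ℕ => ℓ * k := mul_right_injective₀ hℓ0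
  have h1 : HasSum (fun k => coeff (ℓ * k) p * qpar 1 z ^ k) (∑ j : ZMod ℓ, g (hecAct m (some j) z) * (ℓ : ℂ)⁻¹) := by
    have := hasSum_sum fun j (_ : j ∈ (univ : Finset (ZMod ℓ))) => (h (hecAct m (some j) z)).mul_right (ℓ : ℂ)⁻¹
    have h2 : ∀ k, ∑ j : ZMod ℓ, coeff k p * qpar 1 (hecAct m (some j) z) ^ k * (ℓ : ℂ)⁻¹ =
        if ℓ ∣ k then coeff k p * qpar ℓ z ^ k else 0 := fun k => by
      simp only [qpar_one_hecAct_some, mul_pow, ← pow_mul _ _ k]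
      have := sum_root_pow hm k
      rw [← sum_mul, ← mul_sum, ← sum_mul, this]
      split_ifs
      · field_simp
      · simp
    simp only [h2] at this
    rw [← hinj.hasSum_iff] at this
    · refine this.congr_fun fun k => ?_
      simp [pow_mul, hq]
    · intro k hk
      rw [if_neg]
      rintro ⟨k', rfl⟩
      exact hk ⟨k', rfl⟩
  have h2 : HasSum (fun k => (if ℓ ∣ k then (ℓ : ℂ) ^ (n + 1) * coeff (k / ℓ) p else 0) * qpar 1 z ^ k)
      (g (hecAct m (none : Option (ZMod ℓ)) z) * (ℓ : ℂ) ^ (n + 1)) := by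
    rw [← hinj.hasSum_iff]
    · refine ((h (hecAct m (none : Option (ZMod ℓ)) z)).mul_right ((ℓ : ℂ) ^ (n + 1))).congr_fun fun k => ?_
      simp [qpar_one_hecAct_none, ← pow_mul, Nat.mul_div_cancel_left k (Nat.pos_of_ne_zero hℓ0)]
      ring
    · intro k hk
      rw [if_neg, zero_mul]
      rintro ⟨k', rfl⟩
      exact hk ⟨k', rfl⟩
  refine (h1.add h2).congr_fun fun k => ?_
  rw [heckeSeries, coeff_mk, add_mul]

end Series

lemma hasDerivAt_comp_affine {F : ℍ → ℂ} {u : ℍ → ℍ} {c d F' : ℂ} (hu : ∀ z, (u z : ℂ) = c * z + d) {z : ℍ}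
    (h : HasDerivAt (F ∘ ofComplex) F' (u z : ℂ)) :
    HasDerivAt ((fun z => F (u z)) ∘ ofComplex) (F' * c) (z : ℂ) := by
  have h1 : HasDerivAt (fun w : ℂ => c * w + d) c z := by
    simpa using ((hasDerivAt_id (z : ℂ)).const_mul c).add_const d
  refine (HasDerivAt.comp (z : ℂ) (by rw [← hu]; exact h) h1).congr_of_eventuallyEq ?_
  filter_upwards [isOpen_upperHalfPlaneSet.mem_nhds z.im_pos] with w hw
  simp only [Function.comp_apply]
  rw [← ofComplex_apply (u _), hu, ofComplex_apply_of_im_pos hw]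

/-- Power series together with an Eichler integral and its period cocycle. -/
def eichler (n : ℕ) : Submodule ℂ (ℂ⟦X⟧ × ((Fin 2 → ℂ) → ℍ → ℂ) × (SL(2, ℤ) → (Fin 2 → ℂ) → ℂ)) where
  carrier := {t | (∀ z, (fun v => t.2.1 v z) ∈ pol n) ∧
    (∃ g, HasExp 1 t.1 g ∧ ∀ v (z : ℍ), HasDerivAt (t.2.1 v ∘ ofComplex) (g z * (v 0 - z * v 1) ^ n) z) ∧
    ∀ γ : SL(2, ℤ), ∀ v z, t.2.1 (mv γ v) (γ • z) = t.2.1 v z + t.2.2 γ v}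
  add_mem' := by
    rintro ⟨p, Φ, φ⟩ ⟨p', Φ', φ'⟩ ⟨h1, ⟨g, hg, h2⟩, h3⟩ ⟨h1', ⟨g', hg', h2'⟩, h3'⟩
    refine ⟨fun z => add_mem (h1 z) (h1' z), ⟨g + g', hg.add hg', fun v z => ?_⟩, fun γ v z => ?_⟩
    · rw [Pi.add_apply, add_mul]
      exact (h2 v z).add (h2' v z)
    · have := h3 γ v z
      have := h3' γ v z
      simp only [Prod.mk_add_mk, Pi.add_apply] at *
      linear_combination h3 γ v z + h3' γ v z
  zero_mem' := ⟨fun _ => zero_mem _, ⟨0, fun z => by simp, fun v z => by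
    simp⟩, by simp⟩
  smul_mem' := by
    rintro c ⟨p, Φ, φ⟩ ⟨h1, ⟨g, hg, h2⟩, h3⟩
    refine ⟨fun z => (pol n).smul_mem c (h1 z), ⟨c • g, fun z => ?_, fun v z => ?_⟩, fun γ v z => ?_⟩
    · simpa [mul_assoc] using (hg z).mul_left c
    · rw [Pi.smul_apply, smul_eq_mul, mul_assoc]
      exact (h2 v z).const_mul c
    · have := h3 γ v z
      simp only [Prod.smul_mk, Pi.smul_apply, smul_eq_mul] at *
      rw [this, mul_add]

section Hecke

variable {m ℓ : ℕ} [Fact ℓ.Prime]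

/-- The Hecke operator on Eichler integrals. -/
noncomputable def heckeEich (hm : (m : ZMod ℓ) ≠ 0) (n : ℕ)
    (t : ℂ⟦X⟧ × ((Fin 2 → ℂ) → ℍ → ℂ) × (SL(2, ℤ) → (Fin 2 → ℂ) → ℂ)) :
    ℂ⟦X⟧ × ((Fin 2 → ℂ) → ℍ → ℂ) × (SL(2, ℤ) → (Fin 2 → ℂ) → ℂ) :=
  (heckeSeries ℓ n t.1, fun v z => ∑ i, t.2.1 (mv (hecMat m ℓ i) v) (hecAct m i z),
    fun γ v => ∑ i, t.2.2 (hecRep hm γ i) (mv (hecMat m ℓ (hecIdx hm γ i)) v))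

lemma heckeEich_mem (hm : (m : ZMod ℓ) ≠ 0) {n : ℕ} (hn : Even n)
    {t : ℂ⟦X⟧ × ((Fin 2 → ℂ) → ℍ → ℂ) × (SL(2, ℤ) → (Fin 2 → ℂ) → ℂ)} (ht : t ∈ eichler n) :
    heckeEich hm n t ∈ eichler n := by
  obtain ⟨p, Φ, φ⟩ := t
  obtain ⟨h1, ⟨g, hg, h2⟩, h3⟩ := ht
  have hℓ : (ℓ : ℂ) ≠ 0 := by exact_mod_cast (Fact.out : ℓ.Prime).ne_zero
  refine ⟨fun z => ?_, ⟨heckeFun m ℓ n g, hasExp_heckeFun hm n hg, fun v z => ?_⟩, fun γ v z => ?_⟩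
  · convert sum_mem (S := pol n) (t := univ) fun i _ => comp_mv_mem_pol (h1 (hecAct m i z)) (hecMat m ℓ i) using 1
    ext v
    simp [heckeEich]
  · have h4 : ∀ j : ZMod ℓ, HasDerivAt ((fun z => Φ (mv (hecMat m ℓ (some j)) v) (hecAct m (some j) z)) ∘ ofComplex)
        (g (hecAct m (some j) z) * (ℓ : ℂ)⁻¹ * (v 0 - z * v 1) ^ n) z := fun j => by
      convert hasDerivAt_comp_affine (c := (ℓ : ℂ)⁻¹) (d := m ^ 2 * j.val / ℓ) (fun z => ?_) (h2 _ _) using 1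
      · rw [coe_hecAct_some]
        simp only [mv, hecMat, Matrix.of_apply, Matrix.cons_val_zero, Matrix.cons_val_one, Matrix.cons_val_fin_one,
          Matrix.cons_val']
        rw [mul_right_comm]
        congr 3
        push_cast
        field_simp
        ring
      · rw [coe_hecAct_some]
        ring
    have h5 : HasDerivAt ((fun z => Φ (mv (hecMat m ℓ none) v) (hecAct m (none : Option (ZMod ℓ)) z)) ∘ ofComplex)
        (g (hecAct m (none : Option (ZMod ℓ)) z) * (ℓ : ℂ) ^ (n + 1) * (v 0 - z * v 1) ^ n) z := by
      convert hasDerivAt_comp_affine (c := ℓ) (d := 0) (fun z => ?_) (h2 _ _) using 1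
      · rw [coe_hecAct_none]
        have : mv (hecMat m ℓ none) v 0 - ℓ * z * mv (hecMat m ℓ none) v 1 = -(ℓ * (v 0 - z * v 1)) := by
          simp [mv, hecMat]
          ring
        rw [this, hn.neg_pow, mul_pow]
        ring
      · rw [coe_hecAct_none]
        ring
    refine (((HasDerivAt.fun_sum fun j (_ : j ∈ (univ : Finset (ZMod ℓ))) => h4 j).add h5).congr_of_eventuallyEq
      (.of_forall fun w => ?_)).congr_deriv ?_
    · simp [heckeEich, Fintype.sum_option, add_comm]
    · rw [heckeFun, add_mul, sum_mul]
  · simp only [heckeEich]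
    rw [← (Equiv.ofBijective _ (hecIdx_bijective hm γ)).sum_comp fun i => Φ (mv (hecMat m ℓ i) v) (hecAct m i z),
      ← sum_add_distrib]
    refine sum_congr rfl fun i _ => ?_
    rw [hecAct_smul hm, ← mv_mul, hecRep_spec hm, mv_mul]
    exact h3 _ _ _

lemma cocycle_mul {n : ℕ} {t : ℂ⟦X⟧ × ((Fin 2 → ℂ) → ℍ → ℂ) × (SL(2, ℤ) → (Fin 2 → ℂ) → ℂ)}
    (ht : t ∈ eichler n) (γ δ : SL(2, ℤ)) (v : Fin 2 → ℂ) :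
    t.2.2 (γ * δ) v = t.2.2 δ v + t.2.2 γ (mv δ v) := by
  have h1 := ht.2.2 (γ * δ) v I
  have h2 := ht.2.2 γ (mv δ v) (δ • I)
  rw [Matrix.SpecialLinearGroup.coe_mul, mv_mul, mul_smul] at h1
  linear_combination h2 - h1 + ht.2.2 δ v I

lemma cocycle_one {n : ℕ} {t : ℂ⟦X⟧ × ((Fin 2 → ℂ) → ℍ → ℂ) × (SL(2, ℤ) → (Fin 2 → ℂ) → ℂ)}
    (ht : t ∈ eichler n) (v : Fin 2 → ℂ) : t.2.2 1 v = 0 := by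
  have h := ht.2.2 1 v I
  rw [one_smul, Matrix.SpecialLinearGroup.coe_one, mv_one] at h
  linear_combination -h

lemma cocycle_mem_pol {n : ℕ} {t : ℂ⟦X⟧ × ((Fin 2 → ℂ) → ℍ → ℂ) × (SL(2, ℤ) → (Fin 2 → ℂ) → ℂ)}
    (ht : t ∈ eichler n) (γ : SL(2, ℤ)) : t.2.2 γ ∈ pol n := by
  convert sub_mem (comp_mv_mem_pol (ht.1 (γ • I)) γ) (ht.1 I) using 1
  ext v
  rw [Pi.sub_apply, ht.2.2]
  ring

lemma cocycle_mem_congPol {n : ℕ} {t : ℂ⟦X⟧ × ((Fin 2 → ℂ) → ℍ → ℂ) × (SL(2, ℤ) → (Fin 2 → ℂ) → ℂ)}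
    (ht : t ∈ eichler n) {W : AddSubgroup ℂ} (hS : t.2.2 ModularGroup.S ∈ congPol W)
    (hT : t.2.2 ModularGroup.T ∈ congPol W) (γ : SL(2, ℤ)) : t.2.2 γ ∈ congPol W := by
  have h : γ ∈ Subgroup.closure {ModularGroup.S, ModularGroup.T} := by
    rw [SpecialLinearGroup.SL2Z_generators]
    trivial
  induction h using Subgroup.closure_induction with
  | mem γ h => rcases h with rfl | rfl <;> assumption
  | one =>
    convert (congPol W).zero_mem
    ext v
    exact cocycle_one ht v
  | mul γ δ _ _ hγ hδ =>
    convert add_mem hδ (comp_mv_mem_congPol hγ δ) using 1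
    ext v
    exact cocycle_mul ht γ δ v
  | inv γ _ h =>
    convert neg_mem (comp_mv_mem_congPol h (γ⁻¹ : SL(2, ℤ))) using 1
    ext v
    have := cocycle_mul ht γ γ⁻¹ v
    rw [mul_inv_cancel, cocycle_one ht] at this
    rw [Pi.neg_apply]
    linear_combination -this

end Hecke

end MacMahon

namespace MacMahon
open scoped MatrixGroups Manifold UpperHalfPlane
open UpperHalfPlane PowerSeries CongruenceSubgroup

/-- The multiples by `m` of the elements of `W`. -/
def mulSub (m : ℕ) (W : AddSubgroup ℂ) : AddSubgroup ℂ := W.map (AddMonoidHom.mulLeft (m : ℂ))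

lemma congPol_congr_sub {W : AddSubgroup ℂ} {p : (Fin 2 → ℂ) → ℂ} (hp : p ∈ congPol W) {m : ℕ}
    {A B : Matrix (Fin 2) (Fin 2) ℤ} (h : A.map (Int.cast : ℤ → ZMod m) = B.map Int.cast) (a b : ℤ) :
    p (mv A ![(a : ℂ), (b : ℂ)]) - p (mv B ![(a : ℂ), (b : ℂ)]) ∈ mulSub m W := by
  obtain ⟨w, hw, h⟩ := congPol_congr hp (fun i j => congrFun (congrFun h i) j) a b
  exact ⟨w, hw, by rw [h]; simp⟩

lemma map_eq_one_of_mem_Gamma {m : ℕ} {γ : SL(2, ℤ)} (hγ : γ ∈ Gamma m) :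
    (γ : Matrix (Fin 2) (Fin 2) ℤ).map (Int.cast : ℤ → ZMod m) = (1 : Matrix (Fin 2) (Fin 2) ℤ).map Int.cast := by
  obtain ⟨h1, h2, h3, h4⟩ := Gamma_mem.mp hγ
  ext i j
  fin_cases i <;> fin_cases j <;> simp [h1, h2, h3, h4]

variable {m n : ℕ} {W : AddSubgroup ℂ}
  {t : ℂ⟦X⟧ × ((Fin 2 → ℂ) → ℍ → ℂ) × (SL(2, ℤ) → (Fin 2 → ℂ) → ℂ)}

lemma cocycle_mul_sub_mem (ht : t ∈ eichler n) (hW : ∀ γ, t.2.2 γ ∈ congPol W) {γ δ : SL(2, ℤ)} (hδ : δ ∈ Gamma m)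
    (a b : ℤ) : t.2.2 (γ * δ) ![(a : ℂ), (b : ℂ)] -
      (t.2.2 γ ![(a : ℂ), (b : ℂ)] + t.2.2 δ ![(a : ℂ), (b : ℂ)]) ∈ mulSub m W := by
  have h := congPol_congr_sub (hW γ) (map_eq_one_of_mem_Gamma hδ) a b
  rw [mv_one] at h
  rw [cocycle_mul ht]
  convert h using 1
  ring

section

variable {ℓ : ℕ} [Fact ℓ.Prime]

lemma hecke_cocycle_mem_congPol (hm : (m : ZMod ℓ) ≠ 0) (hW : ∀ γ, t.2.2 γ ∈ congPol W) (γ : SL(2, ℤ)) :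
    (heckeEich hm n t).2.2 γ ∈ congPol W := by
  convert sum_mem (S := congPol W) (t := univ) fun i _ =>
    comp_mv_mem_congPol (hW (hecRep hm γ i)) (hecMat m ℓ (hecIdx hm γ i)) using 1
  ext v
  simp [heckeEich]

lemma hecke_cocycle_sub_mem (hm : (m : ZMod ℓ) ≠ 0) (hℓ : (ℓ : ZMod m) = -1) (hW : ∀ γ, t.2.2 γ ∈ congPol W)
    (γ : SL(2, ℤ)) (a b : ℤ) :
    (heckeEich hm n t).2.2 γ ![(a : ℂ), (b : ℂ)] -
      ∑ i, t.2.2 (hecRep hm γ i) (mv !![1, 0; 0, -1] ![(a : ℂ), (b : ℂ)]) ∈ mulSub m W := by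
  rw [heckeEich, ← sum_sub_distrib]
  refine sum_mem fun i _ => congPol_congr_sub (hW _) ?_ a b
  rw [hecMat_mod hℓ]
  ext i j
  fin_cases i <;> fin_cases j <;> simp

lemma mem_mulSub_of_addChar (hm0 : 0 < m) (hWf : W.FG) {x : ℂ} (hx : x ∈ W)
    (h : ∀ e : AddChar (W ⧸ (nsmulAddMonoidHom m : W →+ W).range) ℂ, e (QuotientAddGroup.mk ⟨x, hx⟩) = 1) :
    x ∈ mulSub m W := by
  set A := W ⧸ (nsmulAddMonoidHom m : W →+ W).range
  have h1 : AddGroup.FG W := (AddGroup.fg_iff_addSubgroup_fg W).mpr hWf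
  have h2 : ∀ a : A, m • a = 0 := fun a => by
    induction a using QuotientAddGroup.induction_on with
    | H w => exact (QuotientAddGroup.eq_zero_iff (N := (nsmulAddMonoidHom m : W →+ W).range) _).mpr ⟨w, rfl⟩
  have h3 : Finite A := AddCommGroup.finite_of_fg_isAddTorsion A fun a =>
    isOfFinAddOrder_iff_nsmul_eq_zero.mpr ⟨m, hm0, h2 a⟩
  have h4 : (QuotientAddGroup.mk ⟨x, hx⟩ : A) = 0 := by
    by_contra h5
    obtain ⟨e, he⟩ := AddChar.exists_apply_ne_zero.mpr h5
    exact he (h e)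
  obtain ⟨w, hw⟩ := (QuotientAddGroup.eq_zero_iff _).mp h4
  exact ⟨w, w.2, by simpa using congrArg Subtype.val hw⟩

lemma hecke_cocycle_mem_mulSub (hm0 : 0 < m) (hm : (m : ZMod ℓ) ≠ 0) (hℓ : (ℓ : ZMod m) = -1) (ht : t ∈ eichler n)
    (hWf : W.FG) (hW : ∀ γ, t.2.2 γ ∈ congPol W)
    (hD : ∀ χ : Gamma m →* ℂ, (∀ γ, χ γ ^ m = 1) → hecChar hm hℓ χ = 1) {γ : SL(2, ℤ)} (hγ : γ ∈ Gamma m) (a b : ℤ) :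
    (heckeEich hm n t).2.2 γ ![(a : ℂ), (b : ℂ)] ∈ mulSub m W := by
  rw [← sub_add_cancel ((heckeEich hm n t).2.2 γ ![(a : ℂ), (b : ℂ)])]
  refine add_mem (hecke_cocycle_sub_mem hm hℓ hW γ a b) ?_
  rw [mv_int]
  generalize (!![1, 0; 0, -1] : Matrix (Fin 2) (Fin 2) ℤ) 0 0 * a + _ = a'
  generalize (!![1, 0; 0, -1] : Matrix (Fin 2) (Fin 2) ℤ) 1 0 * a + _ = b'
  have h1 : ∀ γ, t.2.2 γ ![(a' : ℂ), (b' : ℂ)] ∈ W := fun γ => (hW γ).1 a' b'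
  refine mem_mulSub_of_addChar hm0 hWf (sum_mem fun i _ => h1 _) fun e => ?_
  let c : SL(2, ℤ) → W ⧸ (nsmulAddMonoidHom m : W →+ W).range := fun γ => QuotientAddGroup.mk ⟨_, h1 γ⟩
  have hc : ∀ γ δ, δ ∈ Gamma m → c (γ * δ) = c γ + c δ := fun γ δ hδ => by
    obtain ⟨w, hw, h⟩ := cocycle_mul_sub_mem (γ := γ) ht hW hδ a' b'
    rw [← sub_eq_zero]
    exact (QuotientAddGroup.eq_zero_iff (N := (nsmulAddMonoidHom m : W →+ W).range)
      (⟨_, h1 (γ * δ)⟩ - (⟨_, h1 γ⟩ + ⟨_, h1 δ⟩))).mpr ⟨⟨w, hw⟩, Subtype.ext (by simpa using h)⟩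
  have hc1 : c 1 = 0 := by simpa using hc 1 1 (one_mem _)
  let χ : Gamma m →* ℂ :=
    { toFun γ := e (c γ)
      map_one' := by simp [hc1]
      map_mul' γ δ := by rw [Subgroup.coe_mul, hc _ _ δ.2, AddChar.map_add_eq_mul] }
  have h2 := DFunLike.congr_fun (hD χ fun γ => by
    change e (c γ) ^ m = 1
    rw [← AddChar.map_nsmul_eq_pow]
    convert AddChar.map_zero_eq_one e
    exact (QuotientAddGroup.eq_zero_iff (N := (nsmulAddMonoidHom m : W →+ W).range) (m • ⟨_, h1 γ⟩)).mpr ⟨_, rfl⟩) ⟨γ, hγ⟩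
  change ∏ i, e (c (hecRep hm γ i)) = 1 at h2
  have h3 : e (∑ i, c (hecRep hm γ i)) = ∏ i, e (c (hecRep hm γ i)) :=
    map_prod e.toMonoidHom (fun i => Multiplicative.ofAdd (c (hecRep hm γ i))) univ
  rw [← h3] at h2
  convert h2 using 2
  let w : Option (ZMod ℓ) → W := fun i => ⟨_, h1 (hecRep hm γ i)⟩
  have h4 := map_sum (QuotientAddGroup.mk' (nsmulAddMonoidHom m : W →+ W).range) w univ
  refine Eq.trans (congrArg _ (Subtype.ext ?_)) h4
  simp [w]

end

lemma hecke_hecke_cocycle_mem_mulSub {ℓ ℓ' : ℕ} [Fact ℓ.Prime] [Fact ℓ'.Prime] (hm0 : 0 < m) (hm : (m : ZMod ℓ) ≠ 0)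
    (hℓ : (ℓ : ZMod m) = -1) (hm' : (m : ZMod ℓ') ≠ 0)
    (hℓ' : (ℓ' : ZMod m) = -1) (hn : Even n) (ht : t ∈ eichler n)
    (hWf : W.FG) (hW : ∀ γ, t.2.2 γ ∈ congPol W)
    (hD : ∀ χ : Gamma m →* ℂ, (∀ γ, χ γ ^ m = 1) → hecChar hm hℓ χ = 1) (γ : SL(2, ℤ)) (a b : ℤ) :
    (heckeEich hm' n (heckeEich hm n t)).2.2 γ ![(a : ℂ), (b : ℂ)] ∈ mulSub m W := by
  have hs := heckeEich_mem hm hn ht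
  have hsW := hecke_cocycle_mem_congPol (n := n) hm hW
  have hsm := fun {γ} hγ => hecke_cocycle_mem_mulSub (γ := γ) hm0 hm hℓ ht hWf hW hD hγ
  generalize heckeEich hm n t = s at *
  rw [← sub_add_cancel ((heckeEich hm' n s).2.2 γ ![(a : ℂ), (b : ℂ)])]
  refine add_mem (hecke_cocycle_sub_mem hm' hℓ' hsW γ a b) ?_
  rw [mv_int]
  generalize (!![1, 0; 0, -1] : Matrix (Fin 2) (Fin 2) ℤ) 0 0 * a + _ = a'
  generalize (!![1, 0; 0, -1] : Matrix (Fin 2) (Fin 2) ℤ) 1 0 * a + _ = b'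
  set γ₀ := hecRep hm' γ none
  have h1 : ∀ i, s.2.2 (hecRep hm' γ i) ![(a' : ℂ), (b' : ℂ)] - s.2.2 γ₀ ![(a' : ℂ), (b' : ℂ)] ∈ mulSub m W := fun i => by
    have hδ : γ₀⁻¹ * hecRep hm' γ i ∈ Gamma m := by
      rw [Gamma_mem', map_mul, map_inv, inv_mul_eq_one]
      ext r c
      have h := (hecRep_mod hm' hℓ' γ none).trans (hecRep_mod hm' hℓ' γ i).symm
      exact congrFun (congrFun h r) c
    have := add_mem (cocycle_mul_sub_mem (γ := γ₀) hs hsW hδ a' b') (hsm hδ a' b')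
    rw [mul_inv_cancel_left] at this
    convert this using 1
    ring
  have h2 := sum_mem (S := mulSub m W) (t := univ) fun i _ => h1 i
  rw [sum_sub_distrib, sum_const, card_univ, Fintype.card_option, ZMod.card] at h2
  rw [← sub_add_cancel (∑ i, _)]
  refine add_mem h2 ?_
  obtain ⟨k, hk⟩ : m ∣ ℓ' + 1 := (ZMod.natCast_eq_zero_iff _ _).mp (by push_cast; rw [hℓ']; ring)
  rw [hk]
  exact ⟨k • s.2.2 γ₀ ![(a' : ℂ), (b' : ℂ)], nsmul_mem ((hsW _).1 a' b') k, by simp [mul_assoc]⟩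

end MacMahon

namespace MacMahon
open scoped MatrixGroups Manifold UpperHalfPlane
open UpperHalfPlane PowerSeries CongruenceSubgroup

/-- The Lagrange basis at the nodes `0, …, n`. -/
noncomputable def lagr (n j : ℕ) : Polynomial ℂ := Lagrange.basis (range (n + 1)) (fun j : ℕ => (j : ℂ)) j

lemma poly_eq_sum_lagr {n : ℕ} {P : Polynomial ℂ} (hP : P.degree < (n + 1 : ℕ)) :
    P = ∑ j ∈ range (n + 1), Polynomial.C (P.eval (j : ℂ)) * lagr n j := by
  have h := Lagrange.eq_interpolate (f := P) (s := range (n + 1)) (v := fun j : ℕ => (j : ℂ))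
    Nat.cast_injective.injOn (by simpa using hP)
  rwa [Lagrange.interpolate_apply] at h

lemma pol_eq_sum_lagr {n : ℕ} {p : (Fin 2 → ℂ) → ℂ} (hp : p ∈ pol n) (x : ℂ) :
    p ![x, 1] = ∑ j ∈ range (n + 1), p ![(j : ℂ), 1] * (lagr n j).eval x := by
  obtain ⟨P, hP, h⟩ := pol_eq_eval hp
  rw [h]
  conv_lhs => rw [poly_eq_sum_lagr hP, Polynomial.eval_finsetSum]
  simp [h]

lemma pol_eq_zero {n : ℕ} {p : (Fin 2 → ℂ) → ℂ} (hp : p ∈ pol n) (h : ∀ j ≤ n, p ![(j : ℂ), 1] = 0) : p = 0 := by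
  have h1 : ∀ a b : ℂ, b ≠ 0 → p ![a, b] = 0 := fun a b hb => by
    have h2 : p ![a / b, 1] = 0 := by
      rw [pol_eq_sum_lagr hp]
      exact sum_eq_zero fun j hj => by rw [h j (by simpa [Nat.lt_succ_iff] using hj), zero_mul]
    have h3 := pol_smul hp b ![a / b, 1]
    rw [h2, mul_zero] at h3
    convert h3 using 2
    ext i
    fin_cases i <;> simp [mul_div_cancel₀ _ hb]
  have hc : Continuous p := by
    clear h h1
    induction hp using Submodule.span_induction with
    | mem p h =>
      obtain ⟨i, j, -, rfl⟩ := h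
      fun_prop
    | zero => exact continuous_const
    | add p q _ _ hp hq => exact hp.add hq
    | smul c p _ hp => exact hp.const_smul c
  ext v
  have h2 : v = ![v 0, v 1] := by ext i; fin_cases i <;> rfl
  rw [h2, Pi.zero_apply]
  have h3 : Continuous fun b : ℂ => p ![v 0, b] := hc.comp (by fun_prop)
  exact congrFun (h3.ext_on (dense_compl_singleton (0 : ℂ)) (continuous_const (y := (0 : ℂ))) fun b hb => h1 _ b hb) (v 1)

lemma mv_coe_one (γ : SL(2, ℤ)) (z : ℍ) :
    mv γ ![(z : ℂ), 1] = denom γ z • ![((γ • z : ℍ) : ℂ), 1] := by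
  have h := denom_ne_zero γ z
  ext i
  fin_cases i
  · simp only [Fin.zero_eta, Pi.smul_apply, smul_eq_mul, Matrix.cons_val_zero]
    rw [coe_specialLinearGroup_apply, ModularGroup.denom_apply] at *
    simp only [algebraMap_int_eq, eq_intCast, Complex.ofReal_intCast] at *
    rw [mul_div_cancel₀ _ h]
    simp [mv]
  · simp [mv, ModularGroup.denom_apply]

section

variable {n : ℕ} {t : ℂ⟦X⟧ × ((Fin 2 → ℂ) → ℍ → ℂ) × (SL(2, ℤ) → (Fin 2 → ℂ) → ℂ)}

lemma diag_smul (ht : t ∈ eichler n) {γ : SL(2, ℤ)} (h0 : t.2.2 γ = 0) (z : ℍ) :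
    t.2.1 ![(z : ℂ), 1] z = denom γ z ^ n * t.2.1 ![((γ • z : ℍ) : ℂ), 1] (γ • z) := by
  have h := ht.2.2 γ ![(z : ℂ), 1] z
  rw [mv_coe_one, pol_smul (ht.1 (γ • z)), h0, Pi.zero_apply, add_zero] at h
  exact h.symm

lemma eichler_growth (ht : t ∈ eichler n) :
    ∃ A C : ℝ, 1 ≤ A ∧ ∀ z : ℍ, |z.re| ≤ 1 → A ≤ z.im → ‖t.2.1 ![(z : ℂ), 1] z‖ ≤ C * z.im ^ (2 * n + 1) := by
  obtain ⟨hp, ⟨g, hg, hd⟩, -⟩ := ht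
  obtain ⟨M, A, hA⟩ := isBoundedAtImInfty_iff.mp
    (isBoundedAtImInfty_of_hasSum_qExpansion (h := 1) one_pos fun z => by simpa [qpar] using hg z)
  set B := max A 1 with hB
  have hB1 : 1 ≤ B := le_max_right _ _
  have hB0 : 0 < B := by linarith
  have hM : 0 ≤ M := (norm_nonneg _).trans (hA ⟨Complex.I * B, by simpa using hB0⟩ (by simp [UpperHalfPlane.im, hB]))
  set z₀ : ℍ := ⟨Complex.I * B, by simpa using hB0⟩ with hz₀
  have hz : ∀ z : ℍ, |z.re| ≤ 1 → B ≤ z.im → ‖(z : ℂ)‖ ≤ 2 * z.im := fun z h1 h2 => by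
    refine (Complex.norm_le_abs_re_add_abs_im _).trans ?_
    have : |(z : ℂ).im| = z.im := abs_of_pos z.im_pos
    have : |(z : ℂ).re| ≤ 1 := h1
    linarith
  have h1 : ∀ j ∈ range (n + 1), ∃ C, 0 ≤ C ∧ ∀ z : ℍ, |z.re| ≤ 1 → B ≤ z.im →
      ‖t.2.1 ![(j : ℂ), 1] z‖ ≤ C * z.im ^ (n + 1) := fun j hj => by
    refine ⟨‖t.2.1 ![(j : ℂ), 1] z₀‖ + M * (j + 2) ^ n * 4, by positivity, fun z hz1 hz2 => ?_⟩
    set y := z.im with hy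
    let s : Set ℂ := {w | |w.re| ≤ 1} ∩ ({w | B ≤ w.im} ∩ {w | w.im ≤ y})
    have hs : Convex ℝ s := by
      refine Convex.inter ?_ ((convex_halfSpace_im_ge B).inter (convex_halfSpace_im_le y))
      convert (convex_halfSpace_re_ge (-1 : ℝ)).inter (convex_halfSpace_re_le (1 : ℝ)) using 1
      ext w
      simp [abs_le]
    have h2 : ∀ w ∈ s, ∃ d, HasDerivAt (t.2.1 ![(j : ℂ), 1] ∘ ofComplex) d w ∧ ‖d‖ ≤ M * ((j + 2) * y) ^ n := by
      intro w hw
      have hw1 := hw.2.1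
      have hw2 := hw.2.2
      simp only [Set.mem_ofPred_eq] at hw1 hw2
      have hw0 : 0 < w.im := hB0.trans_le hw1
      refine ⟨_, hd ![(j : ℂ), 1] ⟨w, hw0⟩, ?_⟩
      rw [norm_mul, norm_pow]
      gcongr
      · exact hA _ ((le_max_left _ _).trans hw1)
      · have := hz ⟨w, hw0⟩ hw.1 hw1
        simp only [Matrix.cons_val_zero, Matrix.cons_val_one, Matrix.cons_val_fin_one, mul_one]
        refine (norm_sub_le _ _).trans ?_
        simp only [Complex.norm_natCast]
        have h3 : (UpperHalfPlane.im ⟨w, hw0⟩) ≤ y := hw2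
        have h4 : (j : ℝ) ≤ j * y := le_mul_of_one_le_right (by positivity) (hB1.trans hz2)
        change ‖w‖ ≤ 2 * w.im at this
        linarith
    choose! d hd1 hd2 using h2
    have h5 := hs.norm_image_sub_le_of_norm_hasDerivWithin_le (fun w hw => (hd1 w hw).hasDerivWithinAt) hd2
      (x := (z₀ : ℂ)) (y := (z : ℂ)) ⟨by simp [hz₀], by simp [hz₀], by simpa [hz₀] using hz2⟩ ⟨hz1, hz2, (le_refl y : z.im ≤ y)⟩
    simp only [Function.comp_apply, ofComplex_apply] at h5
    have hy1 : 1 ≤ y := hB1.trans hz2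
    have h6 : ‖(z : ℂ) - z₀‖ ≤ 4 * y := by
      refine (norm_sub_le _ _).trans ?_
      have h7 := hz z hz1 hz2
      have h8 : ‖(z₀ : ℂ)‖ = B := by simp [hz₀, abs_of_pos hB0]
      linarith
    have h9 : ‖t.2.1 ![(j : ℂ), 1] z‖ ≤ ‖t.2.1 ![(j : ℂ), 1] z₀‖ + M * ((j + 2) * y) ^ n * (4 * y) := by
      have := norm_le_norm_add_norm_sub' (t.2.1 ![(j : ℂ), 1] z) (t.2.1 ![(j : ℂ), 1] z₀)
      have h10 : M * ((j + 2) * y) ^ n * ‖(z : ℂ) - z₀‖ ≤ M * ((j + 2) * y) ^ n * (4 * y) := by gcongr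
      linarith
    refine h9.trans ?_
    rw [add_mul ‖_‖]
    have h11 : ‖t.2.1 ![(j : ℂ), 1] z₀‖ ≤ ‖t.2.1 ![(j : ℂ), 1] z₀‖ * y ^ (n + 1) :=
      le_mul_of_one_le_right (norm_nonneg _) (one_le_pow₀ hy1)
    refine add_le_add h11 (le_of_eq ?_)
    rw [mul_pow]; ring
  choose! C hC0 hC using h1
  have h2 : ∀ P : Polynomial ℂ, P.natDegree ≤ n → ∃ K, 0 ≤ K ∧ ∀ z : ℍ, |z.re| ≤ 1 → B ≤ z.im →
      ‖P.eval (z : ℂ)‖ ≤ K * z.im ^ n := fun P hP => by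
    refine ⟨∑ i ∈ range (P.natDegree + 1), ‖P.coeff i‖ * 2 ^ i, by positivity, fun z h1 h2 => ?_⟩
    rw [Polynomial.eval_eq_sum_range, sum_mul]
    refine (norm_sum_le _ _).trans (sum_le_sum fun i hi => ?_)
    rw [norm_mul, norm_pow, mul_assoc]
    gcongr
    calc ‖(z : ℂ)‖ ^ i ≤ (2 * z.im) ^ i := by gcongr; exact hz z h1 h2
      _ = 2 ^ i * z.im ^ i := mul_pow _ _ _
      _ ≤ 2 ^ i * z.im ^ n := by
        gcongr
        · exact hB1.trans h2
        · have := mem_range.mp hi; omega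
  have h3 : ∀ j ∈ range (n + 1), (lagr n j).natDegree ≤ n := fun j hj => by
    refine (Polynomial.natDegree_le_iff_degree_le).mpr ?_
    rw [lagr, Lagrange.degree_basis Nat.cast_injective.injOn hj]
    simp
  choose! K hK0 hK using fun j hj => h2 (lagr n j) (h3 j hj)
  refine ⟨B, ∑ j ∈ range (n + 1), C j * K j, hB1, fun z h4 h5 => ?_⟩
  rw [pol_eq_sum_lagr (hp z), sum_mul]
  refine (norm_sum_le _ _).trans (sum_le_sum fun j hj => ?_)
  rw [norm_mul]
  calc _ ≤ (C j * z.im ^ (n + 1)) * (K j * z.im ^ n) :=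
        mul_le_mul (hC j hj z h4 h5) (hK j hj z h4 h5) (norm_nonneg _) (mul_nonneg (hC0 j hj) (by positivity))
    _ = _ := by ring

lemma diag_hasDerivAt {g : ℍ → ℂ}
    (hd : ∀ v (z : ℍ), HasDerivAt (t.2.1 v ∘ ofComplex) (g z * (v 0 - z * v 1) ^ n) z) (k : ℕ) (z : ℍ) :
    HasDerivAt (fun w : ℂ => ∑ j ∈ range (n + 1), t.2.1 ![(j : ℂ), 1] (ofComplex w) *
      ((Polynomial.derivative^[k] (lagr n j)).eval w))
      ((∑ j ∈ range (n + 1), t.2.1 ![(j : ℂ), 1] z * ((Polynomial.derivative^[k + 1] (lagr n j)).eval (z : ℂ))) +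
        g z * (n.descFactorial k * 0 ^ (n - k))) z := by
  have h1 : ∑ j ∈ range (n + 1), ((j : ℂ) - z) ^ n * (Polynomial.derivative^[k] (lagr n j)).eval (z : ℂ) =
      n.descFactorial k * 0 ^ (n - k) := by
    have h2 : ((Polynomial.X - Polynomial.C (z : ℂ)) ^ n).degree < ((n + 1 : ℕ) : WithBot ℕ) := by
      rw [Polynomial.degree_pow, Polynomial.degree_X_sub_C]
      simp only [nsmul_eq_mul, mul_one]
      exact_mod_cast n.lt_succ_self
    have h3 := congrArg (fun P => (Polynomial.derivative^[k] P).eval (z : ℂ)) (poly_eq_sum_lagr h2)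
    simp only [Polynomial.iterate_derivative_X_sub_pow, Polynomial.iterate_derivative_sum,
      Polynomial.iterate_derivative_C_mul, Polynomial.eval_finsetSum] at h3
    simpa using h3.symm
  rw [← h1, mul_sum, ← sum_add_distrib]
  refine HasDerivAt.fun_sum fun j _ => ?_
  have h4 := (hd ![(j : ℂ), 1] z).mul (Polynomial.hasDerivAt (Polynomial.derivative^[k] (lagr n j)) (z : ℂ))
  refine h4.congr_deriv ?_
  rw [← Function.iterate_succ_apply' Polynomial.derivative]
  simp
  ring

lemma eichler_eq_zero_of_diag (ht : t ∈ eichler n) (h0 : ∀ z : ℍ, t.2.1 ![(z : ℂ), 1] z = 0) : t.1 = 0 := by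
  obtain ⟨hp, ⟨g, hg, hd⟩, -⟩ := id ht
  have h1 : ∀ k ≤ n, ∀ z : ℍ, ∑ j ∈ range (n + 1), t.2.1 ![(j : ℂ), 1] z *
      ((Polynomial.derivative^[k] (lagr n j)).eval (z : ℂ)) = 0 ∧ 
      (∑ j ∈ range (n + 1), t.2.1 ![(j : ℂ), 1] z * ((Polynomial.derivative^[k + 1] (lagr n j)).eval (z : ℂ))) +
        g z * (n.descFactorial k * 0 ^ (n - k)) = 0 := by
    have h2 : ∀ k, (∀ z : ℍ, ∑ j ∈ range (n + 1), t.2.1 ![(j : ℂ), 1] z *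
        ((Polynomial.derivative^[k] (lagr n j)).eval (z : ℂ)) = 0) → ∀ z : ℍ,
        (∑ j ∈ range (n + 1), t.2.1 ![(j : ℂ), 1] z * ((Polynomial.derivative^[k + 1] (lagr n j)).eval (z : ℂ))) +
        g z * (n.descFactorial k * 0 ^ (n - k)) = 0 := fun k h z => by
      refine (diag_hasDerivAt hd k z).unique ((hasDerivAt_const (z : ℂ) (0 : ℂ)).congr_of_eventuallyEq ?_)
      filter_upwards [isOpen_upperHalfPlaneSet.mem_nhds z.im_pos] with w hw
      have := h ⟨w, hw⟩
      rw [ofComplex_apply_of_im_pos hw]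
      exact this
    intro k
    induction k with
    | zero =>
      intro _
      have h3 : ∀ z : ℍ, ∑ j ∈ range (n + 1), t.2.1 ![(j : ℂ), 1] z *
          ((Polynomial.derivative^[0] (lagr n j)).eval (z : ℂ)) = 0 := fun z =>
        (pol_eq_sum_lagr (hp z) z).symm.trans (h0 z)
      exact fun z => ⟨h3 z, h2 0 h3 z⟩
    | succ k ih =>
      intro hk
      have h3 := fun z => (ih (by omega) z).2
      simp only [zero_pow (show n - k ≠ 0 by omega), mul_zero, add_zero] at h3
      exact fun z => ⟨h3 z, h2 _ h3 z⟩
  have h4 : ∀ z, g z = 0 := fun z => by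
    have h5 := (h1 n le_rfl z).2
    rw [sum_eq_zero, Nat.descFactorial_self] at h5
    · simpa [Nat.factorial_ne_zero] using h5
    · intro j hj
      rw [Polynomial.iterate_derivative_eq_zero, Polynomial.eval_zero, mul_zero]
      refine Nat.lt_succ_of_le ((Polynomial.natDegree_le_iff_degree_le).mpr ?_)
      rw [lagr, Lagrange.degree_basis Nat.cast_injective.injOn hj]
      simp
  exact hg.unique one_pos fun z => by simp [h4]

lemma eichler_injective (hn : 0 < n) (ht : t ∈ eichler n) (hS : ∀ j ≤ n, t.2.2 ModularGroup.S ![(j : ℂ), 1] = 0)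
    (hT : ∀ j ≤ n, t.2.2 ModularGroup.T ![(j : ℂ), 1] = 0) : t.1 = 0 := by
  have hφ : ∀ γ, t.2.2 γ = 0 := fun γ => by
    have h := cocycle_mem_congPol ht (W := ⊥) (by rw [pol_eq_zero (cocycle_mem_pol ht _) hS]; exact zero_mem _)
      (by rw [pol_eq_zero (cocycle_mem_pol ht _) hT]; exact zero_mem _) γ
    exact pol_eq_zero (cocycle_mem_pol ht _) fun j _ => by simpa using h.1 j 1
  have hE := fun γ z => diag_smul ht (hφ γ) z
  obtain ⟨g, hg, hd⟩ := ht.2.1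
  have hslash : ∀ γ : SL(2, ℤ), SlashAction.map (-n + 12 : ℤ) γ
      (fun z : ℍ => t.2.1 ![(z : ℂ), 1] z * ModularForm.discriminant z) =
      fun z : ℍ => t.2.1 ![(z : ℂ), 1] z * ModularForm.discriminant z := fun γ => by
    ext z
    have h := denom_ne_zero γ z
    rw [ModularForm.SL_slash_apply, hE γ z, ← discriminant_smul γ z, neg_add, neg_neg, zpow_add₀ h, zpow_natCast]
    ring
  have hzero : IsZeroAtImInfty fun z : ℍ => t.2.1 ![(z : ℂ), 1] z * ModularForm.discriminant z := by
    obtain ⟨A, C, hA, hC⟩ := eichler_growth ht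
    have hΔ : ModularForm.discriminant =O[atImInfty] fun z : ℍ => Real.exp (-2 * Real.pi * z.im / 1) :=
      CuspFormClass.exp_decay_atImInfty (h := 1) CuspForm.discriminant one_pos one_mem_strictPeriods_SL
    obtain ⟨K, hK0, hK⟩ := hΔ.exists_pos
    obtain ⟨A', hA'⟩ := (atImInfty_mem _).mp hK.bound
    have hlim := (Real.tendsto_pow_mul_exp_neg_atTop_nhds_zero (2 * n + 1)).const_mul (|C| * K)
    rw [mul_zero] at hlim
    refine isZeroAtImInfty_iff.mpr fun ε hε => ?_
    obtain ⟨B, hB⟩ := Filter.eventually_atTop.mp (hlim.eventually (gt_mem_nhds hε))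
    refine ⟨max B (max A A'), fun z hz => ?_⟩
    have h1 := congrFun (hslash (ModularGroup.T ^ (-round z.re))) z
    rw [ModularForm.SL_slash_apply, show denom (ModularGroup.T ^ (-round z.re) : SL(2, ℤ)) z = 1 by
      rw [ModularGroup.denom_apply, ModularGroup.coe_T_zpow]; simp, one_zpow, mul_one] at h1
    rw [← h1]
    have h2 : (ModularGroup.T ^ (-round z.re) • z).im = z.im := by
      rw [modular_T_zpow_smul, vadd_im]
    have h3 : |(ModularGroup.T ^ (-round z.re) • z).re| ≤ 1 := by
      rw [modular_T_zpow_smul, vadd_re, Int.cast_neg, neg_add_eq_sub]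
      exact (abs_sub_round _).trans (by norm_num)
    generalize ModularGroup.T ^ (-round z.re) • z = w at *
    rw [← h2] at hz
    have hz1 : B ≤ w.im := (le_max_left _ _).trans hz
    have hz2 : A ≤ w.im := ((le_max_left _ _).trans (le_max_right _ _)).trans hz
    have hz3 : A' ≤ w.im := ((le_max_right _ _).trans (le_max_right _ _)).trans hz
    have h4 := hA' w hz3
    simp only [Set.mem_ofPred_eq, div_one, Real.norm_eq_abs, Real.abs_exp] at h4
    have h5 : Real.exp (-2 * Real.pi * w.im) ≤ Real.exp (-w.im) := by
      refine Real.exp_le_exp.mpr ?_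
      have := mul_le_mul_of_nonneg_right Real.pi_gt_three.le w.im_pos.le
      linarith [w.im_pos]
    rw [norm_mul]
    calc _ ≤ (|C| * w.im ^ (2 * n + 1)) * (K * Real.exp (-w.im)) := by
          refine mul_le_mul ((hC w h3 hz2).trans ?_) (h4.trans (by gcongr)) (norm_nonneg _)
            (mul_nonneg (abs_nonneg _) (pow_nonneg w.im_pos.le _))
          exact mul_le_mul_of_nonneg_right (le_abs_self _) (pow_nonneg w.im_pos.le _)
      _ = |C| * K * (w.im ^ (2 * n + 1) * Real.exp (-w.im)) := by ring
      _ ≤ ε := (hB _ hz1).le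
  let f : CuspForm 𝒮ℒ (-n + 12) :=
    { toFun := fun z => t.2.1 ![(z : ℂ), 1] z * ModularForm.discriminant z
      slash_action_eq' := by
        rintro _ ⟨γ, rfl⟩
        exact hslash γ
      holo' := by
        refine MDifferentiable.mul ?_ CuspForm.discriminant.holo'
        rw [UpperHalfPlane.mdifferentiable_iff]
        intro w hw
        refine (((diag_hasDerivAt hd 0 ⟨w, hw⟩).congr_of_eventuallyEq ?_).differentiableAt).differentiableWithinAt
        filter_upwards [isOpen_upperHalfPlaneSet.mem_nhds hw] with x hx
        have := pol_eq_sum_lagr (ht.1 (ofComplex x)) x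
        simpa [ofComplex_apply_of_im_pos hx] using this
      zero_at_cusps' := by
        intro c hc
        rw [Subgroup.IsArithmetic.isCusp_iff_isCusp_SL2Z] at hc
        rw [OnePoint.isZeroAt_iff_forall_SL2Z hc]
        intro γ _
        rw [hslash]
        exact hzero }
  refine eichler_eq_zero_of_diag ht fun z => ?_
  have h1 := congrFun (ModularFormClass.levelOne_neg_weight_eq_zero (k := -n + 12 - 12) (by omega)
    (CuspForm.discriminantEquiv f)) z
  change t.2.1 ![(z : ℂ), 1] z * ModularForm.discriminant z / ModularForm.discriminant z = 0 at h1
  rwa [mul_div_cancel_right₀ _ (ModularForm.discriminant_ne_zero z)] at h1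

end

end MacMahon

namespace MacMahon
open scoped MatrixGroups Manifold UpperHalfPlane
open UpperHalfPlane PowerSeries CongruenceSubgroup

lemma exists_primitive {h : ℂ → ℂ} (hh : DifferentiableOn ℂ h {z | 0 < z.im}) :
    ∃ F : ℂ → ℂ, ∀ z : ℍ, HasDerivAt F (h z) z := by
  have hne : ∀ w ∈ Metric.ball (0 : ℂ) 1, 1 - w ≠ 0 := fun w hw h0 => by
    rw [sub_eq_zero] at h0
    simp [← h0] at hw
  have him : ∀ w ∈ Metric.ball (0 : ℂ) 1, 0 < (Complex.I * (1 + w) / (1 - w)).im := fun w hw => by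
    have h1 : Complex.I * (1 + w) / (1 - w) =
        (((Complex.normSq (1 - w))⁻¹ : ℝ) : ℂ) * (Complex.I * (1 + w) * (starRingEnd ℂ) (1 - w)) := by
      rw [div_eq_mul_inv, Complex.inv_def]
      push_cast
      ring
    rw [h1, Complex.im_ofReal_mul]
    refine mul_pos (inv_pos.mpr (Complex.normSq_pos.mpr (hne w hw))) ?_
    have h2 : Complex.normSq w < 1 := by
      rw [mem_ball_zero_iff] at hw
      rw [Complex.normSq_eq_norm_sq]
      exact pow_lt_one₀ (norm_nonneg _) hw two_ne_zero
    rw [Complex.normSq_apply] at h2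
    simp
    nlinarith
  have hd : DifferentiableOn ℂ (fun w => h (Complex.I * (1 + w) / (1 - w)) * (2 * Complex.I / (1 - w) ^ 2))
      (Metric.ball 0 1) := by
    refine DifferentiableOn.mul (hh.comp (t := {z : ℂ | 0 < z.im}) ?_ him) ?_
    · exact fun w hw => ((by fun_prop : DifferentiableAt ℂ (fun w => Complex.I * (1 + w)) w).div (by fun_prop)
        (hne w hw)).differentiableWithinAt
    · exact fun w hw => ((by fun_prop : DifferentiableAt ℂ (fun _ => 2 * Complex.I) w).div
        (by fun_prop : DifferentiableAt ℂ (fun w => (1 - w) ^ 2) w) (pow_ne_zero 2 (hne w hw))).differentiableWithinAt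
  obtain ⟨G, hG⟩ := hd.isExactOn_ball
  refine ⟨fun z => G ((z - Complex.I) / (z + Complex.I)), fun z => ?_⟩
  have h0 : (z : ℂ) + Complex.I ≠ 0 := fun h0 => by
    have := congrArg Complex.im h0
    have := z.im_pos
    simp at *
    linarith
  have hz : ((z : ℂ) - Complex.I) / (z + Complex.I) ∈ Metric.ball (0 : ℂ) 1 := by
    rw [mem_ball_zero_iff, norm_div, div_lt_one (norm_pos_iff.mpr h0), ← sq_lt_sq₀ (norm_nonneg _) (norm_nonneg _),
      ← Complex.normSq_eq_norm_sq, ← Complex.normSq_eq_norm_sq, Complex.normSq_apply, Complex.normSq_apply]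
    have := z.im_pos
    simp
    nlinarith
  have h1 : HasDerivAt (fun w : ℂ => (w - Complex.I) / (w + Complex.I)) (2 * Complex.I / (z + Complex.I) ^ 2) (z : ℂ) := by
    refine (((hasDerivAt_id (z : ℂ)).sub_const Complex.I).div ((hasDerivAt_id (z : ℂ)).add_const Complex.I) h0).congr_deriv ?_
    simp only [id]
    ring
  refine ((hG _ hz).comp (z : ℂ) h1).congr_deriv ?_
  have h2 : 1 - ((z : ℂ) - Complex.I) / (z + Complex.I) = 2 * Complex.I / (z + Complex.I) := by field_simp; ring
  have h3 : Complex.I * (1 + ((z : ℂ) - Complex.I) / (z + Complex.I)) / (1 - ((z : ℂ) - Complex.I) / (z + Complex.I)) = z := by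
    rw [h2]
    field_simp
    ring
  beta_reduce
  rw [h3, h2]
  field_simp

lemma mv_sub_smul (γ : SL(2, ℤ)) (z : ℍ) (v : Fin 2 → ℂ) :
    mv γ v 0 - (γ • z : ℍ) * mv γ v 1 = (v 0 - z * v 1) / (γ 1 0 * z + γ 1 1) := by
  have h0 : (γ 1 0 * z + γ 1 1 : ℂ) ≠ 0 := by simpa [denom] using denom_ne_zero γ z
  have hd : (γ 0 0 * γ 1 1 - γ 0 1 * γ 1 0 : ℂ) = 1 := by
    have := γ.2
    rw [Matrix.det_fin_two] at this
    exact_mod_cast this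
  rw [coe_specialLinearGroup_apply]
  simp only [mv, Matrix.cons_val_zero, Matrix.cons_val_one, Matrix.cons_val_fin_one, algebraMap_int_eq, eq_intCast,
    Complex.ofReal_intCast]
  rw [eq_div_iff h0, sub_mul, mul_right_comm, div_mul_cancel₀ _ h0]
  linear_combination (v 0 - z * v 1) * hd

lemma hasDerivAt_smul (γ : SL(2, ℤ)) (z : ℍ) :
    HasDerivAt (fun w : ℂ => ((γ • ofComplex w : ℍ) : ℂ)) (1 / (γ 1 0 * z + γ 1 1) ^ 2) (z : ℂ) := by
  have h0 : (γ 1 0 * z + γ 1 1 : ℂ) ≠ 0 := by simpa [denom] using denom_ne_zero γ z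
  have hd : (γ 0 0 * γ 1 1 - γ 0 1 * γ 1 0 : ℂ) = 1 := by
    have := γ.2
    rw [Matrix.det_fin_two] at this
    exact_mod_cast this
  have h1 : HasDerivAt (fun w : ℂ => (γ 0 0 * w + γ 0 1) / (γ 1 0 * w + γ 1 1)) (1 / (γ 1 0 * z + γ 1 1) ^ 2) (z : ℂ) := by
    refine ((((hasDerivAt_id (z : ℂ)).const_mul _).add_const _).div
      (((hasDerivAt_id (z : ℂ)).const_mul _).add_const _) h0).congr_deriv ?_
    simp only [id]
    congr 1
    linear_combination hd
  refine h1.congr_of_eventuallyEq ?_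
  filter_upwards [isOpen_upperHalfPlaneSet.mem_nhds z.im_pos] with w hw
  rw [coe_specialLinearGroup_apply, ofComplex_apply_of_im_pos hw]
  simp

lemma exists_mem_eichler {n : ℕ} {p : ℂ⟦X⟧} {g : ℍ → ℂ} (hp : HasExp 1 p g) (hg : MDiff g)
    (hs : ∀ (γ : SL(2, ℤ)) (z : ℍ), g (γ • z) = (γ 1 0 * z + γ 1 1) ^ (n + 2) * g z) : ∃ t ∈ eichler n, t.1 = p := by
  rw [mdifferentiable_iff] at hg
  have hF : ∀ i : ℕ, ∃ F : ℂ → ℂ, ∀ z : ℍ, HasDerivAt F ((g ∘ ofComplex) z * (z : ℂ) ^ i) z := fun i =>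
    exists_primitive (h := fun z => (g ∘ ofComplex) z * z ^ i) (hg.mul (by fun_prop))
  choose F hF using hF
  let Φ : (Fin 2 → ℂ) → ℍ → ℂ := fun v z => ∑ i ∈ range (n + 1), (F i z * (-1) ^ i * n.choose i) * (v 0 ^ (n - i) * v 1 ^ i)
  have hΦ : ∀ v (z : ℍ), HasDerivAt (Φ v ∘ ofComplex) (g z * (v 0 - z * v 1) ^ n) z := fun v z => by
    have h1 := HasDerivAt.fun_sum fun i (_ : i ∈ range (n + 1)) =>
      (((hF i z).mul_const ((-1) ^ i)).mul_const (n.choose i : ℂ)).mul_const (v 0 ^ (n - i) * v 1 ^ i)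
    refine (h1.congr_of_eventuallyEq ?_).congr_deriv ?_
    · filter_upwards [isOpen_upperHalfPlaneSet.mem_nhds z.im_pos] with w hw
      simp [Φ, ofComplex_apply_of_im_pos hw]
    · rw [sub_eq_neg_add, add_pow, mul_sum]
      refine sum_congr rfl fun i _ => ?_
      simp only [Function.comp_apply, ofComplex_apply]
      rw [neg_pow (_ * _), mul_pow]
      ring
  refine ⟨(p, Φ, fun γ v => Φ (mv γ v) (γ • I) - Φ v I), ⟨fun z => ?_, ⟨g, hp, hΦ⟩, fun γ v z => ?_⟩, rfl⟩
  · refine (?_ : (∑ i ∈ range (n + 1), (F i z * (-1) ^ i * n.choose i) • fun v : Fin 2 → ℂ => (v 0 ^ (n - i) * v 1 ^ i)) ∈ pol n)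
      |> fun h => by convert h using 1; ext v; simp [Φ, Finset.sum_apply]
    refine sum_mem fun i hi => (pol n).smul_mem _ ?_
    have := monomial_mem_pol (n - i) i
    rwa [Nat.sub_add_cancel (by simpa [Nat.lt_succ_iff] using hi)] at this
  · have h1 : ∀ z : ℍ, HasDerivAt (fun w : ℂ => Φ (mv γ v) (γ • ofComplex w) - Φ v (ofComplex w)) 0 z := fun z => by
      have h0 : (γ 1 0 * z + γ 1 1 : ℂ) ≠ 0 := by simpa [denom] using denom_ne_zero γ z
      have h2 := hΦ (mv γ v) (γ • z)
      have h4 := hasDerivAt_smul γ z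
      have h3 := HasDerivAt.comp (z : ℂ) (h₂ := Φ (mv γ v) ∘ ofComplex) (by rw [ofComplex_apply]; exact h2) h4
      refine ((h3.sub (hΦ v z)).congr_of_eventuallyEq (.of_forall fun w => ?_)).congr_deriv ?_
      · simp
      · rw [hs, mv_sub_smul, div_pow]
        field_simp
        ring
    have h2 := isOpen_upperHalfPlaneSet.is_const_of_deriv_eq_zero (𝕜 := ℂ)
      ((convex_halfSpace_im_gt 0).isPreconnected) (fun w hw => ((h1 ⟨w, hw⟩).differentiableAt).differentiableWithinAt)
      (fun w hw => (h1 ⟨w, hw⟩).deriv) z.im_pos I.im_pos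
    simp only [ofComplex_apply] at h2
    linear_combination h2

lemma exists_mul_coeff_int {n : ℕ} (hn : 0 < n) {W : AddSubgroup ℂ} (hW : W.FG) : ∃ c : ℕ, 0 < c ∧
    ∀ t ∈ eichler n, (∀ j ≤ n, t.2.2 ModularGroup.S ![(j : ℂ), 1] ∈ W) → (∀ j ≤ n, t.2.2 ModularGroup.T ![(j : ℂ), 1] ∈ W) →
      (∃ K : ℕ, 0 < K ∧ ∀ i, ∃ a : ℤ, K * coeff i t.1 = a) → ∀ i, ∃ a : ℤ, c * coeff i t.1 = a := by
  have : Module.Finite ℤ W := by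
    rw [Module.Finite.iff_addGroup_fg]
    exact (AddGroup.fg_iff_addSubgroup_fg _).mpr hW
  let A : ℕ → AddSubgroup (Bool × Fin (n + 1) → W) := fun k =>
    { carrier := {w | ∃ t ∈ eichler n, (∀ x, t.2.2 (if x.1 then ModularGroup.S else ModularGroup.T) ![((x.2 : ℕ) : ℂ), 1] = w x) ∧
        ∀ i, ∃ a : ℤ, (k.factorial : ℂ) * coeff i t.1 = a}
      add_mem' := by
        rintro w w' ⟨t, ht, h1, h2⟩ ⟨t', ht', h1', h2'⟩
        refine ⟨t + t', add_mem ht ht', fun x => ?_, fun i => ?_⟩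
        · simpa using congrArg₂ (· + ·) (h1 x) (h1' x)
        · obtain ⟨a, ha⟩ := h2 i
          obtain ⟨a', ha'⟩ := h2' i
          exact ⟨a + a', by simp [mul_add, ha, ha']⟩
      zero_mem' := ⟨0, zero_mem _, by simp, fun i => ⟨0, by simp⟩⟩
      neg_mem' := by
        rintro w ⟨t, ht, h1, h2⟩
        refine ⟨-t, neg_mem ht, fun x => ?_, fun i => ?_⟩
        · simpa using h1 x
        · obtain ⟨a, ha⟩ := h2 i
          exact ⟨-a, by simp [ha]⟩ }
  have hA : Monotone fun k => AddSubgroup.toIntSubmodule (A k) := by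
    rintro k k' hk w ⟨t, ht, h1, h2⟩
    refine ⟨t, ht, h1, fun i => ?_⟩
    obtain ⟨a, ha⟩ := h2 i
    obtain ⟨d, hd⟩ := Nat.factorial_dvd_factorial hk
    exact ⟨d * a, by rw [hd]; push_cast; rw [mul_comm (k.factorial : ℂ), mul_assoc, ha]⟩
  obtain ⟨k, hk⟩ := monotone_stabilizes_iff_noetherian.mpr (inferInstance : IsNoetherian ℤ (Bool × Fin (n + 1) → W)) ⟨_, hA⟩
  refine ⟨k.factorial, k.factorial_pos, fun t ht hS hT ⟨K, hK, h⟩ => ?_⟩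
  let w : Bool × Fin (n + 1) → W := fun x =>
    ⟨t.2.2 (if x.1 then ModularGroup.S else ModularGroup.T) ![((x.2 : ℕ) : ℂ), 1], by
      split_ifs
      · exact hS _ (Nat.lt_succ_iff.mp x.2.2)
      · exact hT _ (Nat.lt_succ_iff.mp x.2.2)⟩
  have hw : w ∈ AddSubgroup.toIntSubmodule (A (max k K)) := by
    refine ⟨t, ht, fun _ => rfl, fun i => ?_⟩
    obtain ⟨a, ha⟩ := h i
    obtain ⟨d, hd⟩ := Nat.dvd_factorial hK (le_max_right k K)
    exact ⟨d * a, by rw [hd]; push_cast; rw [mul_comm (K : ℂ), mul_assoc, ha]⟩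
  have h1 : w ∈ AddSubgroup.toIntSubmodule (A k) := by
    have := hk (max k K) (le_max_left _ _)
    simp only [OrderHom.coe_mk] at this
    rwa [this]
  obtain ⟨t', ht', h2, h3⟩ := h1
  have h4 := eichler_injective hn (sub_mem ht ht')
    (fun j hj => by simpa [w, sub_eq_zero] using (h2 (true, ⟨j, Nat.lt_succ_of_le hj⟩)).symm)
    (fun j hj => by simpa [w, sub_eq_zero] using (h2 (false, ⟨j, Nat.lt_succ_of_le hj⟩)).symm)
  rw [Prod.fst_sub, sub_eq_zero] at h4
  rwa [h4]

lemma heckeSeries_int (ℓ n : ℕ) {p : ℂ⟦X⟧} (h : ∀ i, ∃ a : ℤ, coeff i p = a) (i : ℕ) :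
    ∃ a : ℤ, coeff i (heckeSeries ℓ n p) = a := by
  choose a ha using h
  exact ⟨a (ℓ * i) + if ℓ ∣ i then (ℓ : ℤ) ^ (n + 1) * a (i / ℓ) else 0, by
    rw [heckeSeries, coeff_mk, ha, ha]
    split_ifs <;> push_cast <;> rfl⟩

theorem exists_dvd_coeff {n : ℕ} (hn : Even n) (hn0 : 0 < n) {p : ℂ⟦X⟧} {g : ℍ → ℂ} (hp : HasExp 1 p g) (hg : MDiff g)
    (hs : ∀ (γ : SL(2, ℤ)) (z : ℍ), g (γ • z) = (γ 1 0 * z + γ 1 1) ^ (n + 2) * g z)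
    (h_int : ∀ i, ∃ a : ℤ, coeff i p = a) {m₀ : ℕ} (hm₀ : 0 < m₀) :
    ∃ m, 3 ≤ m ∧ ∃ S : Finset ℂ, ∀ (ℓ ℓ' : ℕ) [Fact ℓ.Prime] [Fact ℓ'.Prime], ℓ ≠ ℓ' → (ℓ : ZMod m) = -1 → (ℓ' : ZMod m) = -1 →
      ∀ (F : Type) [Field F], Nat.card F = ℓ ^ 2 → ∀ _ : finRing S →+* F, ∀ k, ¬ ℓ ∣ k → ¬ ℓ' ∣ k →
        ∃ a : ℤ, coeff (ℓ * (ℓ' * k)) p = m₀ * a := by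
  obtain ⟨t, ht, rfl⟩ := exists_mem_eichler hp hg hs
  obtain ⟨W₁, hW₁, h1⟩ := exists_congPol (cocycle_mem_pol ht ModularGroup.S)
  obtain ⟨W₂, hW₂, h2⟩ := exists_congPol (cocycle_mem_pol ht ModularGroup.T)
  obtain ⟨c, hc, h3⟩ := exists_mul_coeff_int hn0 (hW₁.sup hW₂)
  have hW := cocycle_mem_congPol ht (congPol_mono (le_sup_left : W₁ ≤ W₁ ⊔ W₂) h1) (congPol_mono le_sup_right h2)
  have hm3 : 3 ≤ 3 * (c * m₀) := Nat.le_mul_of_pos_right _ (by positivity)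
  obtain ⟨S, hS⟩ := exists_finset_hecChar_eq_one hm3
  refine ⟨_, hm3, S, fun ℓ ℓ' _ _ hne hℓ hℓ' F _ hF r k hk hk' => ?_⟩
  have hmℓ : ∀ q : ℕ, [Fact q.Prime] → (q : ZMod (3 * (c * m₀))) = -1 → ((3 * (c * m₀) : ℕ) : ZMod q) ≠ 0 := fun q hq h h0 => by
    rw [ZMod.natCast_eq_zero_iff] at h0
    have : (3 * (c * m₀)) ∣ q + 1 := (ZMod.natCast_eq_zero_iff _ _).mp (by push_cast; rw [h]; ring)
    exact hq.out.one_lt.ne' (Nat.dvd_one.mp ((Nat.dvd_add_right dvd_rfl).mp (h0.trans this)))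
  have hm := hmℓ ℓ hℓ
  have hm' := hmℓ ℓ' hℓ'
  have h4 := fun γ a b => hecke_hecke_cocycle_mem_mulSub (by omega) hm hℓ hm' hℓ' hn ht (hW₁.sup hW₂) hW
    (hS ℓ hm hℓ F hF r) γ a b
  have h5 := heckeEich_mem hm' hn (heckeEich_mem hm hn ht)
  set s := heckeEich hm' n (heckeEich hm n t) with hsdef
  set m := 3 * (c * m₀)
  have hmC : (m : ℂ) ≠ 0 := by exact_mod_cast (by omega : m ≠ 0)
  have h6 : ∀ γ, ∀ j ≤ n, ((m : ℂ)⁻¹ • s).2.2 γ ![(j : ℂ), 1] ∈ W₁ ⊔ W₂ := fun γ j _ => by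
    obtain ⟨w, hw, h⟩ := h4 γ j 1
    rw [AddMonoidHom.coe_mulLeft] at h
    simp only [Int.cast_natCast, Int.cast_one] at h
    simpa [← h, hmC] using hw
  have h7 : coeff k s.1 = coeff (ℓ * (ℓ' * k)) t.1 := by
    have : ¬ ℓ ∣ ℓ' * k := fun h => ((Fact.out : ℓ.Prime).dvd_mul.mp h).elim
      (fun h => hne ((Nat.prime_dvd_prime_iff_eq Fact.out Fact.out).mp h)) hk
    simp [hsdef, heckeEich, heckeSeries, hk', this]
  obtain ⟨a, ha⟩ := h3 _ ((eichler n).smul_mem (m : ℂ)⁻¹ h5) (h6 _) (h6 _) ⟨m, by omega, fun i => by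
    obtain ⟨a, ha⟩ := heckeSeries_int ℓ' n (heckeSeries_int ℓ n h_int) i
    exact ⟨a, by rw [← ha]; simp [hsdef, heckeEich, hmC]⟩⟩ k
  refine ⟨3 * a, ?_⟩
  rw [← h7]
  have hcC : (c : ℂ) ≠ 0 := by exact_mod_cast hc.ne'
  have h8 : (m : ℂ) = 3 * (c * m₀) := by simp [m]
  simp only [Prod.smul_fst, map_smul, smul_eq_mul] at ha
  push_cast
  rw [← ha]
  field_simp
  rw [h8]
  ring

end MacMahon

namespace MacMahon
open scoped MatrixGroups Manifold UpperHalfPlane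
open NumberField

lemma exists_hom_isAlgebraic (S : Finset ℂ) : ∃ h : finRing S →+* ℂ, ∀ x, IsAlgebraic ℚ (h x) := by
  let A := Algebra.adjoin ℚ (S : Set ℂ)
  have hA : Algebra.FiniteType ℚ A := A.fg_iff_finiteType.mp (Subalgebra.fg_adjoin_finset S)
  obtain ⟨I, hI⟩ := Ideal.exists_maximal A
  let _ := Ideal.Quotient.field I
  have hfin : Module.Finite ℚ (A ⧸ I) := finite_of_finite_type_of_isJacobsonRing ℚ (A ⧸ I)
  have hle : finRing S ≤ A.toSubring := Subring.closure_le.mpr Algebra.subset_adjoin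
  have key : ∀ (K : Type) [Field K] [Algebra ℚ K] [Module.Finite ℚ K], Nonempty (K →ₐ[ℚ] ℂ) :=
    fun K _ _ _ => ⟨IsAlgClosed.lift⟩
  obtain ⟨j⟩ := key (A ⧸ I)
  refine ⟨(j : (A ⧸ I) →+* ℂ).comp ((Ideal.Quotient.mk I).comp (Subring.inclusion hle)), fun x => ?_⟩
  exact (Algebra.IsAlgebraic.isAlgebraic (R := ℚ) (Ideal.Quotient.mk I (Subring.inclusion hle x))).algHom j

lemma exists_nat_forall_hom {S : Finset ℂ} {E : Type} [Field E] [NumberField E] (h : finRing S →+* E) :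
    ∃ N : ℕ, N ≠ 0 ∧ ∀ (F : Type) [Field F], (𝓞 E →+* F) → (N : F) ≠ 0 → Nonempty (finRing S →+* F) := by
  have h1 : ∀ x : E, ∃ N : ℕ, N ≠ 0 ∧ IsIntegral ℤ (N * x) := fun x => by
    obtain ⟨y, hy, hx⟩ := ((IsFractionRing.isAlgebraic_iff ℤ ℚ E).mpr
      (Algebra.IsAlgebraic.isAlgebraic (R := ℚ) x)).exists_integral_multiple
    refine ⟨y.natAbs, Int.natAbs_ne_zero.mpr hy, ?_⟩
    rcases Int.natAbs_eq y with h | h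
    · rw [h] at hx
      simpa using hx
    · rw [h] at hx
      simpa using hx.neg
  choose N hN0 hN using h1
  let N₀ := ∏ s ∈ S.attach, N (h ⟨s, Subring.subset_closure s.2⟩)
  refine ⟨N₀, prod_ne_zero_iff.mpr fun s _ => hN0 _, fun F _ ρ hF => ?_⟩
  have hE : IsUnit (algebraMap (𝓞 E) E (N₀ : 𝓞 E)) := by
    rw [map_natCast, isUnit_iff_ne_zero]
    exact_mod_cast prod_ne_zero_iff.mpr fun s _ => hN0 _
  have hF' : IsUnit (ρ (N₀ : 𝓞 E)) := by rwa [map_natCast, isUnit_iff_ne_zero]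
  let j : Localization.Away (N₀ : 𝓞 E) →+* E := IsLocalization.Away.lift (N₀ : 𝓞 E) hE
  have hj : Function.Injective j := by
    refine (IsLocalization.lift_injective_iff _).mpr fun x y => ?_
    rw [(IsLocalization.injective _ (powers_le_nonZeroDivisors_of_noZeroDivisors
      (show (N₀ : 𝓞 E) ≠ 0 from fun h0 => by simp [h0] at hE))).eq_iff, (FaithfulSMul.algebraMap_injective (𝓞 E) E).eq_iff]
  have hr : ∀ x (hx : x ∈ finRing S), h ⟨x, hx⟩ ∈ j.range := fun x hx => by
    induction hx using Subring.closure_induction with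
    | mem x hx =>
      obtain ⟨d, hd⟩ : N (h ⟨x, Subring.subset_closure hx⟩) ∣ N₀ := dvd_prod_of_mem (fun s : S => N (h ⟨s, Subring.subset_closure s.2⟩))
        (mem_attach S ⟨x, hx⟩)
      have hi : IsIntegral ℤ (N₀ * h ⟨x, Subring.subset_closure hx⟩) := by
        rw [hd]
        push_cast
        rw [mul_comm (N _ : E), mul_assoc]
        exact (isIntegral_natCast (a := d)).mul (hN _)
      refine ⟨IsLocalization.Away.invSelf (N₀ : 𝓞 E) * algebraMap (𝓞 E) _ ⟨_, hi⟩, ?_⟩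
      refine hE.mul_left_cancel ?_
      rw [map_mul, ← mul_assoc]
      have h2 := congrArg j (IsLocalization.Away.mul_invSelf (S := Localization.Away (N₀ : 𝓞 E)) (N₀ : 𝓞 E))
      rw [map_mul, map_one, IsLocalization.Away.lift_eq] at h2
      rw [h2, one_mul, map_natCast]
      exact IsLocalization.Away.lift_eq (N₀ : 𝓞 E) hE _
    | zero => exact ⟨0, by rw [map_zero]; exact (map_zero h).symm⟩
    | one => exact ⟨1, by rw [map_one]; exact (map_one h).symm⟩
    | add x y hx hy h1 h2 =>
      convert add_mem h1 h2 using 1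
      rw [← map_add]
      rfl
    | neg x hx h1 =>
      convert neg_mem h1 using 1
      rw [← map_neg]
      rfl
    | mul x y hx hy h1 h2 =>
      convert mul_mem h1 h2 using 1
      rw [← map_mul]
      rfl
  exact ⟨((IsLocalization.Away.lift (N₀ : 𝓞 E) hF').comp (RingEquiv.ofLeftInverse (f := j)
    (Function.leftInverse_invFun hj)).symm.toRingHom).comp (h.codRestrict j.range fun x => hr x.1 x.2)⟩

/-- Reduction of a finitely generated ring to a number field with a complex conjugation. -/
lemma exists_numberField (S : Finset ℂ) {m : ℕ} (hm : 0 < m) :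
    ∃ (E : Type) (_ : Field E) (_ : NumberField E) (σ : E →+* E) (ζ : E) (N : ℕ), N ≠ 0 ∧ (∀ x, σ (σ x) = x) ∧
      IsPrimitiveRoot ζ m ∧ σ ζ = ζ⁻¹ ∧
      ∀ (F : Type) [Field F], (𝓞 E →+* F) → (N : F) ≠ 0 → Nonempty (finRing S →+* F) := by
  obtain ⟨h, hh⟩ := exists_hom_isAlgebraic S
  let c : ℂ →ₐ[ℚ] ℂ := (Complex.conjAe.toAlgHom).restrictScalars ℚ
  have hcc : ∀ x, c (c x) = x := Complex.conj_conj
  let z := Complex.exp (2 * Real.pi * Complex.I / m)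
  have hz : IsPrimitiveRoot z m := Complex.isPrimitiveRoot_exp m hm.ne'
  have hcz : c z = z⁻¹ := by
    change (starRingEnd ℂ) _ = _
    rw [← Complex.exp_conj, ← Complex.exp_neg]
    simp [neg_div, Complex.conj_ofNat]
  let T : Set ℂ := Set.range (fun s : S => h ⟨s, Subring.subset_closure s.2⟩) ∪
    Set.range (fun s : S => c (h ⟨s, Subring.subset_closure s.2⟩)) ∪ {z, z⁻¹}
  have hTf : T.Finite := (((Set.finite_range _).union (Set.finite_range _)).union (Set.toFinite _))
  have := hTf.to_subtype
  have hzi : IsIntegral ℚ z := hz.isIntegral hm |>.tower_top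
  have hfd : FiniteDimensional ℚ (IntermediateField.adjoin ℚ T) := by
    refine IntermediateField.finiteDimensional_adjoin ?_
    rintro x ((⟨s, rfl⟩ | ⟨s, rfl⟩) | rfl | rfl)
    · exact (hh _).isIntegral
    · exact ((hh _).algHom c).isIntegral
    · exact hzi
    · exact hzi.inv
  have hT : ∀ x ∈ T, c x ∈ T := by
    rintro x ((⟨s, rfl⟩ | ⟨s, rfl⟩) | rfl | rfl)
    · exact Or.inl (Or.inr ⟨s, rfl⟩)
    · exact Or.inl (Or.inl ⟨s, (hcc _).symm⟩)
    · exact Or.inr (Or.inr hcz)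
    · exact Or.inr (Or.inl (by rw [map_inv₀, hcz, inv_inv]))
  let E := IntermediateField.adjoin ℚ T
  have hTE : T ⊆ E := IntermediateField.subset_adjoin ℚ T
  have hcE : ∀ x ∈ E, c x ∈ E := by
    have : E ≤ E.comap c := IntermediateField.adjoin_le_iff.mpr fun x hx => hTE (hT x hx)
    exact this
  have hE : NumberField E := { to_charZero := inferInstance, to_finiteDimensional := hfd }
  have hr : ∀ x (hx : x ∈ finRing S), h ⟨x, hx⟩ ∈ E.toSubring := fun x hx => by
    induction hx using Subring.closure_induction with
    | mem x hx => exact hTE (Or.inl (Or.inl ⟨⟨x, hx⟩, rfl⟩))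
    | zero => exact (map_zero h).symm ▸ zero_mem _
    | one => exact (map_one h).symm ▸ one_mem _
    | add x y hx hy h1 h2 =>
      convert add_mem h1 h2 using 1
      rw [← map_add]
      rfl
    | neg x hx h1 =>
      convert neg_mem h1 using 1
      rw [← map_neg]
      rfl
    | mul x y hx hy h1 h2 =>
      convert mul_mem h1 h2 using 1
      rw [← map_mul]
      rfl
  obtain ⟨N, hN0, hN⟩ := exists_nat_forall_hom (E := E) (h.codRestrict E.toSubring fun x => hr x.1 x.2)
  let σ : E →+* E := ((c : ℂ →+* ℂ).comp (algebraMap E ℂ)).codRestrict E.toSubring fun x => hcE x.1 x.2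
  refine ⟨E, inferInstance, hE, σ, ⟨z, hTE (Or.inr (Or.inl rfl))⟩, N, hN0, fun x => Subtype.ext (hcc x.1), ?_,
    Subtype.ext hcz, hN⟩
  exact IsPrimitiveRoot.of_map_of_injective (f := algebraMap E ℂ) hz (algebraMap E ℂ).injective

end MacMahon

namespace MacMahon
open scoped MatrixGroups Manifold UpperHalfPlane
open NumberField

lemma tsum_comp_eq_tsum_card {ι : Type*} (f : ι → ℕ) (hf : ∀ n, Finite {i // f i = n}) (F : ℕ → ℝ) (hF : ∀ n, 0 ≤ F n)
    (h : Summable fun n => Nat.card {i // f i = n} * F n) :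
    Summable (fun i => F (f i)) ∧ ∑' i, F (f i) = ∑' n, Nat.card {i // f i = n} * F n := by
  have h1 : ∀ n, ∑' i : {i // f i = n}, F (f i) = Nat.card {i // f i = n} * F n := fun n => by
    have := Fintype.ofFinite {i // f i = n}
    rw [tsum_fintype, sum_congr rfl fun i _ => congrArg F i.2]
    simp
  have h2 : Summable fun x : (n : ℕ) × {i // f i = n} => F (f (Equiv.sigmaFiberEquiv f x)) := by
    rw [summable_sigma_of_nonneg fun _ => hF _]
    refine ⟨fun n => ?_, h.congr fun n => (h1 n).symm⟩
    exact Summable.of_finite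
  refine ⟨(Equiv.sigmaFiberEquiv f).summable_iff.mp h2, ?_⟩
  rw [← (Equiv.sigmaFiberEquiv f).tsum_eq, h2.tsum_sigma]
  exact tsum_congr h1

section

variable (K : Type) [Field K] [NumberField K]

lemma exists_bounds_idealSum : (∀ s : ℝ, 1 < s → Summable fun I : Ideal (𝓞 K) => (Ideal.absNorm I : ℝ) ^ (-s)) ∧
    ∃ C : ℝ, ∀ s : ℝ, 1 < s → s ≤ 2 →
      |Real.log (∑' I : Ideal (𝓞 K), (Ideal.absNorm I : ℝ) ^ (-s)) - Real.log (1 / (s - 1))| ≤ C := by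
  set b : ℕ → ℂ := fun n => Nat.card {I : Ideal (𝓞 K) // Ideal.absNorm I = n} with hb
  set ρ := dedekindZeta_residue K
  have hρ : 0 < ρ := dedekindZeta_residue_pos K
  have hlim := tendsto_sub_one_mul_dedekindZeta_nhdsGT K
  have hn : Filter.Tendsto (fun s : ℝ => ‖((s : ℂ) - 1) * dedekindZeta K s‖) (nhdsWithin 1 (Set.Ioi 1)) (nhds ρ) := by
    have := hlim.norm
    rwa [Complex.norm_real, Real.norm_of_nonneg hρ.le] at this
  have hev : ∀ᶠ s : ℝ in nhdsWithin 1 (Set.Ioi 1), ρ / 2 < ‖((s : ℂ) - 1) * dedekindZeta K s‖ ∧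
      ‖((s : ℂ) - 1) * dedekindZeta K s‖ < 2 * ρ :=
    (hn.eventually_const_lt (by linarith)).and (hn.eventually_lt_const (by linarith))
  obtain ⟨δ, hδ, hδ'⟩ := mem_nhdsGT_iff_exists_Ioo_subset.mp hev
  have hsumm : ∀ s : ℝ, 1 < s → LSeriesSummable b s := fun s hs => by
    obtain ⟨s', h1, h2⟩ := exists_between (lt_min hs hδ)
    have h3 := (hδ' ⟨h1, h2.trans_le (min_le_right _ _)⟩).1
    refine LSeriesSummable.of_re_le_re (s := (s' : ℂ)) (by simpa using (h2.trans_le (min_le_left _ _)).le) ?_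
    by_contra hc
    have : dedekindZeta K s' = 0 := tsum_eq_zero_of_not_summable hc
    rw [this, mul_zero, norm_zero] at h3
    linarith
  have hterm : ∀ s : ℝ, 1 < s → ∀ n, LSeries.term b s n =
      ((Nat.card {I : Ideal (𝓞 K) // Ideal.absNorm I = n} * (n : ℝ) ^ (-s) : ℝ) : ℂ) := fun s hs n => by
    rcases eq_or_ne n 0 with rfl | hn
    · simp [Real.zero_rpow (by linarith : -s ≠ 0)]
    · rw [LSeries.term_of_ne_zero hn, hb]
      push_cast
      rw [Complex.ofReal_cpow (Nat.cast_nonneg n)]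
      push_cast
      rw [Complex.cpow_neg, div_eq_mul_inv]
  have hfin : ∀ n, Finite {I : Ideal (𝓞 K) // Ideal.absNorm I = n} := fun n => Ideal.finite_setOfPred_absNorm_eq n
  have hkey : ∀ s : ℝ, 1 < s → Summable (fun I : Ideal (𝓞 K) => (Ideal.absNorm I : ℝ) ^ (-s)) ∧
      dedekindZeta K s = ((∑' I : Ideal (𝓞 K), (Ideal.absNorm I : ℝ) ^ (-s) : ℝ) : ℂ) := fun s hs => by
    have h1 := hsumm s hs
    rw [LSeriesSummable, funext (hterm s hs), Complex.summable_ofReal] at h1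
    obtain ⟨h2, h3⟩ := tsum_comp_eq_tsum_card (fun I : Ideal (𝓞 K) => Ideal.absNorm I) hfin (fun n => (n : ℝ) ^ (-s))
      (fun n => by positivity) h1
    refine ⟨h2, ?_⟩
    rw [h3, Complex.ofReal_tsum]
    exact tsum_congr (hterm s hs)
  refine ⟨fun s hs => (hkey s hs).1, ?_⟩
  set Z : ℝ → ℝ := fun s => ∑' I : Ideal (𝓞 K), (Ideal.absNorm I : ℝ) ^ (-s)
  have hZ1 : ∀ s : ℝ, 1 < s → 1 ≤ Z s := fun s hs => by
    have := (hkey s hs).1.le_tsum (1 : Ideal (𝓞 K)) fun _ _ => by positivity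
    simpa using this
  have hZn : ∀ s : ℝ, 1 < s → ‖((s : ℂ) - 1) * dedekindZeta K s‖ = (s - 1) * Z s := fun s hs => by
    rw [(hkey s hs).2, show (s : ℂ) - 1 = ((s - 1 : ℝ) : ℂ) by push_cast; rfl, ← Complex.ofReal_mul, Complex.norm_real,
      Real.norm_of_nonneg]
    exact mul_nonneg (by linarith) (zero_le_one.trans (hZ1 s hs))
  have hanti : ∀ s s' : ℝ, 1 < s → s ≤ s' → Z s' ≤ Z s := fun s s' hs hss => by
    refine (hkey s' (hs.trans_le hss)).1.tsum_le_tsum (fun I => ?_) (hkey s hs).1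
    rcases Nat.eq_zero_or_pos (Ideal.absNorm I) with h0 | h0
    · simp [h0, Real.zero_rpow (by linarith : -s ≠ 0), Real.zero_rpow (by linarith : -s' ≠ 0)]
    · exact Real.rpow_le_rpow_of_exponent_le (by exact_mod_cast h0) (by linarith)
  obtain ⟨s₀, h1, h2⟩ := exists_between (show (1 : ℝ) < δ from hδ)
  have hup : ∃ A B : ℝ, 0 < A ∧ 0 < B ∧ ∀ s : ℝ, 1 < s → s ≤ 2 → A ≤ (s - 1) * Z s ∧ (s - 1) * Z s ≤ B := by
    refine ⟨min (ρ / 2) (s₀ - 1), max (2 * ρ) (Z s₀), by simp [hρ, h1], by simp [hρ], fun s hs hs2 => ?_⟩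
    rcases lt_or_ge s s₀ with h | h
    · have h3 := hδ' ⟨hs, h.trans h2⟩
      simp only [Set.mem_ofPred_eq, hZn s hs] at h3
      exact ⟨(min_le_left _ _).trans h3.1.le, h3.2.le.trans (le_max_left _ _)⟩
    · constructor
      · refine (min_le_right _ _).trans ?_
        nlinarith [hZ1 s hs]
      · refine le_trans ?_ (le_max_right _ _)
        have := hanti s₀ s h1 h
        nlinarith [hZ1 s hs]
  obtain ⟨A, B, hA, hB, h⟩ := hup
  refine ⟨max |Real.log A| |Real.log B|, fun s hs hs2 => ?_⟩
  obtain ⟨h3, h4⟩ := h s hs hs2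
  have h5 : Real.log (Z s) - Real.log (1 / (s - 1)) = Real.log ((s - 1) * Z s) := by
    rw [Real.log_mul (by linarith) (by linarith [hZ1 s hs]), one_div, Real.log_inv]
    ring
  rw [h5]
  exact abs_le_max_abs_abs (Real.log_le_log hA h3) (Real.log_le_log (hA.trans_le h3) h4)

end

end MacMahon

namespace MacMahon
open scoped MatrixGroups Manifold UpperHalfPlane
section

variable {R : Type*} [CommMonoidWithZero R] [UniqueFactorizationMonoid R] [Subsingleton Rˣ]
  (x : R →*₀ ℝ)

lemma subset_of_prod_eq {T U : Finset R} (hT : ∀ v ∈ T, Prime v) (hU : ∀ v ∈ U, Prime v)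
    (h : ∏ v ∈ T, v = ∏ v ∈ U, v) : T ⊆ U := fun v hv => by
  obtain ⟨w, hw, hvw⟩ := ((hT v hv).dvd_finsetProd_iff _).mp (h ▸ dvd_prod_of_mem _ hv)
  rwa [associated_iff_eq.mp (((hT v hv).dvd_prime_iff_associated (hU w hw)).mp hvw)]

include x in
lemma prod_one_add_le_tsum (hx : ∀ I, 0 ≤ x I) (hs : Summable x) (T : Finset R) (hT : ∀ v ∈ T, Prime v) :
    ∏ v ∈ T, (1 + x v) ≤ ∑' I, x I := by
  classical
  rw [prod_one_add]
  rw [sum_congr rfl fun U _ => (map_prod x (fun v => v) U).symm]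
  rw [← sum_image (f := fun I => x I) (g := fun U : Finset R => ∏ v ∈ U, v) fun U hU V hV h => ?_]
  · exact hs.sum_le_tsum _ fun I _ => hx I
  · have hU' := fun v hv => hT v (mem_powerset.mp hU hv)
    have hV' := fun v hv => hT v (mem_powerset.mp hV hv)
    exact (subset_of_prod_eq hU' hV' h).antisymm (subset_of_prod_eq hV' hU' h.symm)

include x in
lemma sum_le_prod_inv (hx : ∀ I, 0 ≤ x I) (hs : Summable x) (T : Finset R) (hT : ∀ v ∈ T, Prime v) (hT2 : ∀ v ∈ T, x v ≤ 1 / 2) :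
    ∑' I : R, Set.indicator {I | I ≠ 0 ∧ ∀ v, Prime v → v ∣ I → v ∈ T} x I ≤ ∏ v ∈ T, (1 - x v)⁻¹ := by
  classical
  induction T using Finset.induction_on with
  | empty =>
    rw [tsum_eq_single 1 fun I hI => Set.indicator_of_notMem (fun h => ?_) _]
    · simpa using Set.indicator_apply_le' (fun _ => (map_one x).le) fun _ => zero_le_one
    · obtain ⟨v, hv, hvI⟩ := WfDvdMonoid.exists_irreducible_factor
        (fun h => hI (isUnit_iff_eq_one.mp h)) h.1
      exact notMem_empty _ (h.2 v hv.prime hvI)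
  | insert v T hv ih =>
    set D : Finset R → Set R := fun T => {I | I ≠ 0 ∧ ∀ v, Prime v → v ∣ I → v ∈ T} with hD
    have hvp := hT v (mem_insert_self _ _)
    have hinj : Function.Injective (v * ·) := mul_right_injective₀ hvp.ne_zero
    have hsD : ∀ T, Summable ((D T).indicator x) := fun T => hs.indicator _
    have hext : HasSum (Function.extend (v * ·) (fun J => x v * (D (insert v T)).indicator x J) 0)
        (x v * ∑' J, (D (insert v T)).indicator x J) :=
      (hasSum_extend_zero hinj).mpr ((hsD _).hasSum.mul_left _)
    have hle : ∑' I, (D (insert v T)).indicator x I ≤ ∑' I, (D T).indicator x I + x v * ∑' J, (D (insert v T)).indicator x J := by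
      refine hasSum_le (fun I => ?_) (hsD _).hasSum ((hsD T).hasSum.add hext)
      by_cases hI : I ∈ D (insert v T)
      · by_cases hvI : v ∣ I
        · obtain ⟨J, rfl⟩ := hvI
          have hJ : J ∈ D (insert v T) := ⟨right_ne_zero_of_mul hI.1, fun w hw hwJ => hI.2 w hw (hwJ.mul_left _)⟩
          rw [hinj.extend_apply (fun J => x v * (D (insert v T)).indicator x J) 0 J, Set.indicator_of_mem hI, Set.indicator_of_mem hJ, map_mul]
          exact le_add_of_nonneg_left (Set.indicator_nonneg (fun _ _ => hx _) _)
        · have hI' : I ∈ D T := ⟨hI.1, fun w hw hwI => (mem_insert.mp (hI.2 w hw hwI)).resolve_left fun h => hvI (h ▸ hwI)⟩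
          rw [Function.extend_apply' _ _ _ fun ⟨J, hJ⟩ => hvI ⟨J, hJ.symm⟩, Set.indicator_of_mem hI, Set.indicator_of_mem hI']
          simp
      · rw [Set.indicator_of_notMem hI]
        refine add_nonneg (Set.indicator_nonneg (fun _ _ => hx _) _) ?_
        by_cases h : ∃ J, v * J = I
        · obtain ⟨J, rfl⟩ := h
          rw [hinj.extend_apply (fun J => x v * (D (insert v T)).indicator x J) 0 J]
          exact mul_nonneg (hx _) (Set.indicator_nonneg (fun _ _ => hx _) _)
        · rw [Function.extend_apply' _ _ _ h]; rfl
    have h2 := hT2 v (mem_insert_self _ _)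
    have h3 := ih (fun w hw => hT w (mem_insert_of_mem hw)) fun w hw => hT2 w (mem_insert_of_mem hw)
    rw [prod_insert hv, inv_mul_eq_div, le_div_iff₀ (by linarith)]
    change (∑' I, (D (insert v T)).indicator x I) * _ ≤ _
    change ∑' I, (D T).indicator x I ≤ _ at h3
    linarith

lemma exp_sub_sq_le {y : ℝ} (hy : 0 ≤ y) : Real.exp (y - y ^ 2) ≤ 1 + y := by
  have h1 : 1 - (y - y ^ 2) ≤ Real.exp (-(y - y ^ 2)) := by linarith [Real.add_one_le_exp (-(y - y ^ 2))]
  rw [Real.exp_neg] at h1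
  have h2 : 0 < 1 - (y - y ^ 2) := by nlinarith [sq_nonneg (y - 1)]
  have h3 := (le_inv_comm₀ h2 (Real.exp_pos _)).mp h1
  refine h3.trans ((inv_le_iff_one_le_mul₀ h2).mpr ?_)
  nlinarith [pow_nonneg hy 3]

lemma inv_one_sub_le_exp {y : ℝ} (hy : 0 ≤ y) (hy2 : y ≤ 1 / 2) : (1 - y)⁻¹ ≤ Real.exp (y + 2 * y ^ 2) := by
  refine (inv_le_of_inv_le₀ (Real.exp_pos _) ?_)
  have h1 := Real.add_one_le_exp (y + 2 * y ^ 2)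
  refine (inv_anti₀ (by positivity) h1).trans ((inv_le_iff_one_le_mul₀ (by positivity)).mpr ?_)
  nlinarith [mul_nonneg (sq_nonneg y) (by linarith : 0 ≤ 1 - 2 * y)]

include x in
/-- Logarithm of an Euler product over the primes of a unique factorization monoid. -/
lemma abs_log_tsum_sub_le (hx : ∀ I, 0 ≤ x I) (hs : Summable x) (hx2 : ∀ v, Prime v → x v ≤ 1 / 2) :
    |Real.log (∑' I, x I) - ∑' v : {v : R // Prime v}, x v| ≤ 2 * ∑' v : {v : R // Prime v}, x v ^ 2 := by
  classical
  have hsv : Summable fun v : {v : R // Prime v} => x v := hs.subtype _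
  have hsq : Summable fun v : {v : R // Prime v} => x v ^ 2 :=
    hsv.of_nonneg_of_le (fun v => by positivity) fun v => by nlinarith [hx v, hx2 v v.2]
  have hq0 : 0 ≤ ∑' v : {v : R // Prime v}, x v ^ 2 := tsum_nonneg fun _ => by positivity
  have h1 : 1 ≤ ∑' I, x I := by simpa using hs.le_tsum 1 fun _ _ => hx _
  have hpos : 0 < ∑' I, x I := zero_lt_one.trans_le h1
  have hlow : ∑' v : {v : R // Prime v}, x v - ∑' v : {v : R // Prime v}, x v ^ 2 ≤ Real.log (∑' I, x I) := by
    rw [← hsv.tsum_sub hsq]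
    refine (hsv.sub hsq).tsum_le_of_sum_le fun T => ?_
    rw [Real.le_log_iff_exp_le hpos, Real.exp_sum]
    refine (prod_le_prod (g := fun v : {v : R // Prime v} => 1 + x v) (fun _ _ => (Real.exp_pos _).le) fun v _ => exp_sub_sq_le (hx v)).trans ?_
    have := prod_one_add_le_tsum x hx hs (T.map (Function.Embedding.subtype _)) (by simp +contextual)
    rwa [prod_map] at this
  have hup : Real.log (∑' I, x I) ≤ ∑' v : {v : R // Prime v}, x v + 2 * ∑' v : {v : R // Prime v}, x v ^ 2 := by
    rw [← tsum_mul_left, ← hsv.tsum_add (hsq.mul_left 2), Real.log_le_iff_le_exp hpos]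
    refine hs.tsum_le_of_sum_le fun U => ?_
    let fac : R → Finset R := fun I => (UniqueFactorizationMonoid.factors I).toFinset
    have hfac : ∀ I, I ≠ 0 → ∀ v, Prime v → v ∣ I → v ∈ fac I := fun I hI v hv hvI => by
      obtain ⟨w, hw, hvw⟩ := UniqueFactorizationMonoid.exists_mem_factors_of_dvd hI hv.irreducible hvI
      rwa [associated_iff_eq.mp hvw, Multiset.mem_toFinset]
    set T := U.biUnion fac
    have hT : ∀ v ∈ T, Prime v := fun v hv => by
      obtain ⟨I, _, hv⟩ := mem_biUnion.mp hv
      exact UniqueFactorizationMonoid.prime_of_factor _ (Multiset.mem_toFinset.mp hv)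
    have h2 : ∑ I ∈ U, x I ≤ ∏ v ∈ T, (1 - x v)⁻¹ := by
      refine le_trans ?_ (sum_le_prod_inv x hx hs T hT fun v hv => hx2 v (hT v hv))
      refine le_trans (sum_le_sum fun I hI => ?_) ((hs.indicator _).sum_le_tsum U fun I _ => Set.indicator_nonneg (fun _ _ => hx _) _)
      rcases eq_or_ne I 0 with rfl | h0
      · rw [map_zero]
        exact Set.indicator_nonneg (fun _ _ => hx _) _
      · exact (Set.indicator_of_mem (show I ∈ {I | I ≠ 0 ∧ ∀ v, Prime v → v ∣ I → v ∈ T} from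
          ⟨h0, fun v hv hvI => mem_biUnion.mpr ⟨I, hI, hfac I h0 v hv hvI⟩⟩) _).ge
    refine h2.trans ((prod_le_prod (fun v hv => inv_nonneg.mpr (by linarith [hx2 v (hT v hv)]))
      fun v hv => inv_one_sub_le_exp (hx v) (hx2 v (hT v hv))).trans ?_)
    rw [← Real.exp_sum, Real.exp_le_exp]
    have := (hsv.add (hsq.mul_left 2)).sum_le_tsum (T.subtype Prime) fun v _ => by have := hx v; positivity
    refine le_trans (le_of_eq ?_) this
    rw [sum_subtype_of_mem (fun v => x v + 2 * x v ^ 2) hT]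
  rw [abs_le]
  constructor <;> linarith

end

end MacMahon

namespace MacMahon
open scoped MatrixGroups Manifold UpperHalfPlane
open NumberField

section

variable (K : Type) [Field K] [NumberField K]

/-- The number of ring homomorphisms from the integers of `K` to the field with `p` elements. -/
noncomputable def homCount (p : ℕ) : ℕ := if p.Prime then Nat.card (𝓞 K →+* ZMod p) else 0

lemma exists_absNorm_eq_pow {P : Ideal (𝓞 K)} (hP : Prime P) :
    ∃ p f : ℕ, p.Prime ∧ 0 < f ∧ Ideal.absNorm P = p ^ f ∧ (p : 𝓞 K) ∈ P := by
  have hprime := Ideal.isPrime_of_prime hP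
  have hmax := hprime.isMaximal hP.ne_zero
  let := Ideal.Quotient.field P
  have hn : Ideal.absNorm P ≠ 0 := fun h => hP.ne_zero (Ideal.absNorm_eq_zero_iff.mp h)
  have : Finite (𝓞 K ⧸ P) := Nat.finite_of_card_ne_zero (by rwa [Ideal.absNorm_apply, Submodule.cardQuot_apply] at hn)
  have := Fintype.ofFinite (𝓞 K ⧸ P)
  obtain ⟨p, hp⟩ := CharP.exists (𝓞 K ⧸ P)
  obtain ⟨f, hp1, hf⟩ := FiniteField.card (𝓞 K ⧸ P) p
  refine ⟨p, f, hp1, f.pos, ?_, ?_⟩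
  · rw [Ideal.absNorm_apply, Submodule.cardQuot_apply, Nat.card_eq_fintype_card, hf]
  · rw [← Ideal.Quotient.eq_zero_iff_mem, map_natCast, CharP.cast_eq_zero]

lemma card_le_finrank {p : ℕ} (hp : p.Prime) (T : Finset (Ideal (𝓞 K))) (hT : ∀ P ∈ T, Prime P ∧ (p : 𝓞 K) ∈ P ∧ p ∣ Ideal.absNorm P) :
    T.card ≤ Module.finrank ℚ K := by
  have h1 : ∏ P ∈ T, P ∣ Ideal.span {(p : 𝓞 K)} :=
    prod_primes_dvd _ (fun P hP => (hT P hP).1) fun P hP => Ideal.dvd_iff_le.mpr ((Ideal.span_singleton_le_iff_mem _).mpr (hT P hP).2.1)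
  have h2 : p ^ T.card ∣ ∏ P ∈ T, Ideal.absNorm P := by
    rw [← prod_const]
    exact prod_dvd_prod_of_dvd _ _ fun P hP => (hT P hP).2.2
  have h3 := h2.trans ((map_prod Ideal.absNorm (fun P => P) T).symm ▸ map_dvd Ideal.absNorm h1)
  rw [Ideal.absNorm_span_singleton, show (p : 𝓞 K) = algebraMap ℤ (𝓞 K) p by simp, Algebra.norm_algebraMap, Int.natAbs_pow,
    Int.natAbs_natCast, RingOfIntegers.rank] at h3
  exact (Nat.pow_dvd_pow_iff_le_right hp.one_lt).mp h3

lemma card_absNorm_eq {p : ℕ} (hp : p.Prime) :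
    Nat.card {P : Ideal (𝓞 K) // Ideal.absNorm P = p} = Nat.card (𝓞 K →+* ZMod p) := by
  have := Fact.mk hp
  have hker : ∀ r : 𝓞 K →+* ZMod p, Ideal.absNorm (RingHom.ker r) = p := fun r => by
    rw [Ideal.absNorm_apply, Submodule.cardQuot_apply,
      Nat.card_congr (RingHom.quotientKerEquivOfSurjective (ZMod.ringHom_surjective r)).toEquiv, Nat.card_zmod]
  refine (Nat.card_congr (Equiv.ofBijective (fun r : 𝓞 K →+* ZMod p => (⟨RingHom.ker r, hker r⟩ : {P : Ideal (𝓞 K) // Ideal.absNorm P = p}))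
    ⟨fun r r' h => ?_, fun ⟨P, hP⟩ => ?_⟩)).symm
  · exact ZMod.ringHom_eq_of_ker_eq _ _ (Subtype.ext_iff.mp h)
  · have hcard : Nat.card (𝓞 K ⧸ P) = p := by rwa [Ideal.absNorm_apply, Submodule.cardQuot_apply] at hP
    have : Finite (𝓞 K ⧸ P) := Nat.finite_of_card_ne_zero (hcard ▸ hp.ne_zero)
    have := Fintype.ofFinite (𝓞 K ⧸ P)
    let e := ZMod.ringEquivOfPrime (𝓞 K ⧸ P) hp (by rwa [← Nat.card_eq_fintype_card])
    refine ⟨(e.symm : 𝓞 K ⧸ P →+* ZMod p).comp (Ideal.Quotient.mk P), Subtype.ext ?_⟩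
    ext x
    simp [RingHom.mem_ker, Ideal.Quotient.eq_zero_iff_mem]

lemma prime_of_absNorm {P : Ideal (𝓞 K)} (hP : (Ideal.absNorm P).Prime) : Prime P :=
  Ideal.prime_of_isPrime (fun h => hP.ne_zero (by simp [h])) (Ideal.isPrime_of_irreducible_absNorm hP)

lemma homCount_le (p : ℕ) : homCount K p ≤ Module.finrank ℚ K := by
  rw [homCount]
  split_ifs with hp
  · have : Finite {P : Ideal (𝓞 K) // Ideal.absNorm P = p} := Ideal.finite_setOfPred_absNorm_eq p
    have := Fintype.ofFinite {P : Ideal (𝓞 K) // Ideal.absNorm P = p}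
    rw [← card_absNorm_eq K hp, Nat.card_eq_fintype_card, ← card_univ, ← card_map (Function.Embedding.subtype _)]
    refine card_le_finrank K hp _ fun P hP => ?_
    obtain ⟨⟨P, hPp⟩, -, rfl⟩ := mem_map.mp hP
    clear hP
    exact ⟨prime_of_absNorm K (hPp.symm ▸ hp), hPp ▸ Ideal.absNorm_mem P, hPp.symm.dvd⟩
  · exact Nat.zero_le _

noncomputable def normPow {s : ℝ} (hs : s ≠ 0) : Ideal (𝓞 K) →*₀ ℝ where
  toFun I := (Ideal.absNorm I : ℝ) ^ s
  map_zero' := by simp [Real.zero_rpow hs]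
  map_one' := by simp
  map_mul' I J := by simp [Real.mul_rpow]

lemma summable_homCount {s : ℝ} (hs : 1 < s) : Summable fun n => homCount K n * (n : ℝ) ^ (-s) := by
  refine ((Real.summable_nat_rpow.mpr (by linarith : -s < -1)).mul_left (Module.finrank ℚ K : ℝ)).of_nonneg_of_le
    (fun n => by positivity) fun n => ?_
  gcongr
  exact homCount_le K n

/-- The primes of higher degree contribute a bounded amount. -/
lemma exists_bound_higher_degree : ∃ C : ℝ, ∀ s : ℝ, 1 < s →
    (Summable fun P : {P : Ideal (𝓞 K) // Prime P ∧ ¬ (Ideal.absNorm P).Prime} => (Ideal.absNorm P.1 : ℝ) ^ (-s)) ∧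
    ∑' P : {P : Ideal (𝓞 K) // Prime P ∧ ¬ (Ideal.absNorm P).Prime}, (Ideal.absNorm P.1 : ℝ) ^ (-s) ≤ C := by
  choose! p f hp hf hn hmem using fun P : Ideal (𝓞 K) => exists_absNorm_eq_pow K (P := P)
  set I := {P : Ideal (𝓞 K) // Prime P ∧ ¬ (Ideal.absNorm P).Prime}
  have hfib : ∀ (n : ℕ) (T : Finset {i : I // p i.1 = n}), T.card ≤ Module.finrank ℚ K := fun n T => by
    rcases T.eq_empty_or_nonempty with rfl | ⟨P, hP⟩
    · simp
    · have hpn : n.Prime := P.2 ▸ hp _ P.1.2.1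
      rw [← card_map ((Function.Embedding.subtype _).trans (Function.Embedding.subtype _))]
      refine card_le_finrank K hpn _ fun Q _ => ?_
      obtain ⟨⟨⟨Q, hQ⟩, hQn⟩, -, rfl⟩ := mem_map.mp ‹_›
      subst hQn
      exact ⟨hQ.1, hmem _ hQ.1, hn _ hQ.1 ▸ dvd_pow_self _ (hf _ hQ.1).ne'⟩
  have hfin : ∀ n, Finite {i : I // p i.1 = n} := fun n => by
    by_contra h
    rw [not_finite_iff_infinite] at h
    obtain ⟨T, hT⟩ := Infinite.exists_subset_card_eq {i : I // p i.1 = n} (Module.finrank ℚ K + 1)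
    have := hfib n T
    omega
  have hcard : ∀ n, Nat.card {i : I // p i.1 = n} ≤ Module.finrank ℚ K := fun n => by
    have := Fintype.ofFinite {i : I // p i.1 = n}
    rw [Nat.card_eq_fintype_card]
    exact hfib n univ
  have hsum : Summable fun n : ℕ => (Nat.card {i : I // p i.1 = n} : ℝ) * (n : ℝ) ^ (-2 : ℝ) := by
    refine ((Real.summable_nat_rpow.mpr (by norm_num : (-2 : ℝ) < -1)).mul_left (Module.finrank ℚ K : ℝ)).of_nonneg_of_le
      (fun n => by positivity) fun n => ?_
    gcongr
    exact hcard n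
  have h1 := (tsum_comp_eq_tsum_card (fun i : I => p i.1) hfin (fun n => (n : ℝ) ^ (-2 : ℝ)) (fun n => by positivity) hsum).1
  have hle : ∀ s : ℝ, 1 < s → ∀ P : I, (Ideal.absNorm P.1 : ℝ) ^ (-s) ≤ (p P.1 : ℝ) ^ (-2 : ℝ) := fun s hs P => by
    have hpp := hp _ P.2.1
    have hf2 : 2 ≤ f P.1 := by
      by_contra! h
      have h3 : f P.1 = 1 := by have := hf _ P.2.1; omega
      exact P.2.2 (by rw [hn _ P.2.1, h3, pow_one]; exact hpp)
    rw [hn _ P.2.1, Nat.cast_pow, ← Real.rpow_natCast, ← Real.rpow_mul (Nat.cast_nonneg _)]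
    have h2 : (2 : ℝ) ≤ f P.1 := by exact_mod_cast hf2
    exact Real.rpow_le_rpow_of_exponent_le (by exact_mod_cast hpp.one_le) (by nlinarith)
  refine ⟨∑' P : I, (p P.1 : ℝ) ^ (-2 : ℝ), fun s hs => ?_⟩
  have h2 := h1.of_nonneg_of_le (fun P => by positivity) (hle s hs)
  exact ⟨h2, h2.tsum_le_tsum (hle s hs) h1⟩

theorem exists_bound_homCount : ∃ C : ℝ, ∀ s : ℝ, 1 < s → s ≤ 2 →
    |∑' n, homCount K n * (n : ℝ) ^ (-s) - Real.log (1 / (s - 1))| ≤ C := by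
  obtain ⟨hsum, C₁, hC₁⟩ := exists_bounds_idealSum K
  obtain ⟨C₂, hC₂⟩ := exists_bound_higher_degree K
  refine ⟨C₁ + C₂ + 2 * ∑' I : Ideal (𝓞 K), (Ideal.absNorm I : ℝ) ^ (-2 : ℝ), fun s hs hs2 => ?_⟩
  have hs0 : -s ≠ 0 := by linarith
  have hS := hsum s hs
  have hge : ∀ P : Ideal (𝓞 K), Prime P → 2 ≤ Ideal.absNorm P := fun P hP => by
    obtain ⟨p, f, hp, hf, h, -⟩ := exists_absNorm_eq_pow K hP
    exact h ▸ hp.two_le.trans (Nat.le_self_pow hf.ne' p)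
  have hE := abs_log_tsum_sub_le (normPow K hs0) (fun I => Real.rpow_nonneg (Nat.cast_nonneg (Ideal.absNorm I)) (-s)) hS fun P hP => ?_
  swap
  · have h2 : (2 : ℝ) ≤ Ideal.absNorm P := by exact_mod_cast hge P hP
    change (Ideal.absNorm P : ℝ) ^ (-s) ≤ _
    refine (Real.rpow_le_rpow_of_nonpos (by norm_num) h2 (by linarith)).trans ?_
    refine (Real.rpow_le_rpow_of_exponent_le (by norm_num) (by linarith : -s ≤ -1)).trans ?_
    norm_num [Real.rpow_neg_one]
  change |Real.log (∑' I : Ideal (𝓞 K), (Ideal.absNorm I : ℝ) ^ (-s)) - ∑' v : {v : Ideal (𝓞 K) // Prime v}, (Ideal.absNorm v.1 : ℝ) ^ (-s)| ≤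
    2 * ∑' v : {v : Ideal (𝓞 K) // Prime v}, ((Ideal.absNorm v.1 : ℝ) ^ (-s)) ^ 2 at hE
  have hsq : ∑' v : {v : Ideal (𝓞 K) // Prime v}, ((Ideal.absNorm v.1 : ℝ) ^ (-s)) ^ 2 ≤ ∑' I : Ideal (𝓞 K), (Ideal.absNorm I : ℝ) ^ (-2 : ℝ) := by
    have hle : ∀ v : {v : Ideal (𝓞 K) // Prime v}, ((Ideal.absNorm v.1 : ℝ) ^ (-s)) ^ 2 ≤ (Ideal.absNorm v.1 : ℝ) ^ (-2 : ℝ) := fun v => by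
      rw [← Real.rpow_natCast, ← Real.rpow_mul (Nat.cast_nonneg _)]
      exact Real.rpow_le_rpow_of_exponent_le (by exact_mod_cast one_le_two.trans (hge _ v.2)) (by push_cast; linarith)
    have h2 := hsum 2 (by norm_num)
    have h3 : Summable fun v : {v : Ideal (𝓞 K) // Prime v} => (Ideal.absNorm v.1 : ℝ) ^ (-2 : ℝ) := h2.subtype _
    exact ((h3.of_nonneg_of_le (fun v => by positivity) hle).tsum_le_tsum hle h3).trans
      (h2.tsum_subtype_le _ _ fun _ => by positivity)
  have hsplit : ∑' v : {v : Ideal (𝓞 K) // Prime v}, (Ideal.absNorm v.1 : ℝ) ^ (-s) =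
      ∑' n, homCount K n * (n : ℝ) ^ (-s) +
      ∑' P : {P : Ideal (𝓞 K) // Prime P ∧ ¬ (Ideal.absNorm P).Prime}, (Ideal.absNorm P.1 : ℝ) ^ (-s) := by
    have h1 : ∑' P : {P : Ideal (𝓞 K) // (Ideal.absNorm P).Prime}, (Ideal.absNorm P.1 : ℝ) ^ (-s) =
        ∑' n, homCount K n * (n : ℝ) ^ (-s) := by
      have hc : ∀ n, Nat.card {i : {P : Ideal (𝓞 K) // (Ideal.absNorm P).Prime} // Ideal.absNorm i.1 = n} = homCount K n := fun n => by
        rw [homCount]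
        split_ifs with hn
        · rw [← card_absNorm_eq K hn]
          exact Nat.card_congr ⟨fun i => ⟨i.1.1, i.2⟩, fun i => ⟨⟨i.1, by rw [i.2]; exact hn⟩, i.2⟩, fun _ => rfl, fun _ => rfl⟩
        · have : IsEmpty {i : {P : Ideal (𝓞 K) // (Ideal.absNorm P).Prime} // Ideal.absNorm i.1 = n} := ⟨fun i => hn (by rw [← i.2]; exact i.1.2)⟩
          exact Nat.card_of_isEmpty
      have hfin : ∀ n, Finite {i : {P : Ideal (𝓞 K) // (Ideal.absNorm P).Prime} // Ideal.absNorm i.1 = n} := fun n => by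
        have : Finite {P : Ideal (𝓞 K) // Ideal.absNorm P = n} := Ideal.finite_setOfPred_absNorm_eq n
        exact Finite.of_injective (fun i => (⟨i.1.1, i.2⟩ : {P : Ideal (𝓞 K) // Ideal.absNorm P = n}))
          fun i j h => by
            have := congrArg Subtype.val h
            exact Subtype.ext (Subtype.ext this)
      have := (tsum_comp_eq_tsum_card (fun i : {P : Ideal (𝓞 K) // (Ideal.absNorm P).Prime} => Ideal.absNorm i.1) hfin
        (fun n => (n : ℝ) ^ (-s)) (fun n => by positivity) (by simpa only [hc] using summable_homCount K hs)).2
      simpa only [hc] using this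
    rw [← h1]
    have hA : {P : Ideal (𝓞 K) | Prime P} = {P | (Ideal.absNorm P).Prime} ∪ {P | Prime P ∧ ¬ (Ideal.absNorm P).Prime} := by
      ext P
      have := prime_of_absNorm K (P := P)
      simp only [Set.mem_ofPred_eq, Set.mem_union]
      tauto
    have hd : Disjoint {P : Ideal (𝓞 K) | (Ideal.absNorm P).Prime} {P | Prime P ∧ ¬ (Ideal.absNorm P).Prime} :=
      Set.disjoint_left.mpr fun P h h' => h'.2 h
    have := Summable.tsum_union_disjoint hd (hS.subtype _) (hS.subtype _)
    rw [← hA] at this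
    exact this
  have h3 := hC₁ s hs hs2
  have h4 := (hC₂ s hs).2
  have h5 : 0 ≤ ∑' P : {P : Ideal (𝓞 K) // Prime P ∧ ¬ (Ideal.absNorm P).Prime}, (Ideal.absNorm P.1 : ℝ) ^ (-s) :=
    tsum_nonneg fun _ => by positivity
  rw [abs_le] at *
  constructor <;> linarith

end

end MacMahon

namespace MacMahon
open scoped MatrixGroups Manifold UpperHalfPlane
open NumberField

section

variable {A B : Type} [CommRing A] [CommRing B] {i : A →+* B} {σ : B →+* B} {p : ℕ} [Fact p.Prime]

lemma exists_residue_field (hi : Function.Injective i) (hσ : ∀ x, σ (σ x) = x)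
    (hfix : ∀ y, σ y = y → ∃ t, i t = y) (r : A →+* ZMod p) :
    ∃ (k : Type) (_ : Field k) (_ : CharP k p) (R : B →+* k), Function.Surjective R ∧ (∀ t, R (i t) = ((r t).val : k)) := by
  let := i.toAlgebra
  have h_int : Algebra.IsIntegral A B := ⟨fun x => by
    obtain ⟨a, ha⟩ := hfix (x + σ x) (by rw [map_add, hσ, add_comm])
    obtain ⟨b, hb⟩ := hfix (x * σ x) (by rw [map_mul, hσ, mul_comm])
    refine ⟨Polynomial.X ^ 2 - Polynomial.C a * Polynomial.X + Polynomial.C b, by monicity!, ?_⟩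
    simp only [Polynomial.eval₂_add, Polynomial.eval₂_sub, Polynomial.eval₂_mul, Polynomial.eval₂_C, Polynomial.eval₂_X, Polynomial.eval₂_pow]
    change x ^ 2 - i a * x + i b = 0
    rw [ha, hb]
    ring⟩
  have hmax : (RingHom.ker r).IsMaximal := RingHom.ker_isMaximal_of_surjective r (ZMod.ringHom_surjective r)
  obtain ⟨Q, hQ, hQr⟩ := Ideal.exists_ideal_over_maximal_of_isIntegral (S := B) (RingHom.ker r)
    (by rw [(RingHom.injective_iff_ker_eq_bot (algebraMap A B)).mp hi]; exact bot_le)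
  have hR : ∀ t, Ideal.Quotient.mk Q (i t) = 0 ↔ r t = 0 := fun t => by
    rw [Ideal.Quotient.eq_zero_iff_mem, ← RingHom.mem_ker, ← hQr]
    exact Iff.rfl
  have hp0 : ((p : ℕ) : B ⧸ Q) = 0 := by
    have := (hR p).mpr (by simp)
    simpa using this
  let _ : Field (B ⧸ Q) := Ideal.Quotient.field Q
  refine ⟨B ⧸ Q, inferInstance, (CharP.charP_iff_prime_eq_zero Fact.out).mpr hp0, Ideal.Quotient.mk Q, Ideal.Quotient.mk_surjective, fun t => ?_⟩
  have := (hR (t - (r t).val)).mpr (by simp)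
  rw [map_sub, map_sub, map_natCast, map_natCast, sub_eq_zero] at this
  exact this

variable {k : Type} [Field k] [CharP k p] {R : B →+* k} {r : A →+* ZMod p}

lemma natCast_pow_eq (n : ℕ) : (n : k) ^ p = n := by
  have := map_natCast (frobenius k p) n
  rwa [frobenius_def] at this

lemma pow_eq_or (hσ : ∀ x, σ (σ x) = x) (hfix : ∀ y, σ y = y → ∃ t, i t = y) (hR : ∀ t, R (i t) = ((r t).val : k)) (x : B) :
    R x ^ p = R x ∨ R x ^ p = R (σ x) := by
  obtain ⟨a, ha⟩ := hfix (x + σ x) (by rw [map_add, hσ, add_comm])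
  obtain ⟨b, hb⟩ := hfix (x * σ x) (by rw [map_mul, hσ, mul_comm])
  have h1 : (R x + R (σ x)) ^ p = R x + R (σ x) := by rw [← map_add, ← ha, hR, natCast_pow_eq]
  have h2 : (R x * R (σ x)) ^ p = R x * R (σ x) := by rw [← map_mul, ← hb, hR, natCast_pow_eq]
  rw [add_pow_char] at h1
  rw [mul_pow] at h2
  have h3 : (R x ^ p - R x) * (R x ^ p - R (σ x)) = 0 := by linear_combination (R x ^ p) * h1 - h2
  rcases mul_eq_zero.mp h3 with h | h
  · exact Or.inl (sub_eq_zero.mp h)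
  · exact Or.inr (sub_eq_zero.mp h)

lemma card_le_of_pow_eq {q : ℕ} (hq : 1 < q) (h : ∀ y : k, y ^ q = y) : Finite k ∧ Nat.card k ≤ q := by
  classical
  have hne := FiniteField.X_pow_card_sub_X_ne_zero k hq
  have hmem : ∀ y : k, y ∈ (Polynomial.X ^ q - Polynomial.X : Polynomial k).roots.toFinset := fun y => by
    rw [Multiset.mem_toFinset, Polynomial.mem_roots hne]
    simp [h y]
  have hfin : Fintype k := ⟨_, hmem⟩
  refine ⟨inferInstance, ?_⟩
  rw [Nat.card_eq_fintype_card, ← card_univ]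
  refine (card_le_card fun y _ => hmem y).trans ((Multiset.toFinset_card_le _).trans ((Polynomial.card_roots' _).trans ?_))
  rw [FiniteField.X_pow_card_sub_X_natDegree_eq k hq]

lemma exists_hom_card_sq (hσ : ∀ x, σ (σ x) = x) (hfix : ∀ y, σ y = y → ∃ t, i t = y) (hs : Function.Surjective R)
    (hR : ∀ t, R (i t) = ((r t).val : k)) :
    ∃ (F : Type) (_ : Field F), Nat.card F = p ^ 2 ∧ Nonempty (B →+* F) := by
  have hp : p.Prime := Fact.out
  have h2 : ∀ y : k, y ^ p ^ 2 = y := fun y => by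
    obtain ⟨x, rfl⟩ := hs y
    rw [sq, pow_mul]
    rcases pow_eq_or hσ hfix hR x with h | h
    · rw [h, h]
    · have h3 := pow_eq_or hσ hfix hR (σ x)
      rw [hσ] at h3
      rcases h3 with h3 | h3
      · have h4 : R x = R (σ x) := by
          have : (R x - R (σ x)) ^ p = 0 := by rw [sub_pow_char, h, h3, sub_self]
          exact sub_eq_zero.mp (pow_eq_zero_iff hp.ne_zero |>.mp this)
        rw [h, ← h4, h, h4]
      · rw [h, h3]
  obtain ⟨hfin, hle⟩ := card_le_of_pow_eq (Nat.one_lt_pow two_ne_zero hp.one_lt) h2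
  have := Fintype.ofFinite k
  obtain ⟨f, -, hf⟩ := FiniteField.card k p
  rw [Nat.card_eq_fintype_card, hf, Nat.pow_le_pow_iff_right hp.one_lt] at hle
  have hpos := f.pos
  interval_cases hfv : (f : ℕ)
  · have hk : Fintype.card k = p := by rw [hf, pow_one]
    exact ⟨GaloisField p 2, inferInstance, GaloisField.card p 2 two_ne_zero,
      ⟨(algebraMap (ZMod p) (GaloisField p 2)).comp (((ZMod.ringEquivOfPrime k hp hk).symm : k →+* ZMod p).comp R)⟩⟩
  · exact ⟨k, inferInstance, by rw [Nat.card_eq_fintype_card, hf], ⟨R⟩⟩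

variable {ζ ζ' : B} {m : ℕ}

lemma cast_eq_one_or_neg_one (hσ : ∀ x, σ (σ x) = x) (hfix : ∀ y, σ y = y → ∃ t, i t = y)
    (hR : ∀ t, R (i t) = ((r t).val : k)) (hζ : IsPrimitiveRoot (R ζ) m) (hζ' : σ ζ = ζ') (hmul : ζ * ζ' = 1) :
    (p : ZMod m) = 1 ∨ (p : ZMod m) = -1 := by
  have hp : p.Prime := Fact.out
  have h1 : R ζ * R ζ' = 1 := by rw [← map_mul, hmul, map_one]
  rcases pow_eq_or hσ hfix hR ζ with h | h
  · left
    have h2 : R ζ ^ (p - 1) = 1 := by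
      have : R ζ ^ (p - 1) * R ζ = R ζ := by rw [← pow_succ, Nat.sub_add_cancel hp.one_le, h]
      exact (mul_eq_right₀ (left_ne_zero_of_mul_eq_one h1)).mp this
    have := (ZMod.natCast_eq_zero_iff _ _).mpr (hζ.dvd_of_pow_eq_one _ h2)
    rwa [Nat.cast_sub hp.one_le, Nat.cast_one, sub_eq_zero] at this
  · right
    have h2 : R ζ ^ (p + 1) = 1 := by rw [pow_succ, h, hζ', mul_comm, h1]
    have := (ZMod.natCast_eq_zero_iff _ _).mpr (hζ.dvd_of_pow_eq_one _ h2)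
    rw [Nat.cast_succ] at this
    exact eq_neg_of_add_eq_zero_left this

lemma exists_two_extensions (hσ : ∀ x, σ (σ x) = x) (hfix : ∀ y, σ y = y → ∃ t, i t = y) (hσi : ∀ t, σ (i t) = i t)
    (hs : Function.Surjective R)
    (hR : ∀ t, R (i t) = ((r t).val : k)) (hm : 3 ≤ m) (hζ : IsPrimitiveRoot (R ζ) m) (hζ' : σ ζ = ζ') (hmul : ζ * ζ' = 1)
    (hpm : (p : ZMod m) = 1) :
    ∃ r₁ r₂ : B →+* ZMod p, r₁ ≠ r₂ ∧ r₁.comp i = r ∧ r₂.comp i = r := by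
  have hp : p.Prime := Fact.out
  have h1 : R ζ * R ζ' = 1 := by rw [← map_mul, hmul, map_one]
  have hne : R ζ ≠ R ζ' := fun h => by
    have h2 : R ζ ^ 2 = 1 := by rw [sq]; nth_rw 2 [h]; exact h1
    have := Nat.le_of_dvd two_pos (hζ.dvd_of_pow_eq_one _ h2)
    omega
  have hζp : R ζ ^ p = R ζ := by
    obtain ⟨j, hj⟩ : m ∣ p - 1 := by
      rw [← ZMod.natCast_eq_zero_iff, Nat.cast_sub hp.one_le, hpm, Nat.cast_one, sub_self]
    rw [← Nat.sub_add_cancel hp.one_le, hj, pow_succ, pow_mul, hζ.pow_eq_one, one_pow, one_mul]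
  have hζp' : R ζ' ^ p = R ζ' := by
    have : R ζ' = (R ζ)⁻¹ := eq_inv_of_mul_eq_one_right h1
    rw [this, inv_pow, hζp]
  have hσζ' : σ ζ' = ζ := by rw [← hζ', hσ]
  have hpow : ∀ y : k, y ^ p = y := fun y => by
    obtain ⟨x, rfl⟩ := hs y
    obtain ⟨a, ha⟩ := hfix (x + σ x) (by rw [map_add, hσ, add_comm])
    obtain ⟨b, hb⟩ := hfix (x * ζ' + σ x * ζ) (by rw [map_add, map_mul, map_mul, hσ, hζ', hσζ', add_comm])
    have h2 : R x * (R ζ' - R ζ) = R (i b) - R ζ * R (i a) := by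
      rw [ha, hb]
      simp only [map_add, map_mul]
      ring
    have h3 : R x = (((r b).val : k) - R ζ * ((r a).val : k)) / (R ζ' - R ζ) := by
      rw [eq_div_iff (sub_ne_zero.mpr hne.symm), h2, hR, hR]
    rw [h3, div_pow, sub_pow_char, sub_pow_char, mul_pow, natCast_pow_eq, natCast_pow_eq, hζp, hζp']
  obtain ⟨hfin, hle⟩ := card_le_of_pow_eq hp.one_lt hpow
  have := Fintype.ofFinite k
  obtain ⟨f, -, hf⟩ := FiniteField.card k p
  have hk : Fintype.card k = p := by
    rw [Nat.card_eq_fintype_card] at hle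
    exact hle.antisymm (hf ▸ Nat.le_self_pow f.pos.ne' p)
  let e : k ≃+* ZMod p := (ZMod.ringEquivOfPrime k hp hk).symm
  have he : ∀ t, e (R (i t)) = r t := fun t => by rw [hR, map_natCast, ZMod.natCast_zmod_val]
  refine ⟨(e : k →+* ZMod p).comp R, ((e : k →+* ZMod p).comp R).comp σ, fun h => hne ?_, RingHom.ext he, RingHom.ext fun t => ?_⟩
  · have := RingHom.congr_fun h ζ
    simp only [RingHom.comp_apply, hζ'] at this
    exact e.injective this
  · simp only [RingHom.comp_apply, hσi]
    exact he t

end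

end MacMahon

namespace MacMahon
open scoped MatrixGroups Manifold UpperHalfPlane
open NumberField

lemma homCount_eq {K : Type} [Field K] [NumberField K] {p : ℕ} (hp : p.Prime) :
    homCount K p = Nat.card (𝓞 K →+* ZMod p) := if_pos hp

lemma finite_hom (K : Type) [Field K] [NumberField K] {p : ℕ} (hp : p.Prime) : Finite (𝓞 K →+* ZMod p) := by
  have : Finite {P : Ideal (𝓞 K) // Ideal.absNorm P = p} := Ideal.finite_setOfPred_absNorm_eq p
  have := Fact.mk hp
  refine Finite.of_injective (fun r : 𝓞 K →+* ZMod p => (⟨RingHom.ker r, ?_⟩ : {P : Ideal (𝓞 K) // Ideal.absNorm P = p})) fun r r' h =>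
    ZMod.ringHom_eq_of_ker_eq _ _ (Subtype.ext_iff.mp h)
  rw [Ideal.absNorm_apply, Submodule.cardQuot_apply,
    Nat.card_congr (RingHom.quotientKerEquivOfSurjective (ZMod.ringHom_surjective r)).toEquiv, Nat.card_zmod]

lemma two_mul_card_le {α β : Type*} [Finite α] [Finite β] (f : α → β) (h : ∀ b, ∃ a₁ a₂, a₁ ≠ a₂ ∧ f a₁ = b ∧ f a₂ = b) :
    2 * Nat.card β ≤ Nat.card α := by
  choose g₁ g₂ hne h₁ h₂ using h
  have : Function.Injective (Sum.elim g₁ g₂) := Function.Injective.sumElim (fun a b hab => by rw [← h₁ a, hab, h₁])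
    (fun a b hab => by rw [← h₂ a, hab, h₂]) fun a b hab => by
      have : a = b := by rw [← h₁ a, hab, h₂]
      exact hne a (this ▸ hab)
  have := Nat.card_le_card_of_injective _ this
  rwa [Nat.card_sum, ← two_mul] at this

/-- The primes `p ≡ -1` modulo `m` such that the ring generated by `S` maps to the field with `p ^ 2` elements. -/
def goodPrimes (S : Finset ℂ) (m : ℕ) : Set ℕ :=
  {p | p.Prime ∧ (p : ZMod m) = -1 ∧ ∃ (F : Type) (_ : Field F), Nat.card F = p ^ 2 ∧ Nonempty (finRing S →+* F)}

theorem exists_le_tsum_goodPrimes (S : Finset ℂ) {m : ℕ} (hm : 3 ≤ m) : ∃ c C : ℝ, 0 < c ∧ ∀ s : ℝ, 1 < s → s ≤ 2 →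
    c * Real.log (1 / (s - 1)) - C ≤ ∑' n : ℕ, (goodPrimes S m).indicator (fun n => (n : ℝ) ^ (-s)) n := by
  classical
  obtain ⟨E, _, _, σ, ζ, N, hN, hσ, hζ, hσζ, hhom⟩ := exists_numberField S (show 0 < m by omega)
  let K : Subfield E := RingHom.eqLocusField σ (RingHom.id E)
  have hK : ∀ x : K, σ x = x := fun x => x.2
  have : NumberField K :=
    { to_charZero := inferInstance
      to_finiteDimensional := Module.Finite.of_injective K.subtype.toRatAlgHom.toLinearMap K.subtype.injective }
  let i : 𝓞 K →+* 𝓞 E := RingOfIntegers.mapRingHom K.subtype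
  let τ : 𝓞 E →+* 𝓞 E := RingOfIntegers.mapRingHom σ
  have hi : Function.Injective i := fun x y h => by
    apply RingOfIntegers.ext
    apply Subtype.ext
    exact congrArg (algebraMap (𝓞 E) E) h
  have hτ : ∀ x, τ (τ x) = x := fun x => RingOfIntegers.ext (hσ x)
  have hτi : ∀ t, τ (i t) = i t := fun t => RingOfIntegers.ext (hK t)
  have hfix : ∀ y, τ y = y → ∃ t, i t = y := fun y hy => by
    have h1 : σ (y : E) = y := congrArg (algebraMap (𝓞 E) E) hy
    have h2 : IsIntegral ℤ (⟨(y : E), h1⟩ : K) :=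
      (isIntegral_algHom_iff (K.subtype.toIntAlgHom) K.subtype.injective).mp y.2
    exact ⟨⟨_, h2⟩, RingOfIntegers.ext rfl⟩
  have hm0 : NeZero m := ⟨by omega⟩
  let z : 𝓞 E := hζ.toInteger
  let z' : 𝓞 E := hζ.inv.toInteger
  have hzz : z * z' = 1 := RingOfIntegers.ext (mul_inv_cancel₀ (hζ.ne_zero (by omega)))
  have hτz : τ z = z' := RingOfIntegers.ext hσζ
  have hz : IsPrimitiveRoot z m := hζ.toInteger_isPrimitiveRoot
  set d : ℝ := ((Module.finrank ℚ K : ℕ) : ℝ) with hd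
  have hpt : ∀ n : ℕ, (homCount K n : ℝ) ≤ d * (goodPrimes S m).indicator 1 n + d * (if n ∈ range (m * N + 1) then 1 else 0) + 1 / 2 * homCount E n := fun n => by
    have hle : (homCount K n : ℝ) ≤ d := Nat.cast_le.mpr (homCount_le K n)
    have h0 : (0 : ℝ) ≤ homCount E n := by positivity
    have hd0 : (0 : ℝ) ≤ d := by positivity
    by_cases hnP : n ∈ goodPrimes S m
    · rw [Set.indicator_of_mem hnP]
      simp only [Pi.one_apply]
      split_ifs <;> linarith
    rw [Set.indicator_of_notMem hnP]
    by_cases hn : n ∈ range (m * N + 1)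
    · rw [if_pos hn]
      linarith
    rw [if_neg hn]
    suffices h : 2 * homCount K n ≤ homCount E n by
      have : (2 : ℝ) * homCount K n ≤ homCount E n := by exact_mod_cast h
      linarith
    by_cases hp : n.Prime
    swap
    · simp [homCount, hp]
    have hmN : ¬ n ∣ m * N := fun h => hn (mem_range_succ_iff.mpr (Nat.le_of_dvd (Nat.pos_of_ne_zero (mul_ne_zero (by omega) hN)) h))
    have := Fact.mk hp
    have := finite_hom E hp
    have := finite_hom K hp
    rw [homCount_eq hp, homCount_eq hp]
    refine two_mul_card_le (fun r' : 𝓞 E →+* ZMod n => r'.comp i) fun r => ?_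
    obtain ⟨k, _, _, R, hs, hR⟩ := exists_residue_field hi hτ hfix r
    have hmk : NeZero (m : k) := ⟨fun h => hmN (((CharP.cast_eq_zero_iff k n m).mp h).mul_right _)⟩
    have hRz : IsPrimitiveRoot (R z) m := by
      rw [← Polynomial.isRoot_cyclotomic_iff]
      have h1 : (Polynomial.cyclotomic m (𝓞 E)).IsRoot z := hz.isRoot_cyclotomic (by omega)
      have := h1.map (f := R)
      rwa [Polynomial.map_cyclotomic] at this
    rcases cast_eq_one_or_neg_one hτ hfix hR hRz hτz hzz with h | h
    · exact exists_two_extensions hτ hfix hτi hs hR hm hRz hτz hzz h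
    · exfalso
      obtain ⟨F, _, hF, ⟨f⟩⟩ := exists_hom_card_sq hτ hfix hs hR
      refine hnP ⟨hp, h, F, inferInstance, hF, hhom F f fun h0 => ?_⟩
      have hfin : Finite F := Nat.finite_of_card_ne_zero (by rw [hF]; exact pow_ne_zero _ hp.ne_zero)
      have h3 : ((n ^ 2 : ℕ) : F) = 0 := by
        have := Fintype.ofFinite F
        rw [← hF, Nat.card_eq_fintype_card, FiniteField.cast_card_eq_zero]
      have h4 : IsCoprime ((n ^ 2 : ℕ) : ℤ) (N : ℤ) := Nat.isCoprime_iff_coprime.mpr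
        (((hp.coprime_iff_not_dvd).mpr fun h => hmN (h.mul_left _)).pow_left 2)
      have h5 := h4.map (Int.castRingHom F)
      rw [eq_intCast, eq_intCast, Int.cast_natCast, Int.cast_natCast, h3, h0] at h5
      exact not_isCoprime_zero_zero h5
  obtain ⟨C₁, hC₁⟩ := exists_bound_homCount K
  obtain ⟨C₂, hC₂⟩ := exists_bound_homCount E
  have hd0 : 0 < d := Nat.cast_pos.mpr Module.finrank_pos
  refine ⟨1 / (2 * d), (C₁ + d * (m * N + 1) + C₂ / 2) / d, by positivity, fun s hs hs2 => ?_⟩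
  have hx : ∀ n : ℕ, (n : ℝ) ^ (-s) ≤ 1 := fun n => by
    rcases Nat.eq_zero_or_pos n with rfl | hn
    · simp [Real.zero_rpow (by linarith : -s ≠ 0)]
    · exact Real.rpow_le_one_of_one_le_of_nonpos (by exact_mod_cast hn) (by linarith)
  have hsP : Summable fun n : ℕ => (goodPrimes S m).indicator (fun n : ℕ => (n : ℝ) ^ (-s)) n :=
    (Real.summable_nat_rpow.mpr (by linarith)).indicator _
  have hsum : HasSum (fun n : ℕ => (if n ∈ range (m * N + 1) then (1 : ℝ) else 0)) (m * N + 1) := by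
    have h : HasSum _ _ := hasSum_sum_of_ne_finset_zero (L := .unconditional ℕ) (f := fun n : ℕ => (if n ∈ range (m * N + 1) then (1 : ℝ) else 0)) (s := range (m * N + 1)) fun n hn => if_neg hn
    rw [sum_congr rfl fun n hn => if_pos hn] at h
    simpa using h
  have hle := hasSum_le (fun n => ?_) (summable_homCount K hs).hasSum
    (((hsP.hasSum.mul_left d).add (hsum.mul_left d)).add ((summable_homCount E hs).hasSum.mul_left (1 / 2)))
  swap
  · have h1 := mul_le_mul_of_nonneg_right (hpt n) (by positivity : 0 ≤ (n : ℝ) ^ (-s))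
    refine h1.trans ?_
    have h2 : (goodPrimes S m).indicator (fun n : ℕ => (n : ℝ) ^ (-s)) n = (goodPrimes S m).indicator 1 n * (n : ℝ) ^ (-s) := by
      by_cases h : n ∈ goodPrimes S m <;> simp [h]
    rw [h2]
    have h3 : (if n ∈ range (m * N + 1) then (1 : ℝ) else 0) * (n : ℝ) ^ (-s) ≤ if n ∈ range (m * N + 1) then (1 : ℝ) else 0 :=
      mul_le_of_le_one_right (by split_ifs <;> simp) (hx n)
    have := mul_le_mul_of_nonneg_left h3 hd0.le
    linarith
  have h1 := abs_le.mp (hC₁ s hs hs2)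
  have h2 := abs_le.mp (hC₂ s hs hs2)
  have h3 : (Real.log (1 / (s - 1)) / 2 - (C₁ + d * (m * N + 1) + C₂ / 2)) ≤ d * ∑' n : ℕ, (goodPrimes S m).indicator (fun n => (n : ℝ) ^ (-s)) n := by
    linarith
  refine le_of_mul_le_mul_left (le_trans (le_of_eq ?_) h3) hd0
  field_simp

end MacMahon

namespace MacMahon
open scoped MatrixGroups Manifold UpperHalfPlane
open NumberField ArithmeticFunction

section

variable (P : Set ℕ)

open Classical in
/-- The primes of `P` dividing `n` exactly once. -/
noncomputable def exactPrimes (n : ℕ) : Finset ℕ := {p ∈ n.primeFactors | p ∈ P ∧ n.factorization p = 1}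

lemma mem_exactPrimes {n p : ℕ} : p ∈ exactPrimes P n ↔ p ∈ P ∧ n.factorization p = 1 := by
  simp only [exactPrimes, mem_filter, and_iff_right_iff_imp]
  exact fun h => Nat.support_factorization n ▸ Finsupp.mem_support_iff.mpr (by omega)

noncomputable def weight : ArithmeticFunction ℝ := ⟨fun n => if n = 0 then 0 else (1 / 2) ^ (exactPrimes P n).card, by simp⟩

lemma weight_apply {n : ℕ} (hn : n ≠ 0) : weight P n = (1 / 2) ^ (exactPrimes P n).card := if_neg hn

lemma weight_nonneg (n : ℕ) : 0 ≤ weight P n := by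
  rcases eq_or_ne n 0 with rfl | hn
  · simp
  · rw [weight_apply P hn]; positivity

lemma weight_le_one (n : ℕ) : weight P n ≤ 1 := by
  rcases eq_or_ne n 0 with rfl | hn
  · simp
  · rw [weight_apply P hn]
    exact pow_le_one₀ (by norm_num) (by norm_num)

lemma weight_one : weight P 1 = 1 := by
  rw [weight_apply P one_ne_zero, show exactPrimes P 1 = ∅ by simp [exactPrimes]]
  simp

lemma weight_prime {p : ℕ} (hp : p.Prime) (hpP : p ∈ P) : weight P p ≤ 1 / 2 := by
  rw [weight_apply P hp.ne_zero]
  refine pow_le_of_le_one (by norm_num) (by norm_num) (card_ne_zero.mpr ⟨p, (mem_exactPrimes P).mpr ⟨hpP, by simp [hp.factorization]⟩⟩)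

lemma weight_mul {a b : ℕ} (h : a.Coprime b) : weight P (a * b) = weight P a * weight P b := by
  rcases eq_or_ne a 0 with rfl | ha
  · simp
  rcases eq_or_ne b 0 with rfl | hb
  · simp
  have h0 : ∀ p, a.factorization p = 0 ∨ b.factorization p = 0 := fun p => by
    by_contra! hc
    have h1 := Nat.dvd_of_factorization_pos hc.1
    have h2 := Nat.dvd_of_factorization_pos hc.2
    have h3 := Nat.eq_one_of_dvd_coprimes h h1 h2
    simp [h3] at hc
  have hd : Disjoint (exactPrimes P a) (exactPrimes P b) := disjoint_left.mpr fun p hp hp' => by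
    have := h0 p
    rw [mem_exactPrimes] at hp hp'
    omega
  rw [weight_apply P ha, weight_apply P hb, weight_apply P (mul_ne_zero ha hb), ← pow_add, ← card_union_of_disjoint hd]
  congr 2
  ext p
  have := h0 p
  rw [mem_union, mem_exactPrimes, mem_exactPrimes, mem_exactPrimes, Nat.factorization_mul ha hb, Finsupp.add_apply]
  constructor
  · rintro ⟨h1, h2⟩
    rcases this with h3 | h3
    · exact Or.inr ⟨h1, by omega⟩
    · exact Or.inl ⟨h1, by omega⟩
  · rintro (⟨h1, h2⟩ | ⟨h1, h2⟩) <;> exact ⟨h1, by omega⟩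

lemma weight_primePow_mul {d m : ℕ} (hd : IsPrimePow d) (hm : m ≠ 0) : weight P (d * m) ≤ 2 * weight P m := by
  obtain ⟨q, k, hq, hk, rfl⟩ := hd
  have hq' := hq.nat_prime
  rw [weight_apply P hm, weight_apply P (mul_ne_zero (pow_ne_zero _ hq'.ne_zero) hm)]
  have hsub : (exactPrimes P m).erase q ⊆ exactPrimes P (q ^ k * m) := fun p hp => by
    rw [mem_erase, mem_exactPrimes] at hp
    rw [mem_exactPrimes, Nat.factorization_mul (pow_ne_zero _ hq'.ne_zero) hm, hq'.factorization_pow, Finsupp.add_apply,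
      Finsupp.single_eq_of_ne hp.1, zero_add]
    exact hp.2
  have h1 : (exactPrimes P m).card ≤ (exactPrimes P (q ^ k * m)).card + 1 := by
    have := card_le_card hsub
    have := pred_card_le_card_erase (s := exactPrimes P m) (a := q)
    omega
  have := pow_le_pow_of_le_one (by norm_num : (0 : ℝ) ≤ 1 / 2) (by norm_num) h1
  rw [pow_succ] at this
  linarith

/-- The partial sums of the weight, by comparison with the logarithmic partial sums. -/
lemma exists_sum_weight_le : ∃ A : ℝ, 0 < A ∧ ∀ N : ℕ,
    Real.log N * ∑ n ∈ Ioc 0 N, weight P n ≤ A * N * ∑ n ∈ Ioc 0 N, weight P n / n := by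
  refine ⟨2 * (Real.log 4 + 4) + 1, by positivity, fun N => ?_⟩
  have h1 : ∑ n ∈ Ioc 0 N, weight P n * Real.log n ≤ 2 * (Real.log 4 + 4) * N * ∑ n ∈ Ioc 0 N, weight P n / n := by
    calc ∑ n ∈ Ioc 0 N, weight P n * Real.log n ≤ ∑ n ∈ Ioc 0 N, 2 * (weight P * vonMangoldt) n := by
          refine sum_le_sum fun n hn => ?_
          have hn0 : n ≠ 0 := by simp at hn; omega
          rw [← log_apply, ← vonMangoldt_mul_zeta, mul_comm (weight P), coe_mul_zeta_apply, ArithmeticFunction.mul_apply,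
            ← Nat.sum_divisorsAntidiagonal (fun i _ => vonMangoldt i), mul_sum, mul_sum]
          refine sum_le_sum fun x hx => ?_
          obtain ⟨hx, -⟩ := Nat.mem_divisorsAntidiagonal.mp hx
          subst hx
          by_cases hx1 : IsPrimePow x.1
          · have := weight_primePow_mul P hx1 (right_ne_zero_of_mul hn0)
            nlinarith [vonMangoldt_nonneg (n := x.1)]
          · simp [vonMangoldt_eq_zero_iff.mpr hx1]
      _ = 2 * ∑ n ∈ Ioc 0 N, weight P n * ∑ m ∈ Ioc 0 (N / n), vonMangoldt m := by
          rw [← mul_sum, sum_Ioc_mul_eq_sum_sum]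
      _ ≤ 2 * ∑ n ∈ Ioc 0 N, weight P n * ((Real.log 4 + 4) * (N / n)) := by
          gcongr with n hn
          · exact weight_nonneg P n
          · have := Chebyshev.psi_le_const_mul_self (x := (N : ℝ) / n) (by positivity)
            rwa [Chebyshev.psi, Nat.floor_div_eq_div] at this
      _ = _ := by
          rw [mul_sum, mul_sum]
          exact sum_congr rfl fun n _ => by ring
  have h2 : ∑ n ∈ Ioc 0 N, weight P n * (Real.log N - Real.log n) ≤ N * ∑ n ∈ Ioc 0 N, weight P n / n := by
    rw [mul_sum]
    refine sum_le_sum fun n hn => ?_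
    simp only [mem_Ioc] at hn
    have hn0 : (0 : ℝ) < n := by exact_mod_cast hn.1
    have hN0 : (0 : ℝ) < N := by exact_mod_cast hn.1.trans_le hn.2
    rw [← Real.log_div hN0.ne' hn0.ne', mul_div_left_comm]
    exact mul_le_mul_of_nonneg_left (Real.log_le_self (by positivity)) (weight_nonneg P n)
  have h3 : Real.log N * ∑ n ∈ Ioc 0 N, weight P n = ∑ n ∈ Ioc 0 N, weight P n * Real.log n +
      ∑ n ∈ Ioc 0 N, weight P n * (Real.log N - Real.log n) := by
    rw [← sum_add_distrib, mul_sum]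
    exact sum_congr rfl fun n _ => by ring
  rw [h3]
  linarith

lemma summable_weight {s : ℝ} (hs : 1 < s) : Summable fun n : ℕ => weight P n * (n : ℝ) ^ (-s) :=
  (Real.summable_nat_rpow.mpr (by linarith : -s < -1)).of_nonneg_of_le (fun n => mul_nonneg (weight_nonneg P n) (by positivity))
    fun n => mul_le_of_le_one_left (by positivity) (weight_le_one P n)

lemma tsum_le_of_le_pow {g : ℕ → ℝ} {a x : ℝ} (h0 : g 0 = 1) (h1 : g 1 ≤ a * x) (hg : ∀ e, 0 ≤ g e) (h : ∀ e, g e ≤ x ^ e)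
    (hx : 0 ≤ x) (hx2 : x ≤ 1 / 2) : ∑' e, g e ≤ Real.exp (a * x + 2 * x ^ 2) := by
  have hgeo := summable_geometric_of_lt_one hx (by linarith)
  have hs : Summable g := hgeo.of_nonneg_of_le hg h
  have hs2 : Summable fun e => g (e + 2) := (summable_nat_add_iff 2).mpr hs
  have hgeo2 : HasSum (fun e => x ^ (e + 2)) ((1 - x)⁻¹ * x ^ 2) := by
    simpa only [pow_add] using (hasSum_geometric_of_lt_one hx (by linarith)).mul_right (x ^ 2)
  have h2 : ∑' e, g (e + 2) ≤ (1 - x)⁻¹ * x ^ 2 := hasSum_le (fun e => h (e + 2)) hs2.hasSum hgeo2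
  have h3 : (1 - x)⁻¹ ≤ 2 := by rw [inv_le_comm₀ (by linarith) two_pos]; linarith
  rw [← hs.sum_add_tsum_nat_add 2, sum_range_succ, sum_range_one, h0]
  have h4 := Real.add_one_le_exp (a * x + 2 * x ^ 2)
  nlinarith [sq_nonneg x]

lemma one_le_homCount_rat {p : ℕ} (hp : p.Prime) : 1 ≤ homCount ℚ p := by
  have := finite_hom ℚ hp
  rw [homCount_eq hp]
  have : Nonempty (𝓞 ℚ →+* ZMod p) := ⟨(Int.castRingHom _).comp (Rat.ringOfIntegersEquiv : 𝓞 ℚ →+* ℤ)⟩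
  exact Nat.card_pos

lemma exists_tsum_weight_le (hP : ∀ p ∈ P, p.Prime) {c C : ℝ} (h : ∀ s : ℝ, 1 < s → s ≤ 2 →
    c * Real.log (1 / (s - 1)) - C ≤ ∑' n : ℕ, P.indicator (fun n => (n : ℝ) ^ (-s)) n) :
    ∃ B : ℝ, 0 < B ∧ ∀ s : ℝ, 1 < s → s ≤ 2 → ∑' n : ℕ, weight P n * (n : ℝ) ^ (-s) ≤ B * (1 / (s - 1)) ^ (1 - c / 2) := by
  obtain ⟨C₁, hC₁⟩ := exists_bound_homCount ℚ
  set Z := ∑' n : ℕ, (n : ℝ) ^ (-2 : ℝ)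
  refine ⟨Real.exp (C₁ + 2 * Z + C / 2), Real.exp_pos _, fun s hs hs2 => ?_⟩
  have hsw := summable_weight P hs
  have hE := EulerProduct.eulerProduct (f := fun n : ℕ => weight P n * (n : ℝ) ^ (-s)) (by simp [weight_one])
    (fun {a b} hab => by simp only [weight_mul P hab, Nat.cast_mul]; rw [Real.mul_rpow (by positivity) (by positivity)]; ring)
    hsw.norm (by simp)
  have hsx : Summable fun n : ℕ => (n : ℝ) ^ (-s) := Real.summable_nat_rpow.mpr (by linarith)
  have hs2x : Summable fun n : ℕ => (n : ℝ) ^ (-2 : ℝ) := Real.summable_nat_rpow.mpr (by norm_num)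
  refine le_of_tendsto' hE fun N => ?_
  have hp1 : ∀ p ∈ Nat.primesBelow N, ∑' e, weight P (p ^ e) * ((p ^ e : ℕ) : ℝ) ^ (-s) ≤
      Real.exp (weight P p * (p : ℝ) ^ (-s) + 2 * ((p : ℝ) ^ (-s)) ^ 2) := fun p hp => by
    have hpp := Nat.prime_of_mem_primesBelow hp
    have hp2 : (2 : ℝ) ≤ p := by exact_mod_cast hpp.two_le
    refine tsum_le_of_le_pow (by simp [weight_one]) (by simp) (fun e => mul_nonneg (weight_nonneg P _) (by positivity)) (fun e => ?_)
      (by positivity) ?_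
    · rw [Nat.cast_pow, ← Real.rpow_natCast, ← Real.rpow_mul (by positivity), mul_comm (e : ℝ), Real.rpow_mul (by positivity), Real.rpow_natCast]
      exact mul_le_of_le_one_left (by positivity) (weight_le_one P _)
    · refine (Real.rpow_le_rpow_of_nonpos (by norm_num) hp2 (by linarith)).trans ?_
      refine (Real.rpow_le_rpow_of_exponent_le (by norm_num) (by linarith : -s ≤ -1)).trans ?_
      norm_num [Real.rpow_neg_one]
  refine (prod_le_prod (fun p _ => tsum_nonneg fun e => mul_nonneg (weight_nonneg P _) (by positivity)) hp1).trans ?_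
  rw [← Real.exp_sum, Real.rpow_def_of_pos (by simpa using hs), ← Real.exp_add, Real.exp_le_exp]
  have hH := (((summable_homCount ℚ hs).sub ((hsx.indicator P).mul_left (1 / 2))).add (hs2x.mul_left 2))
  have hnn : ∀ n : ℕ, 0 ≤ homCount ℚ n * (n : ℝ) ^ (-s) - 1 / 2 * P.indicator (fun n : ℕ => (n : ℝ) ^ (-s)) n + 2 * (n : ℝ) ^ (-2 : ℝ) := fun n => by
    by_cases hn : n ∈ P
    · have : (1 : ℝ) ≤ homCount ℚ n := by exact_mod_cast one_le_homCount_rat (hP n hn)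
      rw [Set.indicator_of_mem hn]
      have h1 : 0 ≤ (n : ℝ) ^ (-s) := by positivity
      have h2 : 0 ≤ (n : ℝ) ^ (-2 : ℝ) := by positivity
      nlinarith
    · rw [Set.indicator_of_notMem hn, mul_zero, sub_zero]
      positivity
  have hle : ∑ p ∈ Nat.primesBelow N, (weight P p * (p : ℝ) ^ (-s) + 2 * ((p : ℝ) ^ (-s)) ^ 2) ≤
      ∑' n : ℕ, (homCount ℚ n * (n : ℝ) ^ (-s) - 1 / 2 * P.indicator (fun n => (n : ℝ) ^ (-s)) n + 2 * (n : ℝ) ^ (-2 : ℝ)) := by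
    refine le_trans (sum_le_sum fun p hp => ?_) (hH.sum_le_tsum _ fun n _ => hnn n)
    have hpp := Nat.prime_of_mem_primesBelow hp
    have h1 : 0 ≤ (p : ℝ) ^ (-s) := by positivity
    have h2 : ((p : ℝ) ^ (-s)) ^ 2 ≤ (p : ℝ) ^ (-2 : ℝ) := by
      rw [← Real.rpow_natCast, ← Real.rpow_mul (Nat.cast_nonneg _)]
      exact Real.rpow_le_rpow_of_exponent_le (by exact_mod_cast hpp.one_le) (by push_cast; linarith)
    have h3 : (1 : ℝ) ≤ homCount ℚ p := by exact_mod_cast one_le_homCount_rat hpp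
    by_cases hn : p ∈ P
    · rw [Set.indicator_of_mem hn]
      nlinarith [weight_prime P hpp hn]
    · rw [Set.indicator_of_notMem hn]
      nlinarith [weight_le_one P p]
  refine hle.trans ?_
  rw [((summable_homCount ℚ hs).sub ((hsx.indicator P).mul_left (1 / 2))).tsum_add (hs2x.mul_left 2),
    (summable_homCount ℚ hs).tsum_sub ((hsx.indicator P).mul_left (1 / 2)), tsum_mul_left, tsum_mul_left]
  have h4 := (abs_le.mp (hC₁ s hs hs2)).2
  have h5 := h s hs hs2
  change _ - 1 / 2 * _ + 2 * Z ≤ _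
  linarith

/-- Almost all integers are exactly divisible by two distinct primes of `P`. -/
theorem exists_card_le (hP : ∀ p ∈ P, p.Prime) {c C : ℝ} (hc : 0 < c) (h : ∀ s : ℝ, 1 < s → s ≤ 2 →
    c * Real.log (1 / (s - 1)) - C ≤ ∑' n : ℕ, P.indicator (fun n => (n : ℝ) ^ (-s)) n) :
    ∃ α D : ℝ, 0 < α ∧ 0 < D ∧ ∀ N : ℕ, 3 ≤ N →
      (#{n ∈ Ioc 0 N | (exactPrimes P n).card ≤ 1} : ℝ) ≤ D * N / Real.log N ^ α := by
  obtain ⟨A, hA, hA'⟩ := exists_sum_weight_le P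
  obtain ⟨B, hB, hB'⟩ := exists_tsum_weight_le P hP h
  refine ⟨c / 2, 2 * (A * (Real.exp 1 * B)), by positivity, by positivity, fun N hN => ?_⟩
  have hN3 : (3 : ℝ) ≤ N := by exact_mod_cast hN
  have hlog : 1 ≤ Real.log N := by
    rw [Real.le_log_iff_exp_le (by linarith)]
    linarith [Real.exp_one_lt_d9]
  have hlog0 : 0 < Real.log N := by linarith
  set s := 1 + 1 / Real.log N with hs
  have hs1 : 1 < s := by simp [hs, hlog0]
  have hs2 : s ≤ 2 := by
    have : 1 / Real.log N ≤ 1 := (div_le_one hlog0).mpr hlog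
    linarith
  have h1 : (#{n ∈ Ioc 0 N | (exactPrimes P n).card ≤ 1} : ℝ) ≤ 2 * ∑ n ∈ Ioc 0 N, weight P n := by
    rw [card_eq_sum_ones, Nat.cast_sum, mul_sum]
    refine (sum_le_sum fun n hn => ?_).trans (sum_le_sum_of_subset_of_nonneg (filter_subset _ _) fun n _ _ =>
      mul_nonneg two_pos.le (weight_nonneg P n))
    obtain ⟨hn, hn1⟩ := mem_filter.mp hn
    rw [weight_apply P (by simp at hn; omega)]
    have := pow_le_pow_of_le_one (by norm_num : (0 : ℝ) ≤ 1 / 2) (by norm_num) hn1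
    push_cast
    linarith
  have h2 : ∑ n ∈ Ioc 0 N, weight P n / n ≤ Real.exp 1 * (B * Real.log N ^ (1 - c / 2)) := by
    have h3 := hB' s hs1 hs2
    rw [show 1 / (s - 1) = Real.log N by simp [hs]] at h3
    refine le_trans ?_ (mul_le_mul_of_nonneg_left h3 (Real.exp_pos 1).le)
    refine le_trans ?_ (mul_le_mul_of_nonneg_left ((summable_weight P hs1).sum_le_tsum (Ioc 0 N) fun n _ => mul_nonneg (weight_nonneg P n) (by positivity)) (Real.exp_pos 1).le)
    rw [mul_sum]
    refine sum_le_sum fun n hn => ?_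
    simp only [mem_Ioc] at hn
    have hn0 : (0 : ℝ) < n := by exact_mod_cast hn.1
    rw [div_eq_mul_inv, mul_left_comm]
    refine mul_le_mul_of_nonneg_left ?_ (weight_nonneg P n)
    rw [Real.rpow_def_of_pos hn0, ← Real.exp_add, ← Real.exp_log (inv_pos.mpr hn0), Real.exp_le_exp, Real.log_inv, hs]
    have : Real.log n ≤ Real.log N := Real.log_le_log hn0 (by exact_mod_cast hn.2)
    have h4 : Real.log n * (1 / Real.log N) ≤ 1 := by rw [mul_one_div, div_le_one hlog0]; exact this
    have : Real.log n * -(1 + 1 / Real.log N) = -Real.log n - Real.log n * (1 / Real.log N) := by ring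
    linarith
  have h5 := hA' N
  rw [le_div_iff₀ (by positivity)]
  have h6 : Real.log N ^ (1 - c / 2) * Real.log N ^ (c / 2) = Real.log N := by
    rw [← Real.rpow_add hlog0, sub_add_cancel, Real.rpow_one]
  have h7 : ∑ n ∈ Ioc 0 N, weight P n ≤ A * N * (Real.exp 1 * (B * Real.log N ^ (1 - c / 2))) / Real.log N := by
    rw [le_div_iff₀ hlog0, mul_comm]
    exact h5.trans (mul_le_mul_of_nonneg_left h2 (by positivity))
  have h8 := mul_le_mul_of_nonneg_right (h1.trans (mul_le_mul_of_nonneg_left h7 two_pos.le)) (by positivity : 0 ≤ Real.log N ^ (c / 2))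
  refine h8.trans (le_of_eq ?_)
  have h9 : 2 * (A * N * (Real.exp 1 * (B * Real.log N ^ (1 - c / 2))) / Real.log N) * Real.log N ^ (c / 2) =
    2 * (A * N * (Real.exp 1 * B)) * (Real.log N ^ (1 - c / 2) * Real.log N ^ (c / 2)) / Real.log N := by ring
  rw [h9, h6]
  field_simp

end

end MacMahon

namespace MacMahon
open scoped MatrixGroups Manifold UpperHalfPlane
open PowerSeries

open scoped Classical in
/-- The series whose coefficients are divisible, for every `m`, by `m` at almost all `n`. -/
def IsGood (p : ℚ⟦X⟧) : Prop :=
  ∀ m : ℕ, 0 < m → ∃ α D : ℝ, 0 < α ∧ 0 < D ∧ ∀ N : ℕ, 3 ≤ N →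
    (#{n ∈ Ioc 0 N | ¬ ∃ a : ℤ, coeff n p = m * a} : ℝ) ≤ D * N / Real.log N ^ α

lemma one_le_log {N : ℕ} (hN : 3 ≤ N) : 1 ≤ Real.log N := by
  rw [Real.le_log_iff_exp_le (by positivity)]
  have : (3 : ℝ) ≤ N := by exact_mod_cast hN
  linarith [Real.exp_one_lt_three]

lemma IsGood.of_subset {p q : ℚ⟦X⟧} (hp : IsGood p)
    (h : ∀ m : ℕ, 0 < m → ∃ m' : ℕ, 0 < m' ∧ ∀ n, (∃ a : ℤ, coeff n p = m' * a) → ∃ a : ℤ, coeff n q = m * a) : IsGood q := fun m hm => by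
  obtain ⟨m', hm', h⟩ := h m hm
  obtain ⟨α, D, hα, hD, hb⟩ := hp m' hm'
  refine ⟨α, D, hα, hD, fun N hN => le_trans (Nat.cast_le.mpr (card_le_card fun n hn => ?_)) (hb N hN)⟩
  simp only [mem_filter] at hn ⊢
  exact ⟨hn.1, fun h' => hn.2 (h n h')⟩

lemma div_rpow_le {N : ℕ} (hN : 3 ≤ N) {α β D : ℝ} (hD : 0 ≤ D) (h : α ≤ β) :
    D * N / Real.log N ^ β ≤ D * N / Real.log N ^ α :=
  div_le_div_of_nonneg_left (by positivity) (Real.rpow_pos_of_pos (by linarith [one_le_log hN]) _)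
    (Real.rpow_le_rpow_of_exponent_le (one_le_log hN) h)

lemma IsGood.add {p q : ℚ⟦X⟧} (hp : IsGood p) (hq : IsGood q) : IsGood (p + q) := fun m hm => by
  obtain ⟨α, D, hα, hD, h⟩ := hp m hm
  obtain ⟨β, E, hβ, hE, h'⟩ := hq m hm
  refine ⟨min α β, D + E, lt_min hα hβ, by positivity, fun N hN => ?_⟩
  have h1 := (h N hN).trans (div_rpow_le hN hD.le (min_le_left α β))
  have h2 := (h' N hN).trans (div_rpow_le hN hE.le (min_le_right α β))
  rw [add_mul, add_div]
  refine le_trans ?_ (add_le_add h1 h2)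
  rw [← Nat.cast_add, Nat.cast_le]
  refine le_trans (card_le_card fun n hn => ?_) (card_union_le _ _)
  simp only [mem_union, mem_filter] at hn ⊢
  by_contra! hc
  obtain ⟨a, ha⟩ := hc.1 hn.1
  obtain ⟨b, hb⟩ := hc.2 hn.1
  exact hn.2 ⟨a + b, by rw [map_add, ha, hb]; push_cast; ring⟩

lemma IsGood.smul {p : ℚ⟦X⟧} (hp : IsGood p) (c : ℚ) : IsGood (c • p) :=
  hp.of_subset fun m hm => ⟨m * c.den, Nat.mul_pos hm c.den_pos, fun n ⟨a, ha⟩ => ⟨c.num * a, by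
    rw [coeff_smul, ha, smul_eq_mul]
    nth_rw 1 [← Rat.num_div_den c]
    have : (c.den : ℚ) ≠ 0 := by exact_mod_cast c.den_nz
    push_cast
    field_simp⟩⟩

lemma isGood_C (c : ℚ) : IsGood (C c) := fun m _ => ⟨1, 1, one_pos, one_pos, fun N hN => by
  classical
  rw [filter_false_of_mem, card_empty, Nat.cast_zero]
  · have := one_le_log hN
    positivity
  · intro n hn
    rw [not_not]
    exact ⟨0, by rw [coeff_C, if_neg (by simp at hn; omega)]; simp⟩⟩

/-- The space of good series. -/
def good : Submodule ℚ ℚ⟦X⟧ where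
  carrier := {p | IsGood p}
  zero_mem' := by simpa using isGood_C 0
  add_mem' := IsGood.add
  smul_mem' c _ h := h.smul c

/-- The operator `q d/dq`. -/
noncomputable def theta : Derivation ℚ ℚ⟦X⟧ ℚ⟦X⟧ := (X : ℚ⟦X⟧) • d⁄dX ℚ

@[simp] lemma coeff_theta (n : ℕ) (p : ℚ⟦X⟧) : coeff n (theta p) = n * coeff n p := by
  cases n <;> simp [theta, coeff_succ_X_mul, coeff_derivative, mul_comm]

lemma theta_mem_good {p : ℚ⟦X⟧} (hp : p ∈ good) : theta p ∈ good :=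
  IsGood.of_subset hp fun m hm => ⟨m, hm, fun n ⟨a, ha⟩ => ⟨n * a, by rw [coeff_theta, ha]; push_cast; ring⟩⟩

lemma mem_good_of_exactPrimes {p : ℚ⟦X⟧} (h : ∀ m : ℕ, 0 < m → ∃ (S : Finset ℂ) (m' : ℕ), 3 ≤ m' ∧
    ∀ n, n ≠ 0 → 2 ≤ (exactPrimes (goodPrimes S m') n).card → ∃ a : ℤ, coeff n p = m * a) : p ∈ good := fun m hm => by
  obtain ⟨S, m', hm', h⟩ := h m hm
  obtain ⟨c, C, hc, hs⟩ := exists_le_tsum_goodPrimes S hm'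
  obtain ⟨α, D, hα, hD, hb⟩ := exists_card_le _ (fun p hp => hp.1) hc hs
  refine ⟨α, D, hα, hD, fun N hN => le_trans (Nat.cast_le.mpr (card_le_card fun n hn => ?_)) (hb N hN)⟩
  simp only [mem_filter, mem_Ioc] at hn ⊢
  refine ⟨hn.1, ?_⟩
  by_contra hc
  exact hn.2 (h n (by omega) (by omega))

lemma exists_eq_prime_mul {n p : ℕ} (hp : n.factorization p = 1) : ∃ k, n = p * k ∧ ¬ p ∣ k := by
  have hpp : p.Prime := by
    by_contra h
    simp [Nat.factorization_eq_zero_of_not_prime n h] at hp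
  have hn : n ≠ 0 := by rintro rfl; simp at hp
  obtain ⟨k, rfl⟩ := Nat.dvd_of_factorization_pos (p := p) (by rw [hp]; exact Nat.one_ne_zero)
  refine ⟨k, rfl, fun hk => ?_⟩
  have := (hpp.pow_dvd_iff_le_factorization (k := 2) hn).mp (by rw [pow_two]; exact Nat.mul_dvd_mul_left p hk)
  omega

/-- The series `∑ σ_r(n) q^n`. -/
noncomputable def sigmaSeries (r : ℕ) : ℚ⟦X⟧ := mk fun n => (ArithmeticFunction.sigma r n : ℚ)

lemma sigmaSeries_one_mem_good : sigmaSeries 1 ∈ good :=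
  mem_good_of_exactPrimes fun m hm => ⟨∅, 3 * m, by omega, fun n hn hc => by
    obtain ⟨p, hp⟩ := card_pos.mp (by omega : 0 < (exactPrimes (goodPrimes ∅ (3 * m)) n).card)
    obtain ⟨⟨hpp, hpm, -⟩, hp1⟩ := (mem_exactPrimes _).mp hp
    obtain ⟨k, rfl, hk⟩ := exists_eq_prime_mul hp1
    have h1 : m ∣ p + 1 := by
      refine (dvd_mul_left m 3).trans ((ZMod.natCast_eq_zero_iff _ _).mp ?_)
      push_cast
      rw [hpm]; ring
    obtain ⟨b, hb⟩ := h1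
    refine ⟨b * ArithmeticFunction.sigma 1 k, ?_⟩
    rw [sigmaSeries, coeff_mk, ArithmeticFunction.isMultiplicative_sigma.map_mul_of_coprime ((Nat.Prime.coprime_iff_not_dvd hpp).mpr hk)]
    rw [ArithmeticFunction.sigma_one_apply, hpp.sum_divisors, hb]
    push_cast; ring⟩
end MacMahon

namespace MacMahon
open scoped MatrixGroups Manifold UpperHalfPlane
open UpperHalfPlane PowerSeries Derivative EisensteinSeries
open scoped ModularForm

lemma HasExp.deriv {p : ℂ⟦X⟧} {u : ℍ → ℂ} (h : HasExp 1 p u) :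
    HasExp 1 (mk fun n => n * coeff n p) (normalizedDerivOfComplex u) := fun z => by
  have hz := z.im_pos
  set U : Set ℂ := {w | z.im / 2 < w.im}
  have hU : IsOpen U := isOpen_lt continuous_const Complex.continuous_im
  have hzU : (z : ℂ) ∈ U := by simp only [U, Set.mem_ofPred_eq, coe_im]; linarith
  set F : ℕ → ℂ → ℂ := fun n w => coeff n p * Complex.exp (2 * Real.pi * Complex.I * w) ^ n
  set z' : ℍ := ⟨(z.im / 2 : ℝ) * Complex.I, by simp [hz]⟩
  have hq : ∀ w : ℍ, qpar 1 w = Complex.exp (2 * Real.pi * Complex.I * w) := fun w => by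
    simp [qpar, Function.Periodic.qParam]
  have h1 := Complex.hasSum_deriv_of_summable_norm (F := F) (U := U) (z := (z : ℂ)) (h z').summable.norm
    (fun n => by fun_prop) hU (fun n w hw => ?_) hzU
  · have h2 : _root_.deriv (u ∘ ofComplex) z = _root_.deriv (fun w => ∑' n, F n w) z := by
      refine Filter.EventuallyEq.deriv_eq ?_
      filter_upwards [hU.mem_nhds hzU] with w hw
      have hw0 : 0 < w.im := lt_trans (by positivity) hw
      rw [Function.comp_apply, ← (h (ofComplex w)).tsum_eq, hq, ofComplex_apply_of_im_pos hw0]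
    rw [normalizedDerivOfComplex, h2]
    refine (h1.mul_left _).congr_fun fun n => ?_
    have h3 : HasDerivAt (F n) (coeff n p * (n * Complex.exp (2 * Real.pi * Complex.I * z) ^ n * (2 * Real.pi * Complex.I))) z := by
      refine HasDerivAt.const_mul _ ?_
      have h4 : HasDerivAt (fun w : ℂ => Complex.exp (n * (2 * Real.pi * Complex.I * w)))
          (Complex.exp (n * (2 * Real.pi * Complex.I * z)) * (n * (2 * Real.pi * Complex.I))) z :=
        (by simpa using ((hasDerivAt_id (z : ℂ)).const_mul (2 * Real.pi * Complex.I)).const_mul (n : ℂ) : HasDerivAt _ _ (z : ℂ)).cexp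
      simp only [← Complex.exp_nat_mul]
      exact h4.congr_deriv (by ring)
    rw [h3.deriv, coeff_mk, hq]
    field_simp [Complex.two_pi_I_ne_zero]
  · simp only [F, norm_mul, norm_pow, hq]
    gcongr
    rw [Complex.norm_exp, Complex.norm_exp, Real.exp_le_exp]
    have : z.im / 2 < w.im := hw
    simp [z']
    nlinarith [Real.pi_pos]

/-- Ramanujan's combination `D E₂ - E₂² / 12` is modular of weight four. -/
lemma serreDerivative_one_E2_slash (γ : SL(2, ℤ)) : serreDerivative 1 E2 ∣[(4 : ℤ)] γ = serreDerivative 1 E2 := by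
  have h1 : D2 γ = (2 * Real.pi * Complex.I * γ 1 0 : ℂ) • ((1 : ℍ → ℂ) ∣[(1 : ℤ)] γ) := by
    ext z
    simp [D2, ModularForm.SL_slash_apply, div_eq_mul_inv]
  have h0 : MDiff (1 : ℍ → ℂ) := mdifferentiable_const
  have hm : MDiff ((1 : ℍ → ℂ) ∣[(1 : ℤ)] γ) := by
    exact h0.slash 1 (γ : GL (Fin 2) ℝ)
  have h2 := normalizedDerivOfComplex_SL_slash (k := 1) h0 (γ := γ)
  have h3 := normalizedDerivOfComplex_SL_slash (k := 2) E2_mdifferentiable (γ := γ)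
  rw [E2_slash_action, h1, normalizedDerivOfComplex_sub _ _ E2_mdifferentiable ((hm.const_smul _).const_smul _),
    normalizedDerivOfComplex_smul _ _ (hm.const_smul _), normalizedDerivOfComplex_smul _ _ hm, h2] at h3
  ext z
  have h4 := congrFun h3 z
  have h5 : (normalizedDerivOfComplex (1 : ℍ → ℂ)) = 0 := normalizedDerivOfComplex_const 1
  have h6 : E2 ∣[(2 : ℤ)] γ = _ := E2_slash_action γ
  have h7 := congrFun (ModularForm.mul_slash_SL2 2 2 γ E2 E2) z
  rw [h6] at h7
  have h8 : (serreDerivative 1 E2 ∣[(4 : ℤ)] γ) z = (normalizedDerivOfComplex E2 ∣[(2 + 2 : ℤ)] γ) z - 12⁻¹ * ((E2 * E2) ∣[(2 + 2 : ℤ)] γ) z := by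
    simp only [ModularForm.SL_slash_apply, serreDerivative_apply, Pi.mul_apply]
    norm_num
    ring
  rw [h5] at h4
  rw [h8, h7, serreDerivative_apply]
  simp only [h1, Pi.sub_apply, Pi.smul_apply, Pi.mul_apply, smul_eq_mul, ModularForm.SL_slash_apply, Pi.zero_apply, Pi.one_apply, riemannZeta_two, zero_mul, one_mul, zero_sub, zpow_neg, zpow_one] at h4 ⊢
  have hd : denom γ z ≠ 0 := denom_ne_zero _ z
  have hpi : (Real.pi : ℂ) ≠ 0 := by exact_mod_cast Real.pi_ne_zero
  rw [eq_sub_iff_add_eq] at h4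
  rw [← h4]
  generalize denom _ (z : ℂ) = d at hd
  have hI : (2 * Real.pi * Complex.I : ℂ)⁻¹ = -Complex.I / (2 * Real.pi) := by
    rw [mul_inv, Complex.inv_I]
    ring
  rw [hI]
  push_cast
  field_simp
  ring
/-- A multiple of the series is integral. -/
def BddDen (p : ℚ⟦X⟧) : Prop :=
  ∃ d : ℕ, 0 < d ∧ ∃ r : ℤ⟦X⟧, (d : ℚ⟦X⟧) * p = map (Int.castRingHom ℚ) r

lemma BddDen.mul {p q : ℚ⟦X⟧} : BddDen p → BddDen q → BddDen (p * q) := fun ⟨d, hd, r, h⟩ ⟨d', hd', r', h'⟩ =>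
  ⟨d * d', Nat.mul_pos hd hd', r * r', by rw [map_mul, ← h, ← h']; push_cast; ring⟩

lemma BddDen.add {p q : ℚ⟦X⟧} : BddDen p → BddDen q → BddDen (p + q) := fun ⟨d, hd, r, h⟩ ⟨d', hd', r', h'⟩ =>
  ⟨d * d', Nat.mul_pos hd hd', d' * r + d * r', by simp only [map_add, map_mul, ← h, ← h', map_natCast]; push_cast; ring⟩

lemma bddDen_C (c : ℚ) : BddDen (C c) :=
  ⟨c.den, c.den_pos, C c.num, by
    rw [map_C, ← map_natCast (C : ℚ →+* ℚ⟦X⟧), ← map_mul]; simp⟩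

lemma BddDen.theta {p : ℚ⟦X⟧} : BddDen p → BddDen (theta p) := fun ⟨d, hd, r, h⟩ =>
  ⟨d, hd, mk fun n => n * coeff n r, by
    ext n
    have := congrArg (coeff n) h
    rw [← map_natCast (C : ℚ →+* ℚ⟦X⟧), coeff_C_mul, coeff_map] at this
    rw [← map_natCast (C : ℚ →+* ℚ⟦X⟧), coeff_C_mul, coeff_theta, mul_left_comm, this]
    simp⟩

lemma bddDen_sigmaSeries (r : ℕ) : BddDen (sigmaSeries r) :=
  ⟨1, one_pos, mk fun n => (ArithmeticFunction.sigma r n : ℤ), by ext n; simp [sigmaSeries]⟩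

/-- The `q`-expansion of a modular form of level one, with rational coefficients. -/
def IsLevelOne (k : ℕ) (p : ℚ⟦X⟧) : Prop :=
  BddDen p ∧ ∃ g : ℍ → ℂ, MDiff g ∧ HasExp 1 (map (algebraMap ℚ ℂ) p) g ∧ ∀ γ : SL(2, ℤ), g ∣[(k : ℤ)] γ = g

lemma IsLevelOne.mul {k l : ℕ} {p q : ℚ⟦X⟧} : IsLevelOne k p → IsLevelOne l q → IsLevelOne (k + l) (p * q) :=
  fun ⟨hb, g, hg, he, hs⟩ ⟨hb', g', hg', he', hs'⟩ => ⟨hb.mul hb', g * g', hg.mul hg', by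
    rw [map_mul]; exact he.mul he', fun γ => by
    rw [Nat.cast_add, ModularForm.mul_slash_SL2, hs, hs']⟩

/-- The `q`-expansion of the Eisenstein series of weight two. -/
noncomputable def eisTwo : ℚ⟦X⟧ := 1 + C (-24) * sigmaSeries 1

lemma hasExp_eisTwo : HasExp 1 (map (algebraMap ℚ ℂ) eisTwo) E2 := fun z => by
  refine (hasSum_qExpansion_E2 (z := z)).congr_fun fun n => ?_
  rcases eq_or_ne n 0 with rfl | hn
  · simp [eisTwo, sigmaSeries, -coeff_zero_eq_constantCoeff]
  · simp [eisTwo, sigmaSeries, hn, coeff_one, qpar, Function.Periodic.qParam]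

lemma bddDen_eisTwo : BddDen eisTwo :=
  BddDen.add (by simpa using bddDen_C 1) ((bddDen_C _).mul (bddDen_sigmaSeries 1))

lemma HasExp.serre {p : ℚ⟦X⟧} {g : ℍ → ℂ} (h : HasExp 1 (map (algebraMap ℚ ℂ) p) g) (c : ℚ) :
    HasExp 1 (map (algebraMap ℚ ℂ) (theta p + C (-c / 12) * (eisTwo * p))) (serreDerivative c g) := by
  have h1 : map (algebraMap ℚ ℂ) (theta p) = mk fun n => n * coeff n (map (algebraMap ℚ ℂ) p) := by
    ext n; simp
  rw [map_add, map_mul, map_mul, map_C, h1]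
  convert h.deriv.add ((hasExp_C _).mul (hasExp_eisTwo.mul h)) using 1
  ext z
  simp
  ring

lemma IsLevelOne.serre {k : ℕ} {p : ℚ⟦X⟧} : IsLevelOne k p → IsLevelOne (k + 2) (theta p + C (-(k : ℚ) / 12) * (eisTwo * p)) :=
  fun ⟨hb, g, hg, he, hs⟩ => ⟨hb.theta.add ((bddDen_C _).mul (bddDen_eisTwo.mul hb)), serreDerivative k g,
    serreDerivative_mdifferentiable k hg, by
      have h := he.serre k
      rwa [Rat.cast_natCast] at h, fun γ => by
      simpa using serreDerivative_slash_invariant hg (hs γ)⟩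

lemma isLevelOne_ramanujan : IsLevelOne 4 (theta eisTwo + C (-1 / 12) * (eisTwo * eisTwo)) :=
  ⟨bddDen_eisTwo.theta.add ((bddDen_C _).mul (bddDen_eisTwo.mul bddDen_eisTwo)), serreDerivative 1 E2,
    serreDerivative_mdifferentiable 1 E2_mdifferentiable, by
      have h := hasExp_eisTwo.serre 1
      rwa [Rat.cast_one] at h, serreDerivative_one_E2_slash⟩

lemma exists_isLevelOne_sigmaSeries {k : ℕ} (hk : 4 ≤ k) (hk2 : Even k) : ∃ c : ℚ, c ≠ 0 ∧ IsLevelOne k (1 + C c * sigmaSeries (k - 1)) := by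
  have hk3 : 3 ≤ k := by omega
  refine ⟨-(2 * k / bernoulli k), ?_, BddDen.add (by simpa using bddDen_C 1) ((bddDen_C _).mul (bddDen_sigmaSeries _)),
    ModularForm.E hk3, (ModularForm.E hk3).holo', ?_, fun γ => ?_⟩
  · obtain ⟨j, rfl⟩ := hk2.two_dvd
    have h1 := riemannZeta_two_mul_nat (k := j) (by omega)
    have h2 : riemannZeta (2 * j) ≠ 0 := riemannZeta_ne_zero_of_one_lt_re (by
      norm_cast; omega)
    have h3 : bernoulli (2 * j) ≠ 0 := fun h => h2 (by simpa [h] using h1)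
    have h4 : (2 * j : ℕ) ≠ 0 := by omega
    simp only [neg_ne_zero]
    positivity
  · convert modularForm_hasExp (ModularForm.E hk3) using 1
    ext n
    rw [E_qExpansion_coeff _ hk2]
    rcases eq_or_ne n 0 with rfl | hn
    · simp [sigmaSeries, -coeff_zero_eq_constantCoeff]
    · simp [sigmaSeries, coeff_one, hn]
  · exact SlashInvariantFormClass.slash_action_eq (ModularForm.E hk3) _ ⟨γ, rfl⟩

end MacMahon

namespace MacMahon
open scoped MatrixGroups Manifold UpperHalfPlane
open UpperHalfPlane PowerSeries
open scoped ModularForm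

lemma IsLevelOne.mem_good {k : ℕ} {p : ℚ⟦X⟧} (hk : 4 ≤ k) (hk2 : Even k) : IsLevelOne k p → p ∈ good := by
  rintro ⟨⟨d, hd, r, hr⟩, g, hg, he, hs⟩
  suffices h : map (Int.castRingHom ℚ) r ∈ good by
    have h1 := good.smul_mem (d⁻¹ : ℚ) h
    rwa [← hr, ← nsmul_eq_mul, ← Nat.cast_smul_eq_nsmul ℚ, smul_smul, inv_mul_cancel₀ (by positivity), one_smul] at h1
  obtain ⟨n, rfl⟩ : ∃ n, k = n + 2 := ⟨k - 2, by omega⟩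
  refine mem_good_of_exactPrimes fun m hm => ?_
  have he' : HasExp 1 (map (algebraMap ℚ ℂ) (map (Int.castRingHom ℚ) r)) fun z : ℍ => d * g z := by
    rw [← hr, map_mul]
    convert (hasExp_C (d : ℂ)).mul he using 1
    · simp
    · rfl
  have hs' (γ : SL(2, ℤ)) (z : ℍ) : d * g (γ • z) = (γ 1 0 * z + γ 1 1) ^ (n + 2) * (d * g z) := by
    have h1 := congrFun (hs γ) z
    rw [ModularForm.SL_slash_apply, ModularGroup.denom_apply] at h1
    have h2 : (γ 1 0 * z + γ 1 1 : ℂ) ≠ 0 := by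
      rw [← ModularGroup.denom_apply]; exact denom_ne_zero _ z
    rw [← h1]
    rw [zpow_neg, zpow_natCast]
    field_simp
  obtain ⟨m', hm', S, h⟩ := exists_dvd_coeff (n := n) (by grind) (by omega) he' (hg.const_smul (d : ℂ))
    hs' (fun i => ⟨coeff i r, by simp⟩) hm
  refine ⟨S, m', hm', fun v hv hc => ?_⟩
  obtain ⟨ℓ, hℓ, ℓ', hℓ', hne⟩ := Finset.one_lt_card.mp hc
  rw [mem_exactPrimes] at hℓ hℓ'
  obtain ⟨⟨hp, hm1, F, _, hF, ⟨φ⟩⟩, hv1⟩ := hℓ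
  obtain ⟨⟨hp', hm1', -⟩, hv1'⟩ := hℓ'
  obtain ⟨w, rfl, hw⟩ := exists_eq_prime_mul hv1
  have hw0 : w ≠ 0 := by rintro rfl; simp at hw
  rw [Nat.factorization_mul hp.ne_zero hw0, Finsupp.add_apply, hp.factorization, Finsupp.single_eq_of_ne hne.symm, zero_add] at hv1'
  obtain ⟨k, rfl, hk'⟩ := exists_eq_prime_mul hv1'
  have : Fact ℓ.Prime := ⟨hp⟩
  have : Fact ℓ'.Prime := ⟨hp'⟩
  obtain ⟨a, ha⟩ := h ℓ ℓ' hne hm1 hm1' F hF φ k (fun hd => hw (hd.mul_left _)) hk'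
  refine ⟨a, ?_⟩
  rw [coeff_map] at ha
  have h2 : ((coeff (ℓ * (ℓ' * k)) (map (Int.castRingHom ℚ) r) : ℚ) : ℂ) = ((m * a : ℚ) : ℂ) := by
    push_cast; exact ha
  exact_mod_cast h2

/-- The quasimodular `q`-series of level one. -/
noncomputable def quasi : Subalgebra ℚ ℚ⟦X⟧ :=
  Algebra.adjoin ℚ (insert eisTwo {p | ∃ k, 4 ≤ k ∧ Even k ∧ IsLevelOne k p})

lemma one_mem_good : (1 : ℚ⟦X⟧) ∈ good := (map_one (C : ℚ →+* ℚ⟦X⟧)) ▸ isGood_C 1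

lemma eisTwo_mem_good : eisTwo ∈ good := by
  rw [eisTwo, ← smul_eq_C_mul]
  exact good.add_mem one_mem_good (good.smul_mem _ sigmaSeries_one_mem_good)

/-- A graded piece of the algebra of modular `q`-series. -/
def IsGraded (k : ℕ) (p : ℚ⟦X⟧) : Prop := (k = 0 ∧ p = 1) ∨ (4 ≤ k ∧ Even k ∧ IsLevelOne k p)

lemma IsGraded.mul {k l : ℕ} {p q : ℚ⟦X⟧} : IsGraded k p → IsGraded l q → IsGraded (k + l) (p * q) := by
  rintro (⟨rfl, rfl⟩ | ⟨hk, hk2, hp⟩) (⟨rfl, rfl⟩ | ⟨hl, hl2, hq⟩)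
  · exact .inl (by simp)
  · exact .inr (by simpa using ⟨hl, hl2, hq⟩)
  · exact .inr (by simpa using ⟨hk, hk2, hp⟩)
  · exact .inr ⟨by omega, hk2.add hl2, hp.mul hq⟩

lemma eisTwo_pow_mul_mem_good (i : ℕ) : ∀ {k p}, IsGraded k p → eisTwo ^ i * p ∈ good := by
  induction i using Nat.strong_induction_on with
  | _ i ih =>
  intro k p hp
  obtain rfl | ⟨i, rfl⟩ : i = 0 ∨ ∃ j, i = j + 1 := by cases i <;> simp
  · rcases hp with ⟨-, rfl⟩ | ⟨hk, hk2, hp⟩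
    · simpa using one_mem_good
    · simpa using hp.mem_good hk hk2
  by_cases hik : i = 0 ∧ k = 0
  · obtain ⟨rfl, rfl⟩ := hik
    rcases hp with ⟨-, rfl⟩ | ⟨hk, -⟩
    · simpa using eisTwo_mem_good
    · omega
  have h1 : eisTwo ^ i * (theta p + C (-(k : ℚ) / 12) * (eisTwo * p)) ∈ good := by
    rcases hp with ⟨rfl, rfl⟩ | ⟨hk, hk2, hp⟩
    · simp
    · exact ih i (by omega) (.inr ⟨by omega, hk2.add even_two, hp.serre⟩)
  have h2 : (i : ℚ) • (eisTwo ^ (i - 1) * ((theta eisTwo + C (-1 / 12) * (eisTwo * eisTwo)) * p)) ∈ good :=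
    good.smul_mem _ (ih (i - 1) (by omega) (.mul (.inr ⟨le_rfl, by decide, isLevelOne_ramanujan⟩) hp))
  have h3 := theta_mem_good (ih i (by omega) hp)
  have h4 : (((i : ℚ) + k) / 12) • (eisTwo ^ (i + 1) * p) ∈ good := by
    convert good.sub_mem (good.sub_mem h3 h1) h2 using 1
    have h5 : (i : ℚ) • eisTwo ^ (i - 1) * eisTwo = (i : ℚ) • eisTwo ^ i := by
      cases i <;> simp [pow_succ]
    have h6 : (C (((i : ℚ) + k) / 12) : ℚ⟦X⟧) = - C (i : ℚ) * C (-1 / 12) - C (-(k : ℚ) / 12) := by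
      rw [← map_neg, ← map_mul, ← map_sub]
      congr 1
      ring
    rw [Derivation.leibniz, Derivation.leibniz_pow]
    simp only [smul_eq_C_mul, smul_eq_mul, nsmul_eq_mul, h6, ← map_natCast (C : ℚ →+* ℚ⟦X⟧)] at h5 ⊢
    linear_combination (C (-1 / 12) * eisTwo * p) * h5
  have h7 : ((i : ℚ) + k) / 12 ≠ 0 := by
    have : 0 < i + k := by omega
    have : (0 : ℚ) < (i + k : ℕ) := by exact_mod_cast this
    push_cast at this
    positivity
  have h8 := good.smul_mem (((i : ℚ) + k) / 12)⁻¹ h4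
  rwa [smul_smul, inv_mul_cancel₀ h7, one_smul] at h8

lemma quasi_le_good {p : ℚ⟦X⟧} (hp : p ∈ quasi) : p ∈ good := by
  rw [quasi, ← Subalgebra.mem_toSubmodule, Algebra.adjoin_eq_span] at hp
  refine Submodule.span_le.mpr (fun q hq => ?_) hp
  obtain ⟨i, k, r, hr, rfl⟩ : ∃ i k r, IsGraded k r ∧ q = eisTwo ^ i * r := by
    induction hq using Submonoid.closure_induction with
    | mem q hq =>
      rcases hq with rfl | ⟨k, hk, hk2, hq⟩
      · exact ⟨1, 0, 1, .inl ⟨rfl, rfl⟩, by simp⟩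
      · exact ⟨0, k, q, .inr ⟨hk, hk2, hq⟩, by simp⟩
    | one => exact ⟨0, 0, 1, .inl ⟨rfl, rfl⟩, by simp⟩
    | mul q q' _ _ h h' =>
      obtain ⟨i, k, r, hr, rfl⟩ := h
      obtain ⟨i', k', r', hr', rfl⟩ := h'
      exact ⟨i + i', k + k', r * r', hr.mul hr', by ring⟩
  exact eisTwo_pow_mul_mem_good i hr

lemma sigmaSeries_mem_quasi (r : ℕ) : sigmaSeries (2 * r + 1) ∈ quasi := by
  have key {c : ℚ} (hc : c ≠ 0) {k : ℕ} (h : 1 + C c * sigmaSeries k ∈ quasi) : sigmaSeries k ∈ quasi := by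
    have h1 := quasi.smul_mem (quasi.sub_mem h quasi.one_mem) c⁻¹
    rwa [add_sub_cancel_left, ← smul_eq_C_mul, smul_smul, inv_mul_cancel₀ hc, one_smul] at h1
  rcases r.eq_zero_or_pos with rfl | hr
  · exact key (by norm_num) (Algebra.subset_adjoin (Set.mem_insert eisTwo _))
  · obtain ⟨c, hc, h⟩ := exists_isLevelOne_sigmaSeries (k := 2 * r + 2) (by omega) (by grind)
    exact key hc (Algebra.subset_adjoin (.inr ⟨_, by omega, by grind, h⟩))

end MacMahon

namespace MacMahon
open PowerSeries

/-- The sum of `x t₁ ⋯ x tₐ` over chains `t₁ < ⋯ < tₐ < K` with gaps at least `ε`. -/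
def chain {R : Type*} [CommRing R] (ε : ℕ) (x : ℕ → R) : ℕ → ℕ → R
  | _, 0 => 1
  | K, a + 1 => ∑ t ∈ range K, x t * chain ε x (t + 1 - ε) a

lemma sum_prod_eq_chain {R : Type*} [CommRing R] {ε : ℕ} (hε : ε ≤ 1) {N : ℕ} (w : ℕ → ℕ → R) (a : ℕ) : ∀ {K}, K ≤ N →
    ∑ f : Fin a → Fin N × Fin N, (if (∀ i, (f i).1 < K) ∧ ∀ i j, i < j → (f i).1 + ε ≤ (f j).1.val then ∏ i, w (f i).1 (f i).2 else 0) =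
      chain ε (fun t => ∑ s : Fin N, w t s) K a := by
  induction a with
  | zero => simp [chain]
  | succ a ih =>
    intro K hK
    rw [← (Fin.snocEquiv fun _ => Fin N × Fin N).sum_comp, Fintype.sum_prod_type, Fintype.sum_prod_type, chain]
    have h1 (t s : Fin N) (g : Fin a → Fin N × Fin N) :
        ((∀ i, ((Fin.snoc g (t, s) : Fin (a + 1) → Fin N × Fin N) i).1 < K) ∧ ∀ i j, i < j → ((Fin.snoc g (t, s) : Fin (a + 1) → Fin N × Fin N) i).1 + ε ≤ ((Fin.snoc g (t, s) : Fin (a + 1) → Fin N × Fin N) j).1.val) ↔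
        t < K ∧ (∀ i, (g i).1 < t.val + 1 - ε) ∧ ∀ i j, i < j → (g i).1 + ε ≤ (g j).1.val := by
      simp only [Fin.forall_fin_succ', Fin.snoc_castSucc, Fin.snoc_last, Fin.castSucc_lt_castSucc_iff, Fin.castSucc_lt_last, lt_irrefl, true_imp_iff, false_imp_iff, and_true, (Fin.castSucc_lt_last _).not_gt, imp_true_iff]
      constructor
      · rintro ⟨⟨h1, h2⟩, h3⟩
        exact ⟨h2, fun i => by have := (h3 i).2; omega, fun i => (h3 i).1⟩
      · rintro ⟨h1, h2, h3⟩
        exact ⟨⟨fun i => by have := h2 i; omega, h1⟩, fun i => ⟨h3 i, by have := h2 i; omega⟩⟩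
    have h2 (t s : Fin N) : ∑ g : Fin a → Fin N × Fin N, (if (∀ i, ((Fin.snoc g (t, s) : Fin (a + 1) → Fin N × Fin N) i).1 < K) ∧ ∀ i j, i < j → ((Fin.snoc g (t, s) : Fin (a + 1) → Fin N × Fin N) i).1 + ε ≤ ((Fin.snoc g (t, s) : Fin (a + 1) → Fin N × Fin N) j).1.val then ∏ i, w ((Fin.snoc g (t, s) : Fin (a + 1) → Fin N × Fin N) i).1 ((Fin.snoc g (t, s) : Fin (a + 1) → Fin N × Fin N) i).2 else 0) =
        if t < K then w t s * chain ε (fun t => ∑ s : Fin N, w t s) (t + 1 - ε) a else 0 := by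
      simp only [h1, Fin.prod_univ_castSucc, Fin.snoc_castSucc, Fin.snoc_last, ite_and (t.val < K)]
      split_ifs
      · rw [← ih (by omega), mul_sum]
        exact sum_congr rfl fun g _ => by rw [mul_ite, mul_zero, mul_comm]
      · simp
    refine (sum_congr rfl fun t _ => sum_congr rfl fun s _ => h2 t s).trans ?_
    have h3 := Fin.sum_univ_eq_sum_range (fun t : ℕ => if t < K then (∑ s : Fin N, w t s) * chain ε (fun t => ∑ s : Fin N, w t s) (t + 1 - ε) a else 0) N
    refine ((sum_congr rfl fun t _ => ?_).trans h3).trans ?_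
    · split_ifs <;> simp [sum_mul]
    rw [← sum_filter]
    congr 1
    ext t
    simp
    omega

lemma coeff_chain_eq_sum {ε : ℕ} (hε : ε ≤ 1) (a n : ℕ) :
    coeff n (chain ε (fun t => ∑ s : Fin (n + 1), if 0 < t ∧ 0 < s.val then C (s.val : ℚ) * X ^ (s.val * t) else 0) (n + 1) a) =
      ∑ f : Fin a → Fin (n + 1) × Fin (n + 1), if (∀ i, 0 < (f i).1.val ∧ 0 < (f i).2.val) ∧ (∀ i j, i < j → (f i).1 + ε ≤ (f j).1.val) ∧
        (∑ i, (f i).2.val * (f i).1.val) = n then ∏ i, ((f i).2.val : ℚ) else 0 := by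
  rw [← sum_prod_eq_chain hε (fun t s => if 0 < t ∧ 0 < s then C (s : ℚ) * X ^ (s * t) else 0) a le_rfl, map_sum]
  refine sum_congr rfl fun f _ => ?_
  simp only [Fin.is_lt, imp_true_iff, true_and, prod_ite_zero, mem_univ, true_imp_iff, prod_mul_distrib, ← map_prod, prod_pow_eq_pow_sum]
  by_cases h1 : ∀ i, 0 < (f i).1.val ∧ 0 < (f i).2.val
  · by_cases h2 : ∀ i j, i < j → (f i).1 + ε ≤ (f j).1.val
    · rw [if_pos h1, if_pos h2, coeff_C_mul, coeff_X_pow, mul_ite, mul_one, mul_zero]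
      exact if_congr ⟨fun h => ⟨h1, h2, h.symm⟩, fun h => h.2.2.symm⟩ rfl rfl
    · rw [if_neg h2, if_neg fun h => h2 h.2.1, map_zero]
  · rw [if_neg h1, ite_self, if_neg fun h => h1 h.1, map_zero]

/-- The expansion `∑ s q ^ (s k)` of `q ^ k / (1 - q ^ k) ^ 2`. -/
noncomputable def xSeries (k : ℕ) : ℚ⟦X⟧ := mk fun i => if k ∣ i then ((i / k : ℕ) : ℚ) else 0

/-- Power series with the same coefficients up to degree `n`. -/
def Agree (n : ℕ) (p q : ℚ⟦X⟧) : Prop := ∀ v ≤ n, coeff v p = coeff v q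

lemma Agree.mul {n : ℕ} {p q p' q' : ℚ⟦X⟧} (h : Agree n p q) (h' : Agree n p' q') : Agree n (p * p') (q * q') := fun v hv => by
  simp only [coeff_mul]
  exact sum_congr rfl fun i hi => by
    rw [h _ ((HasAntidiagonal.mem_antidiagonal.mp hi ▸ Nat.le_add_right _ _).trans hv), h' _ ((HasAntidiagonal.mem_antidiagonal.mp hi ▸ Nat.le_add_left _ _).trans hv)]

lemma Agree.sum {ι : Type*} {n : ℕ} {s : Finset ι} {p q : ι → ℚ⟦X⟧} (h : ∀ i ∈ s, Agree n (p i) (q i)) : Agree n (∑ i ∈ s, p i) (∑ i ∈ s, q i) :=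
  fun v hv => by
    simp only [map_sum]
    exact sum_congr rfl fun i hi => h i hi v hv

lemma Agree.chain {ε n : ℕ} {x y : ℕ → ℚ⟦X⟧} (h : ∀ t, Agree n (x t) (y t)) (a : ℕ) : ∀ K, Agree n (chain ε x K a) (chain ε y K a) := by
  induction a with
  | zero => exact fun K v _ => rfl
  | succ a ih => exact fun K => Agree.sum fun t _ => (h t).mul (ih _)

lemma agree_xSeries (n t : ℕ) :
    Agree n (∑ s : Fin (n + 1), if 0 < t ∧ 0 < s.val then C (s.val : ℚ) * X ^ (s.val * t) else 0) (xSeries t) := fun v hv => by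
  rw [Fin.sum_univ_eq_sum_range fun s => if 0 < t ∧ 0 < s then C (s : ℚ) * X ^ (s * t) else 0, map_sum, xSeries, coeff_mk]
  rcases t.eq_zero_or_pos with rfl | ht
  · simp
  split_ifs with hd
  · obtain ⟨k, rfl⟩ := hd
    have hk : k ≤ n := le_trans (Nat.le_mul_of_pos_left k ht) hv
    rw [sum_eq_single_of_mem k (mem_range.mpr (by omega))]
    · rcases k.eq_zero_or_pos with rfl | hk
      · simp
      · rw [if_pos ⟨ht, hk⟩, coeff_C_mul, coeff_X_pow, if_pos (mul_comm t k), mul_one, Nat.mul_div_cancel_left _ ht]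
    · intro s _ hs
      split_ifs
      · rw [coeff_C_mul, coeff_X_pow, if_neg, mul_zero]
        rw [mul_comm s]
        exact fun h => hs (Nat.eq_of_mul_eq_mul_left ht h).symm
      · simp
  · refine sum_eq_zero fun s _ => ?_
    split_ifs
    · rw [coeff_C_mul, coeff_X_pow, if_neg, mul_zero]
      rintro rfl
      exact hd (dvd_mul_left t s)
    · simp

lemma MO_eq_coeff (a n : ℕ) : (MO a n : ℚ) = coeff n (chain 1 xSeries (n + 1) a) := by
  rw [← Agree.chain (agree_xSeries n) a _ n le_rfl, coeff_chain_eq_sum le_rfl, MO, sum_filter]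
  push_cast
  rfl

lemma M_eq_coeff (a n : ℕ) : (M a n : ℚ) = coeff n (chain 0 xSeries (n + 1) a) := by
  rw [← Agree.chain (agree_xSeries n) a _ n le_rfl, coeff_chain_eq_sum zero_le_one, M, sum_filter]
  push_cast
  refine sum_congr rfl fun f _ => if_congr ?_ rfl rfl
  have : (∀ i j : Fin a, i ≤ j → (f i).1 ≤ (f j).1) ↔ ∀ i j, i < j → (f i).1.val + 0 ≤ (f j).1.val :=
    ⟨fun h i j hij => h i j hij.le, fun h i j hij => hij.eq_or_lt.elim (fun h => h ▸ le_rfl) (h i j)⟩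
  rw [this]

end MacMahon

namespace MacMahon
open PowerSeries

lemma xSeries_zero : xSeries 0 = 0 := by
  ext i
  simp [xSeries]

lemma theta_X_pow (t : ℕ) : theta (X ^ t) = (t : ℚ⟦X⟧) * X ^ t := by
  ext i
  rw [coeff_theta, ← map_natCast (C : ℚ →+* ℚ⟦X⟧), coeff_C_mul, coeff_X_pow]
  split_ifs with h <;> simp [h]

lemma xSeries_spec {t : ℕ} (ht : 0 < t) : (1 - X ^ t) ^ 2 * xSeries t = X ^ t := by
  have h1 : (1 - X ^ t) * xSeries t = PowerSeries.mk fun i => if t ∣ i ∧ i ≠ 0 then (1 : ℚ) else 0 := by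
    ext i
    rw [sub_mul, one_mul, map_sub, coeff_X_pow_mul', xSeries, coeff_mk, coeff_mk]
    by_cases hd : t ∣ i
    · obtain ⟨k, rfl⟩ := hd
      rcases k with _ | k
      · simp
      · simp [ht.ne', mul_add, ht]
    · have : ¬ (t ≤ i ∧ t ∣ i - t) := fun h => hd (by simpa [Nat.sub_add_cancel h.1] using h.2.add (dvd_refl t))
      simp only [hd, false_and, if_false, coeff_mk]
      split_ifs <;> simp_all
  have h2 : (1 - X ^ t) * (PowerSeries.mk fun i => if t ∣ i ∧ i ≠ 0 then (1 : ℚ) else 0) = X ^ t := by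
    ext i
    rw [sub_mul, one_mul, map_sub, coeff_X_pow_mul', coeff_mk, coeff_mk, coeff_X_pow]
    by_cases hd : t ∣ i
    · obtain ⟨k, rfl⟩ := hd
      rcases k with _ | _ | k
      · simp [ht.ne]
      · simp [ht.ne']
      · have h3 : t * (k + 1 + 1) - t = t * (k + 1) := by rw [mul_add t (k + 1)]; simp
        have h4 : t ≤ t * (k + 1 + 1) := Nat.le_mul_of_pos_right t (by omega)
        simp [ht.ne', h3, h4]
    · have : ¬ (t ≤ i ∧ t ∣ i - t) := fun h => hd (by simpa [Nat.sub_add_cancel h.1] using h.2.add (dvd_refl t))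
      have : i ≠ t := by rintro rfl; exact hd dvd_rfl
      simp only [hd, false_and, if_false]
      split_ifs <;> simp_all
  rw [pow_two, mul_assoc, h1, h2]

lemma theta_theta_xSeries_pow (t j : ℕ) : theta (theta (xSeries t ^ (j + 1))) =
    (t : ℚ⟦X⟧) ^ 2 * ((j + 1) ^ 2 * xSeries t ^ (j + 1) + 2 * (j + 1) * (2 * j + 3) * xSeries t ^ (j + 2)) := by
  rcases t.eq_zero_or_pos with rfl | ht
  · simp [xSeries_zero]
  set x := xSeries t
  set u : ℚ⟦X⟧ := X ^ t
  have hx : (1 - u) ^ 2 * x = u := xSeries_spec ht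
  have hu : theta u = t * u := theta_X_pow t
  have h1 : 1 - u ≠ 0 := fun h => by
    have := congrArg (coeff 0) h
    simp [u, ht.ne'] at this
  have hu' : theta (1 - u) = - (t * u) := by rw [map_sub, hu, Derivation.map_one_eq_zero, zero_sub]
  have hx1 : (1 - u) ^ 3 * theta x = t * u * (1 + u) := by
    have h := congrArg theta hx
    rw [Derivation.leibniz, Derivation.leibniz_pow, hu, hu'] at h
    simp only [smul_eq_mul, nsmul_eq_mul] at h
    push_cast at h
    linear_combination (1 - u) * h + 2 * t * u * hx
  have hx2 : (1 - u) ^ 4 * theta (theta x) = t ^ 2 * (u + 4 * u ^ 2 + u ^ 3) := by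
    have h := congrArg theta hx1
    rw [Derivation.leibniz, Derivation.leibniz_pow, Derivation.leibniz, Derivation.leibniz, map_add, hu, hu', Derivation.map_one_eq_zero, Derivation.map_natCast] at h
    simp only [smul_eq_mul, nsmul_eq_mul] at h
    push_cast at h
    linear_combination (1 - u) * h + 3 * t * u * hx1
  have e1 : theta x ^ 2 = t ^ 2 * (x ^ 2 + 4 * x ^ 3) := by
    refine mul_left_cancel₀ (pow_ne_zero 6 h1) ?_
    linear_combination ((1 - u) ^ 3 * theta x + t * u * (1 + u)) * hx1 - t ^ 2 * ((1 - u) ^ 2 * ((1 - u) ^ 2 * x + u) + 4 * (((1 - u) ^ 2 * x) ^ 2 + (1 - u) ^ 2 * x * u + u ^ 2)) * hx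
  have e2 : theta (theta x) = t ^ 2 * (x + 6 * x ^ 2) := by
    refine mul_left_cancel₀ (pow_ne_zero 4 h1) ?_
    linear_combination hx2 - t ^ 2 * ((1 - u) ^ 2 + 6 * ((1 - u) ^ 2 * x + u)) * hx
  rcases j with _ | j
  · rw [zero_add, pow_one, e2]
    push_cast
    ring
  · rw [Derivation.leibniz_pow, map_nsmul, smul_eq_mul, Derivation.leibniz, Derivation.leibniz_pow, e2]
    simp only [smul_eq_mul, nsmul_eq_mul, Nat.add_sub_cancel]
    push_cast
    linear_combination ((j + 2 : ℚ⟦X⟧) * (j + 1) * x ^ j) * e1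

lemma powerSum_mem {Q : Subalgebra ℚ ℚ⟦X⟧} (hQ : ∀ r, sigmaSeries (2 * r + 1) ∈ Q) (j : ℕ) : ∀ r,
    (PowerSeries.mk fun n => ∑ t ∈ range (n + 1), ((n / t : ℚ)) ^ (2 * r) * coeff n (xSeries t ^ (j + 1))) ∈ Q := by
  induction j with
  | zero =>
    intro r
    convert hQ r using 1
    ext n
    rw [sigmaSeries, coeff_mk, coeff_mk, ArithmeticFunction.sigma_apply, ← Nat.sum_div_divisors, Nat.divisors, sum_filter,
      range_eq_Ico, sum_eq_sum_Ico_succ_bot n.succ_pos]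
    push_cast
    rw [xSeries_zero, zero_pow (by omega), map_zero, mul_zero, zero_add]
    refine sum_congr rfl fun t ht => ?_
    rw [pow_one, xSeries, coeff_mk]
    split_ifs with hd
    · have : (t : ℚ) ≠ 0 := by
        have := (mem_Ico.mp ht).1
        positivity
      rw [Nat.cast_div hd this, pow_succ]
    · simp
  | succ j ih =>
    intro r
    have h1 : ((2 * (j + 1) * (2 * j + 3) : ℚ)) ≠ 0 := by positivity
    have h2 := Q.smul_mem (Q.sub_mem (ih (r + 1)) (Q.smul_mem (ih r) ((j + 1) ^ 2))) (2 * (j + 1) * (2 * j + 3))⁻¹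
    convert h2 using 1
    ext n
    simp only [coeff_smul, map_sub, coeff_mk, smul_eq_mul]
    rw [eq_inv_mul_iff_mul_eq₀ h1, mul_sum, mul_sum, ← sum_sub_distrib]
    refine sum_congr rfl fun t _ => ?_
    have h3 := congrArg (coeff n) (theta_theta_xSeries_pow t j)
    have h4 : (t : ℚ⟦X⟧) ^ 2 * ((j + 1) ^ 2 * xSeries t ^ (j + 1) + 2 * (j + 1) * (2 * j + 3) * xSeries t ^ (j + 2)) =
      C ((t : ℚ) ^ 2) * (C ((j + 1 : ℚ) ^ 2) * xSeries t ^ (j + 1) + C (2 * (j + 1) * (2 * j + 3) : ℚ) * xSeries t ^ (j + 2)) := by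
      simp only [map_add, map_mul, map_pow, map_natCast, map_one, map_ofNat]
    rw [h4, coeff_theta, coeff_theta, coeff_C_mul, map_add, coeff_C_mul, coeff_C_mul] at h3
    rcases t.eq_zero_or_pos with rfl | ht
    · simp [xSeries_zero]
    have ht' : (t : ℚ) ≠ 0 := by positivity
    generalize hy : (n / t : ℚ) = y
    rw [div_eq_iff ht'] at hy
    rw [hy] at h3
    have h5 := mul_left_cancel₀ (pow_ne_zero 2 ht') ((by ring : (t : ℚ) ^ 2 * (y ^ 2 * coeff n (xSeries t ^ (j + 1))) = _).trans h3)
    linear_combination -y ^ (2 * r) * h5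

end MacMahon

namespace MacMahon
open PowerSeries Derivative

section Newton
variable {R : Type*} [CommRing R] (x : ℕ → R)

lemma chain_succ_succ (ε K a : ℕ) : chain ε x (K + 1) (a + 1) = chain ε x K (a + 1) + x K * chain ε x (K + 1 - ε) a :=
  sum_range_succ _ _

lemma newton_chain_one (K a : ℕ) : (a + 1) * chain 1 x K (a + 1) =
    ∑ i ∈ antidiagonal a, (-1) ^ i.1 * (∑ t ∈ range K, x t ^ (i.1 + 1)) * chain 1 x K i.2 := by
  suffices h : d⁄dX R (PowerSeries.mk (chain 1 x K)) = PowerSeries.mk (fun i => (-1) ^ i * ∑ t ∈ range K, x t ^ (i + 1)) * PowerSeries.mk (chain 1 x K) by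
    have := congrArg (coeff a) h
    simp only [coeff_derivative, coeff_mul, coeff_mk] at this
    rw [← this, mul_comm]
  induction K with
  | zero =>
    ext a
    simp [coeff_derivative, chain, coeff_mul]
  | succ K ih =>
    have h1 : PowerSeries.mk (chain 1 x (K + 1)) = (1 + C (x K) * X) * PowerSeries.mk (chain 1 x K) := by
      ext (_ | a)
      · simp [chain]
      · simp [add_mul, mul_assoc, coeff_succ_X_mul, chain_succ_succ]
    set g := PowerSeries.mk fun i => (-1) ^ i * x K ^ (i + 1)
    have h2 : (1 + C (x K) * X) * g = C (x K) := by
      ext (_ | a)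
      · simp [g]
      · simp [g, add_mul, mul_assoc, coeff_succ_X_mul]
        ring
    have h3 : PowerSeries.mk (fun i => (-1) ^ i * ∑ t ∈ range (K + 1), x t ^ (i + 1)) = PowerSeries.mk (fun i => (-1) ^ i * ∑ t ∈ range K, x t ^ (i + 1)) + g := by
      ext i
      simp [g, sum_range_succ, mul_add]
    rw [h3, h1, Derivation.leibniz, ih]
    simp
    linear_combination (- PowerSeries.mk (chain 1 x K)) * h2

lemma newton_chain_zero [IsDomain R] (K a : ℕ) : (a + 1) * chain 0 x K (a + 1) =
    ∑ i ∈ antidiagonal a, (∑ t ∈ range K, x t ^ (i.1 + 1)) * chain 0 x K i.2 := by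
  suffices h : d⁄dX R (PowerSeries.mk (chain 0 x K)) = PowerSeries.mk (fun i => ∑ t ∈ range K, x t ^ (i + 1)) * PowerSeries.mk (chain 0 x K) by
    have := congrArg (coeff a) h
    simp only [coeff_derivative, coeff_mul, coeff_mk] at this
    rw [← this, mul_comm]
  induction K with
  | zero =>
    ext a
    simp [coeff_derivative, chain, coeff_mul]
  | succ K ih =>
    have h1 : (1 - C (x K) * X) * PowerSeries.mk (chain 0 x (K + 1)) = PowerSeries.mk (chain 0 x K) := by
      ext (_ | a)
      · simp [chain]
      · simp [sub_mul, mul_assoc, coeff_succ_X_mul, chain_succ_succ]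
    set g := PowerSeries.mk fun i => x K ^ (i + 1)
    have h2 : (1 - C (x K) * X) * g = C (x K) := by
      ext (_ | a)
      · simp [g]
      · simp [g, sub_mul, mul_assoc, coeff_succ_X_mul]
        ring
    have h3 : PowerSeries.mk (fun i => ∑ t ∈ range (K + 1), x t ^ (i + 1)) = PowerSeries.mk (fun i => ∑ t ∈ range K, x t ^ (i + 1)) + g := by
      ext i
      simp [g, sum_range_succ]
    have h4 : (1 - C (x K) * X : R⟦X⟧) ≠ 0 := fun h => by simpa using congrArg (coeff 0) h
    rw [← h1, Derivation.leibniz, h1] at ih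
    simp at ih
    rw [h3]
    refine mul_left_cancel₀ h4 ?_
    linear_combination ih - PowerSeries.mk (chain 0 x (K + 1)) * h2 - (PowerSeries.mk fun i => ∑ t ∈ range K, x t ^ (i + 1)) * h1

end Newton

lemma coeff_xSeries_mul {v K : ℕ} (h : v < K) (p : ℚ⟦X⟧) : coeff v (xSeries K * p) = 0 := by
  rw [coeff_mul]
  refine sum_eq_zero fun i hi => ?_
  have h1 : i.1 < K := (HasAntidiagonal.mem_antidiagonal.mp hi ▸ Nat.le_add_right _ _ : i.1 ≤ v).trans_lt h
  simp [xSeries, Nat.div_eq_of_lt h1]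

lemma agree_mk {F : ℕ → ℚ⟦X⟧} (h : ∀ v K, v < K → coeff v (F (K + 1)) = coeff v (F K)) (n : ℕ) :
    Agree n (PowerSeries.mk fun n => coeff n (F (n + 1))) (F (n + 1)) := fun v hv => by
  rw [coeff_mk]
  exact Nat.le_induction (P := fun K _ => coeff v (F (v + 1)) = coeff v (F K)) rfl (fun K hK ih => ih.trans (h v K hK).symm) _ (by omega)

lemma mk_chain_mem {Q : Subalgebra ℚ ℚ⟦X⟧} (hQ : ∀ r, sigmaSeries (2 * r + 1) ∈ Q) {ε : ℕ} (hε : ε ≤ 1) (a : ℕ) :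
    (PowerSeries.mk fun n => coeff n (chain ε xSeries (n + 1) a)) ∈ Q := by
  have hp (j : ℕ) : (PowerSeries.mk fun n => coeff n (∑ t ∈ range (n + 1), xSeries t ^ (j + 1))) ∈ Q := by
    simpa using powerSum_mem hQ j 0
  have hp' (j n) := agree_mk (F := fun K => ∑ t ∈ range K, xSeries t ^ (j + 1)) (fun v K h => by
    rw [sum_range_succ, map_add, pow_succ', coeff_xSeries_mul h, add_zero]) n
  have hc (a n) := agree_mk (F := fun K => chain ε xSeries K a) (fun v K h => by
    cases a
    · rfl
    · rw [chain_succ_succ, map_add, coeff_xSeries_mul h, add_zero]) n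
  induction a using Nat.strong_induction_on with
  | _ a ih =>
  rcases a with _ | a
  · convert Q.one_mem using 1
    ext n
    simp [chain]
  have key : ∃ c : ℕ → ℚ, ∀ K, (C (a + 1 : ℚ) : ℚ⟦X⟧) * chain ε xSeries K (a + 1) =
      ∑ i ∈ antidiagonal a, C (c i.1) * (∑ t ∈ range K, xSeries t ^ (i.1 + 1)) * chain ε xSeries K i.2 := by
    interval_cases ε
    · exact ⟨fun _ => 1, fun K => by simpa using newton_chain_zero xSeries K a⟩
    · exact ⟨fun i => (-1) ^ i, fun K => by simpa using newton_chain_one xSeries K a⟩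
  obtain ⟨c, key⟩ := key
  have h1 : (PowerSeries.mk fun n => coeff n (chain ε xSeries (n + 1) (a + 1))) = (a + 1 : ℚ)⁻¹ • ∑ i ∈ antidiagonal a, c i.1 •
      (PowerSeries.mk fun n => coeff n (∑ t ∈ range (n + 1), xSeries t ^ (i.1 + 1))) * (PowerSeries.mk fun n => coeff n (chain ε xSeries (n + 1) i.2)) := by
    ext n
    have h2 := Agree.sum (s := antidiagonal a) (fun i _ => ((show Agree n (C (c i.1)) (C (c i.1)) from fun v _ => rfl).mul (hp' i.1 n)).mul (hc i.2 n)) n le_rfl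
    rw [← key, coeff_C_mul] at h2
    have h3 : (a + 1 : ℚ) ≠ 0 := by positivity
    rw [coeff_smul, smul_eq_mul, eq_inv_mul_iff_mul_eq₀ h3, coeff_mk, ← h2]
    simp only [smul_eq_C_mul]
  rw [h1]
  refine Q.smul_mem (Q.sum_mem fun i hi => Q.mul_mem (Q.smul_mem (hp _) _) (ih _ ?_)) _
  have := HasAntidiagonal.mem_antidiagonal.mp hi
  omega

lemma isGood_M (a : ℕ) : IsGood (PowerSeries.mk fun n => (M a n : ℚ)) := by
  simp only [M_eq_coeff]
  exact quasi_le_good (mk_chain_mem sigmaSeries_mem_quasi zero_le_one a)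

lemma isGood_MO (a : ℕ) : IsGood (PowerSeries.mk fun n => (MO a n : ℚ)) := by
  simp only [MO_eq_coeff]
  exact quasi_le_good (mk_chain_mem sigmaSeries_mem_quasi le_rfl a)

end MacMahon

namespace MacMahon
open PowerSeries

lemma IsGood.card_le {F : ℕ → ℕ} (hF : IsGood (PowerSeries.mk fun n => (F n : ℚ))) {m : ℕ} (hm : 0 < m) :
    ∃ α C : ℝ, 0 < α ∧ 0 < C ∧ ∀ β, 0 < β → β ≤ α → β ≤ 1 → ∀ X : ℝ, 2 ≤ X →
      (((range (⌊X⌋₊ + 1)).filter fun n => ¬ m ∣ F n).card : ℝ) ≤ C * X / Real.log X ^ β := by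
  obtain ⟨α, D, hα, hD, h⟩ := hF m hm
  refine ⟨α, 3 + 2 * D, hα, by positivity, fun β hβ hβα hβ1 X hX => ?_⟩
  have hlX : 0 < Real.log X := Real.log_pos (by linarith)
  have hpos : 0 < Real.log X ^ β := Real.rpow_pos_of_pos hlX β
  have h1 : Real.log X ^ β ≤ X := by
    rcases le_total (Real.log X) 1 with h | h
    · exact (Real.rpow_le_one hlX.le h hβ.le).trans (by linarith)
    · calc Real.log X ^ β ≤ Real.log X ^ (1 : ℝ) := Real.rpow_le_rpow_of_exponent_le h hβ1
        _ ≤ X := by rw [Real.rpow_one]; exact (Real.log_le_sub_one_of_pos (by linarith)).trans (by linarith)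
  have h2 : 1 ≤ X / Real.log X ^ β := (one_le_div hpos).mpr h1
  rw [mul_div_assoc]
  have hN : (⌊X⌋₊ : ℝ) ≤ X := Nat.floor_le (by linarith)
  have hN' : X < ⌊X⌋₊ + 1 := Nat.lt_floor_add_one X
  set N := ⌊X⌋₊
  rcases lt_or_ge N 3 with h3 | h3
  · calc (((range (N + 1)).filter fun n => ¬ m ∣ F n).card : ℝ) ≤ (3 : ℕ) := by
          exact_mod_cast (card_filter_le _ _).trans (by rw [card_range]; omega)
      _ ≤ (3 + 2 * D) * (X / Real.log X ^ β) := by push_cast; nlinarith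
  have h4 : ((range (N + 1)).filter fun n => ¬ m ∣ F n).card ≤ 1 + ((Ioc 0 N).filter fun n => ¬ m ∣ F n).card := by
    rw [range_eq_Ico, add_comm 1]
    calc _ ≤ (insert 0 ((Ioc 0 N).filter fun n => ¬ m ∣ F n)).card := card_le_card fun n hn => by
          simp only [mem_filter, mem_Ico, mem_insert, mem_Ioc] at hn ⊢
          rcases n.eq_zero_or_pos with h | h
          · exact .inl h
          · exact .inr ⟨⟨h, by omega⟩, hn.2⟩
      _ ≤ _ := card_insert_le _ _
  have h5 : (((Ioc 0 N).filter fun n => ¬ m ∣ F n).card : ℝ) ≤ D * N / Real.log N ^ β := by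
    classical
    refine le_trans (Nat.cast_le.mpr (card_le_card fun n hn => ?_)) ((h N h3).trans (div_rpow_le h3 hD.le hβα))
    rw [mem_filter] at hn ⊢
    refine ⟨hn.1, fun ⟨a, ha⟩ => hn.2 ?_⟩
    rw [coeff_mk] at ha
    have ha' : (F n : ℤ) = m * a := by exact_mod_cast ha
    exact Int.natCast_dvd_natCast.mp ⟨a, ha'⟩
  have hN3 : (3 : ℝ) ≤ N := by exact_mod_cast h3
  have hlN := one_le_log h3
  have h6 : Real.log X ≤ 2 * Real.log N := by
    rw [← Nat.cast_two, ← Real.log_pow]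
    exact Real.log_le_log (by linarith) (by push_cast; nlinarith)
  have h7 : Real.log X ^ β ≤ 2 * Real.log N ^ β := by
    calc Real.log X ^ β ≤ (2 * Real.log N) ^ β := Real.rpow_le_rpow hlX.le h6 hβ.le
      _ = 2 ^ β * Real.log N ^ β := Real.mul_rpow zero_le_two (by linarith)
      _ ≤ 2 ^ (1 : ℝ) * Real.log N ^ β := by gcongr; norm_num
      _ = _ := by rw [Real.rpow_one]
  have h8 : D * N / Real.log N ^ β ≤ 2 * D * (X / Real.log X ^ β) := by
    have hp : 0 < Real.log N ^ β := Real.rpow_pos_of_pos (by linarith) β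
    rw [← mul_div_assoc, div_le_div_iff₀ hp hpos]
    calc D * N * Real.log X ^ β ≤ D * X * (2 * Real.log N ^ β) := by gcongr
      _ = _ := by ring
  have h9 : (((range (N + 1)).filter fun n => ¬ m ∣ F n).card : ℝ) ≤ 1 + ((Ioc 0 N).filter fun n => ¬ m ∣ F n).card := by exact_mod_cast h4
  linarith

end MacMahon

/-- for positive integers `a` and `m` there are constants `α, C > 0` such
that for all real `X ≥ 2`, the number of `n ≤ X` with `m ∤ M (a; n)` is at most
`C·X/(log X)^α`, and likewise for `MO (a; n)`: these coefficients are divisible by `m`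
for almost all `n`. -/
theorem M_MO_almost_always_divisible (a m : ℕ) (ha : 0 < a) (hm : 0 < m) :
    ∃ α C : ℝ, 0 < α ∧ 0 < C ∧ ∀ X : ℝ, 2 ≤ X →
      (((Finset.range (Nat.floor X + 1)).filter (fun n => ¬ m ∣ M a n)).card : ℝ)
          ≤ C * X / Real.log X ^ α ∧
      (((Finset.range (Nat.floor X + 1)).filter (fun n => ¬ m ∣ MO a n)).card : ℝ)
          ≤ C * X / Real.log X ^ α := by
  obtain ⟨α, C, hα, hC, h⟩ := (MacMahon.isGood_M a).card_le hm
  obtain ⟨α', C', hα', hC', h'⟩ := (MacMahon.isGood_MO a).card_le hm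
  have hβ : 0 < min (min α α') 1 := by positivity
  refine ⟨min (min α α') 1, max C C', hβ, by positivity, fun X hX => ?_⟩
  have hp : 0 ≤ Real.log X ^ min (min α α') 1 := Real.rpow_nonneg (Real.log_nonneg (by linarith)) _
  refine ⟨(h _ hβ (by simp) (by simp) X hX).trans ?_, (h' _ hβ (by simp) (by simp) X hX).trans ?_⟩ <;> gcongr
  exacts [le_max_left _ _, le_max_right _ _]
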